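/- Stability of the scheme (pressure estimate): assume the initial values satisfy |u⁰_h| + |u¹_h| + k|∇_h p¹_h| ≤ C₀ and that the velocity increments satisfy |uⁿ_h − uⁿ⁻¹_h| ≤ C₁ k for all n ∈ {1,…,N}. Then there exists a constant C > 0 depending only on Ω, the mesh-regularity constant C_reg, Re, T, sup_{t∈[0,T]}|f(t)|_{L²}, C₀ and C₁ (but not on h, k or N) such that for every m ∈ {2,…,N}: k ∑_{n=2}^m |pⁿ_h|² ≤ C. -/

import Mathlib

open scoped RealInnerProductSpace
open MeasureTheory

attribute [local instance] Classical.propDecidable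

noncomputable section

/-- The Euclidean plane. -/
abbrev E2 : Type := EuclideanSpace ℝ (Fin 2)

/-- A nondegenerate (closed) triangle of the plane, given by its three
affinely independent vertices. -/
structure Tri : Type where
  vtx : Fin 3 → E2
  indep : AffineIndependent ℝ vtx

namespace Tri

/-- The triangle as a subset of the plane: the convex hull of its vertices. -/
def carrier (t : Tri) : Set E2 := convexHull ℝ (Set.range t.vtx)

/-- The area `|K|` of the triangle. -/
def area (t : Tri) : ℝ := (volume t.carrier).toReal

/-- The centroid of the triangle. -/
def centroid (t : Tri) : E2 := Finset.centroid ℝ Finset.univ t.vtx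

/-- The triangle seen as a 2-simplex. -/
def simplex (t : Tri) : Affine.Simplex ℝ E2 2 := ⟨t.vtx, t.indep⟩

/-- The circumcenter `x_K` of the triangle. -/
def ccenter (t : Tri) : E2 := t.simplex.circumcenter

/-- `σ` (an ordered pair of distinct points) is an edge of the triangle `t`:
both of its endpoints are vertices of `t`. -/
def hasEdge (t : Tri) (σ : E2 × E2) : Prop :=
  σ.1 ≠ σ.2 ∧ σ.1 ∈ Set.range t.vtx ∧ σ.2 ∈ Set.range t.vtx

end Tri

/-- The segment of an edge. -/
def eseg (σ : E2 × E2) : Set E2 := segment ℝ σ.1 σ.2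

/-- The length `|σ|` of an edge. -/
def elen (σ : E2 × E2) : ℝ := dist σ.1 σ.2

/-- The midpoint `x_σ` of an edge. -/
def emid (σ : E2 × E2) : E2 := midpoint ℝ σ.1 σ.2

/-- Rotation by `π/2` in the plane. -/
def perp (x : E2) : E2 := (EuclideanSpace.equiv (Fin 2) ℝ).symm ![-(x 1), x 0]

/-- The unit normal `n_{K,σ}` to the edge `σ`, pointing outward of the triangle `t`. -/
def Tri.nrm (t : Tri) (σ : E2 × E2) : E2 :=
  if 0 ≤ ⟪perp (σ.2 - σ.1), emid σ - t.centroid⟫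
  then (elen σ)⁻¹ • perp (σ.2 - σ.1)
  else -((elen σ)⁻¹ • perp (σ.2 - σ.1))

/-- An admissible triangulation `𝒯_h` of `Ω`, together with a registration of its
edges (each geometric edge is recorded once, with a chosen orientation) and a labelling
`K_σ`, `L_σ` of the triangle(s) adjacent to each edge.  All interior angles of all
triangles are `< π/2`. -/
structure Mesh (Ω : Set E2) : Type where
  tris : Finset Tri
  tris_nonempty : tris.Nonempty
  edges : Finset (E2 × E2)
  Kof : E2 × E2 → Tri
  Lof : E2 × E2 → Tri
  interior_disjoint : ∀ t₁ ∈ tris, ∀ t₂ ∈ tris, t₁ ≠ t₂ →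
    interior t₁.carrier ∩ interior t₂.carrier = ∅
  union_eq : ⋃ t ∈ (tris : Set Tri), t.carrier = closure Ω
  inter_structure : ∀ t₁ ∈ tris, ∀ t₂ ∈ tris, t₁ ≠ t₂ →
    t₁.carrier ∩ t₂.carrier = ∅
    ∨ (∃ a ∈ Set.range t₁.vtx ∩ Set.range t₂.vtx, t₁.carrier ∩ t₂.carrier = {a})
    ∨ (∃ σ, t₁.hasEdge σ ∧ t₂.hasEdge σ ∧ t₁.carrier ∩ t₂.carrier = eseg σ)
  angles_lt : ∀ t ∈ tris, ∀ i j l : Fin 3, i ≠ j → i ≠ l → j ≠ l →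
    EuclideanGeometry.angle (t.vtx j) (t.vtx i) (t.vtx l) < Real.pi / 2
  edges_ne : ∀ σ ∈ edges, σ.1 ≠ σ.2
  edges_cover : ∀ t ∈ tris, ∀ i j : Fin 3, i ≠ j →
    (t.vtx i, t.vtx j) ∈ edges ∨ (t.vtx j, t.vtx i) ∈ edges
  edges_sub : ∀ σ ∈ edges, ∃ t ∈ tris, t.hasEdge σ
  edges_orient : ∀ σ ∈ edges, Prod.swap σ ∉ edges
  edges_atMostTwo : ∀ σ ∈ edges, (tris.filter fun t => t.hasEdge σ).card ≤ 2
  Kof_mem : ∀ σ ∈ edges, Kof σ ∈ tris ∧ (Kof σ).hasEdge σ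
  Lof_mem : ∀ σ ∈ edges, (tris.filter fun t => t.hasEdge σ).card = 2 →
    Lof σ ∈ tris ∧ (Lof σ).hasEdge σ ∧ Lof σ ≠ Kof σ
  ext_frontier : ∀ σ ∈ edges, (tris.filter fun t => t.hasEdge σ).card = 1 →
    eseg σ ⊆ frontier Ω

namespace Mesh

variable {Ω : Set E2} (M : Mesh Ω)

/-- The interior edges `ℰ_h^int` (shared by exactly two triangles). -/
def intEdges : Finset (E2 × E2) :=
  M.edges.filter fun σ => (M.tris.filter fun t => t.hasEdge σ).card = 2

/-- The boundary edges `ℰ_h^ext`. -/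
def extEdges : Finset (E2 × E2) :=
  M.edges.filter fun σ => (M.tris.filter fun t => t.hasEdge σ).card = 1

/-- `d_σ`: distance between the circumcenters of the two triangles sharing `σ`
(interior edges), or from the circumcenter of `K_σ` to the midpoint of `σ`
(boundary edges). -/
def dOf (σ : E2 × E2) : ℝ :=
  if (M.tris.filter fun t => t.hasEdge σ).card = 2
  then dist (M.Kof σ).ccenter (M.Lof σ).ccenter
  else dist (M.Kof σ).ccenter (emid σ)

/-- `τ_σ = |σ| / d_σ`. -/
def tau (σ : E2 × E2) : ℝ := elen σ / M.dOf σ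

/-- The mesh size `h`: the largest diameter of a circumscribed circle. -/
def meshSize : ℝ := M.tris.sup' M.tris_nonempty fun t => 2 * t.simplex.circumradius

/-- Mesh regularity with constant `C_reg`: `d_σ ≥ C_reg |σ|` and `|σ| ≥ C_reg h`. -/
def Regular (Creg : ℝ) : Prop :=
  ∀ σ ∈ M.edges, Creg * elen σ ≤ M.dOf σ ∧ Creg * M.meshSize ≤ elen σ

/-- For `σ` an edge of `t`, the triangle on the other side of `σ`. -/
def other (t : Tri) (σ : E2 × E2) : Tri := if M.Kof σ = t then M.Lof σ else M.Kof σ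

/-- The `L²(Ω)` inner product of two piecewise constant (`P₀`) fields. -/
def l2P0 (v w : Tri → E2) : ℝ := ∑ t ∈ M.tris, t.area * ⟪v t, w t⟫

/-- The `L²(Ω)` norm of a `P₀` field. -/
def l2normP0 (v : Tri → E2) : ℝ := Real.sqrt (M.l2P0 v v)

/-- The discrete `H¹` norm `‖·‖_h` on `P₀`. -/
def normh (v : Tri → E2) : ℝ :=
  Real.sqrt (∑ σ ∈ M.intEdges, M.tau σ * ‖v (M.Lof σ) - v (M.Kof σ)‖ ^ 2
    + ∑ σ ∈ M.extEdges, M.tau σ * ‖v (M.Kof σ)‖ ^ 2)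

/-- A family of affine maps (one per triangle) is in `P₁^{nc}`: the two traces agree
at the midpoint of every interior edge. -/
def IsP1nc (q : Tri → (E2 →ᵃ[ℝ] ℝ)) : Prop :=
  ∀ σ ∈ M.intEdges, q (M.Kof σ) (emid σ) = q (M.Lof σ) (emid σ)

/-- Membership in `L²₀`: the piecewise affine function has zero mean on `Ω`. -/
def MeanZero (q : Tri → (E2 →ᵃ[ℝ] ℝ)) : Prop :=
  ∑ t ∈ M.tris, ∫ x in t.carrier, q t x = 0

/-- The `L²(Ω)` inner product of two piecewise affine functions. -/
def l2P1 (q r : Tri → (E2 →ᵃ[ℝ] ℝ)) : ℝ :=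
  ∑ t ∈ M.tris, ∫ x in t.carrier, q t x * r t x

/-- The `L²(Ω)` norm of a piecewise affine function. -/
def l2normP1 (q : Tri → (E2 →ᵃ[ℝ] ℝ)) : ℝ := Real.sqrt (M.l2P1 q q)

end Mesh

/-- The gradient (a constant vector) of an affine function on the plane. -/
def gradA (f : E2 →ᵃ[ℝ] ℝ) : E2 :=
  (InnerProductSpace.toDual ℝ E2).symm (LinearMap.toContinuousLinearMap f.linear)

/-- The discrete gradient `∇_h q` of a piecewise affine function: the piecewise
constant field equal on each triangle to the gradient of the affine piece. -/
def gradh (q : Tri → (E2 →ᵃ[ℝ] ℝ)) : Tri → E2 := fun t => gradA (q t)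

/-- The (constant) divergence of an affine vector field of the plane. -/
def divA (f : E2 →ᵃ[ℝ] E2) : ℝ := LinearMap.trace ℝ E2 f.linear

/-- The normal component `(u·n_{K,σ})_σ` of a piecewise affine field on the edge `σ`
of the triangle `t` (evaluated at the midpoint of `σ`). -/
def unrm (u : Tri → (E2 →ᵃ[ℝ] E2)) (t : Tri) (σ : E2 × E2) : ℝ :=
  ⟪u t (emid σ), t.nrm σ⟫

namespace Mesh

variable {Ω : Set E2} (M : Mesh Ω)

/-- The norm `‖q‖_{1,h} = (|q|² + |∇_h q|²)^{1/2}` on `P₁^{nc}`. -/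
def norm1h (q : Tri → (E2 →ᵃ[ℝ] ℝ)) : ℝ :=
  Real.sqrt ((M.l2normP1 q) ^ 2 + (M.l2normP0 (gradh q)) ^ 2)

/-- The prescribed value of `div_h v` at the midpoint of the edge `σ`. -/
def divhImage (v : Tri → E2) (σ : E2 × E2) : ℝ :=
  if (M.tris.filter fun t => t.hasEdge σ).card = 2 then
    (3 * elen σ / ((M.Kof σ).area + (M.Lof σ).area)) *
      ⟪v (M.Lof σ) - v (M.Kof σ), (M.Kof σ).nrm σ⟫
  else
    -((3 * elen σ / (M.Kof σ).area) * ⟪v (M.Kof σ), (M.Kof σ).nrm σ⟫)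

/-- `d = div_h v`: `d` is the element of `P₁^{nc}` taking the prescribed values at
the midpoints of the edges. -/
def IsDivh (v : Tri → E2) (d : Tri → (E2 →ᵃ[ℝ] ℝ)) : Prop :=
  M.IsP1nc d ∧
    ∀ t ∈ M.tris, ∀ σ ∈ M.edges, t.hasEdge σ → d t (emid σ) = M.divhImage v σ

/-- The discrete Laplacian `Δ̃_h` on `P₀`. -/
def laph (v : Tri → E2) : Tri → E2 := fun t =>
  (t.area)⁻¹ •
    ((∑ σ ∈ M.intEdges.filter fun σ => t.hasEdge σ, M.tau σ • (v (M.other t σ) - v t))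
      - ∑ σ ∈ M.extEdges.filter fun σ => t.hasEdge σ, M.tau σ • v t)

/-- The upwind convection operator `b̃_h(u_h, v_h) ∈ P₀`. -/
def btilde (u : Tri → (E2 →ᵃ[ℝ] E2)) (v : Tri → E2) : Tri → E2 := fun t =>
  (t.area)⁻¹ • ∑ σ ∈ M.intEdges.filter fun σ => t.hasEdge σ,
    elen σ • (max (unrm u t σ) 0 • v t + min (unrm u t σ) 0 • v (M.other t σ))

/-- The trilinear form `b_h(u_h, v_h, w_h)`. -/
def bh (u : Tri → (E2 →ᵃ[ℝ] E2)) (v w : Tri → E2) : ℝ :=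
  ∑ t ∈ M.tris, t.area * ⟪w t, M.btilde u v t⟫

/-- Membership in the lowest-order Raviart–Thomas space `RT₀`: the normal component is
constant on each edge of each triangle, matches across interior edges and vanishes on
boundary edges. -/
def IsRT0 (u : Tri → (E2 →ᵃ[ℝ] E2)) : Prop :=
  (∀ t ∈ M.tris, ∀ σ ∈ M.edges, t.hasEdge σ → ∀ x ∈ eseg σ,
      ⟪u t x, t.nrm σ⟫ = unrm u t σ)
  ∧ (∀ σ ∈ M.intEdges,
      ⟪u (M.Kof σ) (emid σ), (M.Kof σ).nrm σ⟫ =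
        ⟪u (M.Lof σ) (emid σ), (M.Kof σ).nrm σ⟫)
  ∧ (∀ σ ∈ M.extEdges, unrm u (M.Kof σ) σ = 0)

/-- Membership of a piecewise constant field in `P₀ ∩ RT₀`. -/
def IsRT0const (v : Tri → E2) : Prop :=
  (∀ σ ∈ M.intEdges, ⟪v (M.Lof σ) - v (M.Kof σ), (M.Kof σ).nrm σ⟫ = 0)
  ∧ ∀ σ ∈ M.extEdges, ⟪v (M.Kof σ), (M.Kof σ).nrm σ⟫ = 0

/-- The `L²(Ω)` norm of a piecewise affine vector field. -/
def l2normRT (u : Tri → (E2 →ᵃ[ℝ] E2)) : ℝ :=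
  Real.sqrt (∑ t ∈ M.tris, ∫ x in t.carrier, ‖u t x‖ ^ 2)

end Mesh

/-- The projection scheme of the paper: the BDF2 momentum step, the pressure projection
step and the velocity correction step, with time step `k = T/N`. -/
structure Scheme {Ω : Set E2} (M : Mesh Ω) : Type where
  Re : ℝ
  T : ℝ
  N : ℕ
  hRe : 0 < Re
  hT : 0 < T
  hN : 2 ≤ N
  k : ℝ
  hk : k = T / N
  fh : ℕ → Tri → E2
  u : ℕ → Tri → E2
  ut : ℕ → Tri → E2
  p : ℕ → Tri → (E2 →ᵃ[ℝ] ℝ)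
  hu0 : M.IsRT0const (u 0)
  hu1 : M.IsRT0const (u 1)
  hp : ∀ n, 1 ≤ n → n ≤ N → M.IsP1nc (p n) ∧ M.MeanZero (p n)
  mom : ∀ n, 1 ≤ n → n + 1 ≤ N → ∀ t ∈ M.tris,
    (2 * k)⁻¹ • ((3 : ℝ) • ut (n+1) t - (4 : ℝ) • u n t + u (n-1) t)
      - Re⁻¹ • M.laph (ut (n+1)) t
      + M.btilde (fun s => AffineMap.const ℝ E2 ((2 : ℝ) • u n s - u (n-1) s)) (ut (n+1)) t
      + gradh (p n) t
      = fh (n+1) t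
  proj : ∀ n, 1 ≤ n → n + 1 ≤ N → ∀ σ ∈ M.edges,
    M.divhImage (fun s => gradA (p (n+1) s - p n s)) σ =
      (3 / (2 * k)) * M.divhImage (ut (n+1)) σ
  corr : ∀ n, 1 ≤ n → n + 1 ≤ N → ∀ t ∈ M.tris,
    u (n+1) t = ut (n+1) t - (2 * k / 3) • gradA (p (n+1) t - p n t)

/-- The planar cross product. -/
def cross (x y : E2) : ℝ := x 0 * y 1 - x 1 * y 0

theorem inner_coord (x y : E2) : ⟪x, y⟫ = x 0 * y 0 + x 1 * y 1 := by
  simp [PiLp.inner_apply, Fin.sum_univ_two, mul_comm]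

theorem norm_sq_coord (x : E2) : ‖x‖ ^ 2 = x 0 ^ 2 + x 1 ^ 2 := by
  simp [EuclideanSpace.norm_sq_eq, Fin.sum_univ_two]

@[simp] theorem perp_apply_zero (x : E2) : perp x 0 = -(x 1) := by simp [perp]
@[simp] theorem perp_apply_one (x : E2) : perp x 1 = x 0 := by simp [perp]

theorem inner_perp (x y : E2) : ⟪perp x, y⟫ = cross x y := by
  rw [inner_coord]; simp [cross]; ring

theorem norm_perp (x : E2) : ‖perp x‖ = ‖x‖ := by
  rw [← sq_eq_sq₀ (norm_nonneg _) (norm_nonneg _), norm_sq_coord, norm_sq_coord]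
  simp; ring

theorem cross_sq (x y : E2) : cross x y ^ 2 = ‖x‖ ^ 2 * ‖y‖ ^ 2 - ⟪x, y⟫ ^ 2 := by
  rw [norm_sq_coord, norm_sq_coord, inner_coord, cross]; ring

theorem abs_cross_le (x y : E2) : |cross x y| ≤ ‖x‖ * ‖y‖ := by
  rw [← inner_perp, ← norm_perp x]; exact abs_real_inner_le_norm _ _

theorem E2.ext' {x y : E2} (h0 : x 0 = y 0) (h1 : x 1 = y 1) : x = y := by
  ext i; fin_cases i <;> assumption

namespace Tri

/-- Twice the signed area. -/
def sdet (t : Tri) : ℝ := cross (t.vtx 1 - t.vtx 0) (t.vtx 2 - t.vtx 0)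

/-- Barycentric coordinates. -/
def lam (t : Tri) (i : Fin 3) (x : E2) : ℝ :=
  cross (t.vtx (i + 1) - x) (t.vtx (i + 2) - x) / t.sdet

theorem sdet_ne_zero (t : Tri) : t.sdet ≠ 0 := by
  intro h
  have h2 := t.indep
  rw [affineIndependent_iff_linearIndependent_vsub ℝ _ (0 : Fin 3)] at h2
  rw [Fintype.linearIndependent_iff] at h2
  simp only [sdet, cross, PiLp.sub_apply] at h
  set a := t.vtx 1 - t.vtx 0 with ha
  set b := t.vtx 2 - t.vtx 0 with hb
  have key : ∀ g : Fin 3 → ℝ, g 1 • a + g 2 • b = 0 → g 1 = 0 ∧ g 2 = 0 := by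
    intro g hg
    have := h2 (fun x => g x.1) (by
      have : (Finset.univ : Finset {x : Fin 3 // x ≠ 0}) = {⟨1, by decide⟩, ⟨2, by decide⟩} := by
        ext ⟨x, hx⟩; fin_cases x <;> simp at hx ⊢
      rw [this, Finset.sum_pair (by simp)]
      simpa [ha, hb] using hg)
    exact ⟨this ⟨1, by decide⟩, this ⟨2, by decide⟩⟩
  have hb0 : b 0 = 0 ∧ a 0 = 0 := by
    have := key ![0, b 0, -(a 0)] (by
      apply E2.ext'
      · simp; ring
      · simp [ha, hb]; linarith)
    simpa using this
  have hb1 : b 1 = 0 ∧ a 1 = 0 := by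
    have := key ![0, b 1, -(a 1)] (by
      apply E2.ext'
      · simp [ha, hb]; linarith
      · simp; ring)
    simpa using this
  have := key ![0, 1, 1] (by
    apply E2.ext'
    · simp [hb0.1, hb0.2]
    · simp [hb1.1, hb1.2])
  simpa using this.1

theorem sdet_cyc (t : Tri) (i : Fin 3) :
    cross (t.vtx (i + 1) - t.vtx i) (t.vtx (i + 2) - t.vtx i) = t.sdet := by
  fin_cases i <;> simp [sdet, cross] <;> ring

theorem lam_sum (t : Tri) (x : E2) : ∑ i, t.lam i x = 1 := by
  have h := t.sdet_ne_zero
  simp only [lam, ← Finset.sum_div]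
  rw [div_eq_one_iff_eq h]
  simp [Fin.sum_univ_three, sdet, cross]; ring

theorem lam_smul_sum (t : Tri) (x : E2) : ∑ i, t.lam i x • t.vtx i = x := by
  have h := t.sdet_ne_zero
  apply E2.ext'
  · simp only [Fin.sum_univ_three, lam, PiLp.add_apply, PiLp.smul_apply, smul_eq_mul]
    field_simp
    simp [sdet, cross]; ring
  · simp only [Fin.sum_univ_three, lam, PiLp.add_apply, PiLp.smul_apply, smul_eq_mul]
    field_simp
    simp [sdet, cross]; ring

/-- The barycentric coordinates of an affine combination of the vertices. -/
theorem lam_comb (t : Tri) (c : Fin 3 → ℝ) (hc : ∑ i, c i = 1) (i : Fin 3) :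
    t.lam i (∑ j, c j • t.vtx j) = c i := by
  have h := t.sdet_ne_zero
  simp only [Fin.sum_univ_three] at hc ⊢
  have h0 : c 0 = 1 - c 1 - c 2 := by linarith
  rw [lam, div_eq_iff h]
  fin_cases i <;> simp [sdet, cross, h0] <;> ring

theorem lam_vtx (t : Tri) (i j : Fin 3) : t.lam i (t.vtx j) = if j = i then 1 else 0 := by
  have := t.lam_comb (fun l => if j = l then 1 else 0) (by simp) i
  simpa using this

theorem mem_carrier_iff (t : Tri) (x : E2) : x ∈ t.carrier ↔ ∀ i, 0 ≤ t.lam i x := by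
  constructor
  · intro hx i
    rw [carrier, convexHull_range_eq_exists_affineCombination] at hx
    obtain ⟨s, w, hw, hs, rfl⟩ := hx
    have := t.lam_comb (fun j => if j ∈ s then w j else 0) (by simpa using hs) i
    rw [Finset.affineCombination_eq_linear_combination _ _ _ hs]
    have e : ∑ j, (if j ∈ s then w j else 0) • t.vtx j = ∑ j ∈ s, w j • t.vtx j := by
      simp [ite_smul, Finset.sum_ite_mem]
    rw [e] at this
    rw [this]
    split_ifs with h
    · exact hw i h
    · exact le_rfl
  · intro hx
    rw [← t.lam_smul_sum x]
    exact (convex_convexHull ℝ _).sum_mem (fun i _ => hx i) (t.lam_sum x)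
      (fun i _ => subset_convexHull ℝ _ ⟨i, rfl⟩)

theorem continuous_lam (t : Tri) (i : Fin 3) : Continuous (t.lam i) := by
  unfold lam cross; fun_prop

theorem mem_interior (t : Tri) {x : E2} (hx : ∀ i, 0 < t.lam i x) : x ∈ interior t.carrier := by
  have ho : IsOpen {y : E2 | ∀ i, 0 < t.lam i y} := by
    rw [Set.ofPred_forall]
    exact isOpen_iInter_of_finite fun i => isOpen_lt continuous_const (t.continuous_lam i)
  exact interior_maximal (fun y hy => (t.mem_carrier_iff y).2 fun i => (hy i).le) ho hx

theorem isClosed_carrier (t : Tri) : IsClosed t.carrier :=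
  (Set.finite_range _).isClosed_convexHull ℝ

theorem isCompact_carrier (t : Tri) : IsCompact t.carrier :=
  (Set.finite_range _).isCompact_convexHull ℝ

theorem measurableSet_carrier (t : Tri) : MeasurableSet t.carrier := t.isClosed_carrier.measurableSet

theorem vtx_mem (t : Tri) (i : Fin 3) : t.vtx i ∈ t.carrier := subset_convexHull ℝ _ ⟨i, rfl⟩

theorem vtx_ne (t : Tri) {i j : Fin 3} (h : i ≠ j) : t.vtx i ≠ t.vtx j :=
  fun e => h (t.indep.injective e)

/-- Affine parametrization of the triangle starting at vertex `i`. -/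
def par (t : Tri) (i : Fin 3) (r s : ℝ) : E2 :=
  t.vtx i + r • (t.vtx (i + 1) - t.vtx i) + s • (t.vtx (i + 2) - t.vtx i)

end Tri

/-- Integration over a linear image of a plane set. -/
theorem integral_affine_image {F : Type*} [NormedAddCommGroup F] [NormedSpace ℝ F]
    (a u v : E2) (h : cross u v ≠ 0) (Q : Set (ℝ × ℝ)) (hQ : MeasurableSet Q) (f : E2 → F) :
    ∫ x in (fun q : ℝ × ℝ => a + q.1 • u + q.2 • v) '' Q, f x
      = |cross u v| • ∫ q in Q, f (a + q.1 • u + q.2 • v) := by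
  let e : E2 ≃ᵐ (ℝ × ℝ) := (MeasurableEquiv.toLp 2 (Fin 2 → ℝ)).symm.trans MeasurableEquiv.finTwoArrow
  have he : MeasurePreserving e volume volume :=
    (volume_preserving_finTwoArrow ℝ).comp (EuclideanSpace.volume_preserving_symm_measurableEquiv_toLp (Fin 2))
  have hee : ∀ x : E2, e x = (x 0, x 1) := fun x => rfl
  let L : E2 →ₗ[ℝ] E2 :=
    { toFun := fun x => x 0 • u + x 1 • v
      map_add' := by intro x y; simp [add_smul]; abel
      map_smul' := by intro c x; simp [smul_smul, smul_add] }
  have hL : ∀ x, L x = x 0 • u + x 1 • v := fun _ => rfl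
  let Lc : E2 →L[ℝ] E2 := LinearMap.toContinuousLinearMap L
  have hdet : Lc.det = cross u v := by
    change LinearMap.det L = _
    rw [← LinearMap.det_toMatrix (EuclideanSpace.basisFun (Fin 2) ℝ).toBasis, Matrix.det_fin_two]
    simp [LinearMap.toMatrix_apply, hL, cross]
    ring
  have hinj : Set.InjOn (fun x : E2 => a + x 0 • u + x 1 • v) (e ⁻¹' Q) := by
    intro x _ y _ hxy
    have h2 : (x 0 - y 0) • u + (x 1 - y 1) • v = 0 := by
      simp only [add_assoc, add_right_inj] at hxy
      rw [sub_smul, sub_smul, ← sub_eq_zero.2 hxy]; abel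
    have c0 := congrFun (congrArg (fun z : E2 => (z : Fin 2 → ℝ)) h2) 0
    have c1 := congrFun (congrArg (fun z : E2 => (z : Fin 2 → ℝ)) h2) 1
    simp at c0 c1
    unfold cross at h
    apply E2.ext'
    · apply sub_eq_zero.1
      apply (mul_eq_zero.1 (_ : (x 0 - y 0) * (u 0 * v 1 - u 1 * v 0) = 0)).resolve_right h
      linear_combination v 1 * c0 - v 0 * c1
    · apply sub_eq_zero.1
      apply (mul_eq_zero.1 (_ : (x 1 - y 1) * (u 0 * v 1 - u 1 * v 0) = 0)).resolve_right h
      linear_combination u 0 * c1 - u 1 * c0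
  have himg : (fun q : ℝ × ℝ => a + q.1 • u + q.2 • v) '' Q
      = (fun x : E2 => a + x 0 • u + x 1 • v) '' (e ⁻¹' Q) := by
    rw [← MeasurableEquiv.image_symm, Set.image_image]
    apply Set.image_congr
    intro q _
    have : e (e.symm q) = q := e.apply_symm_apply q
    rw [hee] at this
    rw [← this]; simp
    rw [this]
  rw [himg, integral_image_eq_integral_abs_det_fderiv_smul volume (e.measurable hQ)
    (f' := fun _ => Lc) _ hinj]
  · rw [integral_smul, hdet]
    congr 1
    rw [← he.setIntegral_preimage_emb e.measurableEmbedding]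
    rfl
  · intro x _
    apply HasFDerivAt.hasFDerivWithinAt
    have := (Lc.hasFDerivAt (x := x)).const_add a
    refine this.congr_of_eventuallyEq ?_
    filter_upwards with y
    simp [Lc, hL, add_assoc]

/-- The reference triangle. -/
def refTri : Set (ℝ × ℝ) := {q | 0 ≤ q.1 ∧ 0 ≤ q.2 ∧ q.1 + q.2 ≤ 1}

theorem isClosed_refTri : IsClosed refTri :=
  (isClosed_le continuous_const continuous_fst).inter
    ((isClosed_le continuous_const continuous_snd).inter
      (isClosed_le (continuous_fst.add continuous_snd) continuous_const))

theorem isCompact_refTri : IsCompact refTri := by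
  refine (isCompact_Icc (a := ((0, 0) : ℝ × ℝ)) (b := (1, 1))).of_isClosed_subset
    isClosed_refTri ?_
  rintro ⟨a, b⟩ ⟨h1, h2, h3⟩
  simp only at h1 h2 h3
  exact ⟨⟨h1, h2⟩, ⟨by simp; linarith, by simp; linarith⟩⟩

theorem integral_refTri {F : Type*} [NormedAddCommGroup F] [NormedSpace ℝ F]
    (f : ℝ × ℝ → F) (hf : Continuous f) :
    ∫ q in refTri, f q = ∫ s in (0 : ℝ)..1, ∫ r in (0 : ℝ)..(1 - s), f (r, s) := by
  have hi : Integrable (refTri.indicator f) (volume.prod volume) :=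
    (hf.continuousOn.integrableOn_compact isCompact_refTri).integrable_indicator
      isClosed_refTri.measurableSet
  rw [← integral_indicator isClosed_refTri.measurableSet, Measure.volume_eq_prod,
    integral_prod_symm _ hi, intervalIntegral.integral_of_le zero_le_one, ← integral_Icc_eq_integral_Ioc,
    ← integral_indicator measurableSet_Icc]
  congr 1
  ext s
  by_cases hs : s ∈ Set.Icc (0 : ℝ) 1
  · rw [Set.indicator_of_mem hs, intervalIntegral.integral_of_le (by linarith [hs.2]),
      ← integral_Icc_eq_integral_Ioc, ← integral_indicator measurableSet_Icc]
    congr 1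
    ext r
    simp only [Set.indicator, refTri, Set.mem_ofPred_eq, Set.mem_Icc]
    have : (0 ≤ r ∧ 0 ≤ s ∧ r + s ≤ 1) ↔ (0 ≤ r ∧ r ≤ 1 - s) :=
      ⟨fun h => ⟨h.1, by linarith [h.2.2]⟩, fun h => ⟨h.1, hs.1, by linarith [h.2]⟩⟩
    simp [this]
  · rw [Set.indicator_of_notMem hs]
    convert integral_zero ℝ F with r
    apply Set.indicator_of_notMem
    rintro ⟨h1, h2, h3⟩
    simp only at h1 h2 h3
    exact hs ⟨h2, by linarith⟩

namespace Tri

theorem carrier_eq_image (t : Tri) (i : Fin 3) :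
    t.carrier = (fun q : ℝ × ℝ => t.vtx i + q.1 • (t.vtx (i + 1) - t.vtx i)
      + q.2 • (t.vtx (i + 2) - t.vtx i)) '' refTri := by
  ext x
  constructor
  · intro hx
    rw [mem_carrier_iff] at hx
    have h1 := t.lam_sum x
    have h2 := t.lam_smul_sum x
    refine ⟨(t.lam (i + 1) x, t.lam (i + 2) x), ⟨hx _, hx _, ?_⟩, ?_⟩
    · have := hx i
      fin_cases i <;> simp [Fin.sum_univ_three] at h1 this ⊢ <;> linarith
    · conv_rhs => rw [← h2]
      have e : t.lam i x = 1 - t.lam (i + 1) x - t.lam (i + 2) x := by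
        fin_cases i <;> simp [Fin.sum_univ_three] at h1 ⊢ <;> linarith
      have e2 : ∑ j, t.lam j x • t.vtx j = t.lam i x • t.vtx i
          + t.lam (i + 1) x • t.vtx (i + 1) + t.lam (i + 2) x • t.vtx (i + 2) := by
        fin_cases i <;> simp [Fin.sum_univ_three] <;> abel
      rw [e2, e]
      module
  · rintro ⟨⟨r, s⟩, ⟨h1, h2, h3⟩, rfl⟩
    simp only at h1 h2 h3
    have : t.vtx i + r • (t.vtx (i + 1) - t.vtx i) + s • (t.vtx (i + 2) - t.vtx i)
        = (1 - r - s) • t.vtx i + r • t.vtx (i + 1) + s • t.vtx (i + 2) := by module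
    simp only [this]
    have hc := convex_convexHull ℝ (Set.range t.vtx)
    have := hc.sum_mem (t := Finset.univ) (w := ![1 - r - s, r, s])
      (z := ![t.vtx i, t.vtx (i + 1), t.vtx (i + 2)])
      (by intro j _; fin_cases j <;> simp <;> linarith)
      (by simp [Fin.sum_univ_three]; ring)
      (by intro j _; fin_cases j <;> exact t.vtx_mem _)
    simpa [Fin.sum_univ_three, carrier] using this

theorem setIntegral_carrier {F : Type*} [NormedAddCommGroup F] [NormedSpace ℝ F]
    (t : Tri) (i : Fin 3) (f : E2 → F) (hf : Continuous f) :
    ∫ x in t.carrier, f x = |t.sdet| • ∫ s in (0 : ℝ)..1, ∫ r in (0 : ℝ)..(1 - s), f (t.par i r s) := by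
  rw [t.carrier_eq_image i, integral_affine_image _ _ _ (by rw [sdet_cyc]; exact t.sdet_ne_zero)
    _ isClosed_refTri.measurableSet, sdet_cyc, integral_refTri _ (by fun_prop)]
  rfl

theorem area_eq (t : Tri) : t.area = |t.sdet| / 2 := by
  have h := t.setIntegral_carrier 0 (fun _ => (1 : ℝ)) continuous_const
  simp only [integral_const, MeasurableSet.univ, measureReal_restrict_apply, Set.univ_inter,
    smul_eq_mul, mul_one, intervalIntegral.integral_const, sub_zero] at h
  rw [area, ← Measure.real, h, intervalIntegral.integral_sub (by simp) (by simp)]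
  simp; ring

theorem area_pos (t : Tri) : 0 < t.area := by
  rw [area_eq]; have := abs_pos.2 t.sdet_ne_zero; positivity

theorem abs_sdet (t : Tri) : |t.sdet| = 2 * t.area := by rw [area_eq]; ring

end Tri

section average
variable {F : Type*} [NormedAddCommGroup F] [NormedSpace ℝ F]

/-- The mean value of a function on a segment. -/
def savg (φ : E2 → F) (a b : E2) : F := ∫ s in (0 : ℝ)..1, φ (a + s • (b - a))

theorem savg_swap (φ : E2 → F) (a b : E2) : savg φ a b = savg φ b a := by
  unfold savg
  have := intervalIntegral.integral_comp_sub_left (a := 0) (b := 1)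
    (fun s : ℝ => φ (a + s • (b - a))) 1
  simp only [sub_zero, sub_self] at this
  rw [← this]
  congr 1; ext s; congr 1; module

namespace Tri

/-- The outward normal to the edge opposite to vertex `i`, with length the length of the edge. -/
def nvec (t : Tri) (i : Fin 3) : E2 :=
  (-(|t.sdet| / t.sdet)) • perp (t.vtx (i + 2) - t.vtx (i + 1))

/-- The mean of `φ` on the edge opposite to vertex `i`. -/
def eavg (t : Tri) (φ : E2 → F) (i : Fin 3) : F := savg φ (t.vtx (i + 1)) (t.vtx (i + 2))

/-- The midpoint of the edge opposite to vertex `i`. -/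
def mid (t : Tri) (i : Fin 3) : E2 := midpoint ℝ (t.vtx (i + 1)) (t.vtx (i + 2))

theorem inner_nvec (t : Tri) (i : Fin 3) (x y : E2) :
    ⟪t.nvec i, x - y⟫ = |t.sdet| * (t.lam i y - t.lam i x) := by
  have h := t.sdet_ne_zero
  rw [nvec, real_inner_smul_left, inner_perp, lam, lam]
  field_simp
  simp [cross]; ring

theorem par_mem_edge (t : Tri) (i : Fin 3) (s : ℝ) :
    t.lam i (t.vtx (i + 1) + s • (t.vtx (i + 2) - t.vtx (i + 1))) = 0 := by
  rw [lam, div_eq_zero_iff]; left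
  simp [cross]; ring

theorem integral_fderiv_edge [CompleteSpace F] (t : Tri) (i : Fin 3) {φ : E2 → F}
    (hφ : ContDiff ℝ 1 φ) :
    ∫ x in t.carrier, fderiv ℝ φ x (t.vtx (i + 1) - t.vtx i)
      = |t.sdet| • (t.eavg φ i - t.eavg φ (i + 1)) := by
  have hd : Continuous (fderiv ℝ φ) := hφ.continuous_fderiv (by norm_num)
  have hc : Continuous φ := hφ.continuous
  rw [t.setIntegral_carrier i _ (by fun_prop)]
  congr 1
  have h1 : ∀ s : ℝ, ∫ r in (0 : ℝ)..(1 - s), fderiv ℝ φ (t.par i r s) (t.vtx (i + 1) - t.vtx i)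
      = φ (t.par i (1 - s) s) - φ (t.par i 0 s) := by
    intro s
    rw [intervalIntegral.integral_eq_sub_of_hasDerivAt (f := fun r => φ (t.par i r s))]
    · intro r _
      have hp : HasDerivAt (fun r => t.par i r s) (t.vtx (i + 1) - t.vtx i) r := by
        unfold par
        have := ((hasDerivAt_id r).smul_const (t.vtx (i + 1) - t.vtx i)).const_add (t.vtx i)
        simpa using this.add_const (s • (t.vtx (i + 2) - t.vtx i))
      exact ((hφ.differentiable (by norm_num) _).hasFDerivAt).comp_hasDerivAt r hp
    · apply Continuous.intervalIntegrable
      unfold par; fun_prop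
  simp_rw [h1]
  rw [intervalIntegral.integral_sub]
  · congr 1
    · unfold eavg savg
      congr 1; ext s; congr 1; unfold par; module
    · rw [eavg, savg_swap, savg]
      congr 1; ext s; congr 1
      have e1 : i + 1 + 2 = i := by fin_cases i <;> rfl
      have e2 : i + 1 + 1 = i + 2 := by fin_cases i <;> rfl
      unfold par; rw [e1, e2]; module
  · apply Continuous.intervalIntegrable
    unfold par; fun_prop
  · apply Continuous.intervalIntegrable
    unfold par; fun_prop

/-- The divergence theorem on a triangle. -/
theorem integral_fderiv [CompleteSpace F] (t : Tri) {φ : E2 → F} (hφ : ContDiff ℝ 1 φ) (e : E2) :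
    ∫ x in t.carrier, fderiv ℝ φ x e = ∑ i, ⟪t.nvec i, e⟫ • t.eavg φ i := by
  have hd : Continuous (fderiv ℝ φ) := hφ.continuous_fderiv (by norm_num)
  have h0 := t.integral_fderiv_edge 0 hφ
  have h2 := t.integral_fderiv_edge 2 hφ
  set d : Fin 3 → ℝ := fun i => t.lam i e - t.lam i 0 with hdd
  have hds : d 0 + d 1 + d 2 = 0 := by
    have a1 := t.lam_sum e
    have a2 := t.lam_sum 0
    simp only [Fin.sum_univ_three] at a1 a2
    simp only [hdd]; linarith
  have he : e = d 1 • (t.vtx 1 - t.vtx 0) + (-d 2) • (t.vtx 0 - t.vtx 2) := by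
    have a1 := t.lam_smul_sum e
    have a2 := t.lam_smul_sum 0
    have : e = d 0 • t.vtx 0 + d 1 • t.vtx 1 + d 2 • t.vtx 2 := by
      simp only [Fin.sum_univ_three] at a1 a2
      rw [← sub_zero e, ← a2]
      nth_rewrite 1 [← a1]
      simp only [hdd]; module
    rw [this, show d 0 = -d 1 - d 2 by linarith]
    module
  have hn : ∀ i, ⟪t.nvec i, e⟫ = -(|t.sdet| * d i) := by
    intro i
    have := t.inner_nvec i e 0
    rw [sub_zero] at this
    rw [this, hdd]; ring
  have hinteg : ∀ v : E2, IntegrableOn (fun x => fderiv ℝ φ x v) t.carrier := fun v =>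
    (by fun_prop : Continuous fun x => fderiv ℝ φ x v).continuousOn.integrableOn_compact
      t.isCompact_carrier
  have hl : ∫ x in t.carrier, fderiv ℝ φ x e
      = d 1 • (∫ x in t.carrier, fderiv ℝ φ x (t.vtx 1 - t.vtx 0))
        + (-d 2) • ∫ x in t.carrier, fderiv ℝ φ x (t.vtx 0 - t.vtx 2) := by
    rw [← integral_smul, ← integral_smul, ← integral_add ((hinteg _).fun_smul _) ((hinteg _).fun_smul _)]
    congr 1; ext x
    conv_lhs => rw [he]
    simp [map_add, map_smul]
  rw [hl]
  simp only [zero_add, show (2 : Fin 3) + 1 = 0 from rfl] at h0 h2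
  rw [h0, h2]
  simp only [Fin.sum_univ_three, hn, show d 0 = -d 1 - d 2 by linarith]
  module

theorem sum_nvec (t : Tri) : ∑ i, t.nvec i = 0 := by
  simp only [nvec, ← Finset.smul_sum]
  convert smul_zero _
  apply E2.ext' <;> simp [Fin.sum_univ_three]

theorem sum_nvec_mid (t : Tri) (g e c : E2) :
    ∑ i, ⟪t.nvec i, e⟫ * ⟪g, t.mid i - c⟫ = t.area * ⟪g, e⟫ := by
  have h := t.sdet_ne_zero
  rw [area_eq]
  have h2 : |t.sdet| = |t.sdet| / t.sdet * t.sdet := by field_simp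
  rw [h2]
  simp only [nvec, real_inner_smul_left, inner_perp]
  generalize |t.sdet| / t.sdet = s
  simp [Fin.sum_univ_three, mid, midpoint_eq_smul_add, inner_coord, cross, sdet]
  ring

theorem eavg_eq [CompleteSpace F] (t : Tri) {φ : E2 → F} (hφ : ContDiff ℝ 1 φ) (i : Fin 3) :
    (2 * t.area) • t.eavg φ i
      = (2 : ℝ) • (∫ x in t.carrier, φ x) + ∫ x in t.carrier, fderiv ℝ φ x (x - t.vtx i) := by
  have hd : Continuous (fderiv ℝ φ) := hφ.continuous_fderiv (by norm_num)
  have hc : Continuous φ := hφ.continuous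
  let b : Fin 2 → E2 := fun j => EuclideanSpace.single j 1
  have hco : ∀ j : Fin 2, ContDiff ℝ 1 (fun x : E2 => x j - t.vtx i j) := fun j => by fun_prop
  have hψ : ∀ j : Fin 2, ContDiff ℝ 1 (fun x : E2 => (x j - t.vtx i j) • φ x) := fun j =>
    (hco j).smul hφ
  have hder : ∀ j : Fin 2, ∀ x, fderiv ℝ (fun x : E2 => (x j - t.vtx i j) • φ x) x (b j)
      = φ x + (x j - t.vtx i j) • fderiv ℝ φ x (b j) := by
    intro j x
    rw [fderiv_fun_smul ((hco j).differentiable (by norm_num) x)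
      (hφ.differentiable (by norm_num) x)]
    have : HasFDerivAt (fun x : E2 => x j - t.vtx i j) (EuclideanSpace.proj j : E2 →L[ℝ] ℝ) x :=
      ((EuclideanSpace.proj j : E2 →L[ℝ] ℝ).hasFDerivAt).sub_const _
    rw [this.fderiv]
    simp [b, add_comm]
  have hsum : ∀ x, fderiv ℝ φ x (x - t.vtx i) = ∑ j, (x j - t.vtx i j) • fderiv ℝ φ x (b j) := by
    intro x
    have : x - t.vtx i = ∑ j, (x j - t.vtx i j) • b j := by
      apply E2.ext' <;> simp [b, Fin.sum_univ_two]
    conv_lhs => rw [this]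
    simp
  have hI : ∀ j, IntegrableOn (fun x : E2 => (x j - t.vtx i j) • fderiv ℝ φ x (b j)) t.carrier :=
    fun j => (by fun_prop : Continuous fun x : E2 =>
      (x j - t.vtx i j) • fderiv ℝ φ x (b j)).continuousOn.integrableOn_compact t.isCompact_carrier
  have hI0 : IntegrableOn φ t.carrier := hc.continuousOn.integrableOn_compact t.isCompact_carrier
  have hL : ∑ j, ∫ x in t.carrier, fderiv ℝ (fun x : E2 => (x j - t.vtx i j) • φ x) x (b j)
      = (2 : ℝ) • (∫ x in t.carrier, φ x) + ∫ x in t.carrier, fderiv ℝ φ x (x - t.vtx i) := by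
    simp_rw [hder, hsum]
    rw [Fin.sum_univ_two, integral_add hI0 (hI 0), integral_add hI0 (hI 1)]
    simp_rw [Fin.sum_univ_two]
    rw [integral_add (hI 0) (hI 1), two_smul]
    abel
  rw [← hL]
  have hb : ∀ j x, ⟪x, b j⟫ = (x : E2) j := by
    intro j x; simp [b, EuclideanSpace.inner_single_right]
  simp_rw [fun j => t.integral_fderiv (hψ j) (b j), hb]
  rw [Finset.sum_comm]
  have hl : ∀ l : Fin 3, ∑ j, (t.nvec l) j • t.eavg (fun x : E2 => (x j - t.vtx i j) • φ x) l
      = if l = i then (2 * t.area) • t.eavg φ i else 0 := by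
    intro l
    unfold eavg savg
    simp_rw [← intervalIntegral.integral_smul]
    rw [← intervalIntegral.integral_finsetSum]
    · have key : ∀ s : ℝ, ∑ j, (t.nvec l) j •
          (((t.vtx (l + 1) + s • (t.vtx (l + 2) - t.vtx (l + 1))) j - t.vtx i j) •
            φ (t.vtx (l + 1) + s • (t.vtx (l + 2) - t.vtx (l + 1))))
          = (if l = i then 2 * t.area else 0) •
            φ (t.vtx (l + 1) + s • (t.vtx (l + 2) - t.vtx (l + 1))) := by
        intro s
        have h1 := t.inner_nvec l (t.vtx (l + 1) + s • (t.vtx (l + 2) - t.vtx (l + 1))) (t.vtx i)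
        rw [par_mem_edge, lam_vtx, sub_zero, inner_coord, t.abs_sdet] at h1
        simp_rw [smul_smul]
        rw [← Finset.sum_smul, Fin.sum_univ_two]
        congr 1
        simp only [PiLp.sub_apply] at h1
        rw [h1]
        split_ifs with h2 h3 h3
        · ring
        · exact absurd h2.symm h3
        · exact absurd h3.symm h2
        · ring
      simp_rw [key]
      split_ifs with h
      · subst h; simp only [intervalIntegral.integral_smul]
      · simp
    · intro j _
      exact (by fun_prop : Continuous _).intervalIntegrable _ _
  simp_rw [hl]
  simp

/-- The mean value over the triangle. -/
def tavg (t : Tri) (φ : E2 → F) : F := t.area⁻¹ • ∫ x in t.carrier, φ x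

theorem norm_integral_sq_le (t : Tri) {g : E2 → ℝ} (hg : Continuous g) :
    (∫ x in t.carrier, g x) ^ 2 ≤ t.area * ∫ x in t.carrier, g x ^ 2 := by
  have hI : IntegrableOn g t.carrier := hg.continuousOn.integrableOn_compact t.isCompact_carrier
  have hI2 : IntegrableOn (fun x => g x ^ 2) t.carrier :=
    (hg.pow 2).continuousOn.integrableOn_compact t.isCompact_carrier
  set m := ∫ x in t.carrier, g x with hm
  have h1 : 0 ≤ ∫ x in t.carrier, (t.area * g x - m) ^ 2 := integral_nonneg fun x => sq_nonneg _
  have h2 : ∫ x in t.carrier, (t.area * g x - m) ^ 2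
      = t.area ^ 2 * (∫ x in t.carrier, g x ^ 2) - 2 * t.area * m * m + t.area * m ^ 2 := by
    have : ∀ x, (t.area * g x - m) ^ 2 = t.area ^ 2 * g x ^ 2 - 2 * t.area * m * g x + m ^ 2 := by
      intro x; ring
    simp_rw [this]
    have hfin : IntegrableOn (fun _ : E2 => m ^ 2) t.carrier :=
      continuousOn_const.integrableOn_compact t.isCompact_carrier
    rw [integral_add (f := fun x => t.area ^ 2 * g x ^ 2 - 2 * t.area * m * g x)
      ((hI2.const_mul _).sub (hI.const_mul _)) hfin,
      integral_sub (hI2.const_mul _) (hI.const_mul _), integral_const_mul, integral_const_mul]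
    simp [Measure.real, area, hm]
  rw [h2] at h1
  have := t.area_pos
  have h3 : 0 ≤ t.area * (t.area * (∫ x in t.carrier, g x ^ 2) - m ^ 2) := by nlinarith
  linarith [nonneg_of_mul_nonneg_right h3 this]

theorem eavg_sub_tavg_le [CompleteSpace F] (t : Tri) {φ : E2 → F} (hφ : ContDiff ℝ 1 φ)
    (i : Fin 3) {h : ℝ} (hh : ∀ x ∈ t.carrier, ‖x - t.vtx i‖ ≤ h) :
    t.area * ‖t.eavg φ i - t.tavg φ‖ ^ 2
      ≤ h ^ 2 * ∫ x in t.carrier, ‖fderiv ℝ φ x‖ ^ 2 := by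
  have hd : Continuous (fderiv ℝ φ) := hφ.continuous_fderiv (by norm_num)
  have ha := t.area_pos
  have h1 : (2 * t.area) • (t.eavg φ i - t.tavg φ)
      = ∫ x in t.carrier, fderiv ℝ φ x (x - t.vtx i) := by
    rw [smul_sub, t.eavg_eq hφ i, tavg, smul_smul, mul_assoc, mul_inv_cancel₀ ha.ne', mul_one]
    abel
  have h2 : ‖∫ x in t.carrier, fderiv ℝ φ x (x - t.vtx i)‖
      ≤ ∫ x in t.carrier, ‖fderiv ℝ φ x‖ * h := by
    apply norm_integral_le_of_norm_le
    · exact (by fun_prop : Continuous fun x => ‖fderiv ℝ φ x‖ * h).continuousOn.integrableOn_compact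
        t.isCompact_carrier
    · filter_upwards [ae_restrict_mem t.measurableSet_carrier] with x hx
      exact (ContinuousLinearMap.le_opNorm _ _).trans
        (mul_le_mul_of_nonneg_left (hh x hx) (norm_nonneg _))
  rw [integral_mul_const, ← h1, norm_smul, Real.norm_of_nonneg (by positivity)] at h2
  have h3 := t.norm_integral_sq_le hd.norm
  have h4 : 0 ≤ ∫ x in t.carrier, ‖fderiv ℝ φ x‖ ^ 2 := integral_nonneg fun x => by positivity
  have h5 := pow_le_pow_left₀ (by positivity) h2 2
  have h6 : (2 * t.area * ‖t.eavg φ i - t.tavg φ‖) ^ 2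
      ≤ h ^ 2 * (t.area * ∫ x in t.carrier, ‖fderiv ℝ φ x‖ ^ 2) := by
    rw [mul_pow _ h] at h5
    nlinarith [mul_le_mul_of_nonneg_left h3 (sq_nonneg h)]
  have h7 : t.area * (t.area * ‖t.eavg φ i - t.tavg φ‖ ^ 2)
      ≤ t.area * (h ^ 2 * ∫ x in t.carrier, ‖fderiv ℝ φ x‖ ^ 2) := by
    nlinarith [sq_nonneg (t.area * ‖t.eavg φ i - t.tavg φ‖)]
  exact le_of_mul_le_mul_left h7 ha

theorem integral_const_carrier [CompleteSpace F] (t : Tri) (c : F) :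
    ∫ _ in t.carrier, c = t.area • c := by
  simp [Measure.real, area]

end Tri

end average

namespace Tri

/-- The edge opposite to vertex `i`. -/
def edge (t : Tri) (i : Fin 3) : E2 × E2 := (t.vtx (i + 1), t.vtx (i + 2))

theorem centroid_eq (t : Tri) : t.centroid = ∑ i, (1 / 3 : ℝ) • t.vtx i := by
  rw [centroid, Finset.centroid_def, Finset.affineCombination_eq_linear_combination _ _ _
    (by simp [Finset.centroidWeights])]
  simp [Finset.centroidWeights]

theorem lam_centroid (t : Tri) (i : Fin 3) : t.lam i t.centroid = 1 / 3 := by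
  rw [centroid_eq, t.lam_comb (fun _ => 1 / 3) (by simp)]

theorem elen_edge_pos (t : Tri) (i : Fin 3) : 0 < elen (t.edge i) := by
  apply dist_pos.2
  apply t.vtx_ne
  simp

theorem elen_smul_nrm_edge (t : Tri) (i : Fin 3) :
    elen (t.edge i) • t.nrm (t.edge i) = t.nvec i := by
  have h := t.sdet_ne_zero
  have hl := (t.elen_edge_pos i).ne'
  have h1 := t.inner_nvec i (emid (t.edge i)) t.centroid
  have h2 : t.lam i (emid (t.edge i)) = 0 := by
    have := t.par_mem_edge i (1 / 2)
    rwa [show t.vtx (i + 1) + (1 / 2 : ℝ) • (t.vtx (i + 2) - t.vtx (i + 1)) = emid (t.edge i) by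
      rw [emid, midpoint_eq_smul_add]; simp only [edge, invOf_eq_inv]; module] at this
  rw [h2, lam_centroid, nvec, real_inner_smul_left] at h1
  have hP : ⟪perp ((t.edge i).2 - (t.edge i).1), emid (t.edge i) - t.centroid⟫ = - t.sdet / 3 := by
    have h3 : |t.sdet| ≠ 0 := abs_ne_zero.2 h
    change ⟪perp (t.vtx (i + 2) - t.vtx (i + 1)), _⟫ = _
    field_simp at h1 ⊢
    linarith
  rw [nrm, hP, nvec]
  split_ifs with hs
  · have : t.sdet < 0 := lt_of_le_of_ne (by linarith) h
    rw [smul_smul, mul_inv_cancel₀ hl, abs_of_neg this, neg_div, div_self h, neg_neg]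
    rfl
  · have : 0 < t.sdet := by push Not at hs; linarith
    rw [smul_neg, smul_smul, mul_inv_cancel₀ hl, abs_of_pos this, div_self h, neg_smul]
    rfl

theorem elen_swap (σ : E2 × E2) : elen σ.swap = elen σ := dist_comm _ _

theorem emid_swap (σ : E2 × E2) : emid σ.swap = emid σ := midpoint_comm _ _

theorem perp_neg (x : E2) : perp (-x) = -perp x := by
  apply E2.ext' <;> simp

theorem nrm_edge_swap (t : Tri) (i : Fin 3) : t.nrm (t.edge i).swap = t.nrm (t.edge i) := by
  have h := t.sdet_ne_zero
  have h1 := t.inner_nvec i (emid (t.edge i)) t.centroid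
  have h2 : t.lam i (emid (t.edge i)) = 0 := by
    have := t.par_mem_edge i (1 / 2)
    rwa [show t.vtx (i + 1) + (1 / 2 : ℝ) • (t.vtx (i + 2) - t.vtx (i + 1)) = emid (t.edge i) by
      rw [emid, midpoint_eq_smul_add]; simp only [edge, invOf_eq_inv]; module] at this
  rw [h2, lam_centroid, nvec, real_inner_smul_left] at h1
  have h3 : |t.sdet| ≠ 0 := abs_ne_zero.2 h
  have hP : ⟪perp ((t.edge i).2 - (t.edge i).1), emid (t.edge i) - t.centroid⟫ ≠ 0 := by
    intro h0
    change ⟪perp (t.vtx (i + 2) - t.vtx (i + 1)), _⟫ = 0 at h0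
    rw [h0] at h1
    apply h3
    linarith
  have e : perp ((t.edge i).swap.2 - (t.edge i).swap.1)
      = -perp ((t.edge i).2 - (t.edge i).1) := by
    rw [← perp_neg]; simp
  rw [nrm, nrm, e, emid_swap, elen_swap, inner_neg_left]
  rcases lt_or_gt_of_ne hP with hl | hl
  · rw [if_pos (by linarith), if_neg (by linarith)]; simp
  · rw [if_neg (by linarith), if_pos hl.le]; simp

/-- An edge of `t` is, up to orientation, one of the three standard ones. -/
theorem hasEdge_iff (t : Tri) (σ : E2 × E2) :
    t.hasEdge σ ↔ ∃ i, σ = t.edge i ∨ σ = (t.edge i).swap := by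
  constructor
  · rintro ⟨hne, ⟨a, ha⟩, ⟨b, hb⟩⟩
    have hab : a ≠ b := by rintro rfl; exact hne (ha.symm.trans hb)
    obtain ⟨s1, s2⟩ := σ
    simp only at ha hb
    subst ha hb
    fin_cases a <;> fin_cases b <;> simp at hab
    · exact ⟨2, Or.inl rfl⟩
    · exact ⟨1, Or.inr rfl⟩
    · exact ⟨2, Or.inr rfl⟩
    · exact ⟨0, Or.inl rfl⟩
    · exact ⟨1, Or.inl rfl⟩
    · exact ⟨0, Or.inr rfl⟩
  · rintro ⟨i, rfl | rfl⟩
    · exact ⟨t.vtx_ne (by simp), ⟨_, rfl⟩, ⟨_, rfl⟩⟩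
    · exact ⟨t.vtx_ne (by simp), ⟨_, rfl⟩, ⟨_, rfl⟩⟩

theorem hasEdge_swap (t : Tri) (σ : E2 × E2) : t.hasEdge σ.swap ↔ t.hasEdge σ := by
  simp only [hasEdge, Prod.fst_swap, Prod.snd_swap, ne_comm]
  tauto

theorem hasEdge_edge (t : Tri) (i : Fin 3) : t.hasEdge (t.edge i) :=
  (t.hasEdge_iff _).2 ⟨i, Or.inl rfl⟩

theorem edge_inj (t : Tri) {i j : Fin 3}
    (h : t.edge i = t.edge j ∨ t.edge i = (t.edge j).swap) : i = j := by
  have inj := t.indep.injective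
  simp only [edge, Prod.swap_prod_mk, Prod.mk.injEq, inj.eq_iff] at h
  revert h; revert i j; decide

end Tri

namespace Mesh
variable {Ω : Set E2} (M : Mesh Ω)

theorem sum_edges_tri {A : Type*} [AddCommMonoid A] {t : Tri} (ht : t ∈ M.tris)
    (G : E2 × E2 → A) (hG : ∀ i, G (t.edge i).swap = G (t.edge i)) :
    ∑ σ ∈ M.edges.filter (fun σ => t.hasEdge σ), G σ = ∑ i, G (t.edge i) := by
  symm
  have hmem : ∀ i, t.edge i ∈ M.edges ∨ (t.edge i).swap ∈ M.edges := fun i =>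
    M.edges_cover t ht (i + 1) (i + 2) (by simp)
  refine Finset.sum_bij (fun i _ => if t.edge i ∈ M.edges then t.edge i else (t.edge i).swap)
    ?_ ?_ ?_ ?_
  · intro i _
    rw [Finset.mem_filter]
    split_ifs with h
    · exact ⟨h, t.hasEdge_edge i⟩
    · exact ⟨(hmem i).resolve_left h, (t.hasEdge_swap _).2 (t.hasEdge_edge i)⟩
  · intro i _ j _ h
    apply t.edge_inj
    split_ifs at h with h1 h2 h2
    · exact Or.inl h
    · exact Or.inr h
    · right; rw [← h, Prod.swap_swap]
    · left; exact Prod.swap_injective h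
  · intro σ hσ
    rw [Finset.mem_filter] at hσ
    obtain ⟨i, rfl | rfl⟩ := (t.hasEdge_iff σ).1 hσ.2
    · exact ⟨i, Finset.mem_univ _, if_pos hσ.1⟩
    · refine ⟨i, Finset.mem_univ _, if_neg ?_⟩
      have := M.edges_orient _ hσ.1
      rwa [Prod.swap_swap] at this
  · intro i _
    split_ifs
    · rfl
    · rw [hG]

theorem mem_int {σ : E2 × E2} : σ ∈ M.intEdges ↔
    σ ∈ M.edges ∧ (M.tris.filter fun t => t.hasEdge σ).card = 2 := Finset.mem_filter
theorem mem_ext {σ : E2 × E2} : σ ∈ M.extEdges ↔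
    σ ∈ M.edges ∧ (M.tris.filter fun t => t.hasEdge σ).card = 1 := Finset.mem_filter

theorem filter_int {σ : E2 × E2} (hσ : σ ∈ M.intEdges) :
    (M.tris.filter fun t => t.hasEdge σ) = {M.Kof σ, M.Lof σ} := by
  obtain ⟨h1, h2⟩ := M.mem_int.1 hσ
  obtain ⟨hK, hK'⟩ := M.Kof_mem σ h1
  obtain ⟨hL, hL', hne⟩ := M.Lof_mem σ h1 h2
  symm
  apply Finset.eq_of_subset_of_card_le
  · intro t ht
    simp only [Finset.mem_insert, Finset.mem_singleton] at ht
    rcases ht with rfl | rfl <;> simp [*]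
  · rw [h2, Finset.card_pair hne.symm]

theorem filter_ext {σ : E2 × E2} (hσ : σ ∈ M.extEdges) :
    (M.tris.filter fun t => t.hasEdge σ) = {M.Kof σ} := by
  obtain ⟨h1, h2⟩ := M.mem_ext.1 hσ
  obtain ⟨hK, hK'⟩ := M.Kof_mem σ h1
  symm
  apply Finset.eq_of_subset_of_card_le
  · intro t ht
    rw [Finset.mem_singleton] at ht
    subst ht; simp [*]
  · rw [h2, Finset.card_singleton]

theorem edges_eq : M.edges = M.intEdges ∪ M.extEdges := by
  ext σ
  rw [Finset.mem_union, mem_int, mem_ext, ← and_or_left]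
  constructor
  · intro h
    refine ⟨h, ?_⟩
    have h2 := M.edges_atMostTwo σ h
    obtain ⟨t, ht, ht'⟩ := M.edges_sub σ h
    have : 0 < (M.tris.filter fun t => t.hasEdge σ).card :=
      Finset.card_pos.2 ⟨t, Finset.mem_filter.2 ⟨ht, ht'⟩⟩
    omega
  · exact fun h => h.1

theorem disj_edges : Disjoint M.intEdges M.extEdges := by
  rw [Finset.disjoint_left]
  intro σ h1 h2
  have := (M.mem_int.1 h1).2
  rw [(M.mem_ext.1 h2).2] at this
  omega

section sums
variable {A : Type*} [AddCommMonoid A]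

theorem sum_edges (G : E2 × E2 → A) :
    ∑ σ ∈ M.edges, G σ = ∑ σ ∈ M.intEdges, G σ + ∑ σ ∈ M.extEdges, G σ := by
  conv_lhs => rw [M.edges_eq]
  exact Finset.sum_union M.disj_edges

theorem sum_tris_int (G : Tri → E2 × E2 → A) :
    ∑ t ∈ M.tris, ∑ σ ∈ M.intEdges.filter (fun σ => t.hasEdge σ), G t σ
      = ∑ σ ∈ M.intEdges, (G (M.Kof σ) σ + G (M.Lof σ) σ) := by
  rw [Finset.sum_comm' (t' := M.intEdges) (s' := fun σ => M.tris.filter fun t => t.hasEdge σ)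
    (by intro t σ; simp only [Finset.mem_filter]; tauto)]
  apply Finset.sum_congr rfl
  intro σ hσ
  rw [M.filter_int hσ, Finset.sum_pair]
  obtain ⟨h1, h2⟩ := M.mem_int.1 hσ
  exact (M.Lof_mem σ h1 h2).2.2.symm

theorem sum_tris_ext (G : Tri → E2 × E2 → A) :
    ∑ t ∈ M.tris, ∑ σ ∈ M.extEdges.filter (fun σ => t.hasEdge σ), G t σ
      = ∑ σ ∈ M.extEdges, G (M.Kof σ) σ := by
  rw [Finset.sum_comm' (t' := M.extEdges) (s' := fun σ => M.tris.filter fun t => t.hasEdge σ)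
    (by intro t σ; simp only [Finset.mem_filter]; tauto)]
  apply Finset.sum_congr rfl
  intro σ hσ
  rw [M.filter_ext hσ, Finset.sum_singleton]

/-- Regrouping a sum over the edges of all triangles. -/
theorem sum_tris_edges (G : Tri → E2 × E2 → A)
    (hG : ∀ t ∈ M.tris, ∀ i, G t (t.edge i).swap = G t (t.edge i)) :
    ∑ t ∈ M.tris, ∑ i, G t (t.edge i)
      = ∑ σ ∈ M.intEdges, (G (M.Kof σ) σ + G (M.Lof σ) σ) + ∑ σ ∈ M.extEdges, G (M.Kof σ) σ := by
  rw [← M.sum_tris_int, ← M.sum_tris_ext, ← Finset.sum_add_distrib]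
  apply Finset.sum_congr rfl
  intro t ht
  rw [← M.sum_edges_tri ht (G t) (hG t ht), M.edges_eq, Finset.filter_union, Finset.sum_union]
  exact Finset.disjoint_filter_filter M.disj_edges

end sums

theorem Kof_int {σ : E2 × E2} (hσ : σ ∈ M.intEdges) : M.Kof σ ∈ M.tris ∧ (M.Kof σ).hasEdge σ :=
  M.Kof_mem σ (M.mem_int.1 hσ).1
theorem Lof_int {σ : E2 × E2} (hσ : σ ∈ M.intEdges) :
    M.Lof σ ∈ M.tris ∧ (M.Lof σ).hasEdge σ ∧ M.Lof σ ≠ M.Kof σ :=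
  M.Lof_mem σ (M.mem_int.1 hσ).1 (M.mem_int.1 hσ).2
theorem Kof_ext {σ : E2 × E2} (hσ : σ ∈ M.extEdges) : M.Kof σ ∈ M.tris ∧ (M.Kof σ).hasEdge σ :=
  M.Kof_mem σ (M.mem_ext.1 hσ).1

end Mesh

namespace Tri

theorem nrm_eq_or (t : Tri) (σ : E2 × E2) :
    (0 ≤ ⟪perp (σ.2 - σ.1), emid σ - t.centroid⟫ ∧ t.nrm σ = (elen σ)⁻¹ • perp (σ.2 - σ.1)) ∨
    (⟪perp (σ.2 - σ.1), emid σ - t.centroid⟫ < 0 ∧ t.nrm σ = -((elen σ)⁻¹ • perp (σ.2 - σ.1))) := by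
  unfold nrm
  split_ifs with h
  · exact Or.inl ⟨h, rfl⟩
  · exact Or.inr ⟨not_le.1 h, rfl⟩

/-- Points obtained by moving slightly from the midpoint of an edge to the inner side of
the edge are interior points of the triangle. -/
theorem eventually_interior (t : Tri) (i : Fin 3) (d : E2) (hd : ⟪t.nvec i, d⟫ < 0) :
    ∀ᶠ ε in nhdsWithin (0 : ℝ) (Set.Ioi 0), t.mid i + ε • d ∈ interior t.carrier := by
  have hs : 0 < |t.sdet| := abs_pos.2 t.sdet_ne_zero
  have hmid : t.mid i = ∑ j, (if j = i then 0 else (1 / 2 : ℝ)) • t.vtx j := by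
    unfold mid
    rw [midpoint_eq_smul_add]
    fin_cases i <;> simp [Fin.sum_univ_three, smul_add, add_comm]
  have hlm : ∀ j, t.lam j (t.mid i) = if j = i then 0 else 1 / 2 := by
    intro j
    rw [hmid, t.lam_comb]
    fin_cases i <;> simp [Fin.sum_univ_three] <;> norm_num
  have hev : ∀ j, ∀ᶠ ε in nhdsWithin (0 : ℝ) (Set.Ioi 0), 0 < t.lam j (t.mid i + ε • d) := by
    intro j
    by_cases hj : j = i
    · filter_upwards [self_mem_nhdsWithin] with ε hε
      have h1 := t.inner_nvec i (t.mid i + ε • d) (t.mid i)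
      rw [add_sub_cancel_left, inner_smul_right, hlm, if_pos rfl] at h1
      subst hj
      have : 0 < |t.sdet| * t.lam j (t.mid j + ε • d) := by
        have := mul_neg_of_pos_of_neg (Set.mem_Ioi.1 hε) hd
        linarith
      exact (pos_iff_pos_of_mul_pos this).1 hs
    · have hc : ContinuousAt (fun ε : ℝ => t.lam j (t.mid i + ε • d)) 0 := by
        have := t.continuous_lam j
        fun_prop
      have h0 : 0 < t.lam j (t.mid i + (0 : ℝ) • d) := by
        rw [zero_smul, add_zero, hlm, if_neg hj]; norm_num
      exact nhdsWithin_le_nhds (hc.eventually (lt_mem_nhds h0))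
  filter_upwards [Filter.eventually_all.2 hev] with ε hε
  exact t.mem_interior hε

end Tri

namespace Mesh
variable {Ω : Set E2} (M : Mesh Ω)

/-- The normals seen from the two sides of an interior edge are opposite. -/
theorem nrm_Lof {σ : E2 × E2} (hσ : σ ∈ M.intEdges) :
    (M.Lof σ).nrm σ = -(M.Kof σ).nrm σ := by
  obtain ⟨hK, hK'⟩ := M.Kof_int hσ
  obtain ⟨hL, hL', hne⟩ := M.Lof_int hσ
  by_contra hcon
  have heq : (M.Lof σ).nrm σ = (M.Kof σ).nrm σ := by
    rcases (M.Lof σ).nrm_eq_or σ with ⟨_, h1⟩ | ⟨_, h1⟩ <;>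
    rcases (M.Kof σ).nrm_eq_or σ with ⟨_, h2⟩ | ⟨_, h2⟩
    · rw [h1, h2]
    · exact absurd (by rw [h1, h2, neg_neg]) hcon
    · exact absurd (by rw [h1, h2]) hcon
    · rw [h1, h2]
  have key : ∀ t : Tri, t.hasEdge σ → ∃ i, t.mid i = emid σ ∧ t.nvec i = elen σ • t.nrm σ := by
    intro t ht
    obtain ⟨i, hi | hi⟩ := (t.hasEdge_iff σ).1 ht
    · exact ⟨i, by rw [hi]; rfl, by rw [hi, t.elen_smul_nrm_edge]⟩
    · exact ⟨i, by rw [hi, Tri.emid_swap]; rfl,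
        by rw [hi, Tri.elen_swap, t.nrm_edge_swap, t.elen_smul_nrm_edge]⟩
  obtain ⟨i, hi1, hi2⟩ := key _ hK'
  obtain ⟨j, hj1, hj2⟩ := key _ hL'
  rw [heq, ← hi2] at hj2
  have hnz : (M.Kof σ).nvec i ≠ 0 := by
    intro h0
    have := (M.Kof σ).inner_nvec i ((M.Kof σ).vtx i) ((M.Kof σ).vtx (i + 1))
    rw [h0, inner_zero_left, Tri.lam_vtx, Tri.lam_vtx, if_pos rfl, if_neg (by simp)] at this
    have h2 := abs_pos.2 (M.Kof σ).sdet_ne_zero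
    linarith
  have hneg : ⟪(M.Kof σ).nvec i, -(M.Kof σ).nvec i⟫ < 0 := by
    rw [inner_neg_right, real_inner_self_eq_norm_sq]
    have := norm_pos_iff.2 hnz
    have : 0 < ‖(M.Kof σ).nvec i‖ ^ 2 := by positivity
    linarith
  have h1 := (M.Kof σ).eventually_interior i _ hneg
  have h2 := (M.Lof σ).eventually_interior j (-(M.Kof σ).nvec i) (by rw [hj2]; exact hneg)
  obtain ⟨ε, ha, hb⟩ := (h1.and h2).exists
  rw [hi1] at ha
  rw [hj1] at hb
  have := M.interior_disjoint _ hK _ hL hne.symm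
  have hmem : emid σ + ε • -(M.Kof σ).nvec i ∈
      interior (M.Kof σ).carrier ∩ interior (M.Lof σ).carrier := ⟨ha, hb⟩
  rw [this] at hmem
  exact hmem

theorem other_Kof (σ : E2 × E2) : M.other (M.Kof σ) σ = M.Lof σ := if_pos rfl
theorem other_Lof {σ : E2 × E2} (hσ : σ ∈ M.intEdges) : M.other (M.Lof σ) σ = M.Kof σ :=
  if_neg (M.Lof_int hσ).2.2.symm

end Mesh

/-- Unit coordinate vectors of the plane. -/
abbrev ee (j : Fin 2) : E2 := EuclideanSpace.single j 1

/-- Partial derivatives. -/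
def pd (j : Fin 2) (f : E2 → ℝ) (x : E2) : ℝ := fderiv ℝ f x (ee j)

theorem E2.sum_ee (x : E2) : ∑ j, x j • ee j = x := by
  apply E2.ext' <;> simp [Fin.sum_univ_two]

theorem norm_ee (j : Fin 2) : ‖ee j‖ = 1 := by simp

theorem continuous_pd {f : E2 → ℝ} (hf : ContDiff ℝ 1 f) (j : Fin 2) : Continuous (pd j f) :=
  (hf.continuous_fderiv (by norm_num)).clm_apply continuous_const

theorem contDiff_pd {n : ℕ} {f : E2 → ℝ} (hf : ContDiff ℝ (n + 1) f) (j : Fin 2) :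
    ContDiff ℝ n (pd j f) :=
  (hf.fderiv_right le_rfl).clm_apply contDiff_const

/-- A smooth cutoff equal to one near a compact set. -/
theorem exists_cutoff {K : Set E2} (hK : IsCompact K) :
    ∃ χ : E2 → ℝ, ContDiff ℝ 2 χ ∧ HasCompactSupport χ ∧ ∀ x ∈ K, χ =ᶠ[nhds x] fun _ => 1 := by
  obtain ⟨R, hR⟩ := hK.isBounded.subset_ball (0 : E2)
  let b : ContDiffBump (0 : E2) := ⟨max R 1, max R 1 + 1, by positivity, by linarith⟩
  refine ⟨b, b.contDiff, b.hasCompactSupport, fun x hx => ?_⟩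
  have hx' : x ∈ Metric.ball (0 : E2) b.rIn :=
    Metric.ball_subset_ball (le_max_left _ _) (hR hx)
  exact b.eventuallyEq_one_of_mem_ball hx'

theorem lineDeriv_eq_zero_of_notMem_tsupport {η : E2 → ℝ} {x : E2} (hx : x ∉ tsupport η) (v : E2) :
    lineDeriv ℝ η x v = 0 := by
  have h : η =ᶠ[nhds x] fun _ => (0 : ℝ) := by
    rw [notMem_tsupport_iff_eventuallyEq] at hx; exact hx
  rw [h.lineDeriv_eq]; simp [lineDeriv]

/-- Integration by parts against a compactly supported Lipschitz function. -/
theorem lip_ibp {η G : E2 → ℝ} {C : NNReal} (hη : LipschitzWith C η) (hc : HasCompactSupport η)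
    (hG : ContDiff ℝ 1 G) (v : E2) :
    ∫ x, lineDeriv ℝ η x v * G x = - ∫ x, η x * fderiv ℝ G x v := by
  obtain ⟨χ, h1, h2, h3⟩ := exists_cutoff hc
  have hχG : ContDiff ℝ 1 (fun x => χ x * G x) := (h1.of_le (by norm_num)).mul hG
  have hcχ : HasCompactSupport (fun x => χ x * G x) := h2.mul_right
  obtain ⟨D, hD⟩ := hχG.lipschitzWith_of_hasCompactSupport hcχ (by norm_num)
  have := LipschitzWith.integral_lineDeriv_mul_eq (μ := volume) hη hD hcχ v
  rw [← integral_neg]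
  rw [show ∫ x, lineDeriv ℝ η x v * G x = ∫ x, lineDeriv ℝ η x v * (χ x * G x) from ?_, this]
  · apply integral_congr_ae
    filter_upwards with x
    by_cases hx : x ∈ tsupport η
    · have : (fun x => χ x * G x) =ᶠ[nhds x] G := by
        filter_upwards [h3 x hx] with y hy
        rw [hy, one_mul]
      rw [this.lineDeriv_eq, ((hG.differentiable (by norm_num)) x).lineDeriv_eq_fderiv]
      simp; ring
    · rw [image_eq_zero_of_notMem_tsupport hx]; simp
  · apply integral_congr_ae
    filter_upwards with x
    by_cases hx : x ∈ tsupport η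
    · rw [(h3 x hx).self_of_nhds, one_mul]
    · rw [lineDeriv_eq_zero_of_notMem_tsupport hx]; simp

namespace Tri

/-- The open triangle. -/
def inn (t : Tri) : Set E2 := {x | ∀ i, 0 < t.lam i x}

theorem isOpen_inn (t : Tri) : IsOpen t.inn := by
  rw [inn, Set.ofPred_forall]
  exact isOpen_iInter_of_finite fun i => isOpen_lt continuous_const (t.continuous_lam i)

theorem inn_subset (t : Tri) : t.inn ⊆ t.carrier := fun x hx =>
  (t.mem_carrier_iff x).2 fun i => (hx i).le

/-- The smallest barycentric coordinate. -/
def minlam (t : Tri) (x : E2) : ℝ := min (t.lam 0 x) (min (t.lam 1 x) (t.lam 2 x))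

theorem lt_minlam (t : Tri) (a : ℝ) (x : E2) : a < t.minlam x ↔ ∀ i, a < t.lam i x := by
  simp [minlam, Fin.forall_fin_succ]

theorem le_minlam (t : Tri) (a : ℝ) (x : E2) : a ≤ t.minlam x ↔ ∀ i, a ≤ t.lam i x := by
  simp [minlam, Fin.forall_fin_succ]

theorem minlam_le (t : Tri) (x : E2) : t.minlam x ≤ 1 / 3 := by
  by_contra h
  have h1 := (t.lt_minlam _ x).1 (not_le.1 h)
  have h2 := t.lam_sum x
  have := h1 0; have := h1 1; have := h1 2
  rw [Fin.sum_univ_three] at h2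
  linarith

/-- The distance-like tent function of the triangle. -/
def tent (t : Tri) (x : E2) : ℝ := max (t.minlam x) 0

theorem lam_lipschitz (t : Tri) (i : Fin 3) : ∃ C, LipschitzWith C (t.lam i) := by
  refine ⟨(‖t.nvec i‖ / |t.sdet|).toNNReal, LipschitzWith.of_dist_le_mul fun x y => ?_⟩
  have hs : 0 < |t.sdet| := abs_pos.2 t.sdet_ne_zero
  rw [Real.coe_toNNReal _ (by positivity), Real.dist_eq, dist_eq_norm]
  have h := t.inner_nvec i y x
  have h2 := abs_real_inner_le_norm (t.nvec i) (y - x)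
  rw [h, abs_mul, abs_abs, norm_sub_rev y x] at h2
  rw [div_mul_eq_mul_div, le_div_iff₀ hs]
  linarith

theorem tent_lipschitz (t : Tri) : ∃ C, LipschitzWith C t.tent := by
  obtain ⟨a, ha⟩ := t.lam_lipschitz 0
  obtain ⟨b, hb⟩ := t.lam_lipschitz 1
  obtain ⟨c, hc⟩ := t.lam_lipschitz 2
  exact ⟨_, (ha.min (hb.min hc)).max_const 0⟩

theorem tent_eq_zero (t : Tri) {x : E2} (hx : x ∉ t.inn) : t.tent x = 0 := by
  apply max_eq_right
  by_contra h
  exact hx ((t.lt_minlam 0 x).1 (not_le.1 h))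

theorem tent_pos (t : Tri) {x : E2} (hx : x ∈ t.inn) : 0 < t.minlam x := (t.lt_minlam 0 x).2 hx

theorem tent_compact (t : Tri) : HasCompactSupport t.tent :=
  HasCompactSupport.intro t.isCompact_carrier fun _ hx =>
    t.tent_eq_zero fun h => hx (t.inn_subset h)

theorem lam_affine (t : Tri) (i : Fin 3) (x y : E2) (s : ℝ) :
    t.lam i (y + s • (x - y)) = t.lam i y + s * (t.lam i x - t.lam i y) := by
  have h := t.sdet_ne_zero
  simp only [lam]
  field_simp
  simp [cross]; ring

theorem minlam_homothety (t : Tri) (x : E2) {s : ℝ} (hs : 0 ≤ s) :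
    t.minlam (t.centroid + s • (x - t.centroid)) = 1 / 3 + s * (t.minlam x - 1 / 3) := by
  simp only [minlam, lam_affine, lam_centroid]
  have h : ∀ a b : ℝ, min (1 / 3 + s * (a - 1 / 3)) (1 / 3 + s * (b - 1 / 3))
      = 1 / 3 + s * (min a b - 1 / 3) := fun a b => by
    rcases le_total a b with hab | hab
    · rw [min_eq_left hab, min_eq_left (by nlinarith)]
    · rw [min_eq_right hab, min_eq_right (by nlinarith)]
  rw [h, h]

theorem lineDeriv_tent_zero (t : Tri) {x : E2} (hx : x ∉ t.inn) (v : E2) :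
    lineDeriv ℝ t.tent x v = 0 := by
  unfold lineDeriv
  apply IsLocalMin.deriv_eq_zero
  filter_upwards with s
  simp only [zero_smul, add_zero, t.tent_eq_zero hx]
  exact le_max_right _ _

theorem lineDeriv_tent_radial (t : Tri) {x : E2} (hx : x ∈ t.inn) :
    lineDeriv ℝ t.tent x (x - t.centroid) = t.tent x - 1 / 3 := by
  have h0 := t.tent_pos hx
  have h1 := t.minlam_le x
  have e : (fun s : ℝ => t.tent (x + s • (x - t.centroid))) =ᶠ[nhds 0]
      fun s => 1 / 3 + (1 + s) * (t.minlam x - 1 / 3) := by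
    have hc : Filter.Tendsto (fun s : ℝ => 1 / 3 + (1 + s) * (t.minlam x - 1 / 3)) (nhds 0)
        (nhds (1 / 3 + (1 + 0) * (t.minlam x - 1 / 3))) := by
      apply Continuous.tendsto; fun_prop
    have hp : 0 < 1 / 3 + (1 + 0) * (t.minlam x - 1 / 3) := by linarith
    filter_upwards [hc.eventually (lt_mem_nhds hp), lt_mem_nhds (show (-1 : ℝ) < 0 by norm_num)]
      with s hs hs1
    rw [show x + s • (x - t.centroid) = t.centroid + (1 + s) • (x - t.centroid) by module, tent,
      minlam_homothety _ _ (by linarith), max_eq_left hs.le]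
  unfold lineDeriv
  rw [e.deriv_eq, tent, max_eq_left h0.le]
  have : HasDerivAt (fun s : ℝ => 1 / 3 + (1 + s) * (t.minlam x - 1 / 3))
      (1 * (t.minlam x - 1 / 3)) 0 :=
    (((hasDerivAt_id (0 : ℝ)).const_add 1).mul_const _).const_add _
  rw [this.deriv, one_mul]

end Tri

theorem pd_mul {f g : E2 → ℝ} (hf : ContDiff ℝ 1 f) (hg : ContDiff ℝ 1 g) (j : Fin 2) (x : E2) :
    pd j (fun x => f x * g x) x = pd j f x * g x + f x * pd j g x := by
  have h1 := (hf.differentiable (by norm_num)) x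
  have h2 := (hg.differentiable (by norm_num)) x
  rw [pd, fderiv_fun_mul h1 h2]
  simp [pd]; ring

theorem pd_sub {f g : E2 → ℝ} (hf : ContDiff ℝ 1 f) (hg : ContDiff ℝ 1 g) (j : Fin 2) (x : E2) :
    pd j (fun x => f x - g x) x = pd j f x - pd j g x := by
  have h1 := (hf.differentiable (by norm_num)) x
  have h2 := (hg.differentiable (by norm_num)) x
  rw [pd, fderiv_fun_sub h1 h2]
  simp [pd]

theorem pd_coord (c : E2) (i j : Fin 2) (x : E2) :
    pd j (fun x : E2 => (x - c) i) x = if i = j then 1 else 0 := by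
  have h : HasFDerivAt (fun x : E2 => (x - c) i) (EuclideanSpace.proj i : E2 →L[ℝ] ℝ) x := by
    have := ((EuclideanSpace.proj i : E2 →L[ℝ] ℝ).hasFDerivAt (x := x - c)).comp x
      ((hasFDerivAt_id x).sub_const c)
    exact this
  rw [pd, h.fderiv]
  simp

theorem contDiff_coord (c : E2) (i : Fin 2) : ContDiff ℝ 2 (fun x : E2 => (x - c) i) := by
  have : ContDiff ℝ 2 (fun x : E2 => (EuclideanSpace.proj i : E2 →L[ℝ] ℝ) (x - c)) := by fun_prop
  exact this

namespace Tri

theorem integrable_lineDeriv_mul (t : Tri) {G : E2 → ℝ} (hG : Continuous G) (v : E2) :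
    Integrable (fun x => lineDeriv ℝ t.tent x v * G x) := by
  obtain ⟨C, hC⟩ := t.tent_lipschitz
  have h1 : Integrable (t.carrier.indicator G) :=
    (hG.continuousOn.integrableOn_compact t.isCompact_carrier).integrable_indicator
      t.measurableSet_carrier
  have h2 := h1.bdd_mul (f := fun x => lineDeriv ℝ t.tent x v) (c := C * ‖v‖)
    (aestronglyMeasurable_lineDeriv hC.continuous _)
    (Filter.Eventually.of_forall fun x => norm_lineDeriv_le_of_lipschitz ℝ hC)
  refine h2.congr (Filter.Eventually.of_forall fun x => ?_)
  by_cases hx : x ∈ t.carrier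
  · simp [hx]
  · simp [hx, t.lineDeriv_tent_zero fun h => hx (t.inn_subset h)]

theorem measurableSet_inn (t : Tri) : MeasurableSet t.inn := t.isOpen_inn.measurableSet

theorem integrableOn_inn (t : Tri) {G : E2 → ℝ} (hG : Continuous G) : IntegrableOn G t.inn :=
  (hG.continuousOn.integrableOn_compact t.isCompact_carrier).mono_set t.inn_subset

theorem continuous_minlam (t : Tri) : Continuous t.minlam :=
  (t.continuous_lam 0).min ((t.continuous_lam 1).min (t.continuous_lam 2))

theorem setIntegral_inn_tent (t : Tri) (G : E2 → ℝ) :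
    ∫ x, t.tent x * G x = ∫ x in t.inn, t.minlam x * G x := by
  rw [← integral_indicator t.measurableSet_inn]
  congr 1; ext x
  by_cases hx : x ∈ t.inn
  · simp [hx, tent, max_eq_left (t.tent_pos hx).le]
  · simp [hx, t.tent_eq_zero hx]

/-- A Rellich-type identity for conjugate harmonic functions on a triangle bounds the
difference of their squares near the boundary. -/
theorem boundary_estimate (t : Tri) : ∃ C, 0 ≤ C ∧ ∀ f g : E2 → ℝ, ContDiff ℝ 2 f → ContDiff ℝ 2 g →
    (∀ x ∈ t.inn, pd 0 f x = pd 1 g x ∧ pd 1 f x = - pd 0 g x) →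
    ∫ x in t.inn, (1 / 3 - 3 * t.minlam x) * (f x ^ 2 - g x ^ 2) ≤ C * ∫ x in t.inn, |f x * g x| := by
  obtain ⟨L, hL⟩ := t.tent_lipschitz
  obtain ⟨R, hR⟩ := t.isCompact_carrier.isBounded.subset_closedBall t.centroid
  have hR0 : 0 ≤ max R 0 := le_max_right _ _
  refine ⟨4 * L * max R 0, by positivity, fun f g hf hg hCR => ?_⟩
  set c := t.centroid
  set D : Fin 2 → E2 → ℝ := fun j x => lineDeriv ℝ t.tent x (ee j) with hD
  set q : Fin 2 → E2 → ℝ := fun j x => (x - c) j with hq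
  have hq2 : ∀ j, ContDiff ℝ 2 (q j) := contDiff_coord c
  have hq1 : ∀ j, ContDiff ℝ 1 (q j) := fun j => (hq2 j).of_le (by norm_num)
  have hf1 : ContDiff ℝ 1 f := hf.of_le (by norm_num)
  have hg1 : ContDiff ℝ 1 g := hg.of_le (by norm_num)
  set u : E2 → ℝ := fun x => f x * f x - g x * g x with hu
  set v : E2 → ℝ := fun x => f x * g x with hv
  have hu1 : ContDiff ℝ 1 u := (hf1.mul hf1).sub (hg1.mul hg1)
  have hv1 : ContDiff ℝ 1 v := hf1.mul hg1
  have hpu : ∀ j x, pd j u x = 2 * (f x * pd j f x) - 2 * (g x * pd j g x) := fun j x => by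
    rw [hu, pd_sub (hf1.mul hf1) (hg1.mul hg1), pd_mul hf1 hf1, pd_mul hg1 hg1]; ring
  have hpv : ∀ j x, pd j v x = pd j f x * g x + f x * pd j g x := fun j x => pd_mul hf1 hg1 j x
  have hA : ∀ j, ∫ x, D j x * (q j x * u x) = - ∫ x, t.tent x * (u x + q j x * pd j u x) := by
    intro j
    rw [lip_ibp hL t.tent_compact ((hq1 j).mul hu1)]
    congr 2; ext x
    have := pd_mul (hq1 j) hu1 j x
    rw [pd_coord, if_pos rfl, one_mul] at this
    rw [← this]; rfl
  have hB : ∀ i j, i ≠ j → ∫ x, D j x * (q i x * v x) = - ∫ x, t.tent x * (q i x * pd j v x) := by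
    intro i j hij
    rw [lip_ibp hL t.tent_compact ((hq1 i).mul hv1)]
    congr 2; ext x
    have := pd_mul (hq1 i) hv1 j x
    rw [pd_coord, if_neg hij, zero_mul, zero_add] at this
    rw [← this]; rfl
  have hrad : ∀ᵐ x, D 0 x * (q 0 x * u x) + D 1 x * (q 1 x * u x)
      = t.inn.indicator (fun x => (t.minlam x - 1 / 3) * u x) x := by
    filter_upwards [hL.ae_differentiableAt (μ := volume)] with x hx
    by_cases hi : x ∈ t.inn
    · have h1 := t.lineDeriv_tent_radial hi
      rw [hx.lineDeriv_eq_fderiv, ← E2.sum_ee (x - t.centroid), map_sum, Fin.sum_univ_two, map_smul,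
        map_smul, tent, max_eq_left (t.tent_pos hi).le] at h1
      simp only [hi, Set.indicator_of_mem, hD, hx.lineDeriv_eq_fderiv, hq]
      rw [← h1]; simp only [smul_eq_mul, c]; ring
    · simp [hi, hD, t.lineDeriv_tent_zero hi]
  have cu := hu1.continuous
  have cv := hv1.continuous
  have cq : ∀ j, Continuous (q j) := fun j => (hq1 j).continuous
  have ct : Continuous t.tent := hL.continuous
  have it : ∀ G : E2 → ℝ, Continuous G → Integrable (fun x => t.tent x * G x) := fun G hG =>
    (ct.mul hG).integrable_of_hasCompactSupport (t.tent_compact.mul_right)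
  have cpu := fun j => continuous_pd hu1 j
  have cpv := fun j => continuous_pd hv1 j
  have iD : ∀ i j (w : E2 → ℝ), Continuous w → Integrable (fun x => D i x * (q j x * w x)) :=
    fun i j w hw => t.integrable_lineDeriv_mul (G := fun x => q j x * w x) ((cq j).mul hw) _
  have hsum : ∫ x in t.inn, (t.minlam x - 1 / 3) * u x
      = - 2 * (∫ x in t.inn, t.minlam x * u x) + 2 * ((∫ x, D 1 x * (q 0 x * v x))
        - ∫ x, D 0 x * (q 1 x * v x)) := by
    rw [← integral_indicator t.measurableSet_inn, ← integral_congr_ae hrad,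
      integral_add (iD 0 0 u cu) (iD 1 1 u cu), hA, hA, hB 0 1 (by simp),
      hB 1 0 (by simp), ← setIntegral_inn_tent, ← integral_const_mul, ← integral_neg,
      ← integral_neg, ← integral_neg, ← integral_neg]
    rw [← integral_add, ← integral_sub, ← integral_const_mul, ← integral_add]
    · congr 1; ext x
      by_cases hi : x ∈ t.inn
      · obtain ⟨h1, h2⟩ := hCR x hi
        rw [hpu, hpu, hpv, hpv, h1, h2]; simp only [hu]; ring
      · simp [t.tent_eq_zero hi]
    · exact (it _ cu).const_mul _
    · exact ((it _ ((cq 0).mul (cpv 1))).neg.sub (it _ ((cq 1).mul (cpv 0))).neg).const_mul _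
    · exact (it _ ((cq 0).mul (cpv 1))).neg
    · exact (it _ ((cq 1).mul (cpv 0))).neg
    · exact (it _ (cu.add ((cq 0).mul (cpu 0)))).neg
    · exact (it _ (cu.add ((cq 1).mul (cpu 1)))).neg
  have hbd : |(∫ x, D 1 x * (q 0 x * v x)) - ∫ x, D 0 x * (q 1 x * v x)|
      ≤ 2 * L * max R 0 * ∫ x in t.inn, |v x| := by
    rw [← integral_sub (iD 1 0 v cv) (iD 0 1 v cv), ← integral_const_mul,
        ← integral_indicator t.measurableSet_inn, ← Real.norm_eq_abs]
    apply norm_integral_le_of_norm_le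
    · exact IntegrableOn.integrable_indicator ((t.integrableOn_inn cv.abs).const_mul _)
        t.measurableSet_inn
    · filter_upwards with x
      by_cases hi : x ∈ t.inn
      · have hDb : ∀ j, |D j x| ≤ L := fun j => by
          have := norm_lineDeriv_le_of_lipschitz ℝ hL (x₀ := x) (v := ee j)
          rwa [norm_ee, mul_one] at this
        have hqb : ∀ j, |q j x| ≤ max R 0 := fun j => by
          have h1 := PiLp.norm_apply_le (x - c) j
          have h2 := hR (t.inn_subset hi)
          rw [mem_closedBall_iff_norm] at h2
          exact h1.trans (h2.trans (le_max_left _ _))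
        rw [Set.indicator_of_mem hi, Real.norm_eq_abs]
        have key : ∀ i j, |D i x * (q j x * v x)| ≤ L * max R 0 * |v x| := fun i j => by
          rw [abs_mul, abs_mul, ← mul_assoc]
          exact mul_le_mul_of_nonneg_right
            (mul_le_mul (hDb i) (hqb j) (abs_nonneg _) (NNReal.coe_nonneg _)) (abs_nonneg _)
        refine (abs_sub _ _).trans ?_
        have := key 1 0; have := key 0 1
        linarith
      · simp [hi, hD, t.lineDeriv_tent_zero hi]
  have hlhs : ∫ x in t.inn, (1 / 3 - 3 * t.minlam x) * (f x ^ 2 - g x ^ 2)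
      = -(∫ x in t.inn, (t.minlam x - 1 / 3) * u x) - 2 * ∫ x in t.inn, t.minlam x * u x := by
    have cm := t.continuous_minlam
    rw [← integral_const_mul, ← integral_neg, ← integral_sub]
    · congr 1; ext x; simp only [hu]; ring
    · exact t.integrableOn_inn (by fun_prop)
    · exact t.integrableOn_inn (by fun_prop)
  rw [hlhs, hsum]
  have := (abs_le.1 hbd).1
  simp only [hv] at this ⊢
  linarith

end Tri

/-- The squared length of the gradient. -/
def gsq (f : E2 → ℝ) (x : E2) : ℝ := pd 0 f x ^ 2 + pd 1 f x ^ 2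

theorem gsq_nonneg (f : E2 → ℝ) (x : E2) : 0 ≤ gsq f x := by unfold gsq; positivity

theorem continuous_gsq {f : E2 → ℝ} (hf : ContDiff ℝ 1 f) : Continuous (gsq f) :=
  ((continuous_pd hf 0).pow 2).add ((continuous_pd hf 1).pow 2)

theorem fderiv_apply_eq (f : E2 → ℝ) (x v : E2) :
    fderiv ℝ f x v = v 0 * pd 0 f x + v 1 * pd 1 f x := by
  conv_lhs => rw [← E2.sum_ee v]
  rw [map_sum, Fin.sum_univ_two, map_smul, map_smul]; rfl

theorem fderiv_apply_sq_le (f : E2 → ℝ) (x v : E2) :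
    fderiv ℝ f x v ^ 2 ≤ ‖v‖ ^ 2 * gsq f x := by
  rw [fderiv_apply_eq, norm_sq_coord, gsq]
  nlinarith [sq_nonneg (v 0 * pd 1 f x - v 1 * pd 0 f x)]

theorem norm_fderiv_sq_le (f : E2 → ℝ) (x : E2) : ‖fderiv ℝ f x‖ ^ 2 ≤ gsq f x := by
  rw [← Real.sqrt_le_sqrt_iff (gsq_nonneg f x), Real.sqrt_sq (norm_nonneg _)]
  refine ContinuousLinearMap.opNorm_le_bound _ (Real.sqrt_nonneg _) fun v => ?_
  rw [Real.norm_eq_abs, ← Real.sqrt_sq_eq_abs, mul_comm, ← Real.sqrt_sq (norm_nonneg v),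
    ← Real.sqrt_mul (sq_nonneg _)]
  exact Real.sqrt_le_sqrt (fderiv_apply_sq_le f x v)

theorem pd_hasCompactSupport {f : E2 → ℝ} (hf : HasCompactSupport f) (j : Fin 2) :
    HasCompactSupport (pd j f) := hf.fderiv_apply ℝ (ee j)

theorem pd_ibp {a b : E2 → ℝ} (ha : ContDiff ℝ 1 a) (hb : ContDiff ℝ 1 b)
    (hc : HasCompactSupport a) (j : Fin 2) :
    ∫ x, pd j a x * b x = - ∫ x, a x * pd j b x := by
  have h1 : Integrable (fun x => pd j a x * b x) :=
    ((continuous_pd ha j).mul hb.continuous).integrable_of_hasCompactSupport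
      (pd_hasCompactSupport hc j).mul_right
  have h2 : Integrable (fun x => a x * pd j b x) :=
    (ha.continuous.mul (continuous_pd hb j)).integrable_of_hasCompactSupport hc.mul_right
  have h3 : Integrable (fun x => a x * b x) :=
    (ha.continuous.mul hb.continuous).integrable_of_hasCompactSupport hc.mul_right
  have := integral_mul_fderiv_eq_neg_fderiv_mul_of_integrable h1 h2 h3
    (fun x _ => ha.differentiable (by norm_num) x) (fun x _ => hb.differentiable (by norm_num) x)
  simp only [pd]
  rw [this, neg_neg]

theorem lintegral_homothety (φ : E2 → ENNReal) (hφ : Measurable φ) (w : E2) {s : ℝ} (hs : 1 / 2 ≤ s) :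
    ∫⁻ x, φ (s • x + w) ≤ 4 * ∫⁻ x, φ x := by
  have hs0 : s ≠ 0 := by linarith
  have h1 : ∫⁻ x, φ (s • x + w) = ∫⁻ z, φ (z + w) ∂(Measure.map (s • ·) volume) := by
    exact (lintegral_map (f := fun z => φ (z + w)) (hφ.comp (measurable_add_const w))
      (measurable_const_smul s)).symm
  rw [h1, Measure.map_addHaar_smul _ hs0, lintegral_smul_measure, lintegral_add_right_eq_self φ w]
  refine mul_le_mul_left ?_ _
  rw [finrank_euclideanSpace_fin]
  have : |(s ^ 2)⁻¹| ≤ 4 := by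
    rw [abs_of_nonneg (by positivity), inv_le_comm₀ (by positivity) (by norm_num)]
    nlinarith
  calc ENNReal.ofReal |(s ^ 2)⁻¹| ≤ ENNReal.ofReal 4 := ENNReal.ofReal_le_ofReal this
    _ = 4 := by simp

theorem sq_intervalIntegral_le {g : ℝ → ℝ} (hg : Continuous g) :
    (∫ s in (0:ℝ)..1, g s) ^ 2 ≤ ∫ s in (0:ℝ)..1, g s ^ 2 := by
  set m := ∫ s in (0:ℝ)..1, g s with hm
  have : 0 ≤ ∫ s in (0:ℝ)..1, (g s - m) ^ 2 :=
    intervalIntegral.integral_nonneg zero_le_one fun _ _ => sq_nonneg _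
  have h2 : ∫ s in (0:ℝ)..1, (g s - m) ^ 2 = (∫ s in (0:ℝ)..1, g s ^ 2) - m ^ 2 := by
    have e : (fun s : ℝ => (g s - m) ^ 2) = fun s => g s ^ 2 - ((2 * m) * g s - m ^ 2) := by
      ext s; ring
    rw [e, intervalIntegral.integral_sub, intervalIntegral.integral_sub,
      intervalIntegral.integral_const_mul, ← hm]
    · simp; ring
    all_goals exact Continuous.intervalIntegrable (by fun_prop) _ _
  linarith

theorem sq_sub_le_integral {f : E2 → ℝ} (hf : ContDiff ℝ 1 f) (x y : E2) :
    (f x - f y) ^ 2 ≤ ‖x - y‖ ^ 2 * ∫ s in (0:ℝ)..1, gsq f (s • x + (1 - s) • y) := by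
  have hd : ∀ s ∈ Set.uIcc (0:ℝ) 1, HasDerivAt (fun s : ℝ => f (s • x + (1 - s) • y))
      (fderiv ℝ f (s • x + (1 - s) • y) (x - y)) s := by
    intro s _
    have h1 : HasDerivAt (fun s : ℝ => s • x + (1 - s) • y) (x - y) s := by
      have := ((hasDerivAt_id s).smul_const x).add
        (((hasDerivAt_const s (1:ℝ)).sub (hasDerivAt_id s)).smul_const y)
      have e : (1:ℝ) • x + ((0:ℝ) - 1) • y = x - y := by module
      rw [e] at this
      exact this
    exact ((hf.differentiable (by norm_num)) _).hasFDerivAt.comp_hasDerivAt s h1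
  have hcp : Continuous (fun s : ℝ => s • x + (1 - s) • y) := by fun_prop
  have hc : Continuous (fun s : ℝ => fderiv ℝ f (s • x + (1 - s) • y) (x - y)) :=
    ((hf.continuous_fderiv (by norm_num)).comp hcp).clm_apply continuous_const
  have h := intervalIntegral.integral_eq_sub_of_hasDerivAt hd (hc.intervalIntegrable _ _)
  simp only [one_smul, sub_self, zero_smul, add_zero, sub_zero, zero_add] at h
  rw [← h, ← intervalIntegral.integral_const_mul]
  have hcs := sq_intervalIntegral_le hc
  refine hcs.trans (intervalIntegral.integral_mono_on zero_le_one ((hc.pow 2).intervalIntegrable _ _)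
    ((continuous_const.mul ((continuous_gsq hf).comp hcp)).intervalIntegrable _ _) fun s _ => ?_)
  exact fderiv_apply_sq_le f _ _

/-- The double integral of squared differences of a function on a set. -/
def osc (A : Set E2) (f : E2 → ℝ) : ENNReal :=
  ∫⁻ x in A, ∫⁻ y in A, ENNReal.ofReal ((f x - f y) ^ 2)

theorem osc_convex_le {K : Set E2} (hK : IsCompact K) (hconv : Convex ℝ K) {d : ℝ}
    (hd : ∀ x ∈ K, ∀ y ∈ K, ‖x - y‖ ≤ d) {f : E2 → ℝ} (hf : ContDiff ℝ 1 f) :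
    osc K f ≤ ENNReal.ofReal (4 * d ^ 2) * volume K * ∫⁻ x in K, ENNReal.ofReal (gsq f x) := by
  set φ : E2 → ENNReal := K.indicator fun x => ENNReal.ofReal (gsq f x) with hφ
  have hKm := hK.isClosed.measurableSet
  have hφm : Measurable φ := ((continuous_gsq hf).measurable.ennreal_ofReal).indicator hKm
  have h1 : ∀ x ∈ K, ∀ y ∈ K, ENNReal.ofReal ((f x - f y) ^ 2)
      ≤ ENNReal.ofReal (d ^ 2) * ∫⁻ s in Set.Ioc (0:ℝ) 1, φ (s • x + (1 - s) • y) := by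
    intro x hx y hy
    have hcp : Continuous (fun s : ℝ => s • x + (1 - s) • y) := by fun_prop
    have hg : Continuous (fun s : ℝ => gsq f (s • x + (1 - s) • y)) :=
      (continuous_gsq hf).comp hcp
    have h2 : (f x - f y) ^ 2 ≤ d ^ 2 * ∫ s in (0:ℝ)..1, gsq f (s • x + (1 - s) • y) :=
      (sq_sub_le_integral hf x y).trans (mul_le_mul_of_nonneg_right
        (pow_le_pow_left₀ (norm_nonneg _) (hd x hx y hy) 2)
        (intervalIntegral.integral_nonneg zero_le_one fun _ _ => gsq_nonneg _ _))
    refine (ENNReal.ofReal_le_ofReal h2).trans ?_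
    rw [ENNReal.ofReal_mul (sq_nonneg _), intervalIntegral.integral_of_le zero_le_one,
      ofReal_integral_eq_lintegral_ofReal
        (hg.intervalIntegrable 0 1).1 (Filter.Eventually.of_forall fun _ => gsq_nonneg _ _)]
    refine mul_le_mul_right (setLIntegral_mono' measurableSet_Ioc fun s hs => ?_) _
    have : s • x + (1 - s) • y ∈ K := hconv hx hy hs.1.le (by linarith [hs.2]) (by ring)
    simp [hφ, this]
  have h3 : ∀ s ∈ Set.Ioc (0:ℝ) 1, ∫⁻ x in K, ∫⁻ y in K, φ (s • x + (1 - s) • y)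
      ≤ 4 * volume K * ∫⁻ x, φ x := by
    intro s hs
    have key : ∀ r : ℝ, 1 / 2 ≤ r → ∀ w : ℝ, ∫⁻ y in K, ∫⁻ x in K, φ (r • x + w • y)
        ≤ 4 * volume K * ∫⁻ x, φ x := by
      intro r hr w
      calc ∫⁻ y in K, ∫⁻ x in K, φ (r • x + w • y) ≤ ∫⁻ y in K, 4 * ∫⁻ x, φ x :=
            lintegral_mono fun y => (setLIntegral_le_lintegral _ _).trans
              (lintegral_homothety φ hφm (w • y) hr)
        _ = _ := by rw [setLIntegral_const]; ring
    rcases le_total (1 / 2) s with h | h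
    · rw [lintegral_lintegral_swap]
      · exact key s h _
      · exact (hφm.comp (by fun_prop)).aemeasurable
    · have := key (1 - s) (by linarith) s
      simpa only [add_comm] using this
  have h4 : ∫⁻ x in K, ∫⁻ y in K, ∫⁻ s in Set.Ioc (0:ℝ) 1, φ (s • x + (1 - s) • y)
      ≤ 4 * volume K * ∫⁻ x, φ x := by
    have e1 : ∀ x, ∫⁻ y in K, ∫⁻ s in Set.Ioc (0:ℝ) 1, φ (s • x + (1 - s) • y)
        = ∫⁻ s in Set.Ioc (0:ℝ) 1, ∫⁻ y in K, φ (s • x + (1 - s) • y) := fun x =>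
      lintegral_lintegral_swap (hφm.comp (by fun_prop)).aemeasurable
    simp only [e1]
    rw [lintegral_lintegral_swap]
    · calc _ ≤ ∫⁻ s in Set.Ioc (0:ℝ) 1, 4 * volume K * ∫⁻ x, φ x :=
            setLIntegral_mono' measurableSet_Ioc h3
        _ = _ := by simp
    · refine Measurable.aemeasurable ?_
      have : Measurable (fun q : (E2 × ℝ) × E2 => φ (q.1.2 • q.1.1 + (1 - q.1.2) • q.2)) :=
        hφm.comp (by fun_prop)
      exact this.lintegral_prod_right'
  calc osc K f ≤ ∫⁻ x in K, ∫⁻ y in K, ENNReal.ofReal (d ^ 2)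
        * ∫⁻ s in Set.Ioc (0:ℝ) 1, φ (s • x + (1 - s) • y) :=
        setLIntegral_mono' hKm fun x hx => setLIntegral_mono' hKm fun y hy => h1 x hx y hy
    _ = ENNReal.ofReal (d ^ 2) * ∫⁻ x in K, ∫⁻ y in K,
        ∫⁻ s in Set.Ioc (0:ℝ) 1, φ (s • x + (1 - s) • y) := by
        simp only [lintegral_const_mul' _ _ ENNReal.ofReal_ne_top]
    _ ≤ ENNReal.ofReal (d ^ 2) * (4 * volume K * ∫⁻ x, φ x) := mul_le_mul_right h4 _
    _ = _ := by
        rw [hφ, lintegral_indicator hKm, ENNReal.ofReal_mul (by norm_num)]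
        simp; ring

theorem exists_center {A : Set E2} (h0 : volume A ≠ 0) (h1 : volume A ≠ ⊤) {f : E2 → ℝ}
    (hf : Measurable f) :
    ∃ c, volume A * ∫⁻ x in A, ENNReal.ofReal ((f x - c) ^ 2) ≤ osc A f := by
  have hm : Measurable (fun q : E2 × E2 => ENNReal.ofReal ((f q.1 - f q.2) ^ 2)) := by fun_prop
  have hm' : Measurable (fun x => ∫⁻ y in A, ENNReal.ofReal ((f x - f y) ^ 2)) :=
    hm.lintegral_prod_right'
  obtain ⟨x, -, hx⟩ := exists_le_setLAverage h0 h1 hm'.aemeasurable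
  refine ⟨f x, ?_⟩
  rw [setLAverage_eq, ENNReal.le_div_iff_mul_le (Or.inl h0) (Or.inl h1), mul_comm] at hx
  refine le_trans (le_of_eq ?_) hx
  congr 2; ext y; congr 1; ring

theorem osc_le {A : Set E2} {f : E2 → ℝ} (hf : Measurable f) (c : ℝ) :
    osc A f ≤ 4 * volume A * ∫⁻ x in A, ENNReal.ofReal ((f x - c) ^ 2) := by
  set I := ∫⁻ x in A, ENNReal.ofReal ((f x - c) ^ 2) with hI
  have hm : Measurable (fun x => ENNReal.ofReal ((f x - c) ^ 2)) := by fun_prop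
  calc osc A f ≤ ∫⁻ x in A, ∫⁻ y in A, (2 * ENNReal.ofReal ((f x - c) ^ 2)
        + 2 * ENNReal.ofReal ((f y - c) ^ 2)) := by
        refine lintegral_mono fun x => lintegral_mono fun y => ?_
        rw [show (2 : ENNReal) = ENNReal.ofReal 2 by simp, ← ENNReal.ofReal_mul (by norm_num),
          ← ENNReal.ofReal_mul (by norm_num), ← ENNReal.ofReal_add (by positivity) (by positivity)]
        apply ENNReal.ofReal_le_ofReal
        nlinarith [sq_nonneg ((f x - c) + (f y - c))]
    _ = ∫⁻ x in A, (2 * ENNReal.ofReal ((f x - c) ^ 2) * volume A + 2 * I) := by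
        congr 1; ext x
        rw [lintegral_add_left measurable_const, setLIntegral_const, lintegral_const_mul _ hm]
    _ = _ := by
        rw [lintegral_add_right _ measurable_const, setLIntegral_const, lintegral_mul_const _ (by fun_prop),
          lintegral_const_mul _ hm]
        ring

namespace Tri

theorem contDiff_lam (t : Tri) (i : Fin 3) : ContDiff ℝ 2 (t.lam i) := by
  unfold lam
  have : ∀ j : Fin 2, ContDiff ℝ 2 (fun x : E2 => x j) := fun j => by
    simpa using contDiff_coord 0 j
  have h0 := this 0
  have h1 := this 1
  simp only [cross, PiLp.sub_apply]
  fun_prop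

/-- The set of points of a triangle at barycentric depth at least `1/18`. -/
def core (t : Tri) : Set E2 := {x | ∀ i, 1 / 18 ≤ t.lam i x}

theorem core_subset (t : Tri) : t.core ⊆ t.inn := fun x hx i => by
  have := hx i
  linarith

theorem isCompact_core (t : Tri) : IsCompact t.core := by
  refine t.isCompact_carrier.of_isClosed_subset ?_ (t.core_subset.trans t.inn_subset)
  have : t.core = ⋂ i, {x | 1 / 18 ≤ t.lam i x} := by ext; simp [core]
  rw [this]
  exact isClosed_iInter fun i => isClosed_le continuous_const (t.continuous_lam i)

theorem convex_core (t : Tri) : Convex ℝ t.core := by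
  intro x hx y hy a b ha hb hab i
  have h := t.lam_affine i x y a
  have e : a • x + b • y = y + a • (x - y) := by
    obtain rfl : b = 1 - a := by linarith
    module
  rw [e, h]
  have h1 := hx i
  have h2 := hy i
  have : b = 1 - a := by linarith
  subst this
  nlinarith

theorem volume_core (t : Tri) : volume t.core ≠ 0 := by
  have ho : IsOpen {x | ∀ i, 1 / 18 < t.lam i x} := by
    have : {x | ∀ i, 1 / 18 < t.lam i x} = ⋂ i, {x | 1 / 18 < t.lam i x} := by ext; simp
    rw [this]
    exact isOpen_iInter_of_finite fun i => isOpen_lt continuous_const (t.continuous_lam i)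
  have hne : ({x | ∀ i, 1 / 18 < t.lam i x} : Set E2).Nonempty :=
    ⟨t.centroid, fun i => by rw [t.lam_centroid]; norm_num⟩
  have := ho.measure_pos volume hne
  exact (this.trans_le (measure_mono fun x hx i => (hx i).le)).ne'

theorem exists_core_cutoff (t : Tri) : ∃ ζ : E2 → ℝ, ContDiff ℝ 2 ζ ∧ HasCompactSupport ζ ∧
    tsupport ζ ⊆ t.inn ∧ ∀ x ∈ t.core, ζ x = 1 := by
  set ζ : E2 → ℝ := fun x => ∏ i, Real.smoothTransition (36 * (t.lam i x - 1 / 36)) with hζ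
  have hcl : IsClosed {x | ∀ i, 1 / 36 ≤ t.lam i x} := by
    have : {x | ∀ i, 1 / 36 ≤ t.lam i x} = ⋂ i, {x | 1 / 36 ≤ t.lam i x} := by ext; simp
    rw [this]
    exact isClosed_iInter fun i => isClosed_le continuous_const (t.continuous_lam i)
  have hsub : tsupport ζ ⊆ {x | ∀ i, 1 / 36 ≤ t.lam i x} := by
    refine closure_minimal (fun x hx i => ?_) hcl
    by_contra! h
    refine hx (Finset.prod_eq_zero (Finset.mem_univ i) ?_)
    exact Real.smoothTransition.zero_of_nonpos (by linarith)
  have hsub' : tsupport ζ ⊆ t.inn := hsub.trans fun x hx i => by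
    have := hx i
    linarith
  refine ⟨ζ, ?_, ?_, hsub', fun x hx => ?_⟩
  · have := t.contDiff_lam
    refine contDiff_prod fun i _ => ?_
    exact Real.smoothTransition.contDiff.comp
      (contDiff_const.mul ((t.contDiff_lam i).sub contDiff_const))
  · exact t.isCompact_carrier.of_isClosed_subset (isClosed_tsupport _) (hsub'.trans t.inn_subset)
  · refine Finset.prod_eq_one fun i _ => Real.smoothTransition.one_of_one_le ?_
    have := hx i
    linarith

theorem caccioppoli (t : Tri) : ∃ C, 0 ≤ C ∧ ∀ f g : E2 → ℝ, ContDiff ℝ 2 f → ContDiff ℝ 2 g →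
    (∀ x ∈ t.inn, pd 0 f x = pd 1 g x ∧ pd 1 f x = - pd 0 g x) →
    ∫ x in t.core, gsq f x ≤ C * ∫ x in t.inn, g x ^ 2 := by
  obtain ⟨ζ, hζ, hcs, hsub, hone⟩ := t.exists_core_cutoff
  have hζ1 : ContDiff ℝ 1 ζ := hζ.of_le (by norm_num)
  obtain ⟨L, hL⟩ : ∃ L, ∀ x j, |pd j ζ x| ≤ L := by
    have h := fun j => (pd_hasCompactSupport hcs j).exists_bound_of_continuous (continuous_pd hζ1 j)
    choose L hL using h
    refine ⟨max (L 0) (L 1), fun x j => ?_⟩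
    fin_cases j
    · exact (hL 0 x).trans (le_max_left _ _)
    · exact (hL 1 x).trans (le_max_right _ _)
  have hL0 : 0 ≤ L := (abs_nonneg _).trans (hL 0 0)
  refine ⟨8 * L ^ 2, by positivity, fun f g hf hg hCR => ?_⟩
  have hf1 : ContDiff ℝ 1 f := hf.of_le (by norm_num)
  have hg1 : ContDiff ℝ 1 g := hg.of_le (by norm_num)
  have hpf : ∀ j, ContDiff ℝ 1 (pd j f) := fun j => contDiff_pd (n := 1) hf j
  set Z : E2 → ℝ := fun x => ζ x * ζ x with hZ
  have hZ1 : ContDiff ℝ 1 Z := hζ1.mul hζ1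
  have hZc : HasCompactSupport Z := hcs.mul_right
  have hzero : ∀ x, x ∉ t.inn → ζ x = 0 := fun x hx => image_eq_zero_of_notMem_tsupport fun h => hx (hsub h)
  have hibp : ∀ i j, ∫ x, (Z x * pd i f x) * pd j g x
      = - ∫ x, (2 * ζ x * pd j ζ x * pd i f x + Z x * pd j (pd i f) x) * g x := by
    intro i j
    have h := pd_ibp (hZ1.mul (hpf i)) hg1 hZc.mul_right j
    have e : ∀ x, pd j (fun x => Z x * pd i f x) x
        = 2 * ζ x * pd j ζ x * pd i f x + Z x * pd j (pd i f) x := fun x => by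
      rw [pd_mul hZ1 (hpf i), hZ, pd_mul hζ1 hζ1]; ring
    simp only [← e]
    rw [h, neg_neg]
  have hsymm : ∀ x, pd 1 (pd 0 f) x = pd 0 (pd 1 f) x := by
    intro x
    have hs : IsSymmSndFDerivAt ℝ f x := hf.contDiffAt.isSymmSndFDerivAt (by simp)
    have hd : DifferentiableAt ℝ (fderiv ℝ f) x :=
      (hf.fderiv_right (m := 1) le_rfl).differentiable (by norm_num) x
    have e : ∀ i j, pd j (pd i f) x = fderiv ℝ (fderiv ℝ f) x (ee j) (ee i) := fun i j => by
      have : pd i f = fun y => fderiv ℝ f y (ee i) := rfl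
      rw [pd, this, fderiv_clm_apply hd (differentiableAt_const _)]
      simp
    rw [e, e]; exact hs _ _
  have cζ := hζ1.continuous
  have cg := hg1.continuous
  have cpζ := fun j => continuous_pd hζ1 j
  have cpf := fun j => continuous_pd hf1 j
  have cpg := fun j => continuous_pd hg1 j
  have cZ := hZ1.continuous
  have cppf := fun i j => continuous_pd (hpf i) j
  have hinteg : ∀ G : E2 → ℝ, Continuous G → Integrable (fun x => ζ x * G x) := fun G hG =>
    (cζ.mul hG).integrable_of_hasCompactSupport hcs.mul_right
  have hintI : Integrable (fun x => ζ x * (ζ x * gsq f x)) :=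
    hinteg _ (cζ.mul (continuous_gsq hf1))
  -- the energy identity
  have hid : ∫ x, ζ x * (ζ x * gsq f x)
      = - ∫ x, ζ x * (2 * (pd 1 ζ x * pd 0 f x - pd 0 ζ x * pd 1 f x) * g x) := by
    have e1 : ∀ x, ζ x * (ζ x * gsq f x) = (Z x * pd 0 f x) * pd 1 g x - (Z x * pd 1 f x) * pd 0 g x := by
      intro x
      by_cases hx : x ∈ t.inn
      · obtain ⟨a, b⟩ := hCR x hx
        have b' : pd 0 g x = - pd 1 f x := by rw [b, neg_neg]
        rw [← a, b', gsq]; simp only [hZ]; ring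
      · simp [hZ, hzero x hx]
    have i1 : ∀ i j, Integrable (fun x => (Z x * pd i f x) * pd j g x) := fun i j => by
      refine (hinteg (fun x => ζ x * pd i f x * pd j g x) ((cζ.mul (cpf i)).mul (cpg j))).congr
        (Filter.Eventually.of_forall fun x => ?_)
      simp only [hZ]; ring
    have i2 : ∀ i j, Integrable
        (fun x => (2 * ζ x * pd j ζ x * pd i f x + Z x * pd j (pd i f) x) * g x) := fun i j => by
      have hcG : Continuous (fun x => (2 * pd j ζ x * pd i f x + ζ x * pd j (pd i f) x) * g x) := by
        have := cpζ j; have := cpf i; have := cppf i j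
        fun_prop
      refine (hinteg _ hcG).congr (Filter.Eventually.of_forall fun x => ?_)
      simp only [hZ]; ring
    simp only [e1]
    rw [integral_sub (i1 0 1) (i1 1 0), hibp, hibp, ← integral_neg, ← integral_neg, ← integral_neg,
      ← integral_sub (i2 0 1).fun_neg (i2 1 0).fun_neg]
    congr 1; ext x
    rw [hsymm]; ring
  have hY : - ∫ x, ζ x * (2 * (pd 1 ζ x * pd 0 f x - pd 0 ζ x * pd 1 f x) * g x)
      ≤ ∫ x, ((1 / 2) * (ζ x * (ζ x * gsq f x)) + t.inn.indicator (fun x => 4 * L ^ 2 * g x ^ 2) x) := by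
    rw [← integral_neg]
    have i3 : Integrable (t.inn.indicator (fun x => 4 * L ^ 2 * g x ^ 2)) :=
      IntegrableOn.integrable_indicator (t.integrableOn_inn (by fun_prop)) t.measurableSet_inn
    have hcG : Continuous (fun x => 2 * (pd 1 ζ x * pd 0 f x - pd 0 ζ x * pd 1 f x) * g x) := by
      have := cpζ 0; have := cpf 0; have := cpζ 1; have := cpf 1
      fun_prop
    refine integral_mono (hinteg _ hcG).neg ((hintI.const_mul _).add i3) fun x => ?_
    by_cases hx : x ∈ t.inn
    · simp only [hx, Set.indicator_of_mem, gsq]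
      have q : ∀ j, pd j ζ x ^ 2 ≤ L ^ 2 := fun j => sq_le_sq' (by linarith [(abs_le.1 (hL x j)).1])
        (abs_le.1 (hL x j)).2
      have q0 := mul_le_mul_of_nonneg_right (q 0) (sq_nonneg (g x))
      have q1 := mul_le_mul_of_nonneg_right (q 1) (sq_nonneg (g x))
      nlinarith [sq_nonneg (ζ x * pd 0 f x + 2 * pd 1 ζ x * g x),
        sq_nonneg (ζ x * pd 1 f x - 2 * pd 0 ζ x * g x)]
    · simp [hx, hzero x hx]
  have hfin : ∫ x, ((1 / 2) * (ζ x * (ζ x * gsq f x)) + t.inn.indicator (fun x => 4 * L ^ 2 * g x ^ 2) x)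
      = (1 / 2) * (∫ x, ζ x * (ζ x * gsq f x)) + 4 * L ^ 2 * ∫ x in t.inn, g x ^ 2 := by
    rw [integral_add (hintI.const_mul _), integral_const_mul, integral_indicator t.measurableSet_inn,
      integral_const_mul]
    exact IntegrableOn.integrable_indicator (t.integrableOn_inn (by fun_prop)) t.measurableSet_inn
  have hcore : ∫ x in t.core, gsq f x ≤ ∫ x, ζ x * (ζ x * gsq f x) := by
    rw [← integral_indicator t.isCompact_core.isClosed.measurableSet]
    refine integral_mono (IntegrableOn.integrable_indicator
      ((continuous_gsq hf1).continuousOn.integrableOn_compact t.isCompact_core)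
      t.isCompact_core.isClosed.measurableSet) hintI fun x => ?_
    by_cases hx : x ∈ t.core
    · simp [hx, hone x hx]
    · simp only [hx, not_false_eq_true, Set.indicator_of_notMem, ← mul_assoc]
      exact mul_nonneg (mul_self_nonneg _) (gsq_nonneg _ _)
  linarith

/-- Friedrichs' inequality for conjugate harmonic functions, smooth case. -/
theorem friedrichs (t : Tri) : ∃ C, 0 ≤ C ∧ ∀ f g : E2 → ℝ, ContDiff ℝ 2 f → ContDiff ℝ 2 g →
    (∀ x ∈ t.inn, pd 0 f x = pd 1 g x ∧ pd 1 f x = - pd 0 g x) →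
    ∃ c, ∫ x in t.inn, (f x - c) ^ 2 ≤ C * ∫ x in t.inn, g x ^ 2 := by
  obtain ⟨C1, hC1, H1⟩ := t.boundary_estimate
  obtain ⟨C2, hC2, H2⟩ := t.caccioppoli
  obtain ⟨d, hd⟩ := Metric.isBounded_iff.1 t.isCompact_core.isBounded
  have hV := t.volume_core
  have hV' : volume t.core ≠ ⊤ := t.isCompact_core.measure_lt_top.ne
  refine ⟨12 * (5 / 6 * (4 * d ^ 2 * C2) + 2 / 3 + 3 * C1 ^ 2), by positivity, fun f g hf hg hCR => ?_⟩
  have hf1 : ContDiff ℝ 1 f := hf.of_le (by norm_num)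
  have hg1 : ContDiff ℝ 1 g := hg.of_le (by norm_num)
  have hcm := t.isCompact_core.isClosed.measurableSet
  obtain ⟨c, hc⟩ := exists_center hV hV' hf1.continuous.measurable
  have hK : ∫ x in t.core, (f x - c) ^ 2 ≤ 4 * d ^ 2 * C2 * ∫ x in t.inn, g x ^ 2 := by
    have h := hc.trans (osc_convex_le t.isCompact_core t.convex_core
      (fun x hx y hy => by rw [← dist_eq_norm]; exact hd hx hy) hf1)
    rw [mul_comm (ENNReal.ofReal _), mul_assoc, ENNReal.mul_le_mul_iff_right hV hV'] at h
    have cf : Continuous (fun x => (f x - c) ^ 2) := by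
      have := hf1.continuous
      fun_prop
    rw [← ofReal_integral_eq_lintegral_ofReal (cf.continuousOn.integrableOn_compact t.isCompact_core)
        (Filter.Eventually.of_forall fun _ => sq_nonneg _),
      ← ofReal_integral_eq_lintegral_ofReal
        ((continuous_gsq hf1).continuousOn.integrableOn_compact t.isCompact_core)
        (Filter.Eventually.of_forall fun _ => gsq_nonneg _ _),
      ← ENNReal.ofReal_mul (by positivity), ENNReal.ofReal_le_ofReal_iff] at h
    · refine h.trans ?_
      rw [mul_assoc (4 * d ^ 2)]
      exact mul_le_mul_of_nonneg_left (H2 f g hf hg hCR) (by positivity)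
    · exact mul_nonneg (by positivity) (integral_nonneg fun _ => gsq_nonneg _ _)
  refine ⟨c, ?_⟩
  have hF : ContDiff ℝ 2 (fun x => f x - c) := hf.sub contDiff_const
  have hFp : ∀ j x, pd j (fun x => f x - c) x = pd j f x := fun j x => by
    rw [pd, fderiv_sub_const]; rfl
  have h1 := H1 (fun x => f x - c) g hF hg fun x hx => by
    simpa only [hFp] using hCR x hx
  have cF := hF.continuous
  have cg := hg.continuous
  have cm := t.continuous_minlam
  set F : E2 → ℝ := fun x => f x - c with hFdef
  change ∫ x in t.inn, F x ^ 2 ≤ _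
  change ∫ x in t.core, F x ^ 2 ≤ _ at hK
  have i1 : IntegrableOn (fun x => F x ^ 2) t.inn := t.integrableOn_inn (by fun_prop)
  have i2 : IntegrableOn (fun x => g x ^ 2) t.inn := t.integrableOn_inn (by fun_prop)
  have i3 : IntegrableOn (fun x => (1 / 3 - 3 * t.minlam x) * (F x ^ 2 - g x ^ 2)) t.inn :=
    t.integrableOn_inn (by fun_prop)
  have i4 : IntegrableOn (t.core.indicator fun x => F x ^ 2) t.inn := i1.indicator hcm
  have i5 : IntegrableOn (fun x => |F x * g x|) t.inn := t.integrableOn_inn (by fun_prop)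
  have hKi : ∫ x in t.inn, t.core.indicator (fun x => F x ^ 2) x = ∫ x in t.core, F x ^ 2 := by
    rw [setIntegral_indicator hcm, Set.inter_eq_right.2 t.core_subset]
  have hfg : C1 * ∫ x in t.inn, |F x * g x|
      ≤ (1 / 12) * (∫ x in t.inn, F x ^ 2) + 3 * C1 ^ 2 * ∫ x in t.inn, g x ^ 2 := by
    rw [← integral_const_mul, ← integral_const_mul, ← integral_const_mul,
      ← integral_add (i1.const_mul _) (i2.const_mul _)]
    refine integral_mono (i5.const_mul _) ((i1.const_mul _).add (i2.const_mul _)) fun x => ?_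
    simp only [abs_mul]
    rw [← sq_abs (F x), ← sq_abs (g x)]
    nlinarith [sq_nonneg (|F x| - 6 * C1 * |g x|)]
  have hmain : (1 / 6) * ∫ x in t.inn, F x ^ 2
      ≤ (∫ x in t.inn, (1 / 3 - 3 * t.minlam x) * (F x ^ 2 - g x ^ 2))
        + (5 / 6) * (∫ x in t.inn, t.core.indicator (fun x => F x ^ 2) x)
        + (2 / 3) * ∫ x in t.inn, g x ^ 2 := by
    rw [← integral_const_mul, ← integral_const_mul, ← integral_const_mul,
      ← integral_add i3 (i4.const_mul _), ← integral_add (i3.fun_add (i4.const_mul _)) (i2.const_mul _)]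
    refine setIntegral_mono_on (i1.const_mul _) ((i3.fun_add (i4.const_mul _)).fun_add (i2.const_mul _))
      t.measurableSet_inn fun x hx => ?_
    have hp := t.tent_pos hx
    have hl := t.minlam_le x
    have e1 := mul_nonneg hp.le (sq_nonneg (g x))
    by_cases hxc : x ∈ t.core
    · simp only [hxc, Set.indicator_of_mem]
      have : t.minlam x * F x ^ 2 ≤ 1 / 3 * F x ^ 2 := mul_le_mul_of_nonneg_right hl (sq_nonneg _)
      nlinarith [sq_nonneg (g x)]
    · simp only [hxc, not_false_eq_true, Set.indicator_of_notMem]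
      have hlt : t.minlam x < 1 / 18 := by
        by_contra! h
        exact hxc ((t.le_minlam _ _).1 h)
      have : t.minlam x * F x ^ 2 ≤ 1 / 18 * F x ^ 2 := mul_le_mul_of_nonneg_right hlt.le (sq_nonneg _)
      nlinarith [sq_nonneg (g x)]
  rw [hKi] at hmain
  nlinarith

end Tri

/-- The mollifier kernel attached to a bump function. -/
def ker (b : ContDiffBump (0 : E2)) : E2 → ℝ := b.normed volume

/-- Mollification. -/
def moll (b : ContDiffBump (0 : E2)) (f : E2 → ℝ) (x : E2) : ℝ := ∫ y, ker b (x - y) * f y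

section
variable (b : ContDiffBump (0 : E2))

theorem ker_nonneg (x : E2) : 0 ≤ ker b x := b.nonneg_normed x

theorem ker_contDiff {n : ℕ∞} : ContDiff ℝ n (ker b) := b.contDiff_normed

theorem ker_continuous : Continuous (ker b) := b.continuous_normed

theorem ker_compact : HasCompactSupport (ker b) := b.hasCompactSupport_normed

theorem ker_integral : ∫ x, ker b x = 1 := b.integral_normed

theorem ker_eq_zero {x : E2} (h : b.rOut ≤ ‖x‖) : ker b x = 0 := by
  have : x ∉ Function.support (b.normed volume) := by
    rw [b.support_normed_eq]; simpa using h
  simpa [ker] using this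

theorem moll_eq_convolution (f : E2 → ℝ) :
    moll b f = convolution (b.normed volume) f (ContinuousLinearMap.lsmul ℝ ℝ) volume := by
  ext x; rw [convolution_lsmul_swap]; rfl

theorem moll_contDiff {f : E2 → ℝ} (hf : LocallyIntegrable f) {n : ℕ∞} : ContDiff ℝ n (moll b f) := by
  rw [moll_eq_convolution]
  exact b.hasCompactSupport_normed.contDiff_convolution_left _ b.contDiff_normed hf

theorem integrable_mul_locallyIntegrable {a f : E2 → ℝ} (ha : Continuous a) (hc : HasCompactSupport a)
    (hf : LocallyIntegrable f) : Integrable (fun x => a x * f x) := by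
  have := hf.integrable_smul_left_of_hasCompactSupport ha hc
  simpa using this

theorem pd_moll {f : E2 → ℝ} (hf : LocallyIntegrable f) (j : Fin 2) (x : E2) :
    pd j (moll b f) x = ∫ y, pd j (ker b) (x - y) * f y := by
  have h := b.hasCompactSupport_normed.hasFDerivAt_convolution_left (μ := volume)
    (ContinuousLinearMap.lsmul ℝ ℝ) (ker_contDiff b (n := 1)) hf x
  rw [pd, moll_eq_convolution, h.fderiv, convolution_eq_swap,
    ContinuousLinearMap.integral_apply]
  · rfl
  · have hc := b.hasCompactSupport_normed (μ := volume)
    have := (hc.fderiv (𝕜 := ℝ)).convolutionExists_left (μ := volume)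
      ((ContinuousLinearMap.lsmul ℝ ℝ).precompL E2)
      (b.contDiff_normed.continuous_fderiv (n := 1) (by norm_num)) hf x
    simpa [sub_sub_cancel] using (this.integrable_swap)

theorem integral_ker_sub (x : E2) : ∫ y, ker b (x - y) = 1 := by
  rw [integral_sub_left_eq_self (ker b) volume x]; exact ker_integral b

theorem ker_sub_compact (x : E2) : HasCompactSupport (fun y => ker b (x - y)) :=
  (ker_compact b).comp_homeomorph (Homeomorph.subLeft x)

theorem ker_sub_continuous (x : E2) : Continuous (fun y => ker b (x - y)) :=
  (ker_continuous b).comp (continuous_const.sub continuous_id)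

theorem moll_sq_le {f : E2 → ℝ} (hf : LocallyIntegrable f) (hf2 : LocallyIntegrable (fun x => f x ^ 2))
    (x : E2) : moll b f x ^ 2 ≤ ∫ y, ker b (x - y) * f y ^ 2 := by
  have i1 := integrable_mul_locallyIntegrable (ker_sub_continuous b x) (ker_sub_compact b x) hf
  have i2 := integrable_mul_locallyIntegrable (ker_sub_continuous b x) (ker_sub_compact b x) hf2
  have i0 : Integrable (fun y => ker b (x - y)) :=
    (ker_sub_continuous b x).integrable_of_hasCompactSupport (ker_sub_compact b x)
  set m := moll b f x with hm
  have : 0 ≤ ∫ y, ker b (x - y) * (f y - m) ^ 2 :=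
    integral_nonneg fun y => mul_nonneg (ker_nonneg _ _) (sq_nonneg _)
  have e : (fun y => ker b (x - y) * (f y - m) ^ 2) = fun y => ker b (x - y) * f y ^ 2
      - ((2 * m) * (ker b (x - y) * f y) - m ^ 2 * ker b (x - y)) := by
    ext y; ring
  have i3 : Integrable (fun y => 2 * m * (ker b (x - y) * f y) - m ^ 2 * ker b (x - y)) :=
    (i1.const_mul _).sub (i0.const_mul _)
  rw [e, integral_sub i2 i3,
    integral_sub (i1.const_mul _) (i0.const_mul _), integral_const_mul, integral_const_mul,
    integral_ker_sub, show ∫ y, ker b (x - y) * f y = m from rfl] at this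
  nlinarith

theorem lintegral_ker_conv {φ : E2 → ENNReal} (hφ : AEMeasurable φ) :
    ∫⁻ x, ∫⁻ y, ENNReal.ofReal (ker b (x - y)) * φ y = ∫⁻ y, φ y := by
  have hk : Measurable (fun x => ENNReal.ofReal (ker b x)) :=
    (ker_continuous b).measurable.ennreal_ofReal
  rw [lintegral_lintegral_swap]
  · congr 1; ext y
    rw [lintegral_mul_const (f := fun x => ENNReal.ofReal (ker b (x - y))) _
        (hk.comp (measurable_sub_const y)),
      lintegral_sub_right_eq_self (fun x => ENNReal.ofReal (ker b x)) y,
      ← ofReal_integral_eq_lintegral_ofReal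
        ((ker_continuous b).integrable_of_hasCompactSupport (ker_compact b))
        (Filter.Eventually.of_forall (ker_nonneg b)), ker_integral]
    simp
  · exact (hk.comp (measurable_fst.sub measurable_snd)).aemeasurable.mul hφ.comp_snd

theorem lintegral_moll_sq_le {f : E2 → ℝ} (hf : MemLp f 2 volume) :
    ∫⁻ x, ENNReal.ofReal (moll b f x ^ 2) ≤ ∫⁻ x, ENNReal.ofReal (f x ^ 2) := by
  have hl : LocallyIntegrable f := hf.locallyIntegrable (by norm_num)
  have hl2 : LocallyIntegrable (fun x => f x ^ 2) := hf.integrable_sq.locallyIntegrable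
  rw [← lintegral_ker_conv b (φ := fun x => ENNReal.ofReal (f x ^ 2))
    (hf.integrable_sq.aestronglyMeasurable.aemeasurable.ennreal_ofReal)]
  refine lintegral_mono fun x => ?_
  refine (ENNReal.ofReal_le_ofReal (moll_sq_le b hl hl2 x)).trans ?_
  rw [ofReal_integral_eq_lintegral_ofReal
    (integrable_mul_locallyIntegrable (ker_sub_continuous b x) (ker_sub_compact b x) hl2)
    (Filter.Eventually.of_forall fun y => mul_nonneg (ker_nonneg _ _) (sq_nonneg _))]
  refine lintegral_mono fun y => ?_
  rw [ENNReal.ofReal_mul (ker_nonneg _ _)]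

end

/-- A sequence of bump functions shrinking to the origin. -/
def bumpSeq (n : ℕ) : ContDiffBump (0 : E2) :=
  ⟨(1 / ((n : ℝ) + 1)) / 2, 1 / ((n : ℝ) + 1), by positivity, half_lt_self (by positivity)⟩

theorem bumpSeq_rOut : Filter.Tendsto (fun n => (bumpSeq n).rOut) Filter.atTop (nhds 0) :=
  tendsto_one_div_add_atTop_nhds_zero_nat

theorem moll_tendsto {f : E2 → ℝ} (hf : LocallyIntegrable f) :
    ∀ᵐ x, Filter.Tendsto (fun n => moll (bumpSeq n) f x) Filter.atTop (nhds (f x)) := by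
  have := ContDiffBump.ae_convolution_tendsto_right_of_locallyIntegrable (K := 2) bumpSeq_rOut
    (Filter.Eventually.of_forall fun n => by simp [bumpSeq]; field_simp; norm_num) hf
  simpa only [moll_eq_convolution] using this

theorem osc_homothety_le {A : Set E2} (hA : MeasurableSet A) {F : E2 → ℝ} (hF : Measurable F)
    (w : E2) {s : ℝ} (hs : 1 / 2 ≤ s) :
    osc ((fun x => s • x + w) ⁻¹' A) (fun x => F (s • x + w)) ≤ 16 * osc A F := by
  have hT : Measurable (fun x : E2 => s • x + w) := by fun_prop
  have hm : Measurable (fun q : E2 × E2 => ENNReal.ofReal ((F q.1 - F q.2) ^ 2)) := by fun_prop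
  have hin : Measurable (fun x => ∫⁻ y in A, ENNReal.ofReal ((F x - F y) ^ 2)) :=
    hm.lintegral_prod_right'
  have key : ∀ φ : E2 → ENNReal, Measurable φ →
      ∫⁻ x in (fun x => s • x + w) ⁻¹' A, φ (s • x + w) ≤ 4 * ∫⁻ x in A, φ x := by
    intro φ hφ
    rw [← lintegral_indicator (hT hA), ← lintegral_indicator hA]
    exact lintegral_homothety (A.indicator φ) (hφ.indicator hA) w hs
  calc osc ((fun x => s • x + w) ⁻¹' A) (fun x => F (s • x + w))
      ≤ ∫⁻ x in (fun x => s • x + w) ⁻¹' A,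
          4 * ∫⁻ y in A, ENNReal.ofReal ((F (s • x + w) - F y) ^ 2) := by
        refine lintegral_mono fun x => ?_
        exact key (fun y => ENNReal.ofReal ((F (s • x + w) - F y) ^ 2)) (by fun_prop)
    _ ≤ 4 * ∫⁻ x in A, 4 * ∫⁻ y in A, ENNReal.ofReal ((F x - F y) ^ 2) :=
        key (fun x => 4 * ∫⁻ y in A, ENNReal.ofReal ((F x - F y) ^ 2)) (hin.const_mul 4)
    _ = 16 * osc A F := by
        rw [lintegral_const_mul _ hin, ← mul_assoc, osc]; norm_num

theorem osc_le_of_tendsto {A : Set E2} (hA : MeasurableSet A) {An : ℕ → Set E2}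
    (hAn : ∀ n, MeasurableSet (An n)) (hsub : ∀ x ∈ A, ∀ᶠ n in Filter.atTop, x ∈ An n)
    {fn : ℕ → E2 → ℝ} (hfn : ∀ n, Measurable (fn n)) {f : E2 → ℝ}
    (hlim : ∀ᵐ x, Filter.Tendsto (fun n => fn n x) Filter.atTop (nhds (f x))) {B : ENNReal}
    (hB : ∀ n, osc (An n) (fn n) ≤ B) : osc A f ≤ B := by
  set Φ : ℕ → E2 → E2 → ENNReal := fun n x y =>
    (An n).indicator 1 x * ((An n).indicator 1 y * ENNReal.ofReal ((fn n x - fn n y) ^ 2)) with hΦ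
  have hΦm : ∀ n, Measurable (fun q : E2 × E2 => Φ n q.1 q.2) := fun n => by
    have h1 : Measurable ((An n).indicator (1 : E2 → ENNReal)) := measurable_one.indicator (hAn n)
    have := hfn n
    simp only [hΦ]; fun_prop
  have hin : ∀ n, Measurable (fun x => ∫⁻ y in A, Φ n x y) := fun n => (hΦm n).lintegral_prod_right'
  have hle : ∀ n, ∫⁻ x in A, ∫⁻ y in A, Φ n x y ≤ B := fun n => by
    refine le_trans ?_ (hB n)
    have h2 : ∀ φ : E2 → ENNReal, ∫⁻ x in A, (An n).indicator 1 x * φ x ≤ ∫⁻ x in An n, φ x := by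
      intro φ
      rw [← lintegral_indicator (hAn n)]
      refine (setLIntegral_le_lintegral _ _).trans (lintegral_mono fun x => ?_)
      by_cases hx : x ∈ An n <;> simp [hx]
    refine le_trans (lintegral_mono fun x => ?_) (h2 _)
    have h1 : Measurable ((An n).indicator (1 : E2 → ENNReal)) := measurable_one.indicator (hAn n)
    have := hfn n
    simp only [hΦ]
    rw [lintegral_const_mul _ (by fun_prop)]
    exact mul_le_mul' le_rfl (h2 _)
  have hpt : ∀ᵐ x ∂(volume.restrict A), ∀ᵐ y ∂(volume.restrict A),
      ENNReal.ofReal ((f x - f y) ^ 2) = Filter.liminf (fun n => Φ n x y) Filter.atTop := by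
    filter_upwards [ae_restrict_mem hA, ae_restrict_of_ae hlim] with x hx hx'
    filter_upwards [ae_restrict_mem hA, ae_restrict_of_ae hlim] with y hy hy'
    symm
    apply Filter.Tendsto.liminf_eq
    have : Filter.Tendsto (fun n => ENNReal.ofReal ((fn n x - fn n y) ^ 2)) Filter.atTop
        (nhds (ENNReal.ofReal ((f x - f y) ^ 2))) :=
      ENNReal.tendsto_ofReal ((hx'.sub hy').pow 2)
    refine this.congr' ?_
    filter_upwards [hsub x hx, hsub y hy] with n h1 h2
    simp [hΦ, h1, h2]
  calc osc A f = ∫⁻ x in A, ∫⁻ y in A, Filter.liminf (fun n => Φ n x y) Filter.atTop := by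
        refine lintegral_congr_ae ?_
        filter_upwards [hpt] with x hx
        exact lintegral_congr_ae hx
    _ ≤ ∫⁻ x in A, Filter.liminf (fun n => ∫⁻ y in A, Φ n x y) Filter.atTop :=
        lintegral_mono fun x => lintegral_liminf_le fun n => (hΦm n).comp measurable_prodMk_left
    _ ≤ Filter.liminf (fun n => ∫⁻ x in A, ∫⁻ y in A, Φ n x y) Filter.atTop :=
        lintegral_liminf_le hin
    _ ≤ Filter.liminf (fun _ : ℕ => B) Filter.atTop :=
        Filter.liminf_le_liminf (Filter.Eventually.of_forall hle)
    _ = B := by simp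

/-- `φ` is a test function on the set `D`. -/
structure IsTest (D : Set E2) (φ : E2 → ℝ) : Prop where
  smooth : ContDiff ℝ 2 φ
  compact : HasCompactSupport φ
  sub : tsupport φ ⊆ D

theorem pd_comp_affine {f : E2 → ℝ} (hf : ContDiff ℝ 1 f) (s : ℝ) (w : E2) (j : Fin 2) (x : E2) :
    pd j (fun x => f (s • x + w)) x = s * pd j f (s • x + w) := by
  have h1 : HasFDerivAt f (fderiv ℝ f (s • x + w)) (s • x + w) :=
    (hf.differentiable (by norm_num) _).hasFDerivAt
  have h2 : HasFDerivAt (fun x : E2 => s • x + w) (s • ContinuousLinearMap.id ℝ E2) x :=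
    ((hasFDerivAt_id x).const_smul s).add_const w
  have := (h1.comp x h2).fderiv
  simp only [pd]
  rw [show (fun x => f (s • x + w)) = f ∘ (fun x => s • x + w) from rfl, this]
  simp

theorem ker_sub_isTest (b : ContDiffBump (0 : E2)) {D : Set E2} {x : E2}
    (h : Metric.closedBall x b.rOut ⊆ D) : IsTest D (fun y => ker b (x - y)) where
  smooth := (ker_contDiff b (n := 2)).comp (contDiff_const.sub contDiff_id)
  compact := ker_sub_compact b x
  sub := by
    refine (closure_minimal ?_ Metric.isClosed_closedBall).trans h
    intro y hy
    rw [Metric.mem_closedBall, dist_comm, dist_eq_norm]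
    by_contra hc
    exact hy (ker_eq_zero b (not_le.1 hc).le)

theorem pd_moll_eq (b : ContDiffBump (0 : E2)) {f : E2 → ℝ} (hf : LocallyIntegrable f) (j : Fin 2)
    (x : E2) : pd j (moll b f) x = -∫ y, f y * pd j (fun y => ker b (x - y)) y := by
  rw [pd_moll b hf, ← integral_neg]
  congr 1; ext y
  have : (fun y => ker b (x - y)) = fun y => ker b ((-1 : ℝ) • y + x) := by
    ext y; congr 1; module
  rw [this, pd_comp_affine (ker_contDiff b (n := 1))]
  rw [show (-1 : ℝ) • y + x = x - y by module]; ring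

namespace Tri

theorem volume_inn_ne_zero (t : Tri) : volume t.inn ≠ 0 := by
  refine (t.isOpen_inn.measure_pos volume ⟨t.centroid, fun i => ?_⟩).ne'
  rw [lam_centroid]; norm_num

theorem volume_inn_ne_top (t : Tri) : volume t.inn ≠ ⊤ :=
  ((measure_mono t.inn_subset).trans_lt t.isCompact_carrier.measure_lt_top).ne

theorem minlam_lipschitz (t : Tri) : ∃ C, LipschitzWith C t.minlam := by
  obtain ⟨a, ha⟩ := t.lam_lipschitz 0
  obtain ⟨b, hb⟩ := t.lam_lipschitz 1
  obtain ⟨c, hc⟩ := t.lam_lipschitz 2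
  exact ⟨_, ha.min (hb.min hc)⟩

/-- The weak Cauchy–Riemann equations on the open set `D`. -/
def _root_.WeakCR (D : Set E2) (f g : E2 → ℝ) : Prop :=
  ∀ φ, IsTest D φ → ∫ x, f x * pd 0 φ x = ∫ x, g x * pd 1 φ x ∧
    ∫ x, f x * pd 1 φ x = -∫ x, g x * pd 0 φ x

theorem _root_.WeakCR.moll {D : Set E2} {f g : E2 → ℝ} (h : WeakCR D f g) (hf : LocallyIntegrable f)
    (hg : LocallyIntegrable g) (b : ContDiffBump (0 : E2)) {x : E2}
    (hx : Metric.closedBall x b.rOut ⊆ D) :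
    pd 0 (moll b f) x = pd 1 (moll b g) x ∧ pd 1 (moll b f) x = -pd 0 (moll b g) x := by
  obtain ⟨h0, h1⟩ := h _ (ker_sub_isTest b hx)
  simp only [pd_moll_eq b hf, pd_moll_eq b hg, h0, h1, and_self]

theorem osc_inn_le (t : Tri) : ∃ C : ℝ, 0 ≤ C ∧ ∀ f g : E2 → ℝ, MemLp f 2 volume →
    MemLp g 2 volume → WeakCR t.inn f g →
    osc t.inn f ≤ ENNReal.ofReal C * ∫⁻ x, ENNReal.ofReal (g x ^ 2) := by
  obtain ⟨C, hC, hF⟩ := t.friedrichs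
  refine ⟨16 * (4 * (volume t.inn).toReal * (C * 4)), by positivity, fun f g hf hg hw => ?_⟩
  obtain ⟨L, hL⟩ := t.minlam_lipschitz
  have hfl : LocallyIntegrable f := hf.locallyIntegrable (by norm_num)
  have hgl : LocallyIntegrable g := hg.locallyIntegrable (by norm_num)
  have hm : ∀ n : ℕ, ∃ m : ℕ, n ≤ m ∧ L * (bumpSeq m).rOut < 1 / (3 * ((n : ℝ) + 2)) := by
    intro n
    have : Filter.Tendsto (fun m => L * (bumpSeq m).rOut) Filter.atTop (nhds (L * 0)) :=
      bumpSeq_rOut.const_mul _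
    rw [mul_zero] at this
    have h2 := (this.eventually (gt_mem_nhds (show (0 : ℝ) < 1 / (3 * ((n : ℝ) + 2)) by positivity))).and
      (Filter.eventually_ge_atTop n)
    obtain ⟨m, h3, h4⟩ := h2.exists
    exact ⟨m, h4, h3⟩
  choose m hm1 hm2 using hm
  set A : ℕ → Set E2 := fun n => {x | 1 / (3 * ((n : ℝ) + 2)) < t.minlam x} with hA
  refine osc_le_of_tendsto t.measurableSet_inn (An := A)
    (fun n => (isOpen_lt continuous_const t.continuous_minlam).measurableSet) ?_
    (fn := fun n => moll (bumpSeq (m n)) f)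
    (fun n => (moll_contDiff _ hfl (n := 0)).continuous.measurable) ?_ ?_
  · intro x hx
    have h0 := t.tent_pos hx
    obtain ⟨n0, hn0⟩ := exists_nat_gt (1 / t.minlam x)
    filter_upwards [Filter.eventually_ge_atTop n0] with n hn
    have : (n0 : ℝ) ≤ n := by exact_mod_cast hn
    rw [div_lt_iff₀ h0] at hn0
    change 1 / (3 * ((n : ℝ) + 2)) < t.minlam x
    rw [div_lt_iff₀ (by positivity)]
    nlinarith
  · filter_upwards [moll_tendsto hfl] with x hx
    exact hx.comp (Filter.tendsto_atTop_mono hm1 Filter.tendsto_id)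
  · intro n
    set l : ℝ := 1 - 1 / ((n : ℝ) + 2) with hl
    have hl1 : 1 / ((n : ℝ) + 2) ≤ 1 / 2 := by
      apply one_div_le_one_div_of_le <;> linarith [(Nat.cast_nonneg n : (0:ℝ) ≤ n)]
    have hl2 : 0 < 1 / ((n : ℝ) + 2) := by positivity
    have hl0 : 0 < l := by linarith
    have e3 : 1 / (3 * ((n : ℝ) + 2)) = 1 / 3 - l / 3 := by rw [hl]; field_simp; ring
    set b := bumpSeq (m n)
    set w : E2 := t.centroid - l • t.centroid with hw'
    set fn := moll b f
    set gn := moll b g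
    have hfn : ContDiff ℝ 2 fn := moll_contDiff b hfl (n := 2)
    have hgn : ContDiff ℝ 2 gn := moll_contDiff b hgl (n := 2)
    have hT : ContDiff ℝ 2 (fun x : E2 => l • x + w) := by fun_prop
    have hml : ∀ x, t.minlam (l • x + w) = 1 / 3 + l * (t.minlam x - 1 / 3) := fun x => by
      rw [← t.minlam_homothety x hl0.le]; congr 1; rw [hw']; module
    obtain ⟨c, hc⟩ := hF (fun x => fn (l • x + w)) (fun x => gn (l • x + w)) (hfn.comp hT)
      (hgn.comp hT) (by
        intro x hx
        have hx' : Metric.closedBall (l • x + w) b.rOut ⊆ t.inn := by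
          intro y hy i
          refine (t.lt_minlam 0 y).1 ?_ i
          have h1 := hL.dist_le_mul y (l • x + w)
          rw [Real.dist_eq] at h1
          have h2 : L * dist y (l • x + w) ≤ L * b.rOut :=
            mul_le_mul_of_nonneg_left hy L.2
          have h3 := hm2 n
          have h4 := hml x
          have h5 := t.tent_pos hx
          have h6 := (abs_le.1 h1).1
          have h7 : 0 < l * t.minlam x := mul_pos hl0 h5
          rw [e3] at h3
          change (L : ℝ) * b.rOut < _ at h3
          linarith
        obtain ⟨k0, k1⟩ := hw.moll hfl hgl b hx'
        simp only [pd_comp_affine (hfn.of_le (by norm_num)), pd_comp_affine (hgn.of_le (by norm_num))]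
        rw [k0, k1]; constructor <;> ring)
    have hAn : A n = (fun x => l⁻¹ • x + (-(l⁻¹ • w))) ⁻¹' t.inn := by
      ext y
      have e1 : l • (l⁻¹ • y + -(l⁻¹ • w)) + w = y := by
        rw [smul_add, smul_neg, smul_smul, smul_smul, mul_inv_cancel₀ hl0.ne']; module
      have := hml (l⁻¹ • y + -(l⁻¹ • w))
      rw [e1] at this
      change 1 / (3 * ((n : ℝ) + 2)) < t.minlam y ↔ ∀ i, 0 < t.lam i (l⁻¹ • y + -(l⁻¹ • w))
      rw [← lt_minlam]
      rw [this, e3]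
      constructor
      · intro h; by_contra hc'; push Not at hc'
        nlinarith [mul_nonneg hl0.le (neg_nonneg.2 hc')]
      · intro h; nlinarith [mul_pos hl0 h]
    have hfe : fn = fun x => (fun x => fn (l • x + w)) (l⁻¹ • x + (-(l⁻¹ • w))) := by
      ext y
      have e1 : l • (l⁻¹ • y + -(l⁻¹ • w)) + w = y := by
        rw [smul_add, smul_neg, smul_smul, smul_smul, mul_inv_cancel₀ hl0.ne']; module
      simp only [e1]
    have hfm : Measurable (fun x => fn (l • x + w)) := (hfn.comp hT).continuous.measurable
    have hlinv : 1 / 2 ≤ l⁻¹ := by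
      rw [one_div]; exact inv_anti₀ hl0 (by linarith)
    have o1 : osc (A n) fn ≤ 16 * osc t.inn (fun x => fn (l • x + w)) := by
      rw [hAn]
      conv_lhs => rw [hfe]
      exact osc_homothety_le t.measurableSet_inn hfm _ hlinv
    have o2 := osc_le (A := t.inn) hfm c
    have o3 : ∫⁻ x in t.inn, ENNReal.ofReal ((fn (l • x + w) - c) ^ 2)
        ≤ ENNReal.ofReal C * (4 * ∫⁻ x, ENNReal.ofReal (g x ^ 2)) := by
      have hcf : Continuous (fun x => (fn (l • x + w) - c) ^ 2) := by
        have := (hfn.comp hT).continuous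
        exact (this.sub continuous_const).pow 2
      have hcg : Continuous (fun x => gn (l • x + w) ^ 2) := ((hgn.comp hT).continuous).pow 2
      rw [← ofReal_integral_eq_lintegral_ofReal (t.integrableOn_inn hcf)
        (Filter.Eventually.of_forall fun x => sq_nonneg _)]
      refine (ENNReal.ofReal_le_ofReal hc).trans ?_
      rw [ENNReal.ofReal_mul hC]
      gcongr
      rw [ofReal_integral_eq_lintegral_ofReal (t.integrableOn_inn hcg)
        (Filter.Eventually.of_forall fun x => sq_nonneg _)]
      refine (setLIntegral_le_lintegral _ _).trans ?_
      refine (lintegral_homothety (fun x => ENNReal.ofReal (gn x ^ 2))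
        (hgn.continuous.pow 2).measurable.ennreal_ofReal w (s := l) (by linarith)).trans ?_
      exact mul_le_mul' le_rfl (lintegral_moll_sq_le b hg)
    calc osc (A n) fn ≤ 16 * (4 * volume t.inn *
          (ENNReal.ofReal C * (4 * ∫⁻ x, ENNReal.ofReal (g x ^ 2)))) :=
          o1.trans (by gcongr; exact o2.trans (by gcongr))
      _ = _ := by
          rw [ENNReal.ofReal_mul (by norm_num), ENNReal.ofReal_mul (by positivity),
            ENNReal.ofReal_mul (by norm_num), ENNReal.ofReal_toReal t.volume_inn_ne_top,
            ENNReal.ofReal_mul hC]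
          simp only [ENNReal.ofReal_ofNat]
          ring

theorem friedrichs_weak (t : Tri) : ∃ C : ℝ, 0 ≤ C ∧ ∀ f g : E2 → ℝ, MemLp f 2 volume →
    MemLp g 2 volume → WeakCR t.inn f g →
    ∃ c, ∫ x in t.inn, (f x - c) ^ 2 ≤ C * ∫ x, g x ^ 2 := by
  obtain ⟨C, hC, h⟩ := t.osc_inn_le
  have hv : 0 < (volume t.inn).toReal := ENNReal.toReal_pos t.volume_inn_ne_zero t.volume_inn_ne_top
  refine ⟨C / (volume t.inn).toReal, by positivity, fun f g hf hg hw => ?_⟩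
  obtain ⟨f', hf', hff'⟩ := hf.1.aemeasurable
  have ho : osc t.inn f' = osc t.inn f := by
    refine lintegral_congr_ae ?_
    filter_upwards [ae_restrict_of_ae hff'] with x hx
    refine lintegral_congr_ae ?_
    filter_upwards [ae_restrict_of_ae hff'] with y hy
    rw [hx, hy]
  obtain ⟨c, hc⟩ := exists_center t.volume_inn_ne_zero t.volume_inn_ne_top hf'
  refine ⟨c, ?_⟩
  have h1 : ∫⁻ x in t.inn, ENNReal.ofReal ((f x - c) ^ 2)
      = ∫⁻ x in t.inn, ENNReal.ofReal ((f' x - c) ^ 2) := by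
    refine lintegral_congr_ae ?_
    filter_upwards [ae_restrict_of_ae hff'] with x hx
    rw [hx]
  rw [← h1, ho] at hc
  have h2 := hc.trans (h f g hf hg hw)
  have : IsFiniteMeasure (volume.restrict t.inn) :=
    ⟨by simpa using t.volume_inn_ne_top.lt_top⟩
  have hi : MemLp (fun x => f x - c) 2 (volume.restrict t.inn) := (hf.restrict _).sub (memLp_const c)
  rw [← ofReal_integral_eq_lintegral_ofReal hi.integrable_sq
    (Filter.Eventually.of_forall fun x => sq_nonneg _),
    ← ofReal_integral_eq_lintegral_ofReal hg.integrable_sq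
    (Filter.Eventually.of_forall fun x => sq_nonneg _), ← ENNReal.ofReal_toReal t.volume_inn_ne_top,
    ← ENNReal.ofReal_mul hv.le, ← ENNReal.ofReal_mul hC, ENNReal.ofReal_le_ofReal_iff
      (mul_nonneg hC (integral_nonneg fun x => sq_nonneg _))] at h2
  rw [div_mul_eq_mul_div, le_div_iff₀ hv]
  linarith

end Tri

/-- `|∫ P div (a, b)| ≤ S |∇(a, b)|` for all test fields on `D`. -/
def NecasHyp (D : Set E2) (P : E2 → ℝ) (S : ℝ) : Prop :=
  ∀ a b, IsTest D a → IsTest D b →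
    |∫ x, P x * (pd 0 a x + pd 1 b x)| ≤ S * Real.sqrt (∫ x, (gsq a x + gsq b x))

/-- Nečas' inequality on `D`, observed on the subset `A`. -/
def NecasGood (D A : Set E2) : Prop :=
  ∃ C : ℝ, 0 ≤ C ∧ ∀ (P : E2 → ℝ) (S : ℝ), MemLp P 2 volume → 0 ≤ S → NecasHyp D P S →
    ∃ c, ∫ x in A, (P x - c) ^ 2 ≤ C * S ^ 2

theorem isTest_zero (D : Set E2) : IsTest D (fun _ => 0) where
  smooth := contDiff_const
  compact := HasCompactSupport.zero
  sub := by simp [tsupport, Function.support]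

theorem IsTest.add {D : Set E2} {a b : E2 → ℝ} (ha : IsTest D a) (hb : IsTest D b) :
    IsTest D (a + b) where
  smooth := ha.smooth.add hb.smooth
  compact := ha.compact.add hb.compact
  sub := (tsupport_add a b).trans (Set.union_subset ha.sub hb.sub)

theorem IsTest.smul {D : Set E2} {a : E2 → ℝ} (ha : IsTest D a) (c : ℝ) : IsTest D (c • a) where
  smooth := contDiff_const.smul ha.smooth
  compact := ha.compact.smul_left (f := fun _ => c)
  sub := (tsupport_smul_subset_right (fun _ => c) a).trans ha.sub

theorem IsTest.memLp_pd {D : Set E2} {a : E2 → ℝ} (ha : IsTest D a) (j : Fin 2) :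
    MemLp (pd j a) 2 volume :=
  (continuous_pd (ha.smooth.of_le (by norm_num)) j).memLp_of_hasCompactSupport
    (pd_hasCompactSupport ha.compact j)

/-- The plane fields with four components. -/
abbrev E4 : Type := EuclideanSpace ℝ (Fin 4)

theorem memLp_vec4 {f : Fin 4 → E2 → ℝ} (hf : ∀ i, MemLp (f i) 2 volume) :
    MemLp (fun x => (WithLp.toLp 2 (fun i => f i x) : E4)) 2 volume := by
  exact MemLp.of_eval_piLp fun i => hf i

/-- Assemble an element of `L²(ℝ²; ℝ⁴)`. -/
def vec4 (f : Fin 4 → E2 → ℝ) (hf : ∀ i, MemLp (f i) 2 volume) : Lp E4 2 (volume : Measure E2) :=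
  (memLp_vec4 hf).toLp _

theorem inner_vec4 (G : Lp E4 2 (volume : Measure E2)) (f : Fin 4 → E2 → ℝ)
    (hf : ∀ i, MemLp (f i) 2 volume) :
    ⟪G, vec4 f hf⟫ = ∫ x, ∑ i, G x i * f i x := by
  rw [L2.inner_def]
  refine integral_congr_ae ?_
  filter_upwards [(memLp_vec4 hf).coeFn_toLp] with x hx
  rw [vec4, hx]
  simp [PiLp.inner_apply, mul_comm]

theorem inner_vec4_vec4 (e f : Fin 4 → E2 → ℝ) (he : ∀ i, MemLp (e i) 2 volume)
    (hf : ∀ i, MemLp (f i) 2 volume) :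
    ⟪vec4 e he, vec4 f hf⟫ = ∫ x, ∑ i, e i x * f i x := by
  rw [inner_vec4]
  refine integral_congr_ae ?_
  filter_upwards [(memLp_vec4 he).coeFn_toLp] with x hx
  rw [vec4, hx]

theorem memLp_coord (G : Lp E4 2 (volume : Measure E2)) (i : Fin 4) :
    MemLp (fun x => G x i) 2 volume := by
  have := (Lp.memLp G)
  refine MemLp.of_le this ?_ (Filter.Eventually.of_forall fun x => PiLp.norm_apply_le (G x) i)
  exact (EuclideanSpace.proj (𝕜 := ℝ) i).continuous.comp_aestronglyMeasurable this.1

/-- Gradients of test fields, as a subspace of `L²`. -/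
def gradSpace (D : Set E2) : Submodule ℝ (Lp E4 2 (volume : Measure E2)) where
  carrier := {w | ∃ (a b : E2 → ℝ) (ha : IsTest D a) (hb : IsTest D b), w =
    vec4 ![pd 0 a, pd 1 a, pd 0 b, pd 1 b] (by
      intro i; fin_cases i
      exacts [ha.memLp_pd 0, ha.memLp_pd 1, hb.memLp_pd 0, hb.memLp_pd 1])}
  zero_mem' := by
    refine ⟨_, _, isTest_zero D, isTest_zero D, ?_⟩
    symm
    refine (Lp.eq_zero_iff_ae_eq_zero).2 ((MemLp.coeFn_toLp _).trans
      (Filter.Eventually.of_forall fun x => ?_))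
    ext i; fin_cases i <;> simp [pd]
  add_mem' := by
    rintro _ _ ⟨a, b, ha, hb, rfl⟩ ⟨a', b', ha', hb', rfl⟩
    refine ⟨_, _, ha.add ha', hb.add hb', ?_⟩
    rw [vec4, vec4, ← MemLp.toLp_add, vec4]
    congr 1
    have hd : ∀ {f}, IsTest D f → ∀ x, DifferentiableAt ℝ f x := fun h x =>
      h.smooth.differentiable (by norm_num) x
    ext x i; fin_cases i <;> simp [pd, fderiv_add (hd ha x) (hd ha' x), fderiv_add (hd hb x) (hd hb' x)]
  smul_mem' := by
    rintro c _ ⟨a, b, ha, hb, rfl⟩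
    refine ⟨_, _, ha.smul c, hb.smul c, ?_⟩
    rw [vec4, ← MemLp.toLp_const_smul, vec4]
    congr 1
    have hd : ∀ {f}, IsTest D f → ∀ x, DifferentiableAt ℝ f x := fun h x =>
      h.smooth.differentiable (by norm_num) x
    ext x i; fin_cases i <;> simp [pd, fderiv_const_smul (hd ha x), fderiv_const_smul (hd hb x)]

theorem IsTest.integral_pd_comm {D : Set E2} {a b : E2 → ℝ} (ha : IsTest D a) (hb : IsTest D b) :
    ∫ x, pd 0 a x * pd 1 b x = ∫ x, pd 1 a x * pd 0 b x := by
  have h1 : ContDiff ℝ 1 (pd 1 b) := contDiff_pd (n := 1) (by exact_mod_cast hb.smooth) 1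
  have h0 : ContDiff ℝ 1 (pd 0 b) := contDiff_pd (n := 1) (by exact_mod_cast hb.smooth) 0
  have ha1 : ContDiff ℝ 1 a := ha.smooth.of_le (by norm_num)
  rw [pd_ibp ha1 h1 ha.compact, pd_ibp ha1 h0 ha.compact]
  congr 2; ext x; congr 1
  have hsym : IsSymmSndFDerivAt ℝ b x := hb.smooth.contDiffAt.isSymmSndFDerivAt (by simp)
  have hd : DifferentiableAt ℝ (fderiv ℝ b) x :=
    (hb.smooth.fderiv_right (m := 1) (by norm_num)).differentiable (by norm_num) x
  have e : ∀ i j, pd i (pd j b) x = fderiv ℝ (fderiv ℝ b) x (ee i) (ee j) := fun i j => by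
    change fderiv ℝ (fun y => fderiv ℝ b y (ee j)) x (ee i) = _
    rw [fderiv_clm_apply hd (differentiableAt_const _)]
    simp
  rw [e, e, hsym]

theorem exists_weakCR {D : Set E2} {P : E2 → ℝ} {S : ℝ} (hP : MemLp P 2 volume) (hS : 0 ≤ S)
    (h : NecasHyp D P S) : ∃ d g : E2 → ℝ, MemLp d 2 volume ∧ MemLp g 2 volume ∧
      ∫ x, d x ^ 2 ≤ 2 * S ^ 2 ∧ ∫ x, g x ^ 2 ≤ 2 * S ^ 2 ∧ WeakCR D (fun x => P x - d x) g := by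
  have hv : ∀ i : Fin 4, MemLp ((![P, fun _ => 0, fun _ => 0, P] : Fin 4 → E2 → ℝ) i) 2 volume := by
    have h0 : MemLp (fun _ : E2 => (0 : ℝ)) 2 volume := MemLp.zero
    intro i; fin_cases i
    exacts [hP, h0, h0, hP]
  set v0 := vec4 _ hv with hv0
  set W := gradSpace D
  set K := W.topologicalClosure
  set G : Lp E4 2 (volume : Measure E2) := K.starProjection v0 with hG
  have hGK : G ∈ K := K.starProjection_apply_mem v0
  have horth : ∀ w ∈ K, ⟪v0 - G, w⟫ = 0 := fun w hw => K.starProjection_inner_eq_zero v0 w hw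
  have hbd : ∀ w ∈ W, ⟪v0, w⟫ ≤ S * ‖w‖ := by
    rintro w ⟨a, b, ha, hb, rfl⟩
    have e : ‖vec4 ![pd 0 a, pd 1 a, pd 0 b, pd 1 b] (by
      intro i; fin_cases i
      exacts [ha.memLp_pd 0, ha.memLp_pd 1, hb.memLp_pd 0, hb.memLp_pd 1])‖
        = Real.sqrt (∫ x, (gsq a x + gsq b x)) := by
      rw [norm_eq_sqrt_real_inner, inner_vec4_vec4]
      congr 2; ext x; simp [Fin.sum_univ_four, gsq]; ring
    rw [e, hv0, inner_vec4_vec4]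
    refine le_trans (le_of_eq ?_) ((le_abs_self _).trans (h a b ha hb))
    congr 1; ext x; simp [Fin.sum_univ_four]; ring
  have hbdK : ∀ w ∈ K, ⟪v0, w⟫ ≤ S * ‖w‖ := by
    intro w hw
    have hc : IsClosed {w : Lp E4 2 (volume : Measure E2) | ⟪v0, w⟫ ≤ S * ‖w‖} :=
      isClosed_le (by fun_prop) (by fun_prop)
    exact closure_minimal (fun w hw => hbd w hw) hc hw
  have hGS : ‖G‖ ≤ S := by
    have h1 := horth G hGK
    rw [inner_sub_left, real_inner_self_eq_norm_sq] at h1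
    have h2 := hbdK G hGK
    by_contra hc; push Not at hc
    nlinarith
  have hGsq : ∫ x, ∑ i, G x i ^ 2 ≤ S ^ 2 := by
    have : ∫ x, ∑ i, G x i ^ 2 = ‖G‖ ^ 2 := by
      rw [← real_inner_self_eq_norm_sq, L2.inner_def]
      congr 1; ext x
      rw [real_inner_self_eq_norm_sq, EuclideanSpace.norm_sq_eq]; simp
    rw [this]; exact pow_le_pow_left₀ (norm_nonneg _) hGS 2
  have hGm := memLp_coord G
  have hinteg : Integrable (fun x => ∑ i, G x i ^ 2) :=
    integrable_finsetSum _ fun i _ => (hGm i).integrable_sq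
  have hWK : W ≤ K := Submodule.le_topologicalClosure W
  have hpm : ∀ {a b : E2 → ℝ}, MemLp a 2 volume → MemLp b 2 volume →
      Integrable (fun x => a x * b x) := fun ha hb => ha.integrable_mul hb
  have hpn : ∀ {a b : E2 → ℝ}, MemLp a 2 volume → MemLp b 2 volume →
      Integrable (fun x => -(a x * b x)) := fun ha hb => (hpm ha hb).neg
  refine ⟨fun x => G x 0 + G x 3, fun x => G x 1 - G x 2, (hGm 0).add (hGm 3), (hGm 1).sub (hGm 2),
    ?_, ?_, ?_⟩
  · calc ∫ x, (G x 0 + G x 3) ^ 2 ≤ ∫ x, 2 * ∑ i, G x i ^ 2 := by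
          refine integral_mono ((hGm 0).add (hGm 3)).integrable_sq (hinteg.const_mul 2) fun x => ?_
          simp only [Fin.sum_univ_four]
          nlinarith [sq_nonneg (G x 0 - G x 3), sq_nonneg (G x 1), sq_nonneg (G x 2)]
      _ ≤ 2 * S ^ 2 := by rw [integral_const_mul]; linarith
  · calc ∫ x, (G x 1 - G x 2) ^ 2 ≤ ∫ x, 2 * ∑ i, G x i ^ 2 := by
          refine integral_mono ((hGm 1).sub (hGm 2)).integrable_sq (hinteg.const_mul 2) fun x => ?_
          simp only [Fin.sum_univ_four]
          nlinarith [sq_nonneg (G x 1 + G x 2), sq_nonneg (G x 0), sq_nonneg (G x 3)]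
      _ ≤ 2 * S ^ 2 := by rw [integral_const_mul]; linarith
  · intro φ hφ
    have h0 : ∀ x, pd 0 (fun _ : E2 => (0 : ℝ)) x = 0 := fun x => by simp [pd]
    have h1 : ∀ x, pd 1 (fun _ : E2 => (0 : ℝ)) x = 0 := fun x => by simp [pd]
    have z := isTest_zero D
    have hz : MemLp (fun _ : E2 => (0 : ℝ)) 2 volume := MemLp.zero
    have m0 := hφ.memLp_pd 0
    have m1 := hφ.memLp_pd 1
    have hperp : ∀ (ω : Fin 4 → E2 → ℝ) (hω : ∀ i, MemLp (ω i) 2 volume),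
        (∀ a b, IsTest D a → IsTest D b →
          ∫ x, (pd 0 a x * ω 0 x + pd 1 a x * ω 1 x + pd 0 b x * ω 2 x + pd 1 b x * ω 3 x) = 0) →
        ⟪G, vec4 ω hω⟫ = 0 := by
      intro ω hω hab
      have hc : IsClosed {w : Lp E4 2 (volume : Measure E2) | ⟪w, vec4 ω hω⟫ = 0} :=
        isClosed_eq (by fun_prop) (by fun_prop)
      refine closure_minimal ?_ hc hGK
      rintro w ⟨a, b, ha, hb, rfl⟩
      change ⟪vec4 _ _, _⟫ = 0
      rw [inner_vec4_vec4, ← hab a b ha hb]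
      congr 1; ext x; simp [Fin.sum_univ_four]
    constructor
    · have q1 := horth _ (hWK ⟨φ, _, hφ, z, rfl⟩)
      have hω : ∀ i : Fin 4, MemLp ((![fun _ => 0, fun _ => 0, pd 1 φ, fun x => - pd 0 φ x]
          : Fin 4 → E2 → ℝ) i) 2 volume := by
        intro i; fin_cases i
        exacts [hz, hz, m1, m0.neg]
      have q2 := hperp _ hω (by
        intro a b ha hb
        have := hb.integral_pd_comm hφ
        simp only [Matrix.cons_val_zero, Matrix.cons_val_one, Matrix.cons_val, mul_zero, zero_add,
          mul_neg]
        rw [integral_add (hpm (hb.memLp_pd 0) m1) (hpn (hb.memLp_pd 1) m0), integral_neg,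
          this, add_neg_cancel])
      rw [inner_sub_left, hv0, inner_vec4_vec4, inner_vec4] at q1
      rw [inner_vec4] at q2
      simp only [Fin.sum_univ_four, Matrix.cons_val_zero, Matrix.cons_val_one, Matrix.cons_val,
        mul_zero, zero_mul, zero_add, add_zero, h0, h1, mul_neg] at q1 q2
      rw [integral_add (hpm (hGm 0) m0) (hpm (hGm 1) m1)] at q1
      rw [integral_add (hpm (hGm 2) m1) (hpn (hGm 3) m0), integral_neg] at q2
      have e1 : (fun x => (P x - (G x 0 + G x 3)) * pd 0 φ x) = fun x => P x * pd 0 φ x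
          - (G x 0 * pd 0 φ x + G x 3 * pd 0 φ x) := by ext x; ring
      have e2 : (fun x => (G x 1 - G x 2) * pd 1 φ x) = fun x => G x 1 * pd 1 φ x
          - G x 2 * pd 1 φ x := by ext x; ring
      have i3 : Integrable (fun x => G x 0 * pd 0 φ x + G x 3 * pd 0 φ x) :=
        (hpm (hGm 0) m0).add (hpm (hGm 3) m0)
      rw [e1, e2, integral_sub (hpm hP m0) i3, integral_add (hpm (hGm 0) m0) (hpm (hGm 3) m0),
        integral_sub (hpm (hGm 1) m1) (hpm (hGm 2) m1)]
      linarith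
    · have q1 := horth _ (hWK ⟨_, φ, z, hφ, rfl⟩)
      have hω : ∀ i : Fin 4, MemLp ((![fun x => - pd 1 φ x, pd 0 φ, fun _ => 0, fun _ => 0]
          : Fin 4 → E2 → ℝ) i) 2 volume := by
        intro i; fin_cases i
        exacts [m1.neg, m0, hz, hz]
      have q2 := hperp _ hω (by
        intro a b ha hb
        have := ha.integral_pd_comm hφ
        simp only [Matrix.cons_val_zero, Matrix.cons_val_one, Matrix.cons_val, mul_zero, add_zero,
          mul_neg]
        rw [integral_add (hpn (ha.memLp_pd 0) m1) (hpm (ha.memLp_pd 1) m0), integral_neg,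
          this, neg_add_cancel])
      rw [inner_sub_left, hv0, inner_vec4_vec4, inner_vec4] at q1
      rw [inner_vec4] at q2
      simp only [Fin.sum_univ_four, Matrix.cons_val_zero, Matrix.cons_val_one, Matrix.cons_val,
        mul_zero, zero_mul, zero_add, add_zero, h0, h1, mul_neg] at q1 q2
      rw [integral_add (hpm (hGm 2) m0) (hpm (hGm 3) m1)] at q1
      rw [integral_add (hpn (hGm 0) m1) (hpm (hGm 1) m0), integral_neg] at q2
      have e1 : (fun x => (P x - (G x 0 + G x 3)) * pd 1 φ x) = fun x => P x * pd 1 φ x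
          - (G x 0 * pd 1 φ x + G x 3 * pd 1 φ x) := by ext x; ring
      have e2 : (fun x => (G x 1 - G x 2) * pd 0 φ x) = fun x => G x 1 * pd 0 φ x
          - G x 2 * pd 0 φ x := by ext x; ring
      have i3 : Integrable (fun x => G x 0 * pd 1 φ x + G x 3 * pd 1 φ x) :=
        (hpm (hGm 0) m1).add (hpm (hGm 3) m1)
      rw [e1, e2, integral_sub (hpm hP m1) i3, integral_add (hpm (hGm 0) m1) (hpm (hGm 3) m1),
        integral_sub (hpm (hGm 1) m0) (hpm (hGm 2) m0)]
      linarith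

theorem NecasHyp.mono {D D' : Set E2} (hD : D' ⊆ D) {P : E2 → ℝ} {S : ℝ} (h : NecasHyp D P S) :
    NecasHyp D' P S := fun a b ha hb =>
  h a b ⟨ha.1, ha.2, ha.3.trans hD⟩ ⟨hb.1, hb.2, hb.3.trans hD⟩

theorem Tri.necasGood (t : Tri) {D : Set E2} (hD : t.inn ⊆ D) : NecasGood D t.inn := by
  obtain ⟨C, hC, hF⟩ := t.friedrichs_weak
  refine ⟨2 * (C * 2) + 2 * 2, by positivity, fun P S hP hS h => ?_⟩
  obtain ⟨d, g, hd, hg, hd2, hg2, hw⟩ := exists_weakCR hP hS (h.mono hD)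
  obtain ⟨c, hc⟩ := hF _ g (hP.sub hd) hg hw
  have hc' : ∫ x in t.inn, (P x - d x - c) ^ 2 ≤ C * ∫ x, g x ^ 2 := hc
  refine ⟨c, ?_⟩
  have : IsFiniteMeasure (volume.restrict t.inn) := ⟨by simpa using t.volume_inn_ne_top.lt_top⟩
  have m1 : MemLp (fun x => P x - d x - c) 2 (volume.restrict t.inn) :=
    ((hP.sub hd).restrict _).sub (memLp_const c)
  have m2 : MemLp (fun x => P x - c) 2 (volume.restrict t.inn) :=
    (hP.restrict _).sub (memLp_const c)
  have m3 := hd.restrict t.inn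
  calc ∫ x in t.inn, (P x - c) ^ 2
      ≤ ∫ x in t.inn, (2 * (P x - d x - c) ^ 2 + 2 * d x ^ 2) := by
        refine integral_mono m2.integrable_sq
          ((m1.integrable_sq.const_mul 2).add (m3.integrable_sq.const_mul 2)) fun x => ?_
        nlinarith [sq_nonneg (P x - d x - c - d x)]
    _ = 2 * (∫ x in t.inn, (P x - d x - c) ^ 2) + 2 * ∫ x in t.inn, d x ^ 2 := by
        rw [integral_add (m1.integrable_sq.const_mul 2) (m3.integrable_sq.const_mul 2),
          integral_const_mul, integral_const_mul]
    _ ≤ 2 * (C * (2 * S ^ 2)) + 2 * (2 * S ^ 2) := by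
        have h3 : ∫ x in t.inn, d x ^ 2 ≤ ∫ x, d x ^ 2 :=
          setIntegral_le_integral hd.integrable_sq (Filter.Eventually.of_forall fun x => sq_nonneg _)
        have h4 := mul_le_mul_of_nonneg_left hg2 hC
        linarith
    _ = _ := by ring

namespace Tri

theorem interior_subset_inn (t : Tri) : interior t.carrier ⊆ t.inn := by
  intro x hx i
  have h0 : 0 ≤ t.lam i x := (t.mem_carrier_iff x).1 (interior_subset hx) i
  rcases h0.lt_or_eq with h | h
  · exact h
  exfalso
  have hc : Continuous (fun s : ℝ => t.centroid + s • (x - t.centroid)) := by fun_prop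
  have hev : ∀ᶠ s in nhds (1 : ℝ), t.centroid + s • (x - t.centroid) ∈ interior t.carrier := by
    apply hc.continuousAt.eventually_mem
    apply isOpen_interior.mem_nhds
    simpa using hx
  obtain ⟨s, hs, hs1⟩ := ((hev.filter_mono nhdsWithin_le_nhds).and
    (self_mem_nhdsWithin (a := (1 : ℝ)) (s := Set.Ioi 1))).exists
  have h1 := (t.mem_carrier_iff _).1 (interior_subset hs) i
  rw [lam_affine, lam_centroid, ← h] at h1
  have : 1 < s := hs1
  linarith

theorem inn_ae_eq (t : Tri) : t.inn =ᵐ[volume] t.carrier := by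
  have h : volume (frontier t.carrier) = 0 := (convex_convexHull ℝ _).addHaar_frontier _
  refine Filter.EventuallyLE.antisymm (Filter.Eventually.of_forall t.inn_subset) ?_
  rw [ae_le_set]
  refine measure_mono_null ?_ h
  rintro x ⟨hx, hx'⟩
  exact ⟨subset_closure hx, fun h => hx' (t.interior_subset_inn h)⟩

theorem inn_nonempty (t : Tri) : t.inn.Nonempty :=
  ⟨t.centroid, fun i => by rw [lam_centroid]; norm_num⟩

/-- A homothetic copy of `t` with prescribed centroid. -/
def shrink (t : Tri) (x : E2) (r : ℝ) (hr : r ≠ 0) : Tri where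
  vtx i := x + r • (t.vtx i - t.centroid)
  indep := by
    let f : E2 →ᵃ[ℝ] E2 := AffineMap.const ℝ E2 x +
      r • (AffineMap.id ℝ E2 - AffineMap.const ℝ E2 t.centroid)
    have hf : Function.Injective f := by
      intro y z h
      have h' : x + r • (y - t.centroid) = x + r • (z - t.centroid) := h
      simpa [hr] using h'
    exact t.indep.map' f hf

theorem centroid_shrink (t : Tri) (x : E2) (r : ℝ) (hr : r ≠ 0) : (t.shrink x r hr).centroid = x := by
  have := t.centroid_eq
  simp only [centroid_eq, shrink, Fin.sum_univ_three] at this ⊢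
  module

end Tri

theorem exists_small_tri (t : Tri) {U : Set E2} (hU : IsOpen U) {x : E2} (hx : x ∈ U) :
    ∃ s : Tri, x ∈ s.inn ∧ s.inn ⊆ U := by
  obtain ⟨ε, hε, hb⟩ := Metric.isOpen_iff.1 hU x hx
  set m := ∑ i, ‖t.vtx i - t.centroid‖ with hm
  have hm0 : 0 ≤ m := Finset.sum_nonneg fun i _ => norm_nonneg _
  have hr : 0 < ε / (m + 1) := by positivity
  refine ⟨t.shrink x _ hr.ne', ?_, ?_⟩
  · intro i
    have := (t.shrink x _ hr.ne').lam_centroid i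
    rw [Tri.centroid_shrink] at this
    rw [this]; norm_num
  · refine (Tri.inn_subset _).trans (Set.Subset.trans ?_ hb)
    refine convexHull_min ?_ (convex_ball x ε)
    rintro _ ⟨i, rfl⟩
    have h1 : ‖t.vtx i - t.centroid‖ ≤ m :=
      Finset.single_le_sum (f := fun i => ‖t.vtx i - t.centroid‖) (fun i _ => norm_nonneg _)
        (Finset.mem_univ i)
    simp only [Tri.shrink, Metric.mem_ball, dist_eq_norm, add_sub_cancel_left, norm_smul,
      Real.norm_of_nonneg hr.le]
    rw [div_mul_eq_mul_div, div_lt_iff₀ (by positivity)]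
    nlinarith

section
variable {D A B : Set E2}

theorem memLp_sub_const_restrict (hA : volume A ≠ ⊤) {P : E2 → ℝ} (hP : MemLp P 2 volume) (c : ℝ) :
    MemLp (fun x => P x - c) 2 (volume.restrict A) := by
  have : IsFiniteMeasure (volume.restrict A) := ⟨by simpa using hA.lt_top⟩
  exact (hP.restrict _).sub (memLp_const c)

theorem NecasGood.mono (hA : volume A ≠ ⊤) (h : NecasGood D A) (hBA : B ≤ᵐ[volume] A) :
    NecasGood D B := by
  obtain ⟨C, hC, h⟩ := h
  refine ⟨C, hC, fun P S hP hS hN => ?_⟩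
  obtain ⟨c, hc⟩ := h P S hP hS hN
  exact ⟨c, (setIntegral_mono_set (memLp_sub_const_restrict hA hP c).integrable_sq
    (Filter.Eventually.of_forall fun x => sq_nonneg _) hBA).trans hc⟩

theorem NecasGood.union (hAm : MeasurableSet A) (hBm : MeasurableSet B) (hA : volume A ≠ ⊤)
    (hB : volume B ≠ ⊤) (hAB : volume (A ∩ B) ≠ 0) (h1 : NecasGood D A) (h2 : NecasGood D B) :
    NecasGood D (A ∪ B) := by
  obtain ⟨C1, hC1, h1⟩ := h1
  obtain ⟨C2, hC2, h2⟩ := h2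
  have hABt : volume (A ∩ B) ≠ ⊤ := ((measure_mono Set.inter_subset_left).trans_lt hA.lt_top).ne
  have hv : 0 < (volume (A ∩ B)).toReal := ENNReal.toReal_pos hAB hABt
  set v := (volume (A ∩ B)).toReal with hvdef
  set vB := (volume B).toReal with hvB
  refine ⟨C1 + (2 * C2 + 2 * ((2 * C1 + 2 * C2) / v * vB)), by positivity, fun P S hP hS hN => ?_⟩
  obtain ⟨c1, hc1⟩ := h1 P S hP hS hN
  obtain ⟨c2, hc2⟩ := h2 P S hP hS hN
  have iA : ∀ c, IntegrableOn (fun x => (P x - c) ^ 2) A := fun c =>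
    (memLp_sub_const_restrict hA hP c).integrable_sq
  have iB : ∀ c, IntegrableOn (fun x => (P x - c) ^ 2) B := fun c =>
    (memLp_sub_const_restrict hB hP c).integrable_sq
  have nn : ∀ c (E : Set E2), 0 ≤ᵐ[volume.restrict E] fun x => (P x - c) ^ 2 := fun c E =>
    Filter.Eventually.of_forall fun x => sq_nonneg _
  have k1 : v * (c1 - c2) ^ 2 ≤ 2 * (C1 * S ^ 2) + 2 * (C2 * S ^ 2) := by
    calc v * (c1 - c2) ^ 2 = ∫ x in A ∩ B, (c1 - c2) ^ 2 := by
          rw [setIntegral_const, smul_eq_mul]; rfl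
      _ ≤ ∫ x in A ∩ B, (2 * (P x - c1) ^ 2 + 2 * (P x - c2) ^ 2) := by
          refine integral_mono (integrableOn_const hABt) ?_ fun x => ?_
          · exact (((iA c1).mono_set Set.inter_subset_left).const_mul 2).add
              (((iB c2).mono_set Set.inter_subset_right).const_mul 2)
          · nlinarith [sq_nonneg (P x - c1 + (P x - c2))]
      _ = 2 * (∫ x in A ∩ B, (P x - c1) ^ 2) + 2 * ∫ x in A ∩ B, (P x - c2) ^ 2 := by
          rw [integral_add (((iA c1).mono_set Set.inter_subset_left).const_mul 2)
              (((iB c2).mono_set Set.inter_subset_right).const_mul 2), integral_const_mul,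
            integral_const_mul]
      _ ≤ _ := by
          have q1 : ∫ x in A ∩ B, (P x - c1) ^ 2 ≤ ∫ x in A, (P x - c1) ^ 2 :=
            setIntegral_mono_set (iA c1) (nn c1 A) (Filter.Eventually.of_forall (Set.inter_subset_left (s := A) (t := B)))
          have q2 : ∫ x in A ∩ B, (P x - c2) ^ 2 ≤ ∫ x in B, (P x - c2) ^ 2 :=
            setIntegral_mono_set (iB c2) (nn c2 B) (Filter.Eventually.of_forall (Set.inter_subset_right (s := A) (t := B)))
          linarith
  have k2 : ∫ x in B, (P x - c1) ^ 2 ≤ 2 * (C2 * S ^ 2) + 2 * ((c1 - c2) ^ 2 * vB) := by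
    calc ∫ x in B, (P x - c1) ^ 2 ≤ ∫ x in B, (2 * (P x - c2) ^ 2 + 2 * (c1 - c2) ^ 2) := by
          refine integral_mono (iB c1) (((iB c2).const_mul 2).add (integrableOn_const hB)) fun x => ?_
          nlinarith [sq_nonneg (P x - c2 + (c1 - c2))]
      _ = 2 * (∫ x in B, (P x - c2) ^ 2) + 2 * ((c1 - c2) ^ 2 * vB) := by
          rw [integral_add ((iB c2).const_mul 2) (integrableOn_const hB), integral_const_mul,
            setIntegral_const, smul_eq_mul, Measure.real]
          ring
      _ ≤ _ := by linarith
  refine ⟨c1, ?_⟩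
  have k3 : ∫ x in A ∪ B, (P x - c1) ^ 2 ≤ (∫ x in A, (P x - c1) ^ 2) + ∫ x in B, (P x - c1) ^ 2 := by
    rw [← Set.union_sdiff_self, setIntegral_union Set.disjoint_sdiff_right (hBm.diff hAm) (iA c1)
      ((iB c1).mono_set Set.sdiff_subset)]
    have : ∫ x in B \ A, (P x - c1) ^ 2 ≤ ∫ x in B, (P x - c1) ^ 2 :=
      setIntegral_mono_set (iB c1) (nn c1 B) (Filter.Eventually.of_forall (Set.sdiff_subset (s := B) (t := A)))
    linarith
  have k4 : (c1 - c2) ^ 2 ≤ (2 * C1 + 2 * C2) / v * S ^ 2 := by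
    rw [div_mul_eq_mul_div, le_div_iff₀ hv]; linarith
  have k5 : (c1 - c2) ^ 2 * vB ≤ (2 * C1 + 2 * C2) / v * S ^ 2 * vB :=
    mul_le_mul_of_nonneg_right k4 ENNReal.toReal_nonneg
  nlinarith

end

theorem Mesh.necasGood {Ω : Set E2} (hΩo : IsOpen Ω) (hΩc : IsConnected Ω) (M : Mesh Ω) :
    NecasGood (interior (closure Ω)) (closure Ω) := by
  set D := interior (closure Ω) with hD
  have hΩD : Ω ⊆ D := interior_maximal subset_closure hΩo
  obtain ⟨t0, ht0⟩ := M.tris_nonempty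
  have hsub : ∀ t ∈ M.tris, t.inn ⊆ D := fun t ht =>
    interior_maximal ((t.inn_subset.trans (Set.subset_biUnion_of_mem (u := Tri.carrier) (by exact ht))).trans
      M.union_eq.le) t.isOpen_inn
  have hpt : ∀ t ∈ M.tris, ∃ x ∈ t.inn, x ∈ Ω := fun t ht => by
    obtain ⟨x, hx⟩ := t.inn_nonempty
    have hx' : x ∈ closure Ω := interior_subset (hsub t ht hx)
    obtain ⟨y, hy⟩ := mem_closure_iff.1 hx' t.inn t.isOpen_inn hx
    exact ⟨y, hy⟩
  set G : Set E2 → Prop := fun A => MeasurableSet A ∧ volume A ≠ ⊤ ∧ t0.inn ⊆ A ∧ NecasGood D A with hG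
  have hGu : ∀ A B, G A → MeasurableSet B → volume B ≠ ⊤ → volume (A ∩ B) ≠ 0 → NecasGood D B →
      G (A ∪ B) := fun A B hA hB hB' hAB hBg =>
    ⟨hA.1.union hB, ((measure_union_le A B).trans_lt
      (ENNReal.add_lt_top.2 ⟨hA.2.1.lt_top, hB'.lt_top⟩)).ne, hA.2.2.1.trans Set.subset_union_left,
      NecasGood.union hA.1 hB hA.2.1 hB' hAB hA.2.2.2 hBg⟩
  have hGt : ∀ A (s : Tri), G A → s.inn ⊆ D → (interior A ∩ s.inn).Nonempty → G (A ∪ s.inn) := by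
    intro A s hA hs hne
    refine hGu A _ hA s.measurableSet_inn s.volume_inn_ne_top ?_ (s.necasGood hs)
    have h1 := ((isOpen_interior.inter s.isOpen_inn).measure_pos volume hne).ne'
    exact fun h => h1 (measure_mono_null (Set.inter_subset_inter_left _ interior_subset) h)
  have hG0 : G t0.inn := ⟨t0.measurableSet_inn, t0.volume_inn_ne_top, subset_rfl,
    t0.necasGood (hsub t0 ht0)⟩
  set U : Set E2 := {x | ∃ A, G A ∧ x ∈ interior A} with hU
  have hUo : IsOpen U := by
    rw [isOpen_iff_mem_nhds]
    rintro x ⟨A, hA, hx⟩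
    filter_upwards [isOpen_interior.mem_nhds hx] with y hy using ⟨A, hA, hy⟩
  have hloc : ∀ x ∈ Ω, ∃ s : Tri, x ∈ s.inn ∧ s.inn ⊆ Ω := fun x hx => exists_small_tri t0 hΩo hx
  have hstep : ∀ s : Tri, s.inn ⊆ Ω → (s.inn ∩ U).Nonempty → s.inn ⊆ U := by
    rintro s hs ⟨y, hy, A, hA, hyA⟩ x hx
    exact ⟨_, hGt A s hA (hs.trans hΩD) ⟨y, hyA, hy⟩,
      interior_maximal Set.subset_union_right s.isOpen_inn hx⟩
  set V : Set E2 := {x | ∃ s : Tri, x ∈ s.inn ∧ s.inn ⊆ Ω ∧ ¬ (s.inn ∩ U).Nonempty} with hV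
  have hVo : IsOpen V := by
    rw [isOpen_iff_mem_nhds]
    rintro x ⟨s, hx, hs⟩
    filter_upwards [s.isOpen_inn.mem_nhds hx] with y hy using ⟨s, hy, hs⟩
  have hΩU : Ω ⊆ U := by
    refine hΩc.isPreconnected.subset_left_of_subset_union hUo hVo ?_ ?_ ?_
    · rw [Set.disjoint_left]
      rintro x hx ⟨s, hxs, -, hn⟩
      exact hn ⟨x, hxs, hx⟩
    · intro x hx
      obtain ⟨s, hxs, hs⟩ := hloc x hx
      by_cases h : (s.inn ∩ U).Nonempty
      · exact Or.inl (hstep s hs h hxs)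
      · exact Or.inr ⟨s, hxs, hs, h⟩
    · obtain ⟨x, hx, hxΩ⟩ := hpt t0 ht0
      exact ⟨x, hxΩ, t0.inn, hG0, by rwa [t0.isOpen_inn.interior_eq]⟩
  have hall : ∀ F : Finset Tri, F ⊆ M.tris → ∃ A, G A ∧ ∀ t ∈ F, t.inn ⊆ A := by
    intro F
    induction F using Finset.induction_on with
    | empty => exact fun _ => ⟨_, hG0, by simp⟩
    | insert t F _ ih =>
      intro hF
      obtain ⟨A, hA, hAF⟩ := ih fun s hs => hF (Finset.mem_insert_of_mem hs)
      have ht := hF (Finset.mem_insert_self t F)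
      obtain ⟨x, hx, hxΩ⟩ := hpt t ht
      obtain ⟨B, hB, hxB⟩ := hΩU hxΩ
      have hB' := hGt B t hB (hsub t ht) ⟨x, hxB, hx⟩
      refine ⟨A ∪ (B ∪ t.inn), hGu A _ hA hB'.1 hB'.2.1 ?_ hB'.2.2.2, ?_⟩
      · exact fun h => t0.volume_inn_ne_zero
          (measure_mono_null (Set.subset_inter hA.2.2.1 hB'.2.2.1) h)
      · intro s hs
        rcases Finset.mem_insert.1 hs with rfl | hs
        · exact (Set.subset_union_right).trans Set.subset_union_right
        · exact (hAF s hs).trans Set.subset_union_left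
  obtain ⟨A, hA, hAF⟩ := hall M.tris subset_rfl
  refine hA.2.2.2.mono hA.2.1 ?_
  rw [← M.union_eq, ae_le_set]
  refine measure_mono_null (t := ⋃ t ∈ M.tris, t.carrier \ t.inn) ?_ ?_
  · rintro x ⟨hx, hxA⟩
    simp only [Set.mem_iUnion] at hx ⊢
    obtain ⟨t, ht, hxt⟩ := hx
    exact ⟨t, ht, hxt, fun h => hxA (hAF t ht h)⟩
  · refine (measure_biUnion_null_iff M.tris.countable_toSet).2 fun t _ => ?_
    exact ae_le_set.1 t.inn_ae_eq.symm.le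

theorem Mesh.necas {Ω : Set E2} (hΩo : IsOpen Ω) (hΩc : IsConnected Ω)
    (hΩb : Bornology.IsBounded Ω) (M : Mesh Ω) :
    ∃ C : ℝ, 0 ≤ C ∧ ∀ (P : E2 → ℝ) (S : ℝ), MemLp P 2 volume → 0 ≤ S →
      NecasHyp (interior (closure Ω)) P S → ∫ x in closure Ω, P x = 0 →
      ∫ x in closure Ω, P x ^ 2 ≤ C * S ^ 2 := by
  obtain ⟨C, hC, h⟩ := M.necasGood hΩo hΩc
  refine ⟨C, hC, fun P S hP hS hN h0 => ?_⟩
  obtain ⟨c, hc⟩ := h P S hP hS hN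
  refine le_trans ?_ hc
  have hv : volume (closure Ω) ≠ ⊤ := hΩb.closure.measure_lt_top.ne
  have : IsFiniteMeasure (volume.restrict (closure Ω)) := ⟨by simpa using hv.lt_top⟩
  have i1 : Integrable P (volume.restrict (closure Ω)) := (hP.restrict _).integrable (by norm_num)
  have i2 := (hP.restrict (closure Ω)).integrable_sq
  have e : (fun x => (P x - c) ^ 2) = fun x => P x ^ 2 - (2 * c * P x - c ^ 2) := by ext x; ring
  have i3 : Integrable (fun x => 2 * c * P x - c ^ 2) (volume.restrict (closure Ω)) :=
    (i1.const_mul _).sub (integrable_const _)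
  rw [e, integral_sub i2 i3, integral_sub (i1.const_mul _) (integrable_const _), integral_const_mul,
    h0, setIntegral_const, smul_eq_mul]
  have : 0 ≤ volume.real (closure Ω) * c ^ 2 := by positivity
  linarith

theorem sum_pairs_ge {p q d L : ℝ} (hL : 0 < L) (hp : 0 < p) (hq : 0 < q) (hd : 0 < d)
    (h1 : L ≤ p + d) (h2 : L ≤ q + d) (h3 : L ≤ p + q) :
    (L / 2) ^ 2 ≤ p * q + p * d + q * d := by
  rcases le_total p (L / 2) with c | c
  · have a1 : L / 2 ≤ d := by linarith
    have a2 : L / 2 ≤ q := by linarith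
    nlinarith [mul_le_mul a1 a2 (by positivity) (by linarith), mul_pos hp hq, mul_pos hp hd]
  · rcases le_total q (L / 2) with c' | c'
    · have a1 : L / 2 ≤ d := by linarith
      nlinarith [mul_le_mul a1 c (by positivity) (by linarith), mul_pos hp hq, mul_pos hq hd]
    · nlinarith [mul_le_mul c c' (by positivity) (by linarith), mul_pos hp hd, mul_pos hq hd]

namespace Mesh
variable {Ω : Set E2} (M : Mesh Ω)

theorem two_circumradius_le {t : Tri} (ht : t ∈ M.tris) :
    2 * t.simplex.circumradius ≤ M.meshSize :=
  Finset.le_sup' (fun t : Tri => 2 * t.simplex.circumradius) ht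

end Mesh

namespace Tri

theorem dist_ccenter (t : Tri) (i : Fin 3) :
    dist (t.vtx i) t.ccenter = t.simplex.circumradius :=
  t.simplex.dist_circumcenter_eq_circumradius i

theorem dist_ccenter_range (t : Tri) {a : E2} (ha : a ∈ Set.range t.vtx) :
    dist a t.ccenter = t.simplex.circumradius := by
  obtain ⟨i, rfl⟩ := ha
  exact t.dist_ccenter i

end Tri

namespace Mesh
variable {Ω : Set E2} (M : Mesh Ω)

theorem dist_vtx_le {t : Tri} (ht : t ∈ M.tris) (i j : Fin 3) :
    dist (t.vtx i) (t.vtx j) ≤ M.meshSize := by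
  refine le_trans ?_ (M.two_circumradius_le ht)
  have := dist_triangle_right (t.vtx i) (t.vtx j) t.ccenter
  rw [t.dist_ccenter, t.dist_ccenter] at this
  linarith

theorem meshSize_pos : 0 < M.meshSize := by
  obtain ⟨t, ht⟩ := M.tris_nonempty
  exact lt_of_lt_of_le (dist_pos.2 (t.vtx_ne (i := 0) (j := 1) (by decide)))
    (M.dist_vtx_le ht 0 1)

theorem le_dist_vtx {Creg : ℝ} (hM : M.Regular Creg) {t : Tri} (ht : t ∈ M.tris) {i j : Fin 3}
    (hij : i ≠ j) : Creg * M.meshSize ≤ dist (t.vtx i) (t.vtx j) := by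
  rcases M.edges_cover t ht i j hij with h | h
  · exact (hM _ h).2
  · rw [dist_comm]; exact (hM _ h).2

theorem creg_le_one {Creg : ℝ} (hM : M.Regular Creg) : Creg ≤ 1 := by
  obtain ⟨t, ht⟩ := M.tris_nonempty
  have h1 := M.le_dist_vtx hM ht (i := 0) (j := 1) (by decide)
  have h2 := M.dist_vtx_le ht 0 1
  have h3 := M.meshSize_pos
  nlinarith

theorem dist_le_of_mem {t : Tri} (ht : t ∈ M.tris) {x y : E2} (hx : x ∈ t.carrier)
    (hy : y ∈ t.carrier) : ‖x - y‖ ≤ M.meshSize := by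
  obtain ⟨a, ⟨i, rfl⟩, b, ⟨j, rfl⟩, h⟩ := convexHull_exists_dist_ge2 hx hy
  rw [← dist_eq_norm]
  exact h.trans (M.dist_vtx_le ht i j)

theorem elen_le_of_hasEdge {t : Tri} (ht : t ∈ M.tris) {σ : E2 × E2} (h : t.hasEdge σ) :
    elen σ ≤ M.meshSize := by
  obtain ⟨_, ⟨i, hi⟩, ⟨j, hj⟩⟩ := h
  rw [elen, ← hi, ← hj]
  exact M.dist_vtx_le ht i j

theorem elen_pos {σ : E2 × E2} (h : σ ∈ M.edges) : 0 < elen σ := dist_pos.2 (M.edges_ne σ h)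

theorem dOf_le {σ : E2 × E2} (h : σ ∈ M.edges) : M.dOf σ ≤ M.meshSize := by
  obtain ⟨hK, hK'⟩ := M.Kof_mem σ h
  have h1 := M.two_circumradius_le hK
  have h0 := (M.Kof σ).simplex.circumradius_nonneg
  unfold dOf
  split_ifs with h2
  · obtain ⟨hL, hL', -⟩ := M.Lof_mem σ h h2
    have h3 := M.two_circumradius_le hL
    have := dist_triangle_left (M.Kof σ).ccenter (M.Lof σ).ccenter σ.1
    rw [(M.Kof σ).dist_ccenter_range hK'.2.1, (M.Lof σ).dist_ccenter_range hL'.2.1] at this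
    linarith
  · have hm : emid σ ∈ Metric.closedBall (M.Kof σ).ccenter (M.Kof σ).simplex.circumradius := by
      apply (convex_closedBall _ _).midpoint_mem
      · exact ((M.Kof σ).dist_ccenter_range hK'.2.1).le
      · exact ((M.Kof σ).dist_ccenter_range hK'.2.2).le
    rw [Metric.mem_closedBall, dist_comm] at hm
    linarith

theorem dOf_pos {Creg : ℝ} (hc : 0 < Creg) (hM : M.Regular Creg) {σ : E2 × E2}
    (h : σ ∈ M.edges) : 0 < M.dOf σ :=
  lt_of_lt_of_le (mul_pos hc (M.elen_pos h)) (hM σ h).1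

theorem tau_le {Creg : ℝ} (hc : 0 < Creg) (hM : M.Regular Creg) {σ : E2 × E2}
    (h : σ ∈ M.edges) : M.tau σ ≤ 1 / Creg := by
  rw [tau, div_le_div_iff₀ (M.dOf_pos hc hM h) hc]
  linarith [(hM σ h).1]

theorem le_tau {Creg : ℝ} (hc : 0 < Creg) (hM : M.Regular Creg) {σ : E2 × E2}
    (h : σ ∈ M.edges) : Creg ≤ M.tau σ := by
  rw [tau, le_div_iff₀ (M.dOf_pos hc hM h)]
  exact (mul_le_mul_of_nonneg_left (M.dOf_le h) hc.le).trans (hM σ h).2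

theorem tau_nonneg (σ : E2 × E2) : 0 ≤ M.tau σ := by
  unfold tau dOf elen
  split_ifs <;> positivity

theorem inner_edges_pos {t : Tri} (ht : t ∈ M.tris) {i j l : Fin 3} (hij : i ≠ j) (hil : i ≠ l)
    (hjl : j ≠ l) : 0 < ⟪t.vtx j - t.vtx i, t.vtx l - t.vtx i⟫ := by
  have h := M.angles_lt t ht i j l hij hil hjl
  rw [EuclideanGeometry.angle] at h
  by_contra hcon
  push Not at hcon
  rw [InnerProductGeometry.angle] at h
  have := Real.arccos_lt_pi_div_two.1 h
  exact absurd this (not_lt.2 (div_nonpos_of_nonpos_of_nonneg hcon (by positivity)))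

theorem le_abs_sdet {Creg : ℝ} (hc : 0 < Creg) (hM : M.Regular Creg) {t : Tri} (ht : t ∈ M.tris) :
    (Creg * M.meshSize) ^ 2 / 2 ≤ |t.sdet| := by
  set l := Creg * M.meshSize
  have hl : 0 < l := mul_pos hc M.meshSize_pos
  set u := t.vtx 1 - t.vtx 0 with hu
  set v := t.vtx 2 - t.vtx 0 with hv
  have hd := M.inner_edges_pos ht (i := 0) (j := 1) (l := 2) (by decide) (by decide) (by decide)
  have hp := M.inner_edges_pos ht (i := 1) (j := 0) (l := 2) (by decide) (by decide) (by decide)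
  have hq := M.inner_edges_pos ht (i := 2) (j := 0) (l := 1) (by decide) (by decide) (by decide)
  have hp' : ⟪t.vtx 0 - t.vtx 1, t.vtx 2 - t.vtx 1⟫ = ‖u‖ ^ 2 - ⟪u, v⟫ := by
    rw [show t.vtx 0 - t.vtx 1 = -u by rw [hu]; abel, show t.vtx 2 - t.vtx 1 = v - u by
      rw [hu, hv]; abel, inner_sub_right, inner_neg_left, inner_neg_left,
      real_inner_self_eq_norm_sq]
    ring
  have hq' : ⟪t.vtx 0 - t.vtx 2, t.vtx 1 - t.vtx 2⟫ = ‖v‖ ^ 2 - ⟪u, v⟫ := by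
    rw [show t.vtx 0 - t.vtx 2 = -v by rw [hv]; abel, show t.vtx 1 - t.vtx 2 = u - v by
      rw [hu, hv]; abel, inner_sub_right, inner_neg_left, inner_neg_left,
      real_inner_self_eq_norm_sq, real_inner_comm u v]
    ring
  rw [hp'] at hp
  rw [hq'] at hq
  have e1 : l ≤ ‖u‖ := by
    rw [hu, ← dist_eq_norm]; exact M.le_dist_vtx hM ht (by decide)
  have e2 : l ≤ ‖v‖ := by
    rw [hv, ← dist_eq_norm]; exact M.le_dist_vtx hM ht (by decide)
  have e3 : l ≤ ‖u - v‖ := by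
    rw [show u - v = t.vtx 1 - t.vtx 2 by rw [hu, hv]; abel, ← dist_eq_norm]
    exact M.le_dist_vtx hM ht (by decide)
  have e3' := norm_sub_sq_real u v
  have f1 : l ^ 2 ≤ ‖u‖ ^ 2 := pow_le_pow_left₀ hl.le e1 2
  have f2 : l ^ 2 ≤ ‖v‖ ^ 2 := pow_le_pow_left₀ hl.le e2 2
  have f3 : l ^ 2 ≤ ‖u - v‖ ^ 2 := pow_le_pow_left₀ hl.le e3 2
  have hs : t.sdet ^ 2 = ‖u‖ ^ 2 * ‖v‖ ^ 2 - ⟪u, v⟫ ^ 2 := cross_sq u v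
  change 0 < ⟪u, v⟫ at hd
  apply abs_le_of_sq_le_sq' _ (abs_nonneg _) |>.2
  rw [sq_abs, hs]
  have key := sum_pairs_ge (p := ‖u‖ ^ 2 - ⟪u, v⟫) (q := ‖v‖ ^ 2 - ⟪u, v⟫) (d := ⟪u, v⟫)
    (L := l ^ 2) (by positivity) hp hq hd (by linarith) (by linarith) (by linarith)
  nlinarith

theorem abs_sdet_le {t : Tri} (ht : t ∈ M.tris) : |t.sdet| ≤ M.meshSize ^ 2 := by
  refine (abs_cross_le _ _).trans ?_
  rw [← dist_eq_norm, ← dist_eq_norm, sq]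
  exact mul_le_mul (M.dist_vtx_le ht _ _) (M.dist_vtx_le ht _ _) dist_nonneg M.meshSize_pos.le

theorem norm_nvec_le {t : Tri} (ht : t ∈ M.tris) (i : Fin 3) : ‖t.nvec i‖ ≤ M.meshSize := by
  have : ‖t.nvec i‖ = dist (t.vtx (i + 2)) (t.vtx (i + 1)) := by
    have h := t.sdet_ne_zero
    rw [Tri.nvec, norm_smul, norm_perp, dist_eq_norm, norm_neg, norm_div, Real.norm_eq_abs,
      Real.norm_eq_abs, abs_abs, div_self (abs_ne_zero.2 h), one_mul]
  rw [this]
  exact M.dist_vtx_le ht _ _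

theorem ball_centroid_subset {Creg : ℝ} (hc : 0 < Creg) (hM : M.Regular Creg) {t : Tri}
    (ht : t ∈ M.tris) :
    Metric.closedBall t.centroid (Creg ^ 2 * M.meshSize / 6) ⊆ t.carrier := by
  intro x hx
  rw [Metric.mem_closedBall, dist_eq_norm] at hx
  rw [Tri.mem_carrier_iff]
  intro i
  have h1 := t.inner_nvec i x t.centroid
  rw [t.lam_centroid] at h1
  have h2 := real_inner_le_norm (t.nvec i) (x - t.centroid)
  have h3 := M.norm_nvec_le ht i
  have h4 := M.le_abs_sdet hc hM ht
  have h0 := M.meshSize_pos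
  have h5 : ‖t.nvec i‖ * ‖x - t.centroid‖ ≤ M.meshSize * (Creg ^ 2 * M.meshSize / 6) :=
    mul_le_mul h3 hx (norm_nonneg _) h0.le
  have h6 : |t.sdet| * (1 / 3 - t.lam i x) ≤ |t.sdet| * (1 / 3) := by
    nlinarith
  have hs : 0 < |t.sdet| := abs_pos.2 t.sdet_ne_zero
  have := le_of_mul_le_mul_left h6 hs
  linarith

end Mesh

namespace Mesh
variable {Ω : Set E2} (M : Mesh Ω)

theorem disjoint_inn {t₁ t₂ : Tri} (h₁ : t₁ ∈ M.tris) (h₂ : t₂ ∈ M.tris) (hne : t₁ ≠ t₂) :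
    Disjoint t₁.inn t₂.inn := by
  rw [Set.disjoint_iff_inter_eq_empty]
  apply Set.eq_empty_of_subset_empty
  rw [← M.interior_disjoint t₁ h₁ t₂ h₂ hne]
  exact Set.inter_subset_inter (interior_maximal t₁.inn_subset t₁.isOpen_inn)
    (interior_maximal t₂.inn_subset t₂.isOpen_inn)

theorem aedisjoint_carrier {t₁ t₂ : Tri} (h₁ : t₁ ∈ M.tris) (h₂ : t₂ ∈ M.tris) (hne : t₁ ≠ t₂) :
    AEDisjoint volume t₁.carrier t₂.carrier :=
  (M.disjoint_inn h₁ h₂ hne).aedisjoint.congr t₁.inn_ae_eq.symm t₂.inn_ae_eq.symm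

theorem setIntegral_closure {F : Type*} [NormedAddCommGroup F] [NormedSpace ℝ F] (g : E2 → F)
    (hg : ∀ t ∈ M.tris, IntegrableOn g t.carrier) :
    ∫ x in closure Ω, g x = ∑ t ∈ M.tris, ∫ x in t.carrier, g x := by
  rw [← M.union_eq]
  have h1 : (⋃ t ∈ (M.tris : Set Tri), t.carrier) =ᵐ[volume] ⋃ t ∈ M.tris, t.inn :=
    Filter.EventuallyEq.countable_bUnion M.tris.countable_toSet fun t _ => t.inn_ae_eq.symm
  rw [setIntegral_congr_set h1, integral_biUnion_finset M.tris (fun t _ => t.measurableSet_inn)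
    (fun t₁ h₁ t₂ h₂ hne => M.disjoint_inn h₁ h₂ hne)
    (fun t ht => (hg t ht).mono_set t.inn_subset)]
  exact Finset.sum_congr rfl fun t _ => setIntegral_congr_set t.inn_ae_eq

theorem card_near_le {Creg : ℝ} (hc : 0 < Creg) (hM : M.Regular Creg) (z : E2) {R : ℝ}
    (hR : 0 ≤ R) :
    ((M.tris.filter fun t => (t.carrier ∩ Metric.closedBall z R).Nonempty).card : ℝ)
      * ((Creg * M.meshSize) ^ 2 / 4) ≤ Real.pi * (R + M.meshSize) ^ 2 := by
  set S := M.tris.filter fun t => (t.carrier ∩ Metric.closedBall z R).Nonempty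
  have h0 := M.meshSize_pos
  have hsub : (⋃ t ∈ S, t.carrier) ⊆ Metric.closedBall z (R + M.meshSize) := by
    intro x hx
    simp only [Set.mem_iUnion] at hx
    obtain ⟨t, ht, hxt⟩ := hx
    obtain ⟨ht, y, hy, hyz⟩ := Finset.mem_filter.1 ht
    have := M.dist_le_of_mem ht hxt hy
    rw [← dist_eq_norm] at this
    rw [Metric.mem_closedBall] at hyz ⊢
    linarith [dist_triangle x y z]
  have hvol : volume (⋃ t ∈ S, t.carrier) = ∑ t ∈ S, volume t.carrier :=
    measure_biUnion_finset₀ (fun t₁ h₁ t₂ h₂ hne => M.aedisjoint_carrier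
      (Finset.mem_filter.1 h₁).1 (Finset.mem_filter.1 h₂).1 hne)
      (fun t _ => t.measurableSet_carrier.nullMeasurableSet)
  have h1 : ∑ t ∈ S, t.area ≤ (volume (Metric.closedBall z (R + M.meshSize))).toReal := by
    unfold Tri.area
    rw [← ENNReal.toReal_sum (fun t _ => t.isCompact_carrier.measure_lt_top.ne), ← hvol]
    exact ENNReal.toReal_mono measure_closedBall_lt_top.ne (measure_mono hsub)
  have h2 : (volume (Metric.closedBall z (R + M.meshSize))).toReal
      = Real.pi * (R + M.meshSize) ^ 2 := by
    rw [EuclideanSpace.volume_closedBall_fin_two]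
    simp only [ENNReal.toReal_mul, ENNReal.toReal_pow]
    rw [ENNReal.toReal_ofReal (by positivity)]
    simp [mul_comm, Real.pi_pos.le]
  have h3 : (S.card : ℝ) * ((Creg * M.meshSize) ^ 2 / 4) ≤ ∑ t ∈ S, t.area := by
    rw [← nsmul_eq_mul]
    apply Finset.card_nsmul_le_sum
    intro t ht
    have := M.le_abs_sdet hc hM (Finset.mem_filter.1 ht).1
    rw [t.abs_sdet] at this
    linarith
  linarith

theorem le_area {Creg : ℝ} (hc : 0 < Creg) (hM : M.Regular Creg) {t : Tri} (ht : t ∈ M.tris) :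
    (Creg * M.meshSize) ^ 2 / 4 ≤ t.area := by
  have := M.le_abs_sdet hc hM ht
  rw [t.abs_sdet] at this
  linarith

theorem area_le {t : Tri} (ht : t ∈ M.tris) : t.area ≤ M.meshSize ^ 2 := by
  have := M.abs_sdet_le ht
  rw [t.abs_sdet] at this
  linarith [t.area_pos]

theorem not_mem_interior_of_ext {σ : E2 × E2} (hσ : σ ∈ M.extEdges) {i : Fin 3}
    (hi : σ = (M.Kof σ).edge i ∨ σ = ((M.Kof σ).edge i).swap) {x : E2}
    (hx0 : (M.Kof σ).lam i x = 0) (hx : ∀ j, j ≠ i → 0 < (M.Kof σ).lam j x) :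
    x ∉ interior (closure Ω) := by
  intro hinteg
  set K := M.Kof σ with hKdef
  obtain ⟨hK, hK'⟩ := M.Kof_ext hσ
  have hs : 0 < |K.sdet| := abs_pos.2 K.sdet_ne_zero
  set C : Set E2 := ⋃ t ∈ M.tris.erase K, t.carrier with hC
  have hCc : IsClosed C := by
    rw [hC]
    exact (M.tris.erase K).finite_toSet.isClosed_biUnion (fun t _ => t.isClosed_carrier)
  have hn : K.nvec i ≠ 0 := by
    intro h
    have := K.inner_nvec i (K.vtx i) (K.vtx (i + 1))
    rw [h, inner_zero_left, K.lam_vtx, K.lam_vtx] at this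
    simp at this
    exact K.sdet_ne_zero this
  have hxC : x ∈ C := by
    apply hCc.mem_of_frequently_of_tendsto (f := fun ε : ℝ => x + ε • K.nvec i)
      (b := nhdsWithin 0 (Set.Ioi 0))
    · apply Filter.Eventually.frequently
      have hcont : Filter.Tendsto (fun ε : ℝ => x + ε • K.nvec i) (nhdsWithin 0 (Set.Ioi 0))
          (nhds x) := by
        have : Continuous (fun ε : ℝ => x + ε • K.nvec i) := by fun_prop
        have h := this.tendsto 0
        simp only [zero_smul, add_zero] at h
        exact h.mono_left nhdsWithin_le_nhds
      filter_upwards [hcont (isOpen_interior.mem_nhds hinteg), self_mem_nhdsWithin] with ε h1 h2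
      have h3 := interior_subset h1
      rw [← M.union_eq] at h3
      simp only [Set.mem_iUnion] at h3
      obtain ⟨t, ht, hxt⟩ := h3
      have htK : t ≠ K := by
        rintro rfl
        have h4 := (Tri.mem_carrier_iff _ _).1 hxt i
        have h5 := K.inner_nvec i (x + ε • K.nvec i) x
        rw [add_sub_cancel_left, inner_smul_right, real_inner_self_eq_norm_sq] at h5
        change 0 < ε at h2
        have h6 : 0 < ε * ‖K.nvec i‖ ^ 2 := by have := norm_pos_iff.2 hn; positivity
        change 0 ≤ K.lam i _ at h4
        rw [hx0] at h5
        nlinarith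
      simp only [hC, Set.mem_iUnion]
      exact ⟨t, Finset.mem_erase.2 ⟨htK, ht⟩, hxt⟩
    · have : Continuous (fun ε : ℝ => x + ε • K.nvec i) := by fun_prop
      have h := this.tendsto 0
      simp only [zero_smul, add_zero] at h
      exact h.mono_left nhdsWithin_le_nhds
  simp only [hC, Set.mem_iUnion] at hxC
  obtain ⟨t, ht, hxt⟩ := hxC
  obtain ⟨htK, ht⟩ := Finset.mem_erase.1 ht
  have hxK : x ∈ K.carrier := by
    rw [Tri.mem_carrier_iff]
    intro j
    by_cases hj : j = i
    · rw [hj, hx0]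
    · exact (hx j hj).le
  rcases M.inter_structure K hK t ht htK.symm with h | ⟨a, ⟨⟨j, rfl⟩, -⟩, h⟩ | ⟨τ, h1, h2, h⟩
  · exact absurd (show x ∈ K.carrier ∩ t.carrier from ⟨hxK, hxt⟩) (by rw [h]; simp)
  · have hxa : x = K.vtx j := by
      have : x ∈ K.carrier ∩ t.carrier := ⟨hxK, hxt⟩
      rwa [h] at this
    obtain ⟨l, hl1, hl2⟩ : ∃ l : Fin 3, l ≠ i ∧ l ≠ j := by
      clear * -
      revert i j; decide
    have := hx l hl1
    rw [hxa, K.lam_vtx] at this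
    simp [hl2.symm] at this
  · have hxs : x ∈ eseg τ := by rw [← h]; exact ⟨hxK, hxt⟩
    obtain ⟨j, hj⟩ := (K.hasEdge_iff τ).1 h1
    have hxs' : x ∈ segment ℝ (K.vtx (j + 1)) (K.vtx (j + 2)) := by
      rcases hj with rfl | rfl
      · exact hxs
      · rw [segment_symm]; exact hxs
    rw [segment_eq_image'] at hxs'
    obtain ⟨s, -, rfl⟩ := hxs'
    have hlj := K.par_mem_edge j s
    have hji : j = i := by
      by_contra hne
      have := hx j hne
      linarith
    subst hji
    have hts : t.hasEdge σ := by
      rcases hi with h | h <;> rcases hj with h' | h' <;> rw [h'] at h2 <;> rw [h]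
      · exact h2
      · exact (t.hasEdge_swap _).1 h2
      · exact (t.hasEdge_swap _).2 h2
      · exact h2
    have := M.filter_ext hσ
    have hmem : t ∈ (M.tris.filter fun t => t.hasEdge σ) := Finset.mem_filter.2 ⟨ht, hts⟩
    rw [this, Finset.mem_singleton] at hmem
    exact htK hmem

theorem eavg_ext_eq_zero {F : Type*} [NormedAddCommGroup F] [NormedSpace ℝ F]
    {σ : E2 × E2} (hσ : σ ∈ M.extEdges) {φ : E2 → F}
    (hφ : tsupport φ ⊆ interior (closure Ω)) : savg φ σ.1 σ.2 = 0 := by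
  obtain ⟨hK, hK'⟩ := M.Kof_ext hσ
  obtain ⟨i, hi⟩ := ((M.Kof σ).hasEdge_iff σ).1 hK'
  have key : ∀ s ∈ Set.Ioo (0 : ℝ) 1, φ (σ.1 + s • (σ.2 - σ.1)) = 0 := by
    intro s hs
    by_contra hne
    have hmem := hφ (subset_tsupport _ hne)
    obtain ⟨s', hs', he⟩ : ∃ s' ∈ Set.Ioo (0 : ℝ) 1, σ.1 + s • (σ.2 - σ.1)
        = (M.Kof σ).vtx (i + 1) + s' • ((M.Kof σ).vtx (i + 2) - (M.Kof σ).vtx (i + 1)) := by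
      rcases hi with h | h
      · exact ⟨s, hs, by rw [show σ.1 = (M.Kof σ).vtx (i + 1) from congrArg Prod.fst h,
          show σ.2 = (M.Kof σ).vtx (i + 2) from congrArg Prod.snd h]⟩
      · refine ⟨1 - s, ⟨by linarith [hs.2], by linarith [hs.1]⟩, ?_⟩
        rw [show σ.1 = (M.Kof σ).vtx (i + 2) from congrArg Prod.fst h,
          show σ.2 = (M.Kof σ).vtx (i + 1) from congrArg Prod.snd h]
        module
    rw [he] at hmem
    refine M.not_mem_interior_of_ext hσ hi ((M.Kof σ).par_mem_edge i s') ?_ hmem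
    intro j hj
    have hcomb : (M.Kof σ).vtx (i + 1) + s' • ((M.Kof σ).vtx (i + 2) - (M.Kof σ).vtx (i + 1))
        = ∑ j, (if j = i then 0 else if j = i + 1 then 1 - s' else s') • (M.Kof σ).vtx j := by
      rw [Fin.sum_univ_three]
      fin_cases i <;> simp <;> module
    rw [hcomb, (M.Kof σ).lam_comb]
    · rw [if_neg hj]
      split_ifs
      · linarith [hs'.2]
      · exact hs'.1
    · rw [Fin.sum_univ_three]
      fin_cases i <;> simp
  unfold savg
  rw [intervalIntegral.integral_of_le zero_le_one, integral_Ioc_eq_integral_Ioo]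
  exact setIntegral_eq_zero_of_forall_eq_zero key

end Mesh

theorem inner_gradA (f : E2 →ᵃ[ℝ] ℝ) (v : E2) : ⟪gradA f, v⟫ = f.linear v := by
  simp [gradA]

theorem affine_eq_gradA (f : E2 →ᵃ[ℝ] ℝ) (x c : E2) : f x = f c + ⟪gradA f, x - c⟫ := by
  rw [inner_gradA, ← vsub_eq_sub x c, AffineMap.linearMap_vsub, vsub_eq_sub]
  ring

theorem continuous_affine (f : E2 →ᵃ[ℝ] ℝ) : Continuous f := f.continuous_of_finiteDimensional

namespace Mesh
variable {Ω : Set E2} (M : Mesh Ω)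

theorem eavg_sub_tavg_sq_le {Creg : ℝ} (hc : 0 < Creg) (hM : M.Regular Creg) {t : Tri}
    (ht : t ∈ M.tris) {a : E2 → ℝ} (ha : ContDiff ℝ 1 a) (i : Fin 3) :
    (t.eavg a i - t.tavg a) ^ 2 ≤ 4 / Creg ^ 2 * ∫ x in t.carrier, gsq a x := by
  have h1 := t.eavg_sub_tavg_le ha i (h := M.meshSize)
    (fun x hx => M.dist_le_of_mem ht hx (t.vtx_mem i))
  have h2 : ∫ x in t.carrier, ‖fderiv ℝ a x‖ ^ 2 ≤ ∫ x in t.carrier, gsq a x := by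
    apply setIntegral_mono_on _ _ t.measurableSet_carrier (fun x _ => norm_fderiv_sq_le a x)
    · have : Continuous fun x => ‖fderiv ℝ a x‖ ^ 2 :=
        (ha.continuous_fderiv (by norm_num)).norm.pow 2
      exact this.continuousOn.integrableOn_compact t.isCompact_carrier
    · exact (continuous_gsq ha).continuousOn.integrableOn_compact t.isCompact_carrier
  have h3 := M.le_area hc hM ht
  rw [Real.norm_eq_abs, sq_abs] at h1
  have h0 := M.meshSize_pos
  have h4 : (Creg * M.meshSize) ^ 2 / 4 * (t.eavg a i - t.tavg a) ^ 2
      ≤ M.meshSize ^ 2 * ∫ x in t.carrier, gsq a x :=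
    (mul_le_mul_of_nonneg_right h3 (sq_nonneg _)).trans
      (h1.trans (mul_le_mul_of_nonneg_left h2 (sq_nonneg _)))
  rw [div_mul_eq_mul_div, le_div_iff₀ (by positivity)]
  have h5 : M.meshSize ^ 2 * ((t.eavg a i - t.tavg a) ^ 2 * Creg ^ 2)
      ≤ M.meshSize ^ 2 * (4 * ∫ x in t.carrier, gsq a x) := by nlinarith
  exact le_of_mul_le_mul_left h5 (by positivity)

theorem savg_edge_swap (a : E2 → ℝ) (t : Tri) (i : Fin 3) :
    savg a (t.edge i).swap.1 (t.edge i).swap.2 = savg a (t.edge i).1 (t.edge i).2 :=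
  savg_swap _ _ _

theorem sum_jump_tavg_le {Creg : ℝ} (hc : 0 < Creg) (hM : M.Regular Creg) {a : E2 → ℝ}
    (ha : ContDiff ℝ 1 a) (hs : tsupport a ⊆ interior (closure Ω)) :
    ∑ σ ∈ M.intEdges, ((M.Lof σ).tavg a - (M.Kof σ).tavg a) ^ 2
      + ∑ σ ∈ M.extEdges, ((M.Kof σ).tavg a) ^ 2
      ≤ 24 / Creg ^ 2 * ∑ t ∈ M.tris, ∫ x in t.carrier, gsq a x := by
  have h := M.sum_tris_edges (fun t σ => 2 * (savg a σ.1 σ.2 - t.tavg a) ^ 2)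
    (fun t _ i => by rw [savg_edge_swap])
  have h1 : ∑ t ∈ M.tris, ∑ i, 2 * (savg a (t.edge i).1 (t.edge i).2 - t.tavg a) ^ 2
      ≤ 24 / Creg ^ 2 * ∑ t ∈ M.tris, ∫ x in t.carrier, gsq a x := by
    rw [Finset.mul_sum]
    apply Finset.sum_le_sum
    intro t ht
    have : ∀ i, 2 * (savg a (t.edge i).1 (t.edge i).2 - t.tavg a) ^ 2
        ≤ 2 * (4 / Creg ^ 2 * ∫ x in t.carrier, gsq a x) := fun i =>
      mul_le_mul_of_nonneg_left (M.eavg_sub_tavg_sq_le hc hM ht ha i) (by norm_num)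
    refine (Finset.sum_le_sum fun i _ => this i).trans (le_of_eq ?_)
    simp
    ring
  refine le_trans ?_ (h.symm.le.trans h1)
  apply add_le_add
  · apply Finset.sum_le_sum
    intro σ _
    nlinarith [sq_nonneg ((savg a σ.1 σ.2 - (M.Kof σ).tavg a) + (savg a σ.1 σ.2 - (M.Lof σ).tavg a))]
  · apply Finset.sum_le_sum
    intro σ hσ
    rw [M.eavg_ext_eq_zero hσ hs]
    nlinarith [sq_nonneg ((M.Kof σ).tavg a)]

theorem normh_sq (v : Tri → E2) : M.normh v ^ 2 =
    ∑ σ ∈ M.intEdges, M.tau σ * ‖v (M.Lof σ) - v (M.Kof σ)‖ ^ 2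
    + ∑ σ ∈ M.extEdges, M.tau σ * ‖v (M.Kof σ)‖ ^ 2 := by
  refine Real.sq_sqrt (add_nonneg (Finset.sum_nonneg fun σ _ => ?_)
    (Finset.sum_nonneg fun σ _ => ?_)) <;>
  exact mul_nonneg (M.tau_nonneg σ) (sq_nonneg _)

theorem normh_nonneg (v : Tri → E2) : 0 ≤ M.normh v := Real.sqrt_nonneg _

theorem int_sub {σ : E2 × E2} (h : σ ∈ M.intEdges) : σ ∈ M.edges := (M.mem_int.1 h).1
theorem ext_sub {σ : E2 × E2} (h : σ ∈ M.extEdges) : σ ∈ M.edges := (M.mem_ext.1 h).1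

theorem normh_sq_le {Creg : ℝ} (hc : 0 < Creg) (hM : M.Regular Creg) (v : Tri → E2) :
    M.normh v ^ 2 ≤ 1 / Creg * (∑ σ ∈ M.intEdges, ‖v (M.Lof σ) - v (M.Kof σ)‖ ^ 2
      + ∑ σ ∈ M.extEdges, ‖v (M.Kof σ)‖ ^ 2) := by
  rw [normh_sq, mul_add, Finset.mul_sum, Finset.mul_sum]
  apply add_le_add <;> apply Finset.sum_le_sum <;> intro σ hσ
  · exact mul_le_mul_of_nonneg_right (M.tau_le hc hM (M.int_sub hσ)) (sq_nonneg _)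
  · exact mul_le_mul_of_nonneg_right (M.tau_le hc hM (M.ext_sub hσ)) (sq_nonneg _)

theorem le_normh_sq {Creg : ℝ} (hc : 0 < Creg) (hM : M.Regular Creg) (v : Tri → E2) :
    Creg * (∑ σ ∈ M.intEdges, ‖v (M.Lof σ) - v (M.Kof σ)‖ ^ 2
      + ∑ σ ∈ M.extEdges, ‖v (M.Kof σ)‖ ^ 2) ≤ M.normh v ^ 2 := by
  rw [normh_sq, mul_add, Finset.mul_sum, Finset.mul_sum]
  apply add_le_add <;> apply Finset.sum_le_sum <;> intro σ hσ
  · exact mul_le_mul_of_nonneg_right (M.le_tau hc hM (M.int_sub hσ)) (sq_nonneg _)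
  · exact mul_le_mul_of_nonneg_right (M.le_tau hc hM (M.ext_sub hσ)) (sq_nonneg _)

theorem l2P0_self (v : Tri → E2) : M.l2P0 v v = ∑ t ∈ M.tris, t.area * ‖v t‖ ^ 2 := by
  simp [l2P0]

theorem l2P0_self_nonneg (v : Tri → E2) : 0 ≤ M.l2P0 v v := by
  rw [l2P0_self]
  exact Finset.sum_nonneg fun t _ => mul_nonneg t.area_pos.le (sq_nonneg _)

theorem l2normP0_sq (v : Tri → E2) : M.l2normP0 v ^ 2 = ∑ t ∈ M.tris, t.area * ‖v t‖ ^ 2 := by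
  rw [l2normP0, Real.sq_sqrt (M.l2P0_self_nonneg v), l2P0_self]

theorem l2normP0_nonneg (v : Tri → E2) : 0 ≤ M.l2normP0 v := Real.sqrt_nonneg _

theorem inverse_estimate {Creg : ℝ} (hc : 0 < Creg) (hM : M.Regular Creg) (v : Tri → E2) :
    (M.meshSize * M.normh v) ^ 2 ≤ 24 / Creg ^ 3 * M.l2normP0 v ^ 2 := by
  have h0 := M.meshSize_pos
  have h1 := M.normh_sq_le hc hM v
  have h := M.sum_tris_edges (fun t σ => 2 * ‖v t‖ ^ 2) (fun t _ i => rfl)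
  have h2 : ∑ σ ∈ M.intEdges, ‖v (M.Lof σ) - v (M.Kof σ)‖ ^ 2
      + ∑ σ ∈ M.extEdges, ‖v (M.Kof σ)‖ ^ 2 ≤ ∑ t ∈ M.tris, ∑ i : Fin 3, 2 * ‖v t‖ ^ 2 := by
    rw [h]
    apply add_le_add <;> apply Finset.sum_le_sum <;> intro σ _
    · have e1 := norm_sub_sq_real (v (M.Lof σ)) (v (M.Kof σ))
      have e2 := norm_add_sq_real (v (M.Lof σ)) (v (M.Kof σ))
      nlinarith [sq_nonneg ‖v (M.Lof σ) + v (M.Kof σ)‖]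
    · nlinarith [sq_nonneg ‖v (M.Kof σ)‖]
  have h3 : M.meshSize ^ 2 * ∑ t ∈ M.tris, ∑ i : Fin 3, 2 * ‖v t‖ ^ 2
      ≤ 24 / Creg ^ 2 * M.l2normP0 v ^ 2 := by
    rw [l2normP0_sq, Finset.mul_sum, Finset.mul_sum]
    apply Finset.sum_le_sum
    intro t ht
    have h4 := M.le_area hc hM ht
    rw [div_mul_eq_mul_div, le_div_iff₀ (by positivity)]
    simp only [Finset.sum_const, Finset.card_univ, Fintype.card_fin, nsmul_eq_mul]
    push_cast
    nlinarith [sq_nonneg ‖v t‖, mul_le_mul_of_nonneg_right h4 (sq_nonneg ‖v t‖)]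
  rw [mul_pow]
  calc M.meshSize ^ 2 * M.normh v ^ 2
      ≤ M.meshSize ^ 2 * (1 / Creg * ∑ t ∈ M.tris, ∑ i : Fin 3, 2 * ‖v t‖ ^ 2) := by
        apply mul_le_mul_of_nonneg_left _ (sq_nonneg _)
        exact h1.trans (mul_le_mul_of_nonneg_left h2 (by positivity))
    _ = 1 / Creg * (M.meshSize ^ 2 * ∑ t ∈ M.tris, ∑ i : Fin 3, 2 * ‖v t‖ ^ 2) := by ring
    _ ≤ 1 / Creg * (24 / Creg ^ 2 * M.l2normP0 v ^ 2) :=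
        mul_le_mul_of_nonneg_left h3 (by positivity)
    _ = _ := by field_simp

/-- Discrete integration by parts on one triangle, up to a consistency error. -/
theorem consistency_le {Creg : ℝ} (hc : 0 < Creg) (hM : M.Regular Creg) {t : Tri}
    (ht : t ∈ M.tris) {a : E2 → ℝ} (ha : ContDiff ℝ 1 a) (p : E2 →ᵃ[ℝ] ℝ) (j : Fin 2) :
    |(∫ x in t.carrier, p x * pd j a x) - (∑ i, ⟪t.nvec i, ee j⟫ * p (t.mid i) * t.eavg a i)
      + t.tavg a * (t.area * ⟪gradA p, ee j⟫)|
      ≤ (1 + 12 / Creg ^ 2) * (M.meshSize * (√(t.area) * ‖gradA p‖) *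
          √(∫ x in t.carrier, gsq a x)) := by
  have h0 := M.meshSize_pos
  have hA := t.area_pos
  set c := t.centroid
  have hcm : c ∈ t.carrier := by
    rw [Tri.mem_carrier_iff]; intro i; rw [t.lam_centroid]; norm_num
  set g := gradA p
  set G := ∫ x in t.carrier, gsq a x with hG
  have hG0 : 0 ≤ G := integral_nonneg fun x => gsq_nonneg a x
  have hpc : Continuous (pd j a) := continuous_pd ha j
  have hmul : ∀ f : E2 → ℝ, Continuous f → IntegrableOn f t.carrier := fun f hf =>
    hf.continuousOn.integrableOn_compact t.isCompact_carrier
  have e1 : ∫ x in t.carrier, p x * pd j a x = p c * (∑ i, ⟪t.nvec i, ee j⟫ * t.eavg a i)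
      + ∫ x in t.carrier, ⟪g, x - c⟫ * pd j a x := by
    have := t.integral_fderiv ha (ee j)
    simp only [smul_eq_mul] at this
    rw [← this, ← integral_const_mul, ← integral_add]
    · congr 1; ext x; rw [affine_eq_gradA p x c, pd]; ring
    · exact hmul _ (continuous_const.mul hpc)
    · exact hmul _ ((continuous_const.inner (continuous_id.sub continuous_const)).mul hpc)
  have e2 : ∑ i, ⟪t.nvec i, ee j⟫ = 0 := by
    rw [← sum_inner, t.sum_nvec, inner_zero_left]
  have e3 := t.sum_nvec_mid g (ee j) c
  have e4 : (∫ x in t.carrier, p x * pd j a x)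
      - (∑ i, ⟪t.nvec i, ee j⟫ * p (t.mid i) * t.eavg a i) + t.tavg a * (t.area * ⟪g, ee j⟫)
      = (∫ x in t.carrier, ⟪g, x - c⟫ * pd j a x)
        - ∑ i, ⟪t.nvec i, ee j⟫ * ⟪g, t.mid i - c⟫ * (t.eavg a i - t.tavg a) := by
    rw [e1, ← e3]
    have : ∀ i, ⟪t.nvec i, ee j⟫ * p (t.mid i) * t.eavg a i
        = ⟪t.nvec i, ee j⟫ * (p c + ⟪g, t.mid i - c⟫) * t.eavg a i := fun i => by
      rw [affine_eq_gradA p (t.mid i) c]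
    simp only [this, Fin.sum_univ_three] at e2 ⊢
    ring
  rw [e4]
  have f1 : |∫ x in t.carrier, ⟪g, x - c⟫ * pd j a x|
      ≤ M.meshSize * (√(t.area) * ‖g‖) * √G := by
    have b1 : |∫ x in t.carrier, ⟪g, x - c⟫ * pd j a x|
        ≤ ∫ x in t.carrier, ‖g‖ * M.meshSize * |pd j a x| := by
      refine (abs_integral_le_integral_abs).trans ?_
      apply setIntegral_mono_on _ _ t.measurableSet_carrier
      · intro x hx
        rw [abs_mul]
        refine mul_le_mul_of_nonneg_right ?_ (abs_nonneg _)
        exact (abs_real_inner_le_norm _ _).trans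
          (mul_le_mul_of_nonneg_left (M.dist_le_of_mem ht hx hcm) (norm_nonneg _))
      · exact hmul _
          ((continuous_const.inner (continuous_id.sub continuous_const)).mul hpc).abs
      · exact hmul _ (continuous_const.mul hpc.abs)
    rw [integral_const_mul] at b1
    have b2 := t.norm_integral_sq_le hpc.abs
    have b3 : ∫ x in t.carrier, |pd j a x| ^ 2 ≤ G := by
      apply setIntegral_mono_on (hmul _ (hpc.abs.pow 2)) (hmul _ (continuous_gsq ha))
        t.measurableSet_carrier
      intro x _
      change |pd j a x| ^ 2 ≤ _
      rw [sq_abs, gsq]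
      fin_cases j
      · simp only [Fin.zero_eta]; nlinarith [sq_nonneg (pd 1 a x)]
      · simp only [Fin.mk_one]; nlinarith [sq_nonneg (pd 0 a x)]
    have b4 : ∫ x in t.carrier, |pd j a x| ≤ √(t.area) * √G := by
      rw [← Real.sqrt_mul hA.le]
      apply Real.le_sqrt_of_sq_le
      exact b2.trans (mul_le_mul_of_nonneg_left b3 hA.le)
    calc _ ≤ _ := b1
      _ ≤ ‖g‖ * M.meshSize * (√(t.area) * √G) := mul_le_mul_of_nonneg_left b4 (by positivity)
      _ = _ := by ring
  have f2 : ∀ i, |⟪t.nvec i, ee j⟫ * ⟪g, t.mid i - c⟫ * (t.eavg a i - t.tavg a)|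
      ≤ 4 / Creg ^ 2 * (M.meshSize * (√(t.area) * ‖g‖) * √G) := by
    intro i
    have d1 : |⟪t.nvec i, ee j⟫| ≤ M.meshSize := by
      refine (abs_real_inner_le_norm _ _).trans ?_
      rw [norm_ee, mul_one]
      exact M.norm_nvec_le ht i
    have d2 : |⟪g, t.mid i - c⟫| ≤ ‖g‖ * M.meshSize := by
      refine (abs_real_inner_le_norm _ _).trans
        (mul_le_mul_of_nonneg_left (M.dist_le_of_mem ht ?_ hcm) (norm_nonneg _))
      exact (convex_convexHull ℝ _).midpoint_mem (t.vtx_mem _) (t.vtx_mem _)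
    have d3 : |t.eavg a i - t.tavg a| ≤ 2 / Creg * √G := by
      have := M.eavg_sub_tavg_sq_le hc hM ht ha i
      rw [← Real.sqrt_sq_eq_abs]
      refine (Real.sqrt_le_sqrt this).trans (le_of_eq ?_)
      rw [Real.sqrt_mul (by positivity), show (4 : ℝ) / Creg ^ 2 = (2 / Creg) ^ 2 by ring,
        Real.sqrt_sq (by positivity)]
    have d4 : M.meshSize ≤ 2 / Creg * √(t.area) := by
      have := Real.sqrt_le_sqrt (M.le_area hc hM ht)
      rw [show (Creg * M.meshSize) ^ 2 / 4 = (Creg * M.meshSize / 2) ^ 2 by ring,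
        Real.sqrt_sq (by positivity)] at this
      rw [div_mul_eq_mul_div, le_div_iff₀ hc]
      linarith
    rw [abs_mul, abs_mul]
    calc _ ≤ M.meshSize * (‖g‖ * M.meshSize) * (2 / Creg * √G) := by gcongr
      _ = (2 / Creg * ‖g‖ * √G * M.meshSize) * M.meshSize := by ring
      _ ≤ (2 / Creg * ‖g‖ * √G * M.meshSize) * (2 / Creg * √(t.area)) := by gcongr
      _ = _ := by field_simp; ring
  refine (abs_sub _ _).trans ?_
  have f3 := (Finset.abs_sum_le_sum_abs (fun i => ⟪t.nvec i, ee j⟫ * ⟪g, t.mid i - c⟫ *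
    (t.eavg a i - t.tavg a)) Finset.univ).trans (Finset.sum_le_sum fun i _ => f2 i)
  simp only [Finset.sum_const, Finset.card_univ, Fintype.card_fin, nsmul_eq_mul] at f3
  push_cast at f3
  calc _ ≤ _ := add_le_add f1 f3
    _ = _ := by ring

theorem sum_edge_terms_eq_zero {a : E2 → ℝ} (hs : tsupport a ⊆ interior (closure Ω))
    {p : Tri → (E2 →ᵃ[ℝ] ℝ)} (hp : M.IsP1nc p) (j : Fin 2) :
    ∑ t ∈ M.tris, ∑ i, ⟪t.nvec i, ee j⟫ * p t (t.mid i) * t.eavg a i = 0 := by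
  have h := M.sum_tris_edges (fun t σ => elen σ * ⟪t.nrm σ, ee j⟫ * p t (emid σ) *
    savg a σ.1 σ.2) (fun t _ i => by
      rw [savg_edge_swap, t.nrm_edge_swap, Tri.emid_swap, Tri.elen_swap])
  have h1 : ∀ t ∈ M.tris, ∀ i, elen (t.edge i) * ⟪t.nrm (t.edge i), ee j⟫ * p t (emid (t.edge i)) *
      savg a (t.edge i).1 (t.edge i).2 = ⟪t.nvec i, ee j⟫ * p t (t.mid i) * t.eavg a i := by
    intro t _ i
    rw [← t.elen_smul_nrm_edge, inner_smul_left]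
    rfl
  rw [Finset.sum_congr rfl fun t ht => Finset.sum_congr rfl fun i _ => (h1 t ht i).symm, h,
    Finset.sum_eq_zero, Finset.sum_eq_zero, add_zero]
  · intro σ hσ
    rw [M.eavg_ext_eq_zero hσ hs, mul_zero]
  · intro σ hσ
    rw [M.nrm_Lof hσ, hp σ hσ, inner_neg_left]
    ring

end Mesh

namespace Mesh
variable {Ω : Set E2} (M : Mesh Ω)

/-- A piecewise function on the triangulation, as a function on the plane. -/
def glue (f : Tri → E2 → ℝ) (x : E2) : ℝ := ∑ t ∈ M.tris, t.inn.indicator (f t) x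

theorem glue_of_mem {t : Tri} (ht : t ∈ M.tris) {x : E2} (hx : x ∈ t.inn) (f : Tri → E2 → ℝ) :
    M.glue f x = f t x := by
  rw [glue, Finset.sum_eq_single t]
  · exact Set.indicator_of_mem hx _
  · intro s hs hne
    exact Set.indicator_of_notMem
      (fun h => Set.disjoint_left.1 (M.disjoint_inn hs ht hne) h hx) _
  · exact fun h => absurd ht h

theorem memLp_glue {f : Tri → E2 → ℝ} (hf : ∀ t ∈ M.tris, Continuous (f t)) (p : ENNReal) :
    MemLp (M.glue f) p volume := by
  unfold glue
  apply memLp_finsetSum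
  intro t ht
  rw [memLp_indicator_iff_restrict t.measurableSet_inn]
  obtain ⟨C, hC⟩ := t.isCompact_carrier.exists_bound_of_continuousOn (hf t ht).continuousOn
  have : IsFiniteMeasure (volume.restrict t.inn) :=
    ⟨by rw [Measure.restrict_apply_univ]; exact t.volume_inn_ne_top.lt_top⟩
  exact MemLp.of_bound (hf t ht).aestronglyMeasurable C
    ((ae_restrict_mem t.measurableSet_inn).mono fun x hx => hC x (t.inn_subset hx))

theorem setIntegral_carrier_glue {t : Tri} (ht : t ∈ M.tris) (f : Tri → E2 → ℝ)
    (G : E2 → ℝ → ℝ) :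
    ∫ x in t.carrier, G x (M.glue f x) = ∫ x in t.carrier, G x (f t x) := by
  rw [setIntegral_congr_set t.inn_ae_eq.symm, setIntegral_congr_set t.inn_ae_eq.symm]
  apply setIntegral_congr_fun t.measurableSet_inn
  intro x hx
  simp only [M.glue_of_mem ht hx]

theorem glue_eq_zero {x : E2} (hx : x ∉ closure Ω) (f : Tri → E2 → ℝ) : M.glue f x = 0 := by
  apply Finset.sum_eq_zero
  intro t ht
  apply Set.indicator_of_notMem
  intro h
  apply hx
  rw [← M.union_eq]
  simp only [Set.mem_iUnion]
  exact ⟨t, ht, t.inn_subset h⟩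

theorem integral_mul_glue {f : Tri → E2 → ℝ} (hf : ∀ t ∈ M.tris, Continuous (f t))
    {g : E2 → ℝ} (hg : Continuous g) :
    ∫ x, M.glue f x * g x = ∑ t ∈ M.tris, ∫ x in t.carrier, f t x * g x := by
  rw [← setIntegral_eq_integral_of_forall_compl_eq_zero (s := closure Ω)
    (fun x hx => by rw [M.glue_eq_zero hx, zero_mul]), M.setIntegral_closure]
  · exact Finset.sum_congr rfl fun t ht =>
      M.setIntegral_carrier_glue ht f (fun x y => y * g x)
  · intro t ht
    have h1 : IntegrableOn (fun x => f t x * g x) t.inn :=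
      (((hf t ht).mul hg).continuousOn.integrableOn_compact t.isCompact_carrier).mono_set
        t.inn_subset
    have h2 : IntegrableOn (fun x => M.glue f x * g x) t.inn :=
      h1.congr_fun (fun x hx => by simp only [M.glue_of_mem ht hx]) t.measurableSet_inn
    exact h2.congr_set_ae t.inn_ae_eq.symm

theorem sum_setIntegral_le {g : E2 → ℝ} (hg : Continuous g) (hc : HasCompactSupport g)
    (h0 : ∀ x, 0 ≤ g x) : ∑ t ∈ M.tris, ∫ x in t.carrier, g x ≤ ∫ x, g x := by
  rw [← M.setIntegral_closure g
    (fun t _ => hg.continuousOn.integrableOn_compact t.isCompact_carrier)]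
  exact setIntegral_le_integral (hg.integrable_of_hasCompactSupport hc)
    (Filter.Eventually.of_forall h0)

theorem sum_mul_sqrt_le (s : Finset Tri) (A G : Tri → ℝ) (hG : ∀ t, 0 ≤ G t) :
    ∑ t ∈ s, A t * √(G t) ≤ √(∑ t ∈ s, A t ^ 2) * √(∑ t ∈ s, G t) := by
  refine (Real.sum_mul_le_sqrt_mul_sqrt s A (fun t => √(G t))).trans (le_of_eq ?_)
  simp only [Real.sq_sqrt (hG _)]

theorem gsq_hasCompactSupport {a : E2 → ℝ} (h : HasCompactSupport a) :
    HasCompactSupport (gsq a) := by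
  have h0 := pd_hasCompactSupport h 0
  have h1 := pd_hasCompactSupport h 1
  have : HasCompactSupport (fun x => pd 0 a x * pd 0 a x + pd 1 a x * pd 1 a x) :=
    (h0.mul_left (f := pd 0 a)).add (h1.mul_left (f := pd 1 a))
  rwa [show gsq a = fun x => pd 0 a x * pd 0 a x + pd 1 a x * pd 1 a x from
    funext fun x => by rw [gsq, sq, sq]]

theorem div_estimate {Creg : ℝ} (hc : 0 < Creg) (hM : M.Regular Creg)
    {p : Tri → (E2 →ᵃ[ℝ] ℝ)} (hp : M.IsP1nc p) {a : E2 → ℝ}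
    (ha : IsTest (interior (closure Ω)) a) (j : Fin 2) :
    |(∫ x, M.glue (fun t => p t) x * pd j a x)
      + ∑ t ∈ M.tris, t.tavg a * (t.area * ⟪gradA (p t), ee j⟫)|
      ≤ (1 + 12 / Creg ^ 2) * (M.meshSize * M.l2normP0 (gradh p) * √(∫ x, gsq a x)) := by
  have ha1 : ContDiff ℝ 1 a := ha.smooth.of_le (by norm_num)
  have h0 := M.meshSize_pos
  rw [M.integral_mul_glue (fun t _ => continuous_affine (p t)) (continuous_pd ha1 j)]
  have hz := M.sum_edge_terms_eq_zero ha.sub hp j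
  have e : (∑ t ∈ M.tris, ∫ x in t.carrier, p t x * pd j a x)
      + ∑ t ∈ M.tris, t.tavg a * (t.area * ⟪gradA (p t), ee j⟫)
      = ∑ t ∈ M.tris, ((∫ x in t.carrier, p t x * pd j a x)
        - (∑ i, ⟪t.nvec i, ee j⟫ * p t (t.mid i) * t.eavg a i)
        + t.tavg a * (t.area * ⟪gradA (p t), ee j⟫)) := by
    rw [Finset.sum_add_distrib, Finset.sum_sub_distrib, hz, sub_zero]
  rw [e]
  refine (Finset.abs_sum_le_sum_abs _ _).trans
    ((Finset.sum_le_sum fun t ht => M.consistency_le hc hM ht ha1 (p t) j).trans ?_)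
  rw [← Finset.mul_sum]
  apply mul_le_mul_of_nonneg_left _ (by positivity)
  have hG : ∀ t : Tri, 0 ≤ ∫ x in t.carrier, gsq a x := fun t =>
    integral_nonneg fun x => gsq_nonneg a x
  have h1 := sum_mul_sqrt_le M.tris (fun t => M.meshSize * (√(t.area) * ‖gradA (p t)‖))
    (fun t => ∫ x in t.carrier, gsq a x) hG
  refine h1.trans (mul_le_mul (le_of_eq ?_) (Real.sqrt_le_sqrt ?_) (Real.sqrt_nonneg _)
    (mul_nonneg h0.le (M.l2normP0_nonneg _)))
  · rw [Real.sqrt_eq_iff_mul_self_eq (Finset.sum_nonneg fun t _ => sq_nonneg _)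
      (mul_nonneg h0.le (M.l2normP0_nonneg _)), ← sq, mul_pow, l2normP0_sq, Finset.mul_sum]
    refine Finset.sum_congr rfl fun t _ => ?_
    rw [mul_pow, mul_pow, Real.sq_sqrt t.area_pos.le]
    rfl
  · exact M.sum_setIntegral_le (continuous_gsq ha1) (gsq_hasCompactSupport ha.compact)
      (gsq_nonneg a)

theorem normh_tavg_le {Creg : ℝ} (hc : 0 < Creg) (hM : M.Regular Creg) {a b : E2 → ℝ}
    (ha : IsTest (interior (closure Ω)) a) (hb : IsTest (interior (closure Ω)) b) :
    M.normh (fun t => !₂[t.tavg a, t.tavg b]) ^ 2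
      ≤ 24 / Creg ^ 3 * ((∫ x, gsq a x) + ∫ x, gsq b x) := by
  have ha1 : ContDiff ℝ 1 a := ha.smooth.of_le (by norm_num)
  have hb1 : ContDiff ℝ 1 b := hb.smooth.of_le (by norm_num)
  refine (M.normh_sq_le hc hM _).trans ?_
  have h1 := M.sum_jump_tavg_le hc hM ha1 ha.sub
  have h2 := M.sum_jump_tavg_le hc hM hb1 hb.sub
  have h3 := M.sum_setIntegral_le (continuous_gsq ha1) (gsq_hasCompactSupport ha.compact)
    (gsq_nonneg a)
  have h4 := M.sum_setIntegral_le (continuous_gsq hb1) (gsq_hasCompactSupport hb.compact)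
    (gsq_nonneg b)
  have e1 : ∀ σ, ‖!₂[(M.Lof σ).tavg a, (M.Lof σ).tavg b] - !₂[(M.Kof σ).tavg a, (M.Kof σ).tavg b]‖ ^ 2
      = ((M.Lof σ).tavg a - (M.Kof σ).tavg a) ^ 2 + ((M.Lof σ).tavg b - (M.Kof σ).tavg b) ^ 2 := by
    intro σ; rw [norm_sq_coord]; simp
  have e2 : ∀ σ, ‖!₂[(M.Kof σ).tavg a, (M.Kof σ).tavg b]‖ ^ 2
      = ((M.Kof σ).tavg a) ^ 2 + ((M.Kof σ).tavg b) ^ 2 := by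
    intro σ; rw [norm_sq_coord]; simp
  simp only [e1, e2, Finset.sum_add_distrib]
  have h5 : 24 / Creg ^ 2 * (∑ t ∈ M.tris, ∫ x in t.carrier, gsq a x)
      ≤ 24 / Creg ^ 2 * ∫ x, gsq a x := mul_le_mul_of_nonneg_left h3 (by positivity)
  have h6 : 24 / Creg ^ 2 * (∑ t ∈ M.tris, ∫ x in t.carrier, gsq b x)
      ≤ 24 / Creg ^ 2 * ∫ x, gsq b x := mul_le_mul_of_nonneg_left h4 (by positivity)
  calc _ ≤ 1 / Creg * (24 / Creg ^ 2 * ((∫ x, gsq a x) + ∫ x, gsq b x)) := by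
        apply mul_le_mul_of_nonneg_left _ (by positivity)
        linarith
    _ = _ := by field_simp

/-- The discrete inf-sup condition: the pressure is controlled by its discrete gradient,
measured in the dual of the discrete `H¹` norm. -/
theorem infsup (hΩo : IsOpen Ω) (hΩc : IsConnected Ω) (hΩb : Bornology.IsBounded Ω) {Creg : ℝ}
    (hc : 0 < Creg) (M₀ : Mesh Ω) : ∃ C ≥ 0, ∀ M : Mesh Ω, M.Regular Creg →
      ∀ p, M.IsP1nc p → M.MeanZero p → ∀ R ≥ 0,
      (∀ v, |M.l2P0 (gradh p) v| ≤ R * M.normh v) → M.l2normP1 p ^ 2 ≤ C * R ^ 2 := by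
  obtain ⟨C, hC, H⟩ := M₀.necas hΩo hΩc hΩb
  set c := √(24 / Creg ^ 3) with hcdef
  set B := (1 + 12 / Creg ^ 2) with hB
  refine ⟨C * (2 * B * c + c) ^ 2, by positivity, ?_⟩
  intro M hM p hp hp0 R hR hv
  have h0 := M.meshSize_pos
  have hg : M.meshSize * M.l2normP0 (gradh p) ≤ c * R := by
    have h1 := hv (gradh p)
    have h2 := M.inverse_estimate hc hM (gradh p)
    have h3 : M.meshSize * M.normh (gradh p) ≤ c * M.l2normP0 (gradh p) := by
      have h4 := Real.sqrt_le_sqrt h2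
      rwa [Real.sqrt_sq (mul_nonneg h0.le (M.normh_nonneg _)), Real.sqrt_mul (by positivity),
        Real.sqrt_sq (M.l2normP0_nonneg _)] at h4
    have h5 : M.l2P0 (gradh p) (gradh p) = M.l2normP0 (gradh p) ^ 2 := by
      rw [l2normP0_sq, l2P0_self]
    rw [h5, abs_of_nonneg (sq_nonneg _)] at h1
    rcases (M.l2normP0_nonneg (gradh p)).eq_or_lt with hz | hz
    · rw [← hz, mul_zero]; positivity
    · have : M.l2normP0 (gradh p) * (M.meshSize * M.l2normP0 (gradh p))
          ≤ M.l2normP0 (gradh p) * (c * R) := by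
        nlinarith [mul_le_mul_of_nonneg_left h3 hR, mul_le_mul_of_nonneg_left h1 h0.le]
      exact le_of_mul_le_mul_left this hz
  have hnec : NecasHyp (interior (closure Ω)) (M.glue fun t => p t) ((2 * B * c + c) * R) := by
    intro a b ha hb
    have ha1 : ContDiff ℝ 1 a := ha.smooth.of_le (by norm_num)
    have hb1 : ContDiff ℝ 1 b := hb.smooth.of_le (by norm_num)
    have hia := (continuous_gsq ha1).integrable_of_hasCompactSupport (μ := volume)
      (gsq_hasCompactSupport ha.compact)
    have hib := (continuous_gsq hb1).integrable_of_hasCompactSupport (μ := volume)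
      (gsq_hasCompactSupport hb.compact)
    have hP : LocallyIntegrable (M.glue fun t => p t) volume :=
      (M.memLp_glue (fun t _ => continuous_affine (p t)) 1).locallyIntegrable le_rfl
    have hinteg : ∀ (a : E2 → ℝ) (j : Fin 2), IsTest (interior (closure Ω)) a →
        Integrable (fun x => M.glue (fun t => p t) x * pd j a x) := by
      intro a j ha
      have ha1 : ContDiff ℝ 1 a := ha.smooth.of_le (by norm_num)
      have := hP.integrable_smul_right_of_hasCompactSupport (continuous_pd ha1 j)
        (pd_hasCompactSupport ha.compact j)
      simpa only [smul_eq_mul] using this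
    have hga0 : 0 ≤ ∫ x, gsq a x := integral_nonneg fun x => gsq_nonneg a x
    have hgb0 : 0 ≤ ∫ x, gsq b x := integral_nonneg fun x => gsq_nonneg b x
    have d1 := M.div_estimate hc hM hp ha 0
    have d2 := M.div_estimate hc hM hp hb 1
    have d3 := M.normh_tavg_le hc hM ha hb
    have d4 := hv (fun t => !₂[t.tavg a, t.tavg b])
    have e1 : M.l2P0 (gradh p) (fun t => !₂[t.tavg a, t.tavg b])
        = (∑ t ∈ M.tris, t.tavg a * (t.area * ⟪gradA (p t), ee 0⟫))
          + ∑ t ∈ M.tris, t.tavg b * (t.area * ⟪gradA (p t), ee 1⟫) := by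
      rw [l2P0, ← Finset.sum_add_distrib]
      refine Finset.sum_congr rfl fun t _ => ?_
      rw [inner_coord, inner_coord, inner_coord]
      simp [gradh, ee]
      ring
    rw [e1] at d4
    rw [show (fun x => M.glue (fun t => p t) x * (pd 0 a x + pd 1 b x))
      = fun x => M.glue (fun t => p t) x * pd 0 a x + M.glue (fun t => p t) x * pd 1 b x by
        ext x; ring, integral_add (hinteg a 0 ha) (hinteg b 1 hb), integral_add hia hib]
    set s := √((∫ x, gsq a x) + ∫ x, gsq b x) with hs
    have s1 : √(∫ x, gsq a x) ≤ s := Real.sqrt_le_sqrt (by linarith)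
    have s2 : √(∫ x, gsq b x) ≤ s := Real.sqrt_le_sqrt (by linarith)
    have s3 : M.normh (fun t => !₂[t.tavg a, t.tavg b]) ≤ c * s := by
      rw [hs, hcdef, ← Real.sqrt_mul (by positivity)]
      exact Real.le_sqrt_of_sq_le d3
    have hgn := mul_nonneg h0.le (M.l2normP0_nonneg (gradh p))
    have t1 : M.meshSize * M.l2normP0 (gradh p) * √(∫ x, gsq a x) ≤ c * R * s := by gcongr
    have t2 : M.meshSize * M.l2normP0 (gradh p) * √(∫ x, gsq b x) ≤ c * R * s := by gcongr
    have t1' := mul_le_mul_of_nonneg_left t1 (show 0 ≤ B by positivity)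
    have t2' := mul_le_mul_of_nonneg_left t2 (show 0 ≤ B by positivity)
    have t3 := mul_le_mul_of_nonneg_left s3 hR
    have u1 := abs_le.1 (d1.trans t1')
    have u2 := abs_le.1 (d2.trans t2')
    have u3 := abs_le.1 (d4.trans t3)
    rw [abs_le]
    constructor <;> nlinarith [u1.1, u1.2, u2.1, u2.2, u3.1, u3.2]
  have hfin := H (M.glue fun t => p t) ((2 * B * c + c) * R)
    (M.memLp_glue (fun t _ => continuous_affine (p t)) 2) (by positivity) hnec ?_
  · have e : ∫ x in closure Ω, M.glue (fun t => p t) x ^ 2 = M.l2normP1 p ^ 2 := by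
      rw [M.setIntegral_closure, l2normP1, Real.sq_sqrt]
      · refine Finset.sum_congr rfl fun t ht => ?_
        rw [M.setIntegral_carrier_glue ht _ (fun _ y => y ^ 2)]
        simp only [sq]
      · exact Finset.sum_nonneg fun t _ => integral_nonneg fun x => mul_self_nonneg _
      · intro t ht
        exact ((M.memLp_glue (fun t _ => continuous_affine (p t)) 2).integrable_sq).integrableOn
    rw [← e]
    refine hfin.trans (le_of_eq ?_)
    ring
  · rw [M.setIntegral_closure]
    · rw [← hp0]
      exact Finset.sum_congr rfl fun t ht => M.setIntegral_carrier_glue ht _ (fun _ y => y)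
    · intro t ht
      exact (memLp_one_iff_integrable.1
        (M.memLp_glue (fun t _ => continuous_affine (p t)) 1)).integrableOn

end Mesh

namespace Mesh
variable {Ω : Set E2} (M : Mesh Ω)

theorem l2P0_comm (v w : Tri → E2) : M.l2P0 v w = M.l2P0 w v :=
  Finset.sum_congr rfl fun t _ => by rw [real_inner_comm]

theorem l2P0_add_left (u v w : Tri → E2) :
    M.l2P0 (fun t => u t + v t) w = M.l2P0 u w + M.l2P0 v w := by
  simp only [l2P0, inner_add_left, mul_add, Finset.sum_add_distrib]

theorem l2P0_sub_left (u v w : Tri → E2) :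
    M.l2P0 (fun t => u t - v t) w = M.l2P0 u w - M.l2P0 v w := by
  simp only [l2P0, inner_sub_left, mul_sub, Finset.sum_sub_distrib]

theorem l2P0_smul_left (c : ℝ) (v w : Tri → E2) :
    M.l2P0 (fun t => c • v t) w = c * M.l2P0 v w := by
  simp only [l2P0, real_inner_smul_left, Finset.mul_sum]
  exact Finset.sum_congr rfl fun t _ => by ring

theorem l2P0_congr_left {u v : Tri → E2} (h : ∀ t ∈ M.tris, u t = v t) (w : Tri → E2) :
    M.l2P0 u w = M.l2P0 v w :=
  Finset.sum_congr rfl fun t ht => by rw [h t ht]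

theorem l2normP0_sq' (v : Tri → E2) : M.l2normP0 v ^ 2 = M.l2P0 v v :=
  Real.sq_sqrt (M.l2P0_self_nonneg v)

theorem abs_l2P0_le (v w : Tri → E2) : |M.l2P0 v w| ≤ M.l2normP0 v * M.l2normP0 w := by
  have h1 : |M.l2P0 v w| ≤ ∑ t ∈ M.tris, (√(t.area) * ‖v t‖) * (√(t.area) * ‖w t‖) := by
    refine (Finset.abs_sum_le_sum_abs _ _).trans (Finset.sum_le_sum fun t _ => ?_)
    rw [abs_mul, abs_of_pos t.area_pos]
    calc t.area * |⟪v t, w t⟫| ≤ t.area * (‖v t‖ * ‖w t‖) :=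
          mul_le_mul_of_nonneg_left (abs_real_inner_le_norm _ _) t.area_pos.le
      _ = (√(t.area) * √(t.area)) * (‖v t‖ * ‖w t‖) := by rw [Real.mul_self_sqrt t.area_pos.le]
      _ = _ := by ring
  refine h1.trans ((Real.sum_mul_le_sqrt_mul_sqrt _ _ _).trans (le_of_eq ?_))
  simp only [l2normP0, l2P0_self, mul_pow, Real.sq_sqrt (Tri.area_pos _).le]

theorem l2normP0_add_le (v w : Tri → E2) :
    M.l2normP0 (fun t => v t + w t) ≤ M.l2normP0 v + M.l2normP0 w := by
  apply abs_le_of_sq_le_sq' _ (add_nonneg (M.l2normP0_nonneg _) (M.l2normP0_nonneg _)) |>.2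
  rw [l2normP0_sq', l2P0_add_left, M.l2P0_comm v, M.l2P0_comm w, l2P0_add_left, l2P0_add_left,
    M.l2P0_comm w v, add_sq, l2normP0_sq', l2normP0_sq']
  linarith [(abs_le.1 (M.abs_l2P0_le v w)).2]

theorem l2normP0_smul (c : ℝ) (v : Tri → E2) :
    M.l2normP0 (fun t => c • v t) = |c| * M.l2normP0 v := by
  rw [l2normP0, l2P0_smul_left, M.l2P0_comm v, l2P0_smul_left, ← mul_assoc,
    Real.sqrt_mul (mul_self_nonneg c), Real.sqrt_mul_self_eq_abs]
  rfl

theorem l2normP0_sub_le (v w : Tri → E2) :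
    M.l2normP0 (fun t => v t - w t) ≤ M.l2normP0 v + M.l2normP0 w := by
  have h := M.l2normP0_add_le v (fun t => (-1 : ℝ) • w t)
  rw [l2normP0_smul, abs_neg, abs_one, one_mul] at h
  simpa only [neg_smul, one_smul, ← sub_eq_add_neg] using h

theorem l2normP0_congr {u v : Tri → E2} (h : ∀ t ∈ M.tris, u t = v t) :
    M.l2normP0 u = M.l2normP0 v := by
  unfold l2normP0 l2P0
  congr 1
  exact Finset.sum_congr rfl fun t ht => by rw [h t ht]

/-- The bilinear form of the discrete Laplacian. -/
def ah (v z : Tri → E2) : ℝ :=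
  ∑ σ ∈ M.intEdges, M.tau σ * ⟪v (M.Lof σ) - v (M.Kof σ), z (M.Lof σ) - z (M.Kof σ)⟫
    + ∑ σ ∈ M.extEdges, M.tau σ * ⟪v (M.Kof σ), z (M.Kof σ)⟫

theorem l2P0_laph (v z : Tri → E2) : M.l2P0 (M.laph v) z = -M.ah v z := by
  have h1 : ∀ t : Tri, t.area * ⟪M.laph v t, z t⟫
      = (∑ σ ∈ M.intEdges.filter fun σ => t.hasEdge σ, M.tau σ * ⟪v (M.other t σ) - v t, z t⟫)
      - ∑ σ ∈ M.extEdges.filter fun σ => t.hasEdge σ, M.tau σ * ⟪v t, z t⟫ := by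
    intro t
    rw [laph, real_inner_smul_left, ← mul_assoc, mul_inv_cancel₀ t.area_pos.ne', one_mul,
      inner_sub_left, sum_inner, sum_inner]
    simp only [real_inner_smul_left]
  rw [l2P0, Finset.sum_congr rfl fun t _ => h1 t, Finset.sum_sub_distrib,
    M.sum_tris_int (fun t σ => M.tau σ * ⟪v (M.other t σ) - v t, z t⟫),
    M.sum_tris_ext (fun t σ => M.tau σ * ⟪v t, z t⟫), ah, neg_add, sub_eq_add_neg]
  congr 1
  rw [← Finset.sum_neg_distrib]
  refine Finset.sum_congr rfl fun σ hσ => ?_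
  rw [M.other_Kof, M.other_Lof hσ]
  simp only [inner_sub_left, inner_sub_right]
  ring

theorem ah_self (v : Tri → E2) : M.ah v v = M.normh v ^ 2 := by
  rw [normh_sq, ah]
  simp only [real_inner_self_eq_norm_sq]

theorem abs_ah_le (v z : Tri → E2) : |M.ah v z| ≤ M.normh v * M.normh z := by
  have key : ∀ s : ℝ, 0 ≤ M.normh v ^ 2 * s ^ 2 + 2 * M.ah v z * s + M.normh z ^ 2 := by
    intro s
    have h := M.ah_self (fun t => s • v t + z t)
    have h2 : M.ah (fun t => s • v t + z t) (fun t => s • v t + z t)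
        = s ^ 2 * M.ah v v + 2 * s * M.ah v z + M.ah z z := by
      simp only [ah, mul_add, Finset.mul_sum]
      rw [show ∀ a b c d e f : ℝ, a + b + (c + d) + (e + f) = (a + c + e) + (b + d + f) by
        intros; ring, ← Finset.sum_add_distrib, ← Finset.sum_add_distrib,
        ← Finset.sum_add_distrib, ← Finset.sum_add_distrib]
      congr 1 <;> refine Finset.sum_congr rfl fun σ _ => ?_
      · rw [show s • v (M.Lof σ) + z (M.Lof σ) - (s • v (M.Kof σ) + z (M.Kof σ))
          = s • (v (M.Lof σ) - v (M.Kof σ)) + (z (M.Lof σ) - z (M.Kof σ)) by module]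
        generalize v (M.Lof σ) - v (M.Kof σ) = x
        generalize z (M.Lof σ) - z (M.Kof σ) = y
        rw [inner_add_left, inner_add_right, inner_add_right, real_inner_smul_left,
          real_inner_smul_left, real_inner_smul_right, real_inner_smul_right, real_inner_comm x y]
        ring
      · rw [inner_add_left, inner_add_right, inner_add_right, real_inner_smul_left,
          real_inner_smul_left, real_inner_smul_right, real_inner_smul_right,
          real_inner_comm (v (M.Kof σ)) (z (M.Kof σ))]
        ring
    rw [h2, ah_self, ah_self] at h
    nlinarith [sq_nonneg (M.normh fun t => s • v t + z t)]
  have hd := discrim_le_zero (fun s => by have := key s; nlinarith :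
    ∀ s : ℝ, 0 ≤ M.normh v ^ 2 * (s * s) + (2 * M.ah v z) * s + M.normh z ^ 2)
  rw [discrim] at hd
  apply abs_le_of_sq_le_sq _ (mul_nonneg (M.normh_nonneg v) (M.normh_nonneg z))
  nlinarith

/-- Discrete Poincaré inequality. -/
theorem poincare {Creg ρ : ℝ} (hc : 0 < Creg) (hM : M.Regular Creg)
    (hρ0 : 0 < ρ) (hρ : ∀ t ∈ M.tris, ∀ x ∈ t.carrier, ‖x‖ ≤ ρ) (v : Tri → E2) :
    M.l2normP0 v ^ 2 ≤ 24 * ρ ^ 2 / Creg ^ 3 * M.normh v ^ 2 := by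
  have h0 := M.meshSize_pos
  set α := 12 * ρ ^ 2 / Creg ^ 2 with hα
  have hα0 : 0 < α := by positivity
  have hmid : ∀ t ∈ M.tris, ∀ σ, t.hasEdge σ → |⟪ee 0, emid σ⟫| ≤ ρ := by
    intro t ht σ hσ
    refine (abs_real_inner_le_norm _ _).trans ?_
    rw [norm_ee, one_mul]
    apply hρ t ht
    obtain ⟨_, ⟨i, hi⟩, ⟨j, hj⟩⟩ := hσ
    rw [emid, ← hi, ← hj]
    exact (convex_convexHull ℝ _).midpoint_mem (t.vtx_mem _) (t.vtx_mem _)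
  have hnrm : ∀ t ∈ M.tris, ∀ σ, t.hasEdge σ → |elen σ * ⟪t.nrm σ, ee 0⟫| ≤ M.meshSize := by
    intro t ht σ hσ
    obtain ⟨i, hi⟩ := (t.hasEdge_iff σ).1 hσ
    have : elen σ • t.nrm σ = t.nvec i := by
      rcases hi with rfl | rfl
      · exact t.elen_smul_nrm_edge i
      · rw [t.nrm_edge_swap, Tri.elen_swap]; exact t.elen_smul_nrm_edge i
    rw [← real_inner_smul_left, this]
    refine (abs_real_inner_le_norm _ _).trans ?_
    rw [norm_ee, mul_one]
    exact M.norm_nvec_le ht i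
  have h := M.sum_tris_edges (fun t σ => elen σ * ⟪t.nrm σ, ee 0⟫ * ⟪ee 0, emid σ⟫ * ‖v t‖ ^ 2)
    (fun t _ i => by rw [t.nrm_edge_swap, Tri.emid_swap, Tri.elen_swap])
  have h1 : ∑ t ∈ M.tris, ∑ i, elen (t.edge i) * ⟪t.nrm (t.edge i), ee 0⟫ *
      ⟪ee 0, emid (t.edge i)⟫ * ‖v t‖ ^ 2 = M.l2normP0 v ^ 2 := by
    rw [l2normP0_sq]
    refine Finset.sum_congr rfl fun t _ => ?_
    rw [← Finset.sum_mul]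
    congr 1
    have := t.sum_nvec_mid (ee 0) (ee 0) 0
    rw [real_inner_self_eq_norm_sq, norm_ee] at this
    rw [show t.area = t.area * 1 ^ 2 by ring, ← this]
    refine Finset.sum_congr rfl fun i _ => ?_
    rw [← t.elen_smul_nrm_edge, real_inner_smul_left, sub_zero]
    rfl
  rw [h1] at h
  have hb := M.sum_tris_edges (fun t σ => (ρ * M.meshSize) ^ 2 / (2 * α) * ‖v t‖ ^ 2)
    (fun t _ i => rfl)
  have h2 : M.l2normP0 v ^ 2 ≤ α * (∑ σ ∈ M.intEdges, ‖v (M.Lof σ) - v (M.Kof σ)‖ ^ 2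
      + ∑ σ ∈ M.extEdges, ‖v (M.Kof σ)‖ ^ 2)
      + ∑ t ∈ M.tris, ∑ i : Fin 3, (ρ * M.meshSize) ^ 2 / (2 * α) * ‖v t‖ ^ 2 := by
    rw [hb, h, mul_add, Finset.mul_sum, Finset.mul_sum]
    rw [show ∀ a b c d : ℝ, a + b + (c + d) = (a + c) + (b + d) by intros; ring,
      ← Finset.sum_add_distrib, ← Finset.sum_add_distrib]
    have aux : ∀ J S B : ℝ, 0 ≤ J → 0 ≤ S → 0 ≤ B →
        B * (J * S) ≤ α * J ^ 2 + B ^ 2 / (4 * α) * S ^ 2 := by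
      intro J S B _ _ _
      have e : α * J ^ 2 + B ^ 2 / (4 * α) * S ^ 2 - B * (J * S)
          = (2 * α * J - B * S) ^ 2 / (4 * α) := by
        clear_value α
        field_simp
        ring
      have : 0 ≤ (2 * α * J - B * S) ^ 2 / (4 * α) := by positivity
      linarith
    apply add_le_add <;> apply Finset.sum_le_sum <;> intro σ hσ
    · obtain ⟨hK, hK'⟩ := M.Kof_int hσ
      rw [M.nrm_Lof hσ, inner_neg_left]
      set A := v (M.Kof σ)
      set B := v (M.Lof σ)
      have a1 := hnrm _ hK σ hK'
      have a2 := hmid _ hK σ hK'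
      have a3 : |elen σ * ⟪(M.Kof σ).nrm σ, ee 0⟫ * ⟪ee 0, emid σ⟫| ≤ ρ * M.meshSize := by
        rw [abs_mul, mul_comm ρ]
        exact mul_le_mul a1 a2 (abs_nonneg _) h0.le
      have a4 : |‖A‖ ^ 2 - ‖B‖ ^ 2| ≤ ‖B - A‖ * (‖A‖ + ‖B‖) := by
        rw [sq_sub_sq, abs_mul, mul_comm, abs_of_nonneg (add_nonneg (norm_nonneg A) (norm_nonneg B)),
          norm_sub_rev]
        exact mul_le_mul_of_nonneg_right (abs_norm_sub_norm_le A B) (by positivity)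
      calc _ = elen σ * ⟪(M.Kof σ).nrm σ, ee 0⟫ * ⟪ee 0, emid σ⟫ * (‖A‖ ^ 2 - ‖B‖ ^ 2) := by ring
        _ ≤ |elen σ * ⟪(M.Kof σ).nrm σ, ee 0⟫ * ⟪ee 0, emid σ⟫| * |‖A‖ ^ 2 - ‖B‖ ^ 2| := by
            rw [← abs_mul]; exact le_abs_self _
        _ ≤ (ρ * M.meshSize) * (‖B - A‖ * (‖A‖ + ‖B‖)) := by gcongr
        _ ≤ _ := aux _ _ _ (norm_nonneg _) (by positivity) (by positivity)
        _ ≤ α * ‖B - A‖ ^ 2 + (ρ * M.meshSize) ^ 2 / (4 * α) * (2 * ‖A‖ ^ 2 + 2 * ‖B‖ ^ 2) := by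
            gcongr
            nlinarith [sq_nonneg (‖A‖ - ‖B‖)]
        _ = _ := by field_simp; ring
    · obtain ⟨hK, hK'⟩ := M.Kof_ext hσ
      set A := v (M.Kof σ)
      have a1 := hnrm _ hK σ hK'
      have a2 := hmid _ hK σ hK'
      have a3 : |elen σ * ⟪(M.Kof σ).nrm σ, ee 0⟫ * ⟪ee 0, emid σ⟫| ≤ ρ * M.meshSize := by
        rw [abs_mul, mul_comm ρ]
        exact mul_le_mul a1 a2 (abs_nonneg _) h0.le
      calc _ ≤ (ρ * M.meshSize) * (‖A‖ * ‖A‖) := by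
            rw [← sq]
            exact mul_le_mul_of_nonneg_right ((le_abs_self _).trans a3) (sq_nonneg _)
        _ ≤ _ := aux _ _ _ (norm_nonneg _) (norm_nonneg _) (by positivity)
        _ ≤ _ := by
            gcongr
            norm_num
  have h3 : ∑ t ∈ M.tris, ∑ i : Fin 3, (ρ * M.meshSize) ^ 2 / (2 * α) * ‖v t‖ ^ 2
      ≤ 1 / 2 * M.l2normP0 v ^ 2 := by
    rw [l2normP0_sq, Finset.mul_sum]
    apply Finset.sum_le_sum
    intro t ht
    have h4 := M.le_area hc hM ht
    simp only [Finset.sum_const, Finset.card_univ, Fintype.card_fin, nsmul_eq_mul]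
    push_cast
    have : (3 : ℝ) * ((ρ * M.meshSize) ^ 2 / (2 * α) * ‖v t‖ ^ 2)
        = 1 / 2 * ((Creg * M.meshSize) ^ 2 / 4 * ‖v t‖ ^ 2) := by
      rw [hα]; field_simp; ring
    rw [this]
    gcongr
  have h5 := M.le_normh_sq hc hM v
  have h6 : M.l2normP0 v ^ 2 ≤ 2 * α * (∑ σ ∈ M.intEdges, ‖v (M.Lof σ) - v (M.Kof σ)‖ ^ 2
      + ∑ σ ∈ M.extEdges, ‖v (M.Kof σ)‖ ^ 2) := by linarith
  refine h6.trans ?_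
  calc _ = 24 * ρ ^ 2 / Creg ^ 3 * (Creg * (∑ σ ∈ M.intEdges, ‖v (M.Lof σ) - v (M.Kof σ)‖ ^ 2
      + ∑ σ ∈ M.extEdges, ‖v (M.Kof σ)‖ ^ 2)) := by rw [hα]; field_simp; ring
    _ ≤ _ := mul_le_mul_of_nonneg_left h5 (by positivity)

end Mesh

namespace Mesh
variable {Ω : Set E2} (M : Mesh Ω)

/-- The flux of a piecewise constant field through an edge. -/
def flux (w : Tri → E2) (σ : E2 × E2) : ℝ := elen σ * ⟪w (M.Kof σ), (M.Kof σ).nrm σ⟫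

/-- The centered convection form. -/
def ch (w v z : Tri → E2) : ℝ :=
  ∑ σ ∈ M.intEdges, M.flux w σ / 2 *
    ⟪v (M.Kof σ) + v (M.Lof σ), z (M.Kof σ) - z (M.Lof σ)⟫

/-- The numerical viscosity added by the upwind scheme. -/
def uh (w v z : Tri → E2) : ℝ :=
  ∑ σ ∈ M.intEdges, |M.flux w σ| / 2 *
    ⟪v (M.Kof σ) - v (M.Lof σ), z (M.Kof σ) - z (M.Lof σ)⟫

theorem l2P0_btilde {w : Tri → E2} (hw : M.IsRT0const w) (v z : Tri → E2) :
    M.l2P0 (M.btilde (fun s => AffineMap.const ℝ E2 (w s)) v) z = M.ch w v z + M.uh w v z := by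
  have h1 : ∀ t : Tri, t.area * ⟪M.btilde (fun s => AffineMap.const ℝ E2 (w s)) v t, z t⟫
      = ∑ σ ∈ M.intEdges.filter fun σ => t.hasEdge σ, elen σ *
        (max ⟪w t, t.nrm σ⟫ 0 * ⟪v t, z t⟫ + min ⟪w t, t.nrm σ⟫ 0 * ⟪v (M.other t σ), z t⟫) := by
    intro t
    rw [btilde, real_inner_smul_left, ← mul_assoc, mul_inv_cancel₀ t.area_pos.ne', one_mul,
      sum_inner]
    simp only [real_inner_smul_left, inner_add_left, unrm, AffineMap.const_apply]
  rw [l2P0, Finset.sum_congr rfl fun t _ => h1 t,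
    M.sum_tris_int (fun t σ => elen σ *
        (max ⟪w t, t.nrm σ⟫ 0 * ⟪v t, z t⟫ + min ⟪w t, t.nrm σ⟫ 0 * ⟪v (M.other t σ), z t⟫)),
    ch, uh, ← Finset.sum_add_distrib]
  refine Finset.sum_congr rfl fun σ hσ => ?_
  have h2 := hw.1 σ hσ
  rw [inner_sub_left, sub_eq_zero] at h2
  have hl : 0 ≤ elen σ := dist_nonneg
  rw [M.other_Kof, M.other_Lof hσ, M.nrm_Lof hσ, inner_neg_right, h2, flux, abs_mul,
    abs_of_nonneg hl]
  generalize ⟪w (M.Kof σ), (M.Kof σ).nrm σ⟫ = a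
  simp only [inner_sub_left, inner_sub_right, inner_add_left]
  rcases le_total 0 a with h | h
  · rw [max_eq_left h, min_eq_right h, max_eq_right (by linarith), min_eq_left (by linarith),
      abs_of_nonneg h]
    ring
  · rw [max_eq_right h, min_eq_left h, max_eq_left (by linarith), min_eq_right (by linarith),
      abs_of_nonpos h]
    ring

theorem sum_flux {w : Tri → E2} (hw : M.IsRT0const w) (c : Tri → ℝ) :
    ∑ σ ∈ M.intEdges, M.flux w σ * (c (M.Kof σ) - c (M.Lof σ)) = 0 := by
  have h := M.sum_tris_edges (fun t σ => elen σ * ⟪w t, t.nrm σ⟫ * c t)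
    (fun t _ i => by rw [t.nrm_edge_swap, Tri.elen_swap])
  have h1 : ∑ t ∈ M.tris, ∑ i, elen (t.edge i) * ⟪w t, t.nrm (t.edge i)⟫ * c t = 0 := by
    refine Finset.sum_eq_zero fun t _ => ?_
    rw [← Finset.sum_mul]
    simp only [← real_inner_smul_right, t.elen_smul_nrm_edge]
    rw [← inner_sum, t.sum_nvec, inner_zero_right, zero_mul]
  have h2 : ∑ σ ∈ M.extEdges, elen σ * ⟪w (M.Kof σ), (M.Kof σ).nrm σ⟫ * c (M.Kof σ) = 0 :=
    Finset.sum_eq_zero fun σ hσ => by rw [hw.2 σ hσ]; ring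
  rw [h1, h2, add_zero] at h
  rw [h]
  refine Finset.sum_congr rfl fun σ hσ => ?_
  have h3 := hw.1 σ hσ
  rw [inner_sub_left, sub_eq_zero] at h3
  rw [M.nrm_Lof hσ, inner_neg_right, h3, flux]
  ring

theorem l2P0_btilde_self_nonneg {w : Tri → E2} (hw : M.IsRT0const w) (v : Tri → E2) :
    0 ≤ M.l2P0 (M.btilde (fun s => AffineMap.const ℝ E2 (w s)) v) v := by
  have h := M.sum_flux hw (fun t => ‖v t‖ ^ 2 / 2)
  have h1 : M.ch w v v = 0 := by
    rw [← h, ch]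
    refine Finset.sum_congr rfl fun σ _ => ?_
    simp only [inner_sub_right, inner_add_left, real_inner_self_eq_norm_sq]
    rw [real_inner_comm (v (M.Kof σ)) (v (M.Lof σ))]
    ring
  rw [M.l2P0_btilde hw, h1, zero_add]
  refine Finset.sum_nonneg fun σ _ => ?_
  rw [real_inner_self_eq_norm_sq]
  positivity

theorem meshSize_mul_norm_le {Creg : ℝ} (hc : 0 < Creg) (hM : M.Regular Creg) (w : Tri → E2)
    {t : Tri} (ht : t ∈ M.tris) : M.meshSize * ‖w t‖ ≤ 2 / Creg * M.l2normP0 w := by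
  have h1 : t.area * ‖w t‖ ^ 2 ≤ M.l2normP0 w ^ 2 := by
    rw [l2normP0_sq]
    exact Finset.single_le_sum (f := fun t : Tri => t.area * ‖w t‖ ^ 2)
      (fun t _ => mul_nonneg t.area_pos.le (sq_nonneg _)) ht
  have h2 := M.le_area hc hM ht
  have h3 : (M.meshSize * ‖w t‖) ^ 2 ≤ (2 / Creg * M.l2normP0 w) ^ 2 := by
    calc (M.meshSize * ‖w t‖) ^ 2
        = 4 / Creg ^ 2 * ((Creg * M.meshSize) ^ 2 / 4 * ‖w t‖ ^ 2) := by field_simp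
      _ ≤ 4 / Creg ^ 2 * (t.area * ‖w t‖ ^ 2) := by gcongr
      _ ≤ 4 / Creg ^ 2 * M.l2normP0 w ^ 2 := by gcongr
      _ = _ := by ring
  exact (abs_le_of_sq_le_sq' h3 (mul_nonneg (by positivity) (M.l2normP0_nonneg w))).2

theorem norm_nrm_le (t : Tri) (σ : E2 × E2) : ‖t.nrm σ‖ ≤ 1 := by
  have h : ‖(elen σ)⁻¹ • perp (σ.2 - σ.1)‖ ≤ 1 := by
    rw [norm_smul, norm_perp, Real.norm_eq_abs, abs_inv, elen, abs_of_nonneg dist_nonneg,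
      dist_comm, dist_eq_norm]
    exact inv_mul_le_one
  unfold Tri.nrm
  split_ifs
  · exact h
  · rwa [norm_neg]

theorem abs_flux_le {Creg : ℝ} (hc : 0 < Creg) (hM : M.Regular Creg) (w : Tri → E2)
    {σ : E2 × E2} (hσ : σ ∈ M.edges) : |M.flux w σ| ≤ 2 / Creg * M.l2normP0 w := by
  obtain ⟨h1, h2⟩ := M.Kof_mem σ hσ
  refine le_trans ?_ (M.meshSize_mul_norm_le hc hM w h1)
  rw [flux, abs_mul, elen, abs_of_nonneg dist_nonneg]
  refine mul_le_mul (M.elen_le_of_hasEdge h1 h2) ?_ (abs_nonneg _) M.meshSize_pos.le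
  refine (abs_real_inner_le_norm _ _).trans ?_
  exact mul_le_of_le_one_right (norm_nonneg _) (norm_nrm_le _ _)

theorem sum_jump_mul_le {Creg : ℝ} (hc : 0 < Creg) (hM : M.Regular Creg) (v z : Tri → E2) :
    ∑ σ ∈ M.intEdges, ‖v (M.Kof σ) - v (M.Lof σ)‖ * ‖z (M.Kof σ) - z (M.Lof σ)‖
      ≤ 1 / Creg * (M.normh v * M.normh z) := by
  have key : ∀ v : Tri → E2, √(∑ σ ∈ M.intEdges, ‖v (M.Kof σ) - v (M.Lof σ)‖ ^ 2)
      ≤ √(1 / Creg) * M.normh v := by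
    intro v
    have h1 : ∑ σ ∈ M.intEdges, ‖v (M.Kof σ) - v (M.Lof σ)‖ ^ 2 ≤ 1 / Creg * M.normh v ^ 2 := by
      have h := M.le_normh_sq hc hM v
      have h2 : 0 ≤ ∑ σ ∈ M.extEdges, ‖v (M.Kof σ)‖ ^ 2 := Finset.sum_nonneg fun _ _ => sq_nonneg _
      simp only [norm_sub_rev (v (M.Kof _))]
      rw [one_div, ← div_eq_inv_mul, le_div_iff₀ hc]
      nlinarith
    calc _ ≤ √(1 / Creg * M.normh v ^ 2) := Real.sqrt_le_sqrt h1
      _ = _ := by rw [Real.sqrt_mul (by positivity), Real.sqrt_sq (M.normh_nonneg v)]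
  refine (Real.sum_mul_le_sqrt_mul_sqrt _ _ _).trans ?_
  calc _ ≤ (√(1 / Creg) * M.normh v) * (√(1 / Creg) * M.normh z) :=
        mul_le_mul (key v) (key z) (Real.sqrt_nonneg _)
          (mul_nonneg (Real.sqrt_nonneg _) (M.normh_nonneg v))
    _ = (√(1 / Creg) * √(1 / Creg)) * (M.normh v * M.normh z) := by ring
    _ = _ := by rw [Real.mul_self_sqrt (by positivity)]

theorem abs_uh_le {Creg : ℝ} (hc : 0 < Creg) (hM : M.Regular Creg) (w v z : Tri → E2) :
    |M.uh w v z| ≤ 1 / Creg ^ 2 * M.l2normP0 w * (M.normh v * M.normh z) := by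
  calc |M.uh w v z| ≤ ∑ σ ∈ M.intEdges, 1 / Creg * M.l2normP0 w *
        (‖v (M.Kof σ) - v (M.Lof σ)‖ * ‖z (M.Kof σ) - z (M.Lof σ)‖) := by
        refine (Finset.abs_sum_le_sum_abs _ _).trans (Finset.sum_le_sum fun σ hσ => ?_)
        rw [abs_mul, abs_of_nonneg (by positivity : 0 ≤ |M.flux w σ| / 2)]
        have := M.abs_flux_le hc hM w (M.int_sub hσ)
        refine mul_le_mul ?_ (abs_real_inner_le_norm _ _) (abs_nonneg _)
          (mul_nonneg (by positivity) (M.l2normP0_nonneg w))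
        calc _ ≤ 2 / Creg * M.l2normP0 w / 2 := by gcongr
          _ = _ := by ring
    _ ≤ 1 / Creg * M.l2normP0 w * (1 / Creg * (M.normh v * M.normh z)) := by
        rw [← Finset.mul_sum]
        exact mul_le_mul_of_nonneg_left (M.sum_jump_mul_le hc hM v z)
          (mul_nonneg (by positivity) (M.l2normP0_nonneg w))
    _ = _ := by ring

theorem l2P0_gradh {p : Tri → (E2 →ᵃ[ℝ] ℝ)} (hp : M.IsP1nc p) {u : Tri → E2}
    (hu : M.IsRT0const u) : M.l2P0 (gradh p) u = 0 := by
  have h := M.sum_tris_edges (fun t σ => elen σ * ⟪t.nrm σ, u t⟫ * p t (emid σ))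
    (fun t _ i => by rw [t.nrm_edge_swap, Tri.emid_swap, Tri.elen_swap])
  have h1 : M.l2P0 (gradh p) u = ∑ t ∈ M.tris, ∑ i, elen (t.edge i) *
      ⟪t.nrm (t.edge i), u t⟫ * p t (emid (t.edge i)) := by
    refine Finset.sum_congr rfl fun t _ => ?_
    rw [gradh, ← t.sum_nvec_mid (gradA (p t)) (u t) 0]
    simp only [← real_inner_smul_left, t.elen_smul_nrm_edge]
    have e : ∀ i, p t (emid (t.edge i)) = p t 0 + ⟪gradA (p t), t.mid i - 0⟫ := fun i =>
      affine_eq_gradA (p t) _ 0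
    simp only [e, mul_add, Finset.sum_add_distrib, ← Finset.sum_mul, ← sum_inner, t.sum_nvec,
      inner_zero_left, zero_mul, zero_add, real_inner_smul_left]
  rw [h1, h]
  have h2 : ∑ σ ∈ M.extEdges, elen σ * ⟪(M.Kof σ).nrm σ, u (M.Kof σ)⟫ * p (M.Kof σ) (emid σ) = 0 :=
    Finset.sum_eq_zero fun σ hσ => by rw [real_inner_comm, hu.2 σ hσ]; ring
  rw [h2, add_zero]
  refine Finset.sum_eq_zero fun σ hσ => ?_
  have h3 := hu.1 σ hσ
  rw [inner_sub_left, sub_eq_zero] at h3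
  rw [M.nrm_Lof hσ, inner_neg_left, real_inner_comm (u (M.Lof σ)), h3, hp σ hσ, real_inner_comm]
  ring

theorem isRT0const_iff (v : Tri → E2) :
    M.IsRT0const v ↔ ∀ σ ∈ M.edges, M.divhImage v σ = 0 := by
  have a : ∀ σ ∈ M.intEdges, (M.divhImage v σ = 0 ↔
      ⟪v (M.Lof σ) - v (M.Kof σ), (M.Kof σ).nrm σ⟫ = 0) := by
    intro σ hσ
    have h1 := M.elen_pos (M.int_sub hσ)
    rw [divhImage, if_pos (M.mem_int.1 hσ).2]
    have := (M.Kof σ).area_pos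
    have := (M.Lof σ).area_pos
    rw [mul_eq_zero]
    exact or_iff_right (by positivity)
  have b : ∀ σ ∈ M.extEdges, (M.divhImage v σ = 0 ↔ ⟪v (M.Kof σ), (M.Kof σ).nrm σ⟫ = 0) := by
    intro σ hσ
    have h1 := M.elen_pos (M.ext_sub hσ)
    rw [divhImage, if_neg (by rw [(M.mem_ext.1 hσ).2]; norm_num)]
    have := (M.Kof σ).area_pos
    rw [neg_eq_zero, mul_eq_zero]
    exact or_iff_right (by positivity)
  rw [M.edges_eq]
  simp only [Finset.mem_union, or_imp, forall_and, IsRT0const]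
  exact and_congr (forall₂_congr fun σ hσ => (a σ hσ).symm) (forall₂_congr fun σ hσ => (b σ hσ).symm)

theorem IsRT0const.congr {v w : Tri → E2} (h : ∀ t ∈ M.tris, v t = w t) (hv : M.IsRT0const v) :
    M.IsRT0const w := by
  refine ⟨fun σ hσ => ?_, fun σ hσ => ?_⟩
  · rw [← h _ (M.Lof_int hσ).1, ← h _ (M.Kof_int hσ).1]; exact hv.1 σ hσ
  · rw [← h _ (M.Kof_ext hσ).1]; exact hv.2 σ hσ

theorem IsRT0const.sub_smul {v w : Tri → E2} (hv : M.IsRT0const v) (hw : M.IsRT0const w) (c : ℝ) :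
    M.IsRT0const (fun t => c • v t - w t) := by
  refine ⟨fun σ hσ => ?_, fun σ hσ => ?_⟩
  · have h1 := hv.1 σ hσ
    have h2 := hw.1 σ hσ
    simp only [inner_sub_left, real_inner_smul_left] at h1 h2 ⊢
    linear_combination c * h1 - h2
  · have h1 := hv.2 σ hσ
    have h2 := hw.2 σ hσ
    simp only [inner_sub_left, real_inner_smul_left] at h1 h2 ⊢
    linear_combination c * h1 - h2

theorem divhImage_sub_smul (v w : Tri → E2) (c : ℝ) (σ : E2 × E2) :
    M.divhImage (fun t => v t - c • w t) σ = M.divhImage v σ - c * M.divhImage w σ := by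
  unfold divhImage
  split_ifs <;> simp only [inner_sub_left, real_inner_smul_left] <;> ring

end Mesh

theorem gradA_sub (f g : E2 →ᵃ[ℝ] ℝ) : gradA (f - g) = gradA f - gradA g := by
  refine ext_inner_right ℝ fun v => ?_
  rw [inner_sub_left, inner_gradA, inner_gradA, inner_gradA]
  rfl

namespace Scheme
variable {Ω : Set E2} {M : Mesh Ω} (S : Scheme M)

theorem k_pos : 0 < S.k := by
  rw [S.hk]
  have := S.hN
  exact div_pos S.hT (by exact_mod_cast (by omega : 0 < S.N))

theorem k_mul_N : S.k * S.N = S.T := by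
  rw [S.hk]
  have := S.hN
  exact div_mul_cancel₀ _ (by exact_mod_cast (by omega : S.N ≠ 0))

theorem ut_eq {n : ℕ} (h1 : 1 ≤ n) (h2 : n + 1 ≤ S.N) {t : Tri} (ht : t ∈ M.tris) :
    S.ut (n + 1) t = S.u (n + 1) t
      + (2 * S.k / 3) • (gradh (S.p (n + 1)) t - gradh (S.p n) t) := by
  rw [S.corr n h1 h2 t ht, gradA_sub, gradh, gradh]
  module

theorem isRT0const_u {n : ℕ} (hn : n ≤ S.N) : M.IsRT0const (S.u n) := by
  rcases n with _ | n
  · exact S.hu0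
  rcases n with _ | n
  · exact S.hu1
  refine Mesh.IsRT0const.congr M (v := fun t => S.ut (n + 1 + 1) t - (2 * S.k / 3) •
    gradA (S.p (n + 1 + 1) t - S.p (n + 1) t))
    (fun t ht => (S.corr (n + 1) (by omega) hn t ht).symm) ?_
  rw [M.isRT0const_iff]
  intro σ hσ
  rw [M.divhImage_sub_smul _ (fun t => gradA (S.p (n + 1 + 1) t - S.p (n + 1) t)),
    S.proj (n + 1) (by omega) hn σ hσ]
  have := S.k_pos
  field_simp
  ring

/-- The discrete time derivative. -/
def dt (n : ℕ) (t : Tri) : E2 :=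
  (2 * S.k)⁻¹ • ((3 : ℝ) • (S.u (n + 1) t - S.u n t) - (S.u n t - S.u (n - 1) t))

/-- The extrapolated velocity. -/
def wex (n : ℕ) (t : Tri) : E2 := (2 : ℝ) • S.u n t - S.u (n - 1) t

theorem isRT0const_wex {n : ℕ} (hn : n ≤ S.N) : M.IsRT0const (S.wex n) :=
  (S.isRT0const_u hn).sub_smul M (S.isRT0const_u (by omega)) 2

theorem gradh_eq {n : ℕ} (h1 : 1 ≤ n) (h2 : n + 1 ≤ S.N) {t : Tri} (ht : t ∈ M.tris) :
    gradh (S.p (n + 1)) t = S.fh (n + 1) t - S.dt n t + S.Re⁻¹ • M.laph (S.ut (n + 1)) t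
      - M.btilde (fun s => AffineMap.const ℝ E2 (S.wex n s)) (S.ut (n + 1)) t := by
  have hk := S.k_pos
  rw [← S.mom n h1 h2 t ht, dt]
  have h := S.ut_eq h1 h2 ht
  have e : (2 * S.k)⁻¹ • (3 : ℝ) • S.ut (n + 1) t = (2 * S.k)⁻¹ • (3 : ℝ) • S.u (n + 1) t
      + (gradh (S.p (n + 1)) t - gradh (S.p n) t) := by
    rw [h, smul_add, smul_add, smul_smul, smul_smul, smul_smul]
    congr 1
    rw [show (2 * S.k)⁻¹ * 3 * (2 * S.k / 3) = 1 by field_simp, one_smul]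
  simp only [smul_sub, smul_add] at e ⊢
  rw [e]
  unfold wex
  module

theorem l2P0_gradh_eq {n : ℕ} (h1 : 1 ≤ n) (h2 : n + 1 ≤ S.N) (z : Tri → E2) :
    M.l2P0 (gradh (S.p (n + 1))) z = M.l2P0 (S.fh (n + 1)) z - M.l2P0 (S.dt n) z
      - S.Re⁻¹ * M.ah (S.ut (n + 1)) z
      - M.l2P0 (M.btilde (fun s => AffineMap.const ℝ E2 (S.wex n s)) (S.ut (n + 1))) z := by
  rw [M.l2P0_congr_left fun t ht => S.gradh_eq h1 h2 ht, M.l2P0_sub_left, M.l2P0_add_left,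
    M.l2P0_sub_left, M.l2P0_smul_left, M.l2P0_laph]
  ring

section bounds
variable {C0 C1 Cf : ℝ}

theorem norm_u_le (hC1 : 0 ≤ C1)
    (h0 : M.l2normP0 (S.u 0) + M.l2normP0 (S.u 1) + S.k * M.l2normP0 (gradh (S.p 1)) ≤ C0)
    (h1 : ∀ n, 1 ≤ n → n ≤ S.N → M.l2normP0 (fun t => S.u n t - S.u (n-1) t) ≤ C1 * S.k)
    {n : ℕ} (hn : n ≤ S.N) : M.l2normP0 (S.u n) ≤ C0 + C1 * S.T := by
  have key : ∀ n : ℕ, n ≤ S.N → M.l2normP0 (S.u n) ≤ C0 + C1 * (S.k * n) := by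
    intro n
    induction n with
    | zero =>
      intro _
      have a1 := M.l2normP0_nonneg (S.u 1)
      have a2 := mul_nonneg S.k_pos.le (M.l2normP0_nonneg (gradh (S.p 1)))
      simp only [Nat.cast_zero, mul_zero, add_zero]
      linarith
    | succ n ih =>
      intro hn
      have a1 := ih (by omega)
      have a2 := h1 (n + 1) (by omega) hn
      have a3 := M.l2normP0_add_le (S.u n) (fun t => S.u (n + 1) t - S.u (n + 1 - 1) t)
      rw [M.l2normP0_congr (v := S.u (n + 1)) (fun t _ => by
        rw [Nat.add_sub_cancel]; exact add_sub_cancel _ _)] at a3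
      push_cast
      linarith
  refine (key n hn).trans ?_
  rw [← S.k_mul_N]
  have : (n : ℝ) ≤ S.N := by exact_mod_cast hn
  have := S.k_pos
  gcongr

theorem norm_wex_le (hC1 : 0 ≤ C1)
    (h0 : M.l2normP0 (S.u 0) + M.l2normP0 (S.u 1) + S.k * M.l2normP0 (gradh (S.p 1)) ≤ C0)
    (h1 : ∀ n, 1 ≤ n → n ≤ S.N → M.l2normP0 (fun t => S.u n t - S.u (n-1) t) ≤ C1 * S.k)
    {n : ℕ} (hn : n ≤ S.N) : M.l2normP0 (S.wex n) ≤ 3 * (C0 + C1 * S.T) := by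
  have a1 := S.norm_u_le hC1 h0 h1 hn
  have a2 := S.norm_u_le hC1 h0 h1 (n := n - 1) (by omega)
  have a3 := M.l2normP0_sub_le (fun t => (2 : ℝ) • S.u n t) (S.u (n - 1))
  rw [M.l2normP0_smul, abs_two] at a3
  exact a3.trans (by linarith)

theorem norm_dt_le
    (h1 : ∀ n, 1 ≤ n → n ≤ S.N → M.l2normP0 (fun t => S.u n t - S.u (n-1) t) ≤ C1 * S.k)
    {n : ℕ} (hn : 1 ≤ n) (hn' : n + 1 ≤ S.N) : M.l2normP0 (S.dt n) ≤ 2 * C1 := by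
  have hk := S.k_pos
  have a1 := h1 (n + 1) (by omega) hn'
  rw [Nat.add_sub_cancel] at a1
  have a2 := h1 n hn (by omega)
  have a3 := M.l2normP0_sub_le (fun t => (3 : ℝ) • (S.u (n + 1) t - S.u n t))
    (fun t => S.u n t - S.u (n - 1) t)
  rw [M.l2normP0_smul _ (fun t => S.u (n + 1) t - S.u n t), abs_of_pos (by norm_num : (0:ℝ) < 3)] at a3
  unfold dt
  rw [M.l2normP0_smul _ (fun t => (3 : ℝ) • (S.u (n + 1) t - S.u n t) - (S.u n t - S.u (n - 1) t)),
    abs_of_pos (by positivity), ← div_eq_inv_mul, div_le_iff₀ (by positivity)]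
  linarith

theorem energy_step (hC1 : 0 ≤ C1)
    (h0 : M.l2normP0 (S.u 0) + M.l2normP0 (S.u 1) + S.k * M.l2normP0 (gradh (S.p 1)) ≤ C0)
    (h1 : ∀ n, 1 ≤ n → n ≤ S.N → M.l2normP0 (fun t => S.u n t - S.u (n-1) t) ≤ C1 * S.k)
    (hf : ∀ n ≤ S.N, M.l2normP0 (S.fh n) ≤ Cf) {n : ℕ} (hn : 1 ≤ n) (hn' : n + 1 ≤ S.N) :
    S.Re⁻¹ * M.normh (S.ut (n + 1)) ^ 2
      + S.k / 3 * (M.l2normP0 (gradh (S.p (n + 1))) ^ 2 - M.l2normP0 (gradh (S.p n)) ^ 2)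
      ≤ (Cf + 2 * C1) * (C0 + C1 * S.T) + S.k / 3 * (Cf + 2 * C1) ^ 2 := by
  have hk := S.k_pos
  have hu := S.norm_u_le hC1 h0 h1 hn'
  have hd := S.norm_dt_le h1 hn hn'
  have hff := hf (n + 1) hn'
  set P := gradh (S.p (n + 1)) with hP
  set Q := gradh (S.p n) with hQ
  set V := S.ut (n + 1) with hV
  have a1 := S.l2P0_gradh_eq hn hn' V
  rw [M.ah_self] at a1
  have a2 := M.l2P0_btilde_self_nonneg (S.isRT0const_wex (n := n) (by omega)) V
  have a3 : M.l2P0 P V = S.k / 3 * (M.l2normP0 P ^ 2 - M.l2normP0 Q ^ 2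
      + M.l2normP0 (fun t => P t - Q t) ^ 2) := by
    rw [M.l2P0_comm, M.l2P0_congr_left fun t ht => S.ut_eq hn hn' ht, M.l2P0_add_left,
      M.l2P0_comm (S.u (n + 1)), M.l2P0_gradh (S.hp (n + 1) (by omega) hn').1
      (S.isRT0const_u hn'), M.l2P0_smul_left _ (fun t => P t - Q t), M.l2P0_sub_left,
      M.l2normP0_sq', M.l2normP0_sq', M.l2normP0_sq', M.l2P0_sub_left, M.l2P0_comm P (fun t => P t - Q t),
      M.l2P0_comm Q (fun t => P t - Q t), M.l2P0_sub_left, M.l2P0_sub_left, M.l2P0_comm Q P]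
    ring
  set G := M.l2normP0 (fun t => P t - Q t) with hG
  have hG0 : 0 ≤ G := M.l2normP0_nonneg _
  have a4 : M.l2normP0 V ≤ (C0 + C1 * S.T) + 2 * S.k / 3 * G := by
    rw [M.l2normP0_congr fun t ht => S.ut_eq hn hn' ht]
    refine (M.l2normP0_add_le _ _).trans ?_
    rw [M.l2normP0_smul _ (fun t => P t - Q t), abs_of_pos (by positivity)]
    exact add_le_add hu le_rfl
  have b1 := (abs_le.1 (M.abs_l2P0_le (S.fh (n + 1)) V)).2
  have b2 := (abs_le.1 (M.abs_l2P0_le (S.dt n) V)).1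
  have hV0 := M.l2normP0_nonneg V
  have b3 : M.l2P0 (S.fh (n + 1)) V - M.l2P0 (S.dt n) V ≤ (Cf + 2 * C1) * M.l2normP0 V := by
    nlinarith
  have hA : 0 ≤ Cf + 2 * C1 := by linarith [M.l2normP0_nonneg (S.fh (n + 1))]
  have b4 := mul_le_mul_of_nonneg_left a4 hA
  have b5 : 0 ≤ S.k / 3 * (G - (Cf + 2 * C1)) ^ 2 := by positivity
  nlinarith

theorem energy (hC1 : 0 ≤ C1)
    (h0 : M.l2normP0 (S.u 0) + M.l2normP0 (S.u 1) + S.k * M.l2normP0 (gradh (S.p 1)) ≤ C0)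
    (h1 : ∀ n, 1 ≤ n → n ≤ S.N → M.l2normP0 (fun t => S.u n t - S.u (n-1) t) ≤ C1 * S.k)
    (hf : ∀ n ≤ S.N, M.l2normP0 (S.fh n) ≤ Cf) {m : ℕ} (hm : 1 ≤ m) (hm' : m ≤ S.N) :
    S.Re⁻¹ * (S.k * ∑ n ∈ Finset.Icc 2 m, M.normh (S.ut n) ^ 2)
      ≤ C0 ^ 2 / 3 + S.T * ((Cf + 2 * C1) * (C0 + C1 * S.T) + S.T / 3 * (Cf + 2 * C1) ^ 2) := by
  have hk := S.k_pos
  have hC0 : 0 ≤ C0 := by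
    have := M.l2normP0_nonneg (S.u 0)
    have := M.l2normP0_nonneg (S.u 1)
    have := mul_nonneg hk.le (M.l2normP0_nonneg (gradh (S.p 1)))
    linarith
  have hCf : 0 ≤ Cf := (M.l2normP0_nonneg _).trans (hf 0 (Nat.zero_le _))
  have hT := S.hT
  have hkT : S.k ≤ S.T := by
    rw [← S.k_mul_N]
    have : (1 : ℝ) ≤ S.N := by exact_mod_cast (by have := S.hN; omega : 1 ≤ S.N)
    nlinarith
  set B := (Cf + 2 * C1) * (C0 + C1 * S.T) + S.T / 3 * (Cf + 2 * C1) ^ 2 with hB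
  have hB0 : 0 ≤ B := by positivity
  have key : ∀ m : ℕ, 1 ≤ m → m ≤ S.N →
      S.Re⁻¹ * (S.k * ∑ n ∈ Finset.Icc 2 m, M.normh (S.ut n) ^ 2)
      + S.k ^ 2 / 3 * M.l2normP0 (gradh (S.p m)) ^ 2 ≤ C0 ^ 2 / 3 + S.k * m * B := by
    intro m hm
    induction m, hm using Nat.le_induction with
    | base =>
      intro _
      have a1 : S.k * M.l2normP0 (gradh (S.p 1)) ≤ C0 := by
        have := M.l2normP0_nonneg (S.u 0)
        have := M.l2normP0_nonneg (S.u 1)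
        linarith
      have a2 := pow_le_pow_left₀ (mul_nonneg hk.le (M.l2normP0_nonneg (gradh (S.p 1)))) a1 2
      have a3 : 0 ≤ S.k * (1 : ℕ) * B := by positivity
      simp only [show Finset.Icc 2 1 = ∅ by decide, Finset.sum_empty, mul_zero, zero_add]
      nlinarith
    | succ m hm ih =>
      intro hm'
      have a1 := ih (by omega)
      have a2 := S.energy_step hC1 h0 h1 hf hm hm'
      rw [Finset.sum_Icc_succ_top (by omega)]
      have a3 : (Cf + 2 * C1) * (C0 + C1 * S.T) + S.k / 3 * (Cf + 2 * C1) ^ 2 ≤ B := by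
        rw [hB]; gcongr
      have a4 := mul_le_mul_of_nonneg_left (a2.trans a3) hk.le
      push_cast
      nlinarith
  have a := key m hm hm'
  have b : 0 ≤ S.k ^ 2 / 3 * M.l2normP0 (gradh (S.p m)) ^ 2 := by positivity
  have c : S.k * m ≤ S.T := by
    rw [← S.k_mul_N]
    have : (m : ℝ) ≤ S.N := by exact_mod_cast hm'
    gcongr
  have d := mul_le_mul_of_nonneg_right c hB0
  linarith

end bounds
end Scheme

section fourier
open scoped ENNReal FourierTransform SchwartzMap LineDeriv

theorem lintegral_mul_sq_le {α : Type*} [MeasurableSpace α] (μ : Measure α) {f g : α → ℝ≥0∞}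
    (hf : AEMeasurable f μ) (hg : AEMeasurable g μ) :
    (∫⁻ x, f x * g x ∂μ) ^ 2 ≤ (∫⁻ x, f x ^ 2 ∂μ) * ∫⁻ x, g x ^ 2 ∂μ := by
  have h := ENNReal.lintegral_mul_le_Lp_mul_Lq μ Real.HolderConjugate.two_two hf hg
  simp only [Pi.mul_apply, ENNReal.rpow_two] at h
  calc _ ≤ ((∫⁻ x, f x ^ 2 ∂μ) ^ (1 / (2:ℝ)) * (∫⁻ x, g x ^ 2 ∂μ) ^ (1 / (2:ℝ))) ^ 2 :=
        pow_le_pow_left' h 2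
    _ = _ := by
        rw [mul_pow, ← ENNReal.rpow_two, ← ENNReal.rpow_two, ← ENNReal.rpow_mul,
          ← ENNReal.rpow_mul]
        norm_num

theorem volume_closedBall_E2 (x : E2) {r : ℝ} :
    volume (Metric.closedBall x r) = ENNReal.ofReal r ^ 2 * ENNReal.ofReal Real.pi := by
  rw [Measure.addHaar_closedBall_eq_addHaar_ball, EuclideanSpace.volume_ball_fin_two]

section trilinear
variable {P B W : E2 → ℝ≥0∞}

theorem lintegral_low_sq_le (hP : Measurable P) (hB : Measurable B) (hW : Measurable W) :
    (∫⁻ z : E2 × E2, (if ‖z.1 + z.2‖ ≤ ‖z.1‖ then P z.1 else 0) * (B z.2 * W (z.1 + z.2))) ^ 2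
      ≤ ENNReal.ofReal Real.pi * (∫⁻ x, (‖x‖ₑ * P x) ^ 2) * (∫⁻ x, B x ^ 2) * ∫⁻ x, W x ^ 2 := by
  have hs : MeasurableSet {z : E2 × E2 | ‖z.1 + z.2‖ ≤ ‖z.1‖} :=
    measurableSet_le (by fun_prop) (by fun_prop)
  have m1 : Measurable fun z : E2 × E2 => if ‖z.1 + z.2‖ ≤ ‖z.1‖ then P z.1 else 0 :=
    Measurable.ite hs (by fun_prop) measurable_const
  have m2 : Measurable fun z : E2 × E2 => B z.2 * W (z.1 + z.2) := by fun_prop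
  refine (lintegral_mul_sq_le _ m1.aemeasurable m2.aemeasurable).trans (le_of_eq ?_)
  rw [mul_assoc (_ * _)]
  congr 1
  · rw [Measure.volume_eq_prod, lintegral_prod _ (by fun_prop), ← lintegral_const_mul _ (by fun_prop)]
    refine lintegral_congr fun x => ?_
    have e : ∀ y : E2, (if ‖x + y‖ ≤ ‖x‖ then P x else 0) ^ 2
        = (Metric.closedBall (-x) ‖x‖).indicator (fun _ => P x ^ 2) y := by
      intro y
      have : y ∈ Metric.closedBall (-x) ‖x‖ ↔ ‖x + y‖ ≤ ‖x‖ := by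
        rw [mem_closedBall_iff_norm, sub_neg_eq_add, add_comm]
      by_cases h : ‖x + y‖ ≤ ‖x‖
      · rw [if_pos h, Set.indicator_of_mem (this.2 h)]
      · rw [if_neg h, Set.indicator_of_notMem (mt this.1 h), zero_pow two_ne_zero]
    simp only [e]
    rw [lintegral_indicator_const measurableSet_closedBall, volume_closedBall_E2,
      ofReal_norm, mul_pow]
    ring
  · rw [Measure.volume_eq_prod, lintegral_prod_symm _ (by fun_prop)]
    calc _ = ∫⁻ y : E2, B y ^ 2 * ∫⁻ x, W x ^ 2 := by
          refine lintegral_congr fun y => ?_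
          simp only [mul_pow]
          rw [lintegral_const_mul _ (by fun_prop),
            lintegral_add_right_eq_self (fun x => W x ^ 2) y]
      _ = _ := by rw [lintegral_mul_const _ (by fun_prop)]

theorem lintegral_high_sq_le (hP : Measurable P) (hB : Measurable B) (hW : Measurable W) :
    (∫⁻ z : E2 × E2, ((‖z.1‖ₑ * P z.1) * B z.2) *
        (if ‖z.1‖ < ‖z.1 + z.2‖ then W (z.1 + z.2) / ‖z.1 + z.2‖ₑ else 0)) ^ 2
      ≤ ENNReal.ofReal Real.pi * (∫⁻ x, (‖x‖ₑ * P x) ^ 2) * (∫⁻ x, B x ^ 2) * ∫⁻ x, W x ^ 2 := by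
  have hs : MeasurableSet {z : E2 × E2 | ‖z.1‖ < ‖z.1 + z.2‖} :=
    measurableSet_lt (by fun_prop) (by fun_prop)
  have hs' : MeasurableSet {z : E2 × E2 | ‖z.1‖ < ‖z.2‖} :=
    measurableSet_lt (by fun_prop) (by fun_prop)
  have m1 : Measurable fun z : E2 × E2 =>
      if ‖z.1‖ < ‖z.1 + z.2‖ then W (z.1 + z.2) / ‖z.1 + z.2‖ₑ else 0 :=
    Measurable.ite hs (by fun_prop) measurable_const
  have m1' : Measurable fun z : E2 × E2 =>
      if ‖z.1‖ < ‖z.2‖ then W z.2 / ‖z.2‖ₑ else 0 :=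
    Measurable.ite hs' (by fun_prop) measurable_const
  have m2 : Measurable fun z : E2 × E2 => (‖z.1‖ₑ * P z.1) * B z.2 := by fun_prop
  refine (lintegral_mul_sq_le _ m2.aemeasurable m1.aemeasurable).trans ?_
  have e1 : ∫⁻ z : E2 × E2, ((‖z.1‖ₑ * P z.1) * B z.2) ^ 2
      = (∫⁻ x, (‖x‖ₑ * P x) ^ 2) * ∫⁻ x, B x ^ 2 := by
    simp only [mul_pow _ (B _)]
    rw [Measure.volume_eq_prod]
    exact lintegral_prod_mul (f := fun x : E2 => (‖x‖ₑ * P x) ^ 2) (g := fun x : E2 => B x ^ 2)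
      (by fun_prop) (by fun_prop)
  have e2 : ∫⁻ z : E2 × E2, (if ‖z.1‖ < ‖z.1 + z.2‖ then W (z.1 + z.2) / ‖z.1 + z.2‖ₑ else 0) ^ 2
      ≤ ENNReal.ofReal Real.pi * ∫⁻ x, W x ^ 2 := by
    rw [Measure.volume_eq_prod, lintegral_prod _ (by fun_prop)]
    calc _ = ∫⁻ x : E2, ∫⁻ y : E2, (if ‖x‖ < ‖y‖ then W y / ‖y‖ₑ else 0) ^ 2 := by
          refine lintegral_congr fun x => ?_
          exact lintegral_add_left_eq_self
            (fun y : E2 => (if ‖x‖ < ‖y‖ then W y / ‖y‖ₑ else 0) ^ 2) x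
      _ = ∫⁻ y : E2, ∫⁻ x : E2, (if ‖x‖ < ‖y‖ then W y / ‖y‖ₑ else 0) ^ 2 :=
          lintegral_lintegral_swap (by
            exact (m1'.pow_const 2).aemeasurable)
      _ ≤ ∫⁻ y : E2, ENNReal.ofReal Real.pi * W y ^ 2 := by
          refine lintegral_mono fun y => ?_
          have e : ∀ x : E2, (if ‖x‖ < ‖y‖ then W y / ‖y‖ₑ else 0) ^ 2
              = (Metric.ball (0 : E2) ‖y‖).indicator (fun _ => (W y / ‖y‖ₑ) ^ 2) x := by
            intro x
            have : x ∈ Metric.ball (0 : E2) ‖y‖ ↔ ‖x‖ < ‖y‖ := mem_ball_zero_iff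
            by_cases h : ‖x‖ < ‖y‖
            · rw [if_pos h, Set.indicator_of_mem (this.2 h)]
            · rw [if_neg h, Set.indicator_of_notMem (mt this.1 h), zero_pow two_ne_zero]
          simp only [e]
          rw [lintegral_indicator_const measurableSet_ball, EuclideanSpace.volume_ball_fin_two,
            ofReal_norm, ← mul_assoc, ← mul_pow, mul_comm]
          gcongr
          rw [mul_comm]; exact ENNReal.mul_div_le
      _ = _ := lintegral_const_mul _ (by fun_prop)
  rw [e1]
  calc _ ≤ (∫⁻ x, (‖x‖ₑ * P x) ^ 2) * (∫⁻ x, B x ^ 2) * (ENNReal.ofReal Real.pi * ∫⁻ x, W x ^ 2) := by gcongr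
    _ = _ := by ring

/-- Combination of the two regimes. -/
theorem lintegral_trilinear_sq_le (hP : Measurable P) (hB : Measurable B) (hW : Measurable W)
    {G : E2 × E2 → ℝ≥0∞} (h1 : ∀ x y, G (x, y) ≤ P x * (B y * W (x + y)))
    (h2 : ∀ x y, x + y ≠ 0 → G (x, y) ≤ ((‖x‖ₑ * P x) * B y) * (W (x + y) / ‖x + y‖ₑ)) :
    (∫⁻ z, G z) ^ 2
      ≤ 4 * (ENNReal.ofReal Real.pi * (∫⁻ x, (‖x‖ₑ * P x) ^ 2) * (∫⁻ x, B x ^ 2) * ∫⁻ x, W x ^ 2) := by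
  have hs : MeasurableSet {z : E2 × E2 | ‖z.1 + z.2‖ ≤ ‖z.1‖} :=
    measurableSet_le (by fun_prop) (by fun_prop)
  have m1 : Measurable fun z : E2 × E2 => if ‖z.1 + z.2‖ ≤ ‖z.1‖ then P z.1 else 0 :=
    Measurable.ite hs (by fun_prop) measurable_const
  have a1 := lintegral_low_sq_le hP hB hW
  have a2 := lintegral_high_sq_le hP hB hW
  have h : ∫⁻ z, G z ≤
      (∫⁻ z : E2 × E2, (if ‖z.1 + z.2‖ ≤ ‖z.1‖ then P z.1 else 0) * (B z.2 * W (z.1 + z.2)))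
      + ∫⁻ z : E2 × E2, ((‖z.1‖ₑ * P z.1) * B z.2) *
        (if ‖z.1‖ < ‖z.1 + z.2‖ then W (z.1 + z.2) / ‖z.1 + z.2‖ₑ else 0) := by
    rw [← lintegral_add_left (by fun_prop)]
    refine lintegral_mono fun z => ?_
    obtain ⟨x, y⟩ := z
    by_cases hxy : ‖x + y‖ ≤ ‖x‖
    · simp only [if_pos hxy, if_neg (not_lt.2 hxy), mul_zero, add_zero]
      exact h1 x y
    · simp only [if_neg hxy, if_pos (not_le.1 hxy), zero_mul, zero_add]
      refine h2 x y fun h0 => hxy ?_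
      rw [h0, norm_zero]; exact norm_nonneg x
  refine (pow_le_pow_left' h 2).trans ?_
  set r := ∫⁻ z : E2 × E2, (if ‖z.1 + z.2‖ ≤ ‖z.1‖ then P z.1 else 0) * (B z.2 * W (z.1 + z.2))
  set s := ∫⁻ z : E2 × E2, ((‖z.1‖ₑ * P z.1) * B z.2) *
        (if ‖z.1‖ < ‖z.1 + z.2‖ then W (z.1 + z.2) / ‖z.1 + z.2‖ₑ else 0)
  rcases le_total r s with hrs | hrs
  · calc (r + s) ^ 2 ≤ (s + s) ^ 2 := by gcongr
      _ = 4 * s ^ 2 := by ring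
      _ ≤ _ := by gcongr
  · calc (r + s) ^ 2 ≤ (r + r) ^ 2 := by gcongr
      _ = 4 * r ^ 2 := by ring
      _ ≤ _ := by gcongr

end trilinear

theorem integrable_of_bounded_support {w : E2 → ℝ} {K R : ℝ} (hw : Measurable w)
    (hb : ∀ x, |w x| ≤ K) (hs : ∀ x, R < ‖x‖ → w x = 0) : Integrable w := by
  have h1 : IntegrableOn w (Metric.closedBall 0 R) :=
    Measure.integrableOn_of_bounded (M := K)
      (isCompact_closedBall (0:E2) R).measure_lt_top.ne hw.aestronglyMeasurable
      (Filter.Eventually.of_forall fun x => by simpa using hb x)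
  exact (integrableOn_iff_integrable_of_support_subset fun x hx => by
    rw [mem_closedBall_zero_iff]; by_contra h; exact hx (hs x (not_le.1 h))).1 h1

theorem memLp_of_bounded_support {w : E2 → ℝ} {K R : ℝ} (hw : Measurable w)
    (hb : ∀ x, |w x| ≤ K) (hs : ∀ x, R < ‖x‖ → w x = 0) : MemLp w 2 volume := by
  rw [memLp_two_iff_integrable_sq hw.aestronglyMeasurable]
  refine integrable_of_bounded_support (K := K ^ 2) (R := R) (hw.pow_const 2) (fun x => ?_)
    fun x hx => by rw [hs x hx]; simp
  rw [abs_pow]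
  exact pow_le_pow_left₀ (abs_nonneg _) (hb x) 2

theorem abs_moll_le (b : ContDiffBump (0 : E2)) {w : E2 → ℝ} {K : ℝ} (hw : LocallyIntegrable w)
    (hb : ∀ x, |w x| ≤ K) (x : E2) : |moll b w x| ≤ K := by
  have h1 : ∫ y, ker b (x - y) * K = K := by
    rw [integral_mul_const, integral_ker_sub, one_mul]
  have hi : Integrable fun y => ker b (x - y) :=
    (ker_sub_continuous b x).integrable_of_hasCompactSupport (ker_sub_compact b x)
  calc |moll b w x| ≤ ∫ y, |ker b (x - y) * w y| := abs_integral_le_integral_abs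
    _ ≤ ∫ y, ker b (x - y) * K := by
        refine integral_mono
          (integrable_mul_locallyIntegrable (ker_sub_continuous b x) (ker_sub_compact b x) hw).abs
          (hi.mul_const K) fun y => ?_
        change |ker b (x - y) * w y| ≤ ker b (x - y) * K
        rw [abs_mul, abs_of_nonneg (ker_nonneg b _)]
        exact mul_le_mul_of_nonneg_left (hb y) (ker_nonneg b _)
    _ = K := h1

theorem moll_eq_zero (b : ContDiffBump (0 : E2)) {w : E2 → ℝ} {R : ℝ}
    (hs : ∀ x, R < ‖x‖ → w x = 0) {x : E2} (hx : R + b.rOut < ‖x‖) : moll b w x = 0 := by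
  unfold moll
  refine integral_eq_zero_of_ae (Filter.Eventually.of_forall fun y => ?_)
  change ker b (x - y) * w y = 0
  by_cases h : R < ‖y‖
  · rw [hs y h, mul_zero]
  · rw [ker_eq_zero b, zero_mul]
    have := norm_sub_norm_le x y
    linarith [not_lt.1 h]

theorem hasCompactSupport_of_support {F : Type*} [Zero F] {w : E2 → F} {R : ℝ}
    (hs : ∀ x, R < ‖x‖ → w x = 0) : HasCompactSupport w :=
  HasCompactSupport.intro (isCompact_closedBall (0:E2) R) fun x hx =>
    hs x (by simpa using hx)

theorem continuous_fourierInv {f : E2 → ℂ} (hf : Integrable f) : Continuous (𝓕⁻ f) :=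
  VectorFourier.fourierIntegral_continuous Real.continuous_fourierChar
    (L := -innerₗ E2) (by change Continuous fun p : E2 × E2 => -⟪p.1, p.2⟫; fun_prop) hf

theorem lintegral_fourierInv_sq_le {w : E2 → ℝ} {K R : ℝ} (hw : Measurable w)
    (hb : ∀ x, |w x| ≤ K) (hs : ∀ x, R < ‖x‖ → w x = 0) :
    ∫⁻ ξ, ‖𝓕⁻ (fun x => (w x : ℂ)) ξ‖ₑ ^ 2 ≤ ∫⁻ x, ENNReal.ofReal (w x ^ 2) := by
  have hwi := integrable_of_bounded_support hw hb hs
  have hwl := hwi.locallyIntegrable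
  set m : ℕ → E2 → ℝ := fun n => moll (bumpSeq n) w with hm
  have hmc : ∀ n, ContDiff ℝ (⊤ : ℕ∞) (m n) := fun n => moll_contDiff _ hwl
  have hr : ∀ n, (bumpSeq n).rOut ≤ 1 := fun n => by
    change 1 / ((n:ℝ) + 1) ≤ 1
    rw [div_le_one (by positivity)]; linarith [(Nat.cast_nonneg n : (0:ℝ) ≤ n)]
  have hms : ∀ n x, R + 1 < ‖x‖ → m n x = 0 := fun n x hx =>
    moll_eq_zero _ hs (by linarith [hr n])
  have hmb : ∀ n x, |m n x| ≤ K := fun n x => abs_moll_le _ hwl hb x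
  have hone : ∀ n, ∫⁻ ξ, ‖𝓕⁻ (fun x => (m n x : ℂ)) ξ‖ₑ ^ 2 ≤ ∫⁻ x, ENNReal.ofReal (w x ^ 2) := by
    intro n
    refine le_trans (le_of_eq ?_) (lintegral_moll_sq_le (bumpSeq n)
      (memLp_of_bounded_support hw hb hs))
    have hcs : HasCompactSupport (fun x => (m n x : ℂ)) :=
      hasCompactSupport_of_support (R := R + 1) fun x hx => by simp [hms n x hx]
    have hcd : ContDiff ℝ (⊤ : ℕ∞) (fun x => (m n x : ℂ)) := Complex.ofRealCLM.contDiff.comp (hmc n)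
    let s : 𝓢(E2, ℂ) := hcs.toSchwartzMap hcd
    have e1 : ((𝓕⁻ s : 𝓢(E2, ℂ)) : E2 → ℂ) = 𝓕⁻ (fun x => (m n x : ℂ)) := SchwartzMap.fourierInv_coe s
    have e2 := SchwartzMap.integral_norm_sq_fourier (𝓕⁻ s)
    rw [FourierTransform.fourier_fourierInv_eq, ← e1] at *
    have i1 : Integrable fun x => ‖s x‖ ^ 2 := (SchwartzMap.memLp s 2).integrable_norm_pow two_ne_zero
    have i2 : Integrable fun x => ‖(𝓕⁻ s) x‖ ^ 2 :=
      (SchwartzMap.memLp (𝓕⁻ s) 2).integrable_norm_pow two_ne_zero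
    have l1 := ofReal_integral_eq_lintegral_ofReal i1 (Filter.Eventually.of_forall fun x => by positivity)
    have l2 := ofReal_integral_eq_lintegral_ofReal i2 (Filter.Eventually.of_forall fun x => by positivity)
    rw [e2, l2] at l1
    have c1 : ∀ x, ENNReal.ofReal (m n x ^ 2) = ENNReal.ofReal (‖s x‖ ^ 2) := fun x => by
      change _ = ENNReal.ofReal (‖((m n x : ℝ):ℂ)‖ ^ 2)
      rw [Complex.norm_real, Real.norm_eq_abs, sq_abs]
    change _ = ∫⁻ x, ENNReal.ofReal (m n x ^ 2)
    simp_rw [c1, ← l1, ENNReal.ofReal_pow (norm_nonneg _), ofReal_norm]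
  have hlim : ∀ ξ, Filter.Tendsto (fun n => 𝓕⁻ (fun x => (m n x : ℂ)) ξ) Filter.atTop
      (nhds (𝓕⁻ (fun x => (w x : ℂ)) ξ)) := by
    intro ξ
    simp_rw [Real.fourierInv_eq']
    refine tendsto_integral_of_dominated_convergence
      (fun x => (Metric.closedBall (0:E2) (R + 1)).indicator (fun _ => K) x) (fun n => ?_) ?_
      (fun n => Filter.Eventually.of_forall fun x => ?_) ?_
    · have : Continuous (fun v => (m n v : ℂ)) := Complex.continuous_ofReal.comp (hmc n).continuous
      exact Continuous.aestronglyMeasurable (by fun_prop)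
    · exact (integrable_indicator_iff measurableSet_closedBall).2
        (integrableOn_const (isCompact_closedBall _ _).measure_lt_top.ne)
    · rw [norm_smul, Complex.norm_exp_ofReal_mul_I, one_mul, Complex.norm_real]
      by_cases h : x ∈ Metric.closedBall (0:E2) (R + 1)
      · rw [Set.indicator_of_mem h]; exact hmb n x
      · rw [hms n x (by simpa using h)]; simp [h]
    · filter_upwards [moll_tendsto hwl] with x hx
      exact ((Complex.continuous_ofReal.tendsto _).comp hx).const_smul _
  calc ∫⁻ ξ, ‖𝓕⁻ (fun x => (w x : ℂ)) ξ‖ₑ ^ 2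
      = ∫⁻ ξ, Filter.liminf (fun n => ‖𝓕⁻ (fun x => (m n x : ℂ)) ξ‖ₑ ^ 2) Filter.atTop := by
        refine lintegral_congr fun ξ => ?_
        exact (((ENNReal.continuous_pow 2).tendsto _).comp
          ((continuous_enorm.tendsto _).comp (hlim ξ))).liminf_eq.symm
    _ ≤ Filter.liminf (fun n => ∫⁻ ξ, ‖𝓕⁻ (fun x => (m n x : ℂ)) ξ‖ₑ ^ 2) Filter.atTop := by
        refine lintegral_liminf_le fun n => ?_
        have hmi : Integrable (fun x => (m n x : ℂ)) :=
          (integrable_of_bounded_support (hmc n).continuous.measurable (hmb n) (hms n)).ofReal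
        have : Continuous (𝓕⁻ (fun x => (m n x : ℂ))) := continuous_fourierInv hmi
        exact (this.enorm.measurable).pow_const 2
    _ ≤ _ := Filter.liminf_le_of_le (by isBoundedDefault) fun b hb => by
        obtain ⟨n, hn⟩ := hb.exists
        exact hn.trans (hone n)

/-- The plane wave `exp (2πi ⟪x, ξ⟫)`. -/
def wave (x ξ : E2) : ℂ := Complex.exp (↑(2 * Real.pi * ⟪x, ξ⟫) * Complex.I)

theorem norm_wave (x ξ : E2) : ‖wave x ξ‖ = 1 := Complex.norm_exp_ofReal_mul_I _

theorem wave_comm (x ξ : E2) : wave x ξ = wave ξ x := by rw [wave, wave, real_inner_comm]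

theorem wave_add (x ξ ζ : E2) : wave x (ξ + ζ) = wave x ξ * wave x ζ := by
  rw [wave, wave, wave, ← Complex.exp_add, inner_add_right]
  push_cast; ring_nf

theorem continuous_wave {X : Type*} [TopologicalSpace X] {f g : X → E2} (hf : Continuous f)
    (hg : Continuous g) : Continuous fun x => wave (f x) (g x) := by
  unfold wave; fun_prop

theorem fourierInv_eq_wave (f : E2 → ℂ) (ξ : E2) : 𝓕⁻ f ξ = ∫ x, wave x ξ * f x :=
  Real.fourierInv_eq' f ξ

theorem schwartz_eq_integral_wave (s : 𝓢(E2, ℂ)) (x : E2) :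
    s x = ∫ η, wave η x * (𝓕 s) η := by
  rw [← fourierInv_eq_wave, ← SchwartzMap.fourierInv_coe, FourierTransform.fourierInv_fourier_eq]

theorem integrable_mul_mul_prod {w a b : E2 → ℂ} (hw : Integrable w) (ha : Integrable a)
    (hb : Integrable b) :
    Integrable (fun q : E2 × (E2 × E2) => w q.1 * (a q.2.1 * b q.2.2)) (volume.prod volume) := by
  have h : Integrable (fun z : E2 × E2 => a z.1 * b z.2) := ha.mul_prod hb
  exact Integrable.mul_prod hw h

theorem integral_mul_wave_integrals {w a b : E2 → ℂ} (hw : Integrable w) (ha : Integrable a)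
    (hb : Integrable b) :
    ∫ x, w x * (∫ η, wave η x * a η) * (∫ ζ, wave ζ x * b ζ) =
      ∫ z : E2 × E2, a z.1 * b z.2 * 𝓕⁻ w (z.1 + z.2) := by
  have h1 : ∀ x, w x * (∫ η, wave η x * a η) * (∫ ζ, wave ζ x * b ζ) =
      ∫ z : E2 × E2, (wave x z.1 * wave x z.2) * (w x * (a z.1 * b z.2)) := by
    intro x
    rw [mul_assoc, ← integral_prod_mul, ← integral_const_mul]
    refine integral_congr_ae (Filter.Eventually.of_forall fun z => ?_)
    simp only [wave_comm x]
    ring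
  simp_rw [h1]
  have hI : Integrable (fun q : E2 × (E2 × E2) =>
      (wave q.1 q.2.1 * wave q.1 q.2.2) * (w q.1 * (a q.2.1 * b q.2.2))) (volume.prod volume) := by
    have h1 : Continuous fun q : E2 × (E2 × E2) => wave q.1 q.2.1 :=
      continuous_wave (by fun_prop) (by fun_prop)
    have h2 : Continuous fun q : E2 × (E2 × E2) => wave q.1 q.2.2 :=
      continuous_wave (by fun_prop) (by fun_prop)
    exact (integrable_mul_mul_prod hw ha hb).bdd_mul (c := 1) (h1.mul h2).aestronglyMeasurable
      (Filter.Eventually.of_forall fun q => by rw [norm_mul, norm_wave, norm_wave, one_mul])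
  rw [integral_integral_swap hI]
  refine integral_congr_ae (Filter.Eventually.of_forall fun z => ?_)
  change _ = _ * 𝓕⁻ w (z.1 + z.2)
  rw [fourierInv_eq_wave, ← integral_const_mul]
  refine integral_congr_ae (Filter.Eventually.of_forall fun x => ?_)
  simp only [wave_add]
  ring

theorem integral_mul_schwartz {w : E2 → ℝ} (hw : Integrable w) (s₁ s₂ : 𝓢(E2, ℂ)) :
    ∫ x, (w x : ℂ) * s₁ x * s₂ x =
      ∫ z : E2 × E2, (𝓕 s₁) z.1 * (𝓕 s₂) z.2 * 𝓕⁻ (fun x => (w x : ℂ)) (z.1 + z.2) := by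
  rw [← integral_mul_wave_integrals (w := fun x => (w x : ℂ)) hw.ofReal
    (SchwartzMap.integrable (𝓕 s₁)) (SchwartzMap.integrable (𝓕 s₂))]
  simp_rw [← schwartz_eq_integral_wave]

theorem integrable_mul_schwartz {w : E2 → ℝ} (hw : Integrable w) (s₁ s₂ : 𝓢(E2, ℂ)) :
    Integrable fun z : E2 × E2 =>
      (𝓕 s₁) z.1 * (𝓕 s₂) z.2 * 𝓕⁻ (fun x => (w x : ℂ)) (z.1 + z.2) := by
  have hI : Integrable (fun z : E2 × E2 => (𝓕 s₁) z.1 * (𝓕 s₂) z.2) :=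
    (SchwartzMap.integrable (𝓕 s₁)).mul_prod (SchwartzMap.integrable (𝓕 s₂))
  refine hI.mul_bdd (c := ∫ x, ‖(w x : ℂ)‖) ?_ (Filter.Eventually.of_forall fun z => ?_)
  · exact ((continuous_fourierInv hw.ofReal).comp
      (continuous_fst.add continuous_snd)).aestronglyMeasurable
  · rw [fourierInv_eq_wave]
    refine (norm_integral_le_integral_norm _).trans (le_of_eq ?_)
    simp_rw [norm_mul, norm_wave, one_mul]

/-- A smooth compactly supported real function as a complex Schwartz function. -/
def toS {U : E2 → ℝ} (hU : ContDiff ℝ (⊤ : ℕ∞) U) (hc : HasCompactSupport U) : 𝓢(E2, ℂ) :=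
  (hc.comp_left (g := Complex.ofReal) Complex.ofReal_zero).toSchwartzMap
    (Complex.ofRealCLM.contDiff.comp hU)

section
variable {U : E2 → ℝ} (hU : ContDiff ℝ (⊤ : ℕ∞) U) (hc : HasCompactSupport U)

theorem toS_apply (x : E2) : toS hU hc x = (U x : ℂ) := rfl

theorem lineDeriv_toS (j : Fin 2) (x : E2) : (∂_{ee j} (toS hU hc)) x = (pd j U x : ℂ) := by
  rw [SchwartzMap.lineDerivOp_apply_eq_fderiv]
  have h : HasFDerivAt U (fderiv ℝ U x) x :=
    (hU.differentiable (by simp) x).hasFDerivAt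
  have := (Complex.ofRealCLM.hasFDerivAt.comp x h).fderiv
  change (fderiv ℝ (Complex.ofRealCLM ∘ U) x) (ee j) = _
  rw [this]; rfl

theorem fourier_lineDeriv_toS (j : Fin 2) (η : E2) :
    (𝓕 (∂_{ee j} (toS hU hc))) η = (2 * Real.pi * Complex.I) * (η j * (𝓕 (toS hU hc)) η) := by
  rw [SchwartzMap.fourier_lineDerivOp_eq]
  have h : (inner ℝ · (ee j) : E2 → ℝ).HasTemperateGrowth :=
    ((innerSL ℝ).flip (ee j)).hasTemperateGrowth
  have he : ⟪η, ee j⟫ = η j := by simp [ee, EuclideanSpace.inner_single_right]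
  rw [smul_apply, SchwartzMap.smulLeftCLM_apply_apply h, he]
  simp

theorem lintegral_fourier_gsq :
    ∫⁻ η, (ENNReal.ofReal (2 * Real.pi) * (‖η‖ₑ * ‖(𝓕 (toS hU hc)) η‖ₑ)) ^ 2 =
      ENNReal.ofReal (∫ x, gsq U x) := by
  have key : ∀ j : Fin 2, (Integrable fun x => pd j U x ^ 2) ∧
      (Integrable fun η => (2 * Real.pi * (η j * ‖(𝓕 (toS hU hc)) η‖)) ^ 2) ∧
      ∫ η, (2 * Real.pi * (η j * ‖(𝓕 (toS hU hc)) η‖)) ^ 2 = ∫ x, pd j U x ^ 2 := by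
    intro j
    have e := SchwartzMap.integral_norm_sq_fourier (∂_{ee j} (toS hU hc))
    have i1 := (SchwartzMap.memLp (∂_{ee j} (toS hU hc)) 2).integrable_norm_pow two_ne_zero
    have i2 := (SchwartzMap.memLp (𝓕 (∂_{ee j} (toS hU hc))) 2).integrable_norm_pow two_ne_zero
    have c1 : ∀ x, ‖(∂_{ee j} (toS hU hc)) x‖ ^ 2 = pd j U x ^ 2 := fun x => by
      rw [lineDeriv_toS, Complex.norm_real, Real.norm_eq_abs, sq_abs]
    have c2 : ∀ η, ‖(𝓕 (∂_{ee j} (toS hU hc))) η‖ ^ 2 =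
        (2 * Real.pi * (η j * ‖(𝓕 (toS hU hc)) η‖)) ^ 2 := fun η => by
      rw [fourier_lineDeriv_toS]
      simp [mul_pow, abs_of_pos Real.pi_pos]
    simp_rw [c1] at e i1
    simp_rw [c2] at e i2
    exact ⟨i1, i2, e⟩
  obtain ⟨a0, b0, c0⟩ := key 0
  obtain ⟨a1, b1, c1⟩ := key 1
  have h1 : ∫ x, gsq U x = ∫ η, ((2 * Real.pi * (η 0 * ‖(𝓕 (toS hU hc)) η‖)) ^ 2 +
      (2 * Real.pi * (η 1 * ‖(𝓕 (toS hU hc)) η‖)) ^ 2) := by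
    rw [integral_add b0 b1, c0, c1, ← integral_add a0 a1]; rfl
  have b2 : Integrable fun η => ((2 * Real.pi * (η 0 * ‖(𝓕 (toS hU hc)) η‖)) ^ 2 +
      (2 * Real.pi * (η 1 * ‖(𝓕 (toS hU hc)) η‖)) ^ 2) := b0.add b1
  rw [h1, ofReal_integral_eq_lintegral_ofReal b2 (Filter.Eventually.of_forall fun x => by
      change 0 ≤ (_ : ℝ) ^ 2 + _ ^ 2; positivity)]
  refine lintegral_congr fun η => ?_
  rw [← ofReal_norm, ← ofReal_norm, ← ENNReal.ofReal_mul (norm_nonneg _),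
    ← ENNReal.ofReal_mul (by positivity), ← ENNReal.ofReal_pow (by positivity)]
  congr 1
  have := norm_sq_coord η
  rw [mul_pow, mul_pow, mul_pow, this]; ring

end

theorem fourierInv_div_free {w : Fin 2 → E2 → ℝ} (hw : ∀ j, Integrable (w j))
    (hdiv : ∀ φ : E2 → ℝ, ContDiff ℝ (⊤ : ℕ∞) φ →
      ∫ x, (w 0 x * pd 0 φ x + w 1 x * pd 1 φ x) = 0) (ξ : E2) :
    (ξ 0 : ℂ) * 𝓕⁻ (fun x => (w 0 x : ℂ)) ξ + (ξ 1 : ℂ) * 𝓕⁻ (fun x => (w 1 x : ℂ)) ξ = 0 := by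
  have hpd : ∀ (g g' : ℝ → ℝ) (hg : ∀ y, HasDerivAt g (g' y) y) (j : Fin 2) (x : E2),
      pd j (fun x => g (2 * Real.pi * ⟪x, ξ⟫)) x = g' (2 * Real.pi * ⟪x, ξ⟫) * (2 * Real.pi * ξ j) := by
    intro g g' hg j x
    have h1 : HasFDerivAt (fun x : E2 => 2 * Real.pi * ⟪x, ξ⟫)
        ((2 * Real.pi) • (innerSL ℝ).flip ξ) x :=
      (((innerSL ℝ).flip ξ : E2 →L[ℝ] ℝ).hasFDerivAt).const_mul (2 * Real.pi)
    have h2 := (HasDerivAt.comp_hasFDerivAt x (hg (2 * Real.pi * ⟪x, ξ⟫)) h1).fderiv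
    unfold pd
    change (fderiv ℝ (g ∘ fun x : E2 => 2 * Real.pi * ⟪x, ξ⟫) x) (ee j) = _
    rw [h2]
    have he : ((innerSL ℝ).flip ξ) (ee j) = ξ j := by
      change ⟪ee j, ξ⟫ = ξ j
      simp [ee, EuclideanSpace.inner_single_left]
    rw [smul_apply, smul_apply, he]; simp
  have hlin : ContDiff ℝ (⊤ : ℕ∞) (fun x : E2 => 2 * Real.pi * ⟪x, ξ⟫) :=
    contDiff_const.mul (contDiff_id.inner ℝ contDiff_const)
  have hsin := hdiv (fun x => Real.sin (2 * Real.pi * ⟪x, ξ⟫)) hlin.sin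
  have hcos := hdiv (fun x => Real.cos (2 * Real.pi * ⟪x, ξ⟫)) hlin.cos
  simp_rw [hpd _ _ Real.hasDerivAt_sin] at hsin
  simp_rw [hpd _ (fun y => -Real.sin y) Real.hasDerivAt_cos] at hcos
  have hz : ∀ q : E2 → ℝ, (∫ x, (w 0 x * (q x * (2 * Real.pi * ξ 0)) +
      w 1 x * (q x * (2 * Real.pi * ξ 1)))) = 0 → ∫ x, (ξ 0 * w 0 x + ξ 1 * w 1 x) * q x = 0 := by
    intro q hq
    have : ∀ x, (w 0 x * (q x * (2 * Real.pi * ξ 0)) + w 1 x * (q x * (2 * Real.pi * ξ 1))) =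
        2 * Real.pi * ((ξ 0 * w 0 x + ξ 1 * w 1 x) * q x) := fun x => by ring
    simp_rw [this] at hq
    rw [integral_const_mul] at hq
    exact (mul_eq_zero.1 hq).resolve_left (by positivity)
  have hs := hz _ hsin
  have hc := hz _ hcos
  have hi : ∀ j, Integrable fun x => (ξ j : ℂ) * (wave x ξ * (w j x : ℂ)) := fun j =>
    ((hw j).ofReal.bdd_mul (c := 1)
      (continuous_wave continuous_id continuous_const).aestronglyMeasurable
      (Filter.Eventually.of_forall fun x => (norm_wave x ξ).le)).const_mul _
  rw [fourierInv_eq_wave, fourierInv_eq_wave, ← integral_const_mul, ← integral_const_mul,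
    ← integral_add (hi 0) (hi 1)]
  have hpt : ∀ x, (ξ 0 : ℂ) * (wave x ξ * (w 0 x : ℂ)) + (ξ 1 : ℂ) * (wave x ξ * (w 1 x : ℂ)) =
      (((ξ 0 * w 0 x + ξ 1 * w 1 x) * Real.cos (2 * Real.pi * ⟪x, ξ⟫) : ℝ) : ℂ) -
      Complex.I * (((ξ 0 * w 0 x + ξ 1 * w 1 x) * -Real.sin (2 * Real.pi * ⟪x, ξ⟫) : ℝ) : ℂ) := by
    intro x
    rw [wave, Complex.exp_mul_I]
    push_cast; ring
  have hg : Integrable fun x => ξ 0 * w 0 x + ξ 1 * w 1 x :=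
    ((hw 0).const_mul _).add ((hw 1).const_mul _)
  have g1 : Integrable fun x => (((ξ 0 * w 0 x + ξ 1 * w 1 x) *
      Real.cos (2 * Real.pi * ⟪x, ξ⟫) : ℝ) : ℂ) :=
    (hg.mul_bdd (c := 1) (Continuous.aestronglyMeasurable (by fun_prop))
      (Filter.Eventually.of_forall fun x => Real.abs_cos_le_one _)).ofReal
  have g2 : Integrable fun x => Complex.I * (((ξ 0 * w 0 x + ξ 1 * w 1 x) *
      -Real.sin (2 * Real.pi * ⟪x, ξ⟫) : ℝ) : ℂ) :=
    (hg.mul_bdd (c := 1) (Continuous.aestronglyMeasurable (by fun_prop))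
      (Filter.Eventually.of_forall fun x => by
        rw [norm_neg]; exact Real.abs_sin_le_one _)).ofReal.const_mul _
  simp_rw [hpt]
  rw [integral_sub g1 g2, integral_const_mul, integral_complex_ofReal, integral_complex_ofReal, hs, hc]
  simp

section
variable {η ζ : E2} {a b : ℂ}

theorem norm_transport_le (h : ((η + ζ) 0 : ℂ) * a + ((η + ζ) 1 : ℂ) * b = 0) :
    ‖(η 0 : ℂ) * a + (η 1 : ℂ) * b‖ ≤ ‖ζ‖ * (‖a‖ + ‖b‖) := by
  have e : (η 0 : ℂ) * a + (η 1 : ℂ) * b = -((ζ 0 : ℂ) * a + (ζ 1 : ℂ) * b) := by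
    simp only [PiLp.add_apply, Complex.ofReal_add] at h
    linear_combination h
  have h0 : |ζ 0| ≤ ‖ζ‖ := PiLp.norm_apply_le ζ 0
  have h1 : |ζ 1| ≤ ‖ζ‖ := PiLp.norm_apply_le ζ 1
  rw [e, norm_neg, mul_add]
  refine (norm_add_le _ _).trans ?_
  rw [norm_mul, norm_mul, Complex.norm_real, Complex.norm_real, Real.norm_eq_abs, Real.norm_eq_abs]
  gcongr

theorem norm_mul_transport_le (h : ((η + ζ) 0 : ℂ) * a + ((η + ζ) 1 : ℂ) * b = 0) :
    ‖η + ζ‖ * ‖(η 0 : ℂ) * a + (η 1 : ℂ) * b‖ ≤ ‖η‖ * ‖ζ‖ * (‖a‖ + ‖b‖) := by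
  set S := (η 0 : ℂ) * a + (η 1 : ℂ) * b with hS
  have e0 : ((η + ζ) 0 : ℂ) * S = ((cross ζ η : ℝ) : ℂ) * b := by
    simp only [PiLp.add_apply, Complex.ofReal_add] at h ⊢
    rw [hS, cross]; push_cast
    linear_combination (η 0 : ℂ) * h
  have e1 : ((η + ζ) 1 : ℂ) * S = -((cross ζ η : ℝ) : ℂ) * a := by
    simp only [PiLp.add_apply, Complex.ofReal_add] at h ⊢
    rw [hS, cross]; push_cast
    linear_combination (η 1 : ℂ) * h
  have n0 := congrArg (fun z => ‖z‖ ^ 2) e0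
  have n1 := congrArg (fun z => ‖z‖ ^ 2) e1
  simp only [norm_mul, norm_neg, Complex.norm_real, Real.norm_eq_abs, mul_pow, sq_abs] at n0 n1
  refine abs_le_of_sq_le_sq' ?_ (by positivity) |>.2
  have hc := abs_cross_le ζ η
  have hc2 : cross ζ η ^ 2 ≤ (‖ζ‖ * ‖η‖) ^ 2 := by
    rw [← sq_abs]; exact pow_le_pow_left₀ (abs_nonneg _) hc 2
  calc (‖η + ζ‖ * ‖S‖) ^ 2 = cross ζ η ^ 2 * (‖a‖ ^ 2 + ‖b‖ ^ 2) := by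
        rw [mul_pow, norm_sq_coord (η + ζ)]; linear_combination n0 + n1
    _ ≤ (‖ζ‖ * ‖η‖) ^ 2 * (‖a‖ + ‖b‖) ^ 2 := by
        gcongr
        nlinarith [norm_nonneg a, norm_nonneg b, mul_nonneg (norm_nonneg a) (norm_nonneg b)]
    _ = _ := by ring

end

/-- The transport form `∫ (w · ∇U) V` of a divergence-free field is controlled by the `L²` norm
of the field and the Dirichlet norms of its arguments. -/
theorem trilinear_sq_le {w : Fin 2 → E2 → ℝ} {K R : ℝ} (hw : ∀ j, Measurable (w j))
    (hb : ∀ j x, |w j x| ≤ K) (hs : ∀ j x, R < ‖x‖ → w j x = 0)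
    (hdiv : ∀ φ : E2 → ℝ, ContDiff ℝ (⊤ : ℕ∞) φ →
      ∫ x, (w 0 x * pd 0 φ x + w 1 x * pd 1 φ x) = 0)
    {U V : E2 → ℝ} (hU : ContDiff ℝ (⊤ : ℕ∞) U) (hUc : HasCompactSupport U)
    (hV : ContDiff ℝ (⊤ : ℕ∞) V) (hVc : HasCompactSupport V) :
    (∫ x, (w 0 x * pd 0 U x + w 1 x * pd 1 U x) * V x) ^ 2 ≤
      8 * Real.pi * ((∫ x, (w 0 x ^ 2 + w 1 x ^ 2)) * (∫ x, gsq U x) * ∫ x, gsq V x) := by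
  have hwi : ∀ j, Integrable (w j) := fun j => integrable_of_bounded_support (hw j) (hb j) (hs j)
  have hw2 : ∀ j, Integrable fun x => w j x ^ 2 := fun j =>
    (memLp_of_bounded_support (hw j) (hb j) (hs j)).integrable_sq
  set W : Fin 2 → E2 → ℂ := fun j => 𝓕⁻ (fun x => (w j x : ℂ)) with hWdef
  have hWc : ∀ j, Continuous (W j) := fun j => continuous_fourierInv (hwi j).ofReal
  set Us := toS hU hUc
  set Vs := toS hV hVc
  set F : E2 × E2 → ℂ := fun z => (2 * Real.pi * Complex.I) * ((𝓕 Us) z.1 * (𝓕 Vs) z.2 *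
    ((z.1 0 : ℂ) * W 0 (z.1 + z.2) + (z.1 1 : ℂ) * W 1 (z.1 + z.2))) with hF
  have hterm : ∀ j, ∫ x, (w j x : ℂ) * (∂_{ee j} Us) x * Vs x =
      ∫ z : E2 × E2, (𝓕 (∂_{ee j} Us)) z.1 * (𝓕 Vs) z.2 * W j (z.1 + z.2) := fun j =>
    integral_mul_schwartz (hwi j) _ _
  have hI : ((∫ x, (w 0 x * pd 0 U x + w 1 x * pd 1 U x) * V x : ℝ) : ℂ) = ∫ z, F z := by
    have hinteg : ∀ j, Integrable fun x => (w j x : ℂ) * (∂_{ee j} Us) x * Vs x := by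
      intro j
      have hc1 : Continuous fun x => pd j U x * V x :=
        (continuous_pd (hU.of_le (by simp)) j).mul hV.continuous
      have hc2 : HasCompactSupport fun x => pd j U x * V x := hVc.mul_left
      have : Integrable fun x => ((pd j U x * V x * w j x : ℝ) : ℂ) :=
        (integrable_mul_locallyIntegrable hc1 hc2 (hwi j).locallyIntegrable).ofReal
      refine this.congr (Filter.Eventually.of_forall fun x => ?_)
      change _ = (w j x : ℂ) * (∂_{ee j} Us) x * Vs x
      rw [lineDeriv_toS, toS_apply]; push_cast; ring
    rw [← integral_complex_ofReal]
    have e1 : ∀ x, (((w 0 x * pd 0 U x + w 1 x * pd 1 U x) * V x : ℝ) : ℂ) =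
        (w 0 x : ℂ) * (∂_{ee 0} Us) x * Vs x + (w 1 x : ℂ) * (∂_{ee 1} Us) x * Vs x := fun x => by
      rw [lineDeriv_toS, lineDeriv_toS, toS_apply]; push_cast; ring
    simp_rw [e1]
    rw [integral_add (hinteg 0) (hinteg 1), hterm 0, hterm 1, ← integral_add
      (integrable_mul_schwartz (hwi 0) _ _) (integrable_mul_schwartz (hwi 1) _ _)]
    refine integral_congr_ae (Filter.Eventually.of_forall fun z => ?_)
    simp only [fourier_lineDeriv_toS, hF, Us]
    ring
  have hdf : ∀ ξ : E2, (ξ 0 : ℂ) * W 0 ξ + (ξ 1 : ℂ) * W 1 ξ = 0 := fourierInv_div_free hwi hdiv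
  set cπ : ℝ≥0∞ := ENNReal.ofReal (2 * Real.pi)
  set P : E2 → ℝ≥0∞ := fun η => ‖(𝓕 Us) η‖ₑ with hP
  set B : E2 → ℝ≥0∞ := fun ζ => cπ * (‖ζ‖ₑ * ‖(𝓕 Vs) ζ‖ₑ) with hB
  set Q : E2 → ℝ≥0∞ := fun ξ => ‖W 0 ξ‖ₑ + ‖W 1 ξ‖ₑ with hQ
  have hcπ : ‖(2 * Real.pi * Complex.I : ℂ)‖ₑ = cπ := by
    rw [← ofReal_norm]; simp [abs_of_pos Real.pi_pos, cπ]
  have hFe : ∀ z, ‖F z‖ₑ = cπ * (‖(𝓕 Us) z.1‖ₑ * ‖(𝓕 Vs) z.2‖ₑ *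
      ‖(z.1 0 : ℂ) * W 0 (z.1 + z.2) + (z.1 1 : ℂ) * W 1 (z.1 + z.2)‖ₑ) := fun z => by
    rw [hF]; simp only [enorm_mul]; rw [← hcπ]; simp only [enorm_mul]
  have hT := lintegral_trilinear_sq_le (P := P) (B := B) (W := Q) (G := fun z => ‖F z‖ₑ)
    ((SchwartzMap.continuous (𝓕 Us)).enorm.measurable)
    (((measurable_enorm.mul (SchwartzMap.continuous (𝓕 Vs)).enorm.measurable)).const_mul cπ)
    ((hWc 0).enorm.measurable.add (hWc 1).enorm.measurable)
    (fun x y => by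
      have h := norm_transport_le (hdf (x + y))
      have h' := ENNReal.ofReal_le_ofReal h
      rw [ENNReal.ofReal_mul (norm_nonneg _), ENNReal.ofReal_add (norm_nonneg _) (norm_nonneg _)] at h'
      simp only [ofReal_norm] at h'
      rw [hFe]
      calc _ ≤ cπ * (‖(𝓕 Us) x‖ₑ * ‖(𝓕 Vs) y‖ₑ * (‖y‖ₑ * (‖W 0 (x + y)‖ₑ + ‖W 1 (x + y)‖ₑ))) := by
            gcongr
        _ = _ := by simp only [hP, hB, hQ]; ring)
    (fun x y hxy => by
      have h := norm_mul_transport_le (hdf (x + y))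
      have h' := ENNReal.ofReal_le_ofReal h
      rw [ENNReal.ofReal_mul (norm_nonneg _), ENNReal.ofReal_mul (by positivity),
        ENNReal.ofReal_mul (norm_nonneg _), ENNReal.ofReal_add (norm_nonneg _) (norm_nonneg _)] at h'
      simp only [ofReal_norm] at h'
      rw [hFe]
      have h2 : ‖(x 0 : ℂ) * W 0 (x + y) + (x 1 : ℂ) * W 1 (x + y)‖ₑ ≤
          ‖x‖ₑ * ‖y‖ₑ * (Q (x + y) / ‖x + y‖ₑ) := by
        rw [← mul_div_assoc, ENNReal.le_div_iff_mul_le (Or.inl (by simpa using hxy))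
          (Or.inl (by simp)), mul_comm]
        exact h'
      calc _ ≤ cπ * (‖(𝓕 Us) x‖ₑ * ‖(𝓕 Vs) y‖ₑ * (‖x‖ₑ * ‖y‖ₑ * (Q (x + y) / ‖x + y‖ₑ))) := by
            gcongr
        _ = _ := by simp only [hP, hB]; ring)
  have hPU : ∫⁻ x, (‖x‖ₑ * P x) ^ 2 ≤ ENNReal.ofReal (∫ x, gsq U x) := by
    rw [← lintegral_fourier_gsq hU hUc]
    refine lintegral_mono fun η => pow_le_pow_left' ?_ 2
    refine le_mul_of_one_le_left' ?_
    rw [ENNReal.one_le_ofReal]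
    linarith [Real.pi_gt_three]
  have hBV : ∫⁻ x, B x ^ 2 = ENNReal.ofReal (∫ x, gsq V x) := lintegral_fourier_gsq hV hVc
  have hWW : ∫⁻ x, Q x ^ 2 ≤ 2 * ENNReal.ofReal (∫ x, (w 0 x ^ 2 + w 1 x ^ 2)) := by
    calc ∫⁻ x, Q x ^ 2 ≤ ∫⁻ x, 2 * (‖W 0 x‖ₑ ^ 2 + ‖W 1 x‖ₑ ^ 2) := by
          refine lintegral_mono fun x => ?_
          have := ENNReal.ofReal_le_ofReal (add_sq_le (a := ‖W 0 x‖) (b := ‖W 1 x‖))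
          rw [ENNReal.ofReal_pow (by positivity), ENNReal.ofReal_mul (by norm_num),
            ENNReal.ofReal_add (by positivity) (by positivity),
            ENNReal.ofReal_add (by positivity) (by positivity),
            ENNReal.ofReal_pow (by positivity), ENNReal.ofReal_pow (by positivity)] at this
          simpa [ofReal_norm] using this
      _ = 2 * ((∫⁻ x, ‖W 0 x‖ₑ ^ 2) + ∫⁻ x, ‖W 1 x‖ₑ ^ 2) := by
          rw [lintegral_const_mul' _ _ (by simp), lintegral_add_left
            ((hWc 0).enorm.measurable.pow_const 2)]
      _ ≤ 2 * ((∫⁻ x, ENNReal.ofReal (w 0 x ^ 2)) + ∫⁻ x, ENNReal.ofReal (w 1 x ^ 2)) := by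
          exact mul_le_mul_right (add_le_add (lintegral_fourierInv_sq_le (hw 0) (hb 0) (hs 0))
            (lintegral_fourierInv_sq_le (hw 1) (hb 1) (hs 1))) _
      _ = _ := by
          rw [← ofReal_integral_eq_lintegral_ofReal (hw2 0)
            (Filter.Eventually.of_forall fun x => sq_nonneg _),
            ← ofReal_integral_eq_lintegral_ofReal (hw2 1)
            (Filter.Eventually.of_forall fun x => sq_nonneg _),
            ← ENNReal.ofReal_add (integral_nonneg fun x => sq_nonneg _)
              (integral_nonneg fun x => sq_nonneg _), integral_add (hw2 0) (hw2 1)]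
  have h0 : 0 ≤ ∫ x, (w 0 x ^ 2 + w 1 x ^ 2) := integral_nonneg fun x => by positivity
  have hgU : 0 ≤ ∫ x, gsq U x := integral_nonneg fun x => gsq_nonneg U x
  have hgV : 0 ≤ ∫ x, gsq V x := integral_nonneg fun x => gsq_nonneg V x
  rw [← ENNReal.ofReal_le_ofReal_iff (by positivity)]
  calc ENNReal.ofReal ((∫ x, (w 0 x * pd 0 U x + w 1 x * pd 1 U x) * V x) ^ 2)
      = ‖∫ z, F z‖ₑ ^ 2 := by
        rw [← hI, ← ofReal_norm, ← ENNReal.ofReal_pow (norm_nonneg _), Complex.norm_real,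
          Real.norm_eq_abs, sq_abs]
    _ ≤ (∫⁻ z, ‖F z‖ₑ) ^ 2 := pow_le_pow_left' (enorm_integral_le_lintegral_enorm _) 2
    _ ≤ _ := hT
    _ ≤ 4 * (ENNReal.ofReal Real.pi * ENNReal.ofReal (∫ x, gsq U x) *
        ENNReal.ofReal (∫ x, gsq V x) * (2 * ENNReal.ofReal (∫ x, (w 0 x ^ 2 + w 1 x ^ 2)))) := by
        rw [hBV]; gcongr
    _ = _ := by
        rw [show (8:ℝ) * Real.pi * ((∫ x, (w 0 x ^ 2 + w 1 x ^ 2)) * (∫ x, gsq U x) * ∫ x, gsq V x)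
          = 4 * (Real.pi * (∫ x, gsq U x) * (∫ x, gsq V x) * (2 * ∫ x, (w 0 x ^ 2 + w 1 x ^ 2)))
          from by ring]
        rw [ENNReal.ofReal_mul (by norm_num), ENNReal.ofReal_mul (by positivity),
          ENNReal.ofReal_mul (by positivity), ENNReal.ofReal_mul (by positivity),
          ENNReal.ofReal_mul (by norm_num)]
        norm_num

end fourier

/-- The bump function with inner radius `r / 2` and outer radius `r`. -/
def bumpR (r : ℝ) (hr : 0 < r) : ContDiffBump (0 : E2) := ⟨r / 2, r, half_pos hr, half_lt_self hr⟩

theorem ker_bumpR_le {r : ℝ} (hr : 0 < r) (x : E2) : ker (bumpR r hr) x ≤ 4 / (Real.pi * r ^ 2) := by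
  have h := (bumpR r hr).normed_le_div_measure_closedBall_rOut volume 2
    (by change r ≤ 2 * (r / 2); linarith) x
  refine h.trans (le_of_eq ?_)
  change _ / (volume : Measure E2).real (Metric.closedBall 0 r) = _
  rw [measureReal_def, volume_closedBall_E2]
  simp [ENNReal.toReal_ofReal hr.le, ENNReal.toReal_ofReal Real.pi_pos.le]
  norm_num [mul_comm]

section
variable (b : ContDiffBump (0 : E2))

theorem integrable_segment {g : E2 → ℝ} (hg : Continuous g) (hi : Integrable g) (p q : E2) :
    Integrable (fun z : E2 × ℝ => g (z.1 - (p + z.2 • (q - p))))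
      (volume.prod (volume.restrict (Set.Ioc (0:ℝ) 1))) := by
  have hcont : Continuous (fun z : E2 × ℝ => g (z.1 - (p + z.2 • (q - p)))) := by fun_prop
  rw [integrable_prod_iff' hcont.aestronglyMeasurable]
  refine ⟨Filter.Eventually.of_forall fun s => hi.comp_sub_right (p + s • (q - p)), ?_⟩
  have : ∀ s : ℝ, ∫ x, ‖g (x - (p + s • (q - p)))‖ = ∫ x, ‖g x‖ := fun s =>
    integral_sub_right_eq_self (fun x => ‖g x‖) _
  simp_rw [this]
  exact integrable_const _

theorem integrable_ker_segment (p q : E2) :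
    Integrable (fun z : E2 × ℝ => ker b (z.1 - (p + z.2 • (q - p))))
      (volume.prod (volume.restrict (Set.Ioc (0:ℝ) 1))) :=
  integrable_segment (ker_continuous b)
    ((ker_continuous b).integrable_of_hasCompactSupport (ker_compact b)) p q

theorem savg_ker_eq (p q x : E2) : savg (fun y => ker b (x - y)) p q =
    ∫ s in Set.Ioc (0:ℝ) 1, ker b (x - (p + s • (q - p))) := by
  rw [savg, intervalIntegral.integral_of_le zero_le_one]

theorem savg_ker_nonneg (p q x : E2) : 0 ≤ savg (fun y => ker b (x - y)) p q := by
  rw [savg_ker_eq]; exact integral_nonneg fun s => ker_nonneg b _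

theorem integrable_savg_ker (p q : E2) : Integrable fun x => savg (fun y => ker b (x - y)) p q := by
  simp_rw [savg_ker_eq]
  exact (integrable_ker_segment b p q).integral_prod_left

theorem integral_savg_ker (p q : E2) : ∫ x, savg (fun y => ker b (x - y)) p q = 1 := by
  simp_rw [savg_ker_eq]
  rw [integral_integral_swap (integrable_ker_segment b p q)]
  have : ∀ s : ℝ, ∫ x, ker b (x - (p + s • (q - p))) = 1 := fun s => by
    rw [integral_sub_right_eq_self (ker b), ker_integral]
  simp_rw [this]
  simp

end

theorem savg_ker_bumpR_le {r : ℝ} (hr : 0 < r) (p q x : E2) :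
    savg (fun y => ker (bumpR r hr) (x - y)) p q ≤ 4 / (Real.pi * r ^ 2) := by
  have hcont : Continuous fun s : ℝ => ker (bumpR r hr) (x - (p + s • (q - p))) :=
    (ker_continuous _).comp (by fun_prop)
  have h := intervalIntegral.integral_mono_on (μ := volume) (a := (0:ℝ)) (b := 1) zero_le_one
    (hcont.intervalIntegrable 0 1) (intervalIntegrable_const (μ := volume) (c := 4 / (Real.pi * r ^ 2)))
    (fun s _ => ker_bumpR_le hr _)
  refine h.trans (le_of_eq ?_)
  simp

namespace Mesh
variable {Ω : Set E2} (M : Mesh Ω)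

/-- The jump of a piecewise constant function, extended by zero outside the domain. -/
def jmp (u : Tri → ℝ) (σ : E2 × E2) : ℝ :=
  u (M.Kof σ) - if σ ∈ M.intEdges then u (M.Lof σ) else 0

/-- The sum of the squared jumps of a piecewise constant function. -/
def jsq (u : Tri → ℝ) : ℝ := ∑ σ ∈ M.edges, M.jmp u σ ^ 2

theorem jsq_nonneg (u : Tri → ℝ) : 0 ≤ M.jsq u := Finset.sum_nonneg fun _ _ => sq_nonneg _

/-- The piecewise constant function with given values on the triangles. -/
def step (u : Tri → ℝ) : E2 → ℝ := M.glue fun t _ => u t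

theorem sum_mul_integral_fderiv (e : Tri → E2) (u : Tri → ℝ) {φ : E2 → ℝ} (hφ : ContDiff ℝ 1 φ) :
    ∑ t ∈ M.tris, u t * ∫ x in t.carrier, fderiv ℝ φ x (e t) =
      ∑ σ ∈ M.intEdges, (u (M.Kof σ) * ⟪e (M.Kof σ), (M.Kof σ).nrm σ⟫ -
        u (M.Lof σ) * ⟪e (M.Lof σ), (M.Kof σ).nrm σ⟫) * (elen σ * savg φ σ.1 σ.2) +
      ∑ σ ∈ M.extEdges, u (M.Kof σ) * ⟪e (M.Kof σ), (M.Kof σ).nrm σ⟫ * (elen σ * savg φ σ.1 σ.2) := by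
  have h := M.sum_tris_edges (fun t σ => u t * ⟪e t, t.nrm σ⟫ * (elen σ * savg φ σ.1 σ.2))
    (fun t _ i => by rw [savg_edge_swap, t.nrm_edge_swap, Tri.elen_swap])
  have h1 : ∑ t ∈ M.tris, u t * ∫ x in t.carrier, fderiv ℝ φ x (e t) =
      ∑ t ∈ M.tris, ∑ i, u t * ⟪e t, t.nrm (t.edge i)⟫ *
        (elen (t.edge i) * savg φ (t.edge i).1 (t.edge i).2) := by
    refine Finset.sum_congr rfl fun t _ => ?_
    rw [t.integral_fderiv hφ, Finset.mul_sum]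
    refine Finset.sum_congr rfl fun i _ => ?_
    rw [← t.elen_smul_nrm_edge, real_inner_smul_left, real_inner_comm, smul_eq_mul]
    change _ * (_ * savg φ (t.edge i).1 (t.edge i).2) = _
    ring
  rw [h1, h]
  congr 1
  refine Finset.sum_congr rfl fun σ hσ => ?_
  rw [M.nrm_Lof hσ, inner_neg_right]
  ring

theorem continuous_step_fun (u : Tri → ℝ) : ∀ t ∈ M.tris, Continuous fun _ : E2 => u t :=
  fun _ _ => continuous_const

theorem locallyIntegrable_step (u : Tri → ℝ) : LocallyIntegrable (M.step u) :=
  (memLp_one_iff_integrable.1 (M.memLp_glue (M.continuous_step_fun u) 1)).locallyIntegrable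

theorem pd_moll_step (b : ContDiffBump (0 : E2)) (u : Tri → ℝ) (j : Fin 2) (x : E2) :
    pd j (moll b (M.step u)) x = -∑ σ ∈ M.edges, M.jmp u σ *
      (elen σ * ⟪ee j, (M.Kof σ).nrm σ⟫) * savg (fun y => ker b (x - y)) σ.1 σ.2 := by
  have hφ : ContDiff ℝ 1 fun y => ker b (x - y) :=
    (ker_contDiff b (n := 1)).comp (contDiff_const.sub contDiff_id)
  rw [pd_moll_eq b (M.locallyIntegrable_step u), step,
    M.integral_mul_glue (M.continuous_step_fun u) (continuous_pd hφ j)]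
  simp_rw [integral_const_mul]
  congr 1
  refine (M.sum_mul_integral_fderiv (fun _ => ee j) u hφ).trans ?_
  rw [M.sum_edges]
  congr 1 <;> refine Finset.sum_congr rfl fun σ hσ => ?_
  · rw [jmp, if_pos hσ]; ring
  · rw [jmp, if_neg (Finset.disjoint_right.1 M.disj_edges hσ)]; ring

theorem sum_savg_ker_le {Creg : ℝ} (hc : 0 < Creg) (hM : M.Regular Creg) {r : ℝ} (hr : 0 < r)
    (hrh : r ≤ M.meshSize) (x : E2) :
    ∑ σ ∈ M.edges, savg (fun y => ker (bumpR r hr) (x - y)) σ.1 σ.2 ≤ 192 / (Creg ^ 2 * r ^ 2) := by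
  set g : E2 × E2 → ℝ := fun σ => savg (fun y => ker (bumpR r hr) (x - y)) σ.1 σ.2 with hg
  have g0 : ∀ σ, 0 ≤ g σ := fun σ => savg_ker_nonneg _ _ _ _
  have hh := M.meshSize_pos
  have h := M.sum_tris_edges (fun _ σ => g σ) (fun t _ i => savg_edge_swap _ t i)
  have h1 : ∑ σ ∈ M.edges, g σ ≤ ∑ t ∈ M.tris, ∑ i, g (t.edge i) := by
    rw [h, M.sum_edges]
    gcongr with σ hσ
    linarith [g0 σ]
  set S := M.tris.filter fun t => (t.carrier ∩ Metric.closedBall x r).Nonempty with hS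
  have h2 : ∑ t ∈ M.tris, ∑ i, g (t.edge i) = ∑ t ∈ S, ∑ i, g (t.edge i) := by
    symm
    refine Finset.sum_subset (Finset.filter_subset _ _) fun t ht hn => Finset.sum_eq_zero fun i _ => ?_
    rw [hg]
    change savg _ _ _ = 0
    rw [savg_ker_eq]
    refine setIntegral_eq_zero_of_forall_eq_zero fun s hs => ker_eq_zero _ ?_
    change r ≤ _
    by_contra hlt
    refine hn (Finset.mem_filter.2 ⟨ht, (t.edge i).1 + s • ((t.edge i).2 - (t.edge i).1), ?_, ?_⟩)
    · refine (convex_convexHull ℝ _).add_smul_sub_mem (t.vtx_mem _) (t.vtx_mem _)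
        ⟨hs.1.le, hs.2⟩
    · rw [mem_closedBall_iff_norm, norm_sub_rev]; exact (not_le.1 hlt).le
  have h3 : ∑ t ∈ S, ∑ i, g (t.edge i) ≤ S.card * (3 * (4 / (Real.pi * r ^ 2))) := by
    rw [← nsmul_eq_mul]
    refine Finset.sum_le_card_nsmul _ _ _ fun t _ => ?_
    refine (Finset.sum_le_card_nsmul _ _ _ fun i _ => savg_ker_bumpR_le hr _ _ _).trans ?_
    simp
  have h4 : (S.card : ℝ) ≤ 16 * Real.pi / Creg ^ 2 := by
    have := M.card_near_le hc hM x hr.le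
    rw [← hS] at this
    rw [le_div_iff₀ (by positivity)]
    have h5 : Real.pi * (r + M.meshSize) ^ 2 ≤ Real.pi * (4 * M.meshSize ^ 2) := by
      gcongr; nlinarith
    have : (S.card : ℝ) * Creg ^ 2 * M.meshSize ^ 2 ≤ 16 * Real.pi * M.meshSize ^ 2 := by linarith
    exact le_of_mul_le_mul_right this (by positivity)
  calc _ ≤ (S.card : ℝ) * (3 * (4 / (Real.pi * r ^ 2))) := h1.trans (h2.trans_le h3)
    _ ≤ 16 * Real.pi / Creg ^ 2 * (3 * (4 / (Real.pi * r ^ 2))) := by gcongr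
    _ = _ := by field_simp; norm_num

theorem hasCompactSupport_moll_step (b : ContDiffBump (0 : E2)) {ρ : ℝ}
    (hρ : ∀ x ∈ closure Ω, ‖x‖ ≤ ρ) (u : Tri → ℝ) : HasCompactSupport (moll b (M.step u)) :=
  hasCompactSupport_of_support (R := ρ + b.rOut) fun _ hx => moll_eq_zero b (R := ρ)
    (fun y hy => M.glue_eq_zero (fun hm => absurd (hρ y hm) (not_le.2 hy)) _) hx

theorem integral_gsq_moll_step_le {Creg : ℝ} (hc : 0 < Creg) (hM : M.Regular Creg) {r : ℝ} (hr : 0 < r)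
    (hrh : r ≤ M.meshSize) {ρ : ℝ} (hρ : ∀ x ∈ closure Ω, ‖x‖ ≤ ρ) (u : Tri → ℝ) :
    ∫ x, gsq (moll (bumpR r hr) (M.step u)) x ≤
      384 * M.meshSize ^ 2 / (Creg ^ 2 * r ^ 2) * M.jsq u := by
  set b := bumpR r hr
  set U := moll b (M.step u) with hU
  have hUs : ContDiff ℝ 1 U := moll_contDiff b (M.locallyIntegrable_step u) (n := 1)
  have hUc : HasCompactSupport U := M.hasCompactSupport_moll_step b hρ u
  have hpt : ∀ j x, pd j U x ^ 2 ≤ ∑ σ ∈ M.edges, 192 * M.meshSize ^ 2 / (Creg ^ 2 * r ^ 2) *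
      M.jmp u σ ^ 2 * savg (fun y => ker b (x - y)) σ.1 σ.2 := by
    intro j x
    rw [hU, M.pd_moll_step, neg_sq]
    refine (Finset.sum_sq_le_sum_mul_sum_of_sq_le_mul M.edges
      (f := fun σ => savg (fun y => ker b (x - y)) σ.1 σ.2)
      (g := fun σ => (M.jmp u σ * (elen σ * ⟪ee j, (M.Kof σ).nrm σ⟫)) ^ 2 *
        savg (fun y => ker b (x - y)) σ.1 σ.2)
      (fun σ _ => savg_ker_nonneg _ _ _ _)
      (fun σ _ => mul_nonneg (sq_nonneg _) (savg_ker_nonneg _ _ _ _)) (fun σ _ => le_of_eq (by ring))).trans ?_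
    have hsum := M.sum_savg_ker_le hc hM hr hrh x
    calc _ ≤ 192 / (Creg ^ 2 * r ^ 2) * ∑ σ ∈ M.edges, (M.jmp u σ ^ 2 * M.meshSize ^ 2) *
          savg (fun y => ker b (x - y)) σ.1 σ.2 := by
          refine mul_le_mul hsum (Finset.sum_le_sum fun σ hσ => ?_)
            (Finset.sum_nonneg fun σ _ => mul_nonneg (sq_nonneg _) (savg_ker_nonneg _ _ _ _))
            (by positivity)
          refine mul_le_mul_of_nonneg_right ?_ (savg_ker_nonneg _ _ _ _)
          rw [mul_pow]
          refine mul_le_mul_of_nonneg_left ?_ (sq_nonneg _)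
          obtain ⟨k1, k2⟩ := M.Kof_mem σ hσ
          have a1 := M.elen_le_of_hasEdge k1 k2
          have a2 : |⟪ee j, (M.Kof σ).nrm σ⟫| ≤ 1 := by
            refine (abs_real_inner_le_norm _ _).trans ?_
            rw [norm_ee, one_mul]; exact norm_nrm_le _ _
          rw [← sq_abs, abs_mul, abs_of_nonneg (show 0 ≤ elen σ from dist_nonneg)]
          refine pow_le_pow_left₀ (mul_nonneg dist_nonneg (abs_nonneg _)) ?_ 2
          calc elen σ * |⟪ee j, (M.Kof σ).nrm σ⟫| ≤ M.meshSize * 1 :=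
                mul_le_mul a1 a2 (abs_nonneg _) M.meshSize_pos.le
            _ = _ := mul_one _
      _ = _ := by rw [Finset.mul_sum]; exact Finset.sum_congr rfl fun σ _ => by ring
  have hinteg : ∀ σ ∈ M.edges, Integrable fun x => 192 * M.meshSize ^ 2 / (Creg ^ 2 * r ^ 2) *
      M.jmp u σ ^ 2 * savg (fun y => ker b (x - y)) σ.1 σ.2 := fun σ _ =>
    (integrable_savg_ker b _ _).const_mul _
  have hpd : ∀ j, Integrable fun x => pd j U x ^ 2 := by
    intro j
    have h1 : HasCompactSupport fun x => pd j U x * pd j U x :=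
      (pd_hasCompactSupport hUc j).mul_left
    have h2 : Continuous fun x => pd j U x * pd j U x := (continuous_pd hUs j).mul (continuous_pd hUs j)
    simpa only [sq] using h2.integrable_of_hasCompactSupport h1
  have hj : ∀ j, ∫ x, pd j U x ^ 2 ≤ 192 * M.meshSize ^ 2 / (Creg ^ 2 * r ^ 2) * M.jsq u := by
    intro j
    refine (integral_mono (hpd j) (integrable_finsetSum _ hinteg) (hpt j)).trans (le_of_eq ?_)
    rw [integral_finsetSum _ hinteg, jsq, Finset.mul_sum]
    refine Finset.sum_congr rfl fun σ _ => ?_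
    rw [integral_const_mul, integral_savg_ker, mul_one]
  have : ∫ x, gsq U x = (∫ x, pd 0 U x ^ 2) + ∫ x, pd 1 U x ^ 2 := integral_add (hpd 0) (hpd 1)
  rw [this]
  calc _ ≤ _ := add_le_add (hj 0) (hj 1)
    _ = _ := by ring

end Mesh

theorem le_two_mul_of_forall_young {x C A B : ℝ} (hC : 0 ≤ C) (hA : 0 ≤ A) (hB : 0 ≤ B)
    (h : ∀ s > 0, x ≤ C * (s * A ^ 2 + s⁻¹ * B ^ 2)) : x ≤ 2 * C * (A * B) := by
  have h1 : ∀ ε > 0, x ≤ 2 * C * ((A + ε) * (B + ε)) := by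
    intro ε hε
    have hs := h ((B + ε) / (A + ε)) (by positivity)
    refine hs.trans ?_
    have e1 : (B + ε) / (A + ε) * A ^ 2 ≤ (A + ε) * (B + ε) := by
      rw [div_mul_eq_mul_div, div_le_iff₀ (by positivity)]
      have : (B + ε) * A ^ 2 ≤ (B + ε) * (A + ε) ^ 2 := by gcongr; linarith
      linarith
    have e2 : ((B + ε) / (A + ε))⁻¹ * B ^ 2 ≤ (A + ε) * (B + ε) := by
      rw [inv_div, div_mul_eq_mul_div, div_le_iff₀ (by positivity)]
      have : (A + ε) * B ^ 2 ≤ (A + ε) * (B + ε) ^ 2 := by gcongr; linarith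
      linarith
    nlinarith
  have hlim : Filter.Tendsto (fun ε : ℝ => 2 * C * ((A + ε) * (B + ε))) (nhdsWithin 0 (Set.Ioi 0))
      (nhds (2 * C * ((A + 0) * (B + 0)))) :=
    ((by fun_prop : Continuous fun ε : ℝ => 2 * C * ((A + ε) * (B + ε))).tendsto 0).mono_left
      nhdsWithin_le_nhds
  rw [add_zero, add_zero] at hlim
  exact ge_of_tendsto hlim (Filter.eventually_of_mem self_mem_nhdsWithin fun ε hε => h1 ε hε)

namespace Mesh
variable {Ω : Set E2} (M : Mesh Ω)

theorem moll_step_eq (b : ContDiffBump (0 : E2)) (u : Tri → ℝ) {t : Tri} (ht : t ∈ M.tris) {x : E2}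
    (hx : Metric.closedBall x b.rOut ⊆ t.carrier) : moll b (M.step u) x = u t := by
  have h : ∀ᵐ y : E2, ker b (x - y) * M.step u y = ker b (x - y) * u t := by
    filter_upwards [t.inn_ae_eq] with y hy
    by_cases hc : y ∈ t.carrier
    · have hi : y ∈ t.inn := (iff_of_eq hy).2 hc
      rw [step, M.glue_of_mem ht hi]
    · rw [ker_eq_zero b (x := x - y), zero_mul, zero_mul]
      by_contra hlt
      refine hc (hx ?_)
      rw [mem_closedBall_iff_norm, norm_sub_rev]
      exact (not_le.1 hlt).le
  rw [moll, integral_congr_ae h, integral_mul_const, integral_ker_sub, one_mul]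

theorem glue_mul (f : Tri → E2 → ℝ) (g : E2 → ℝ) (x : E2) :
    M.glue f x * g x = M.glue (fun t y => f t y * g y) x := by
  simp only [glue, Finset.sum_mul]
  refine Finset.sum_congr rfl fun t _ => ?_
  by_cases h : x ∈ t.inn <;> simp [h]

theorem glue_add (f g : Tri → E2 → ℝ) (x : E2) :
    M.glue f x + M.glue g x = M.glue (fun t y => f t y + g t y) x := by
  simp only [glue, ← Finset.sum_add_distrib]
  refine Finset.sum_congr rfl fun t _ => ?_
  by_cases h : x ∈ t.inn <;> simp [h]

theorem glue_of_forall_notMem {x : E2} (h : ∀ t ∈ M.tris, x ∉ t.inn) (f : Tri → E2 → ℝ) :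
    M.glue f x = 0 :=
  Finset.sum_eq_zero fun t ht => Set.indicator_of_notMem (h t ht) _

theorem integral_glue {f : Tri → E2 → ℝ} (hf : ∀ t ∈ M.tris, Continuous (f t)) :
    ∫ x, M.glue f x = ∑ t ∈ M.tris, ∫ x in t.carrier, f t x := by
  simpa using M.integral_mul_glue hf (g := fun _ => 1) continuous_const

/-- The components of a piecewise constant vector field. -/
def comp (w : Tri → E2) (j : Fin 2) : E2 → ℝ := M.step fun t => w t j

theorem measurable_comp (w : Tri → E2) (j : Fin 2) : Measurable (M.comp w j) :=
  Finset.measurable_fun_sum _ fun t _ => measurable_const.indicator t.measurableSet_inn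

theorem abs_comp_le (w : Tri → E2) (j : Fin 2) (x : E2) :
    |M.comp w j x| ≤ ∑ t ∈ M.tris, ‖w t‖ := by
  refine (Finset.abs_sum_le_sum_abs _ _).trans (Finset.sum_le_sum fun t _ => ?_)
  by_cases h : x ∈ t.inn
  · simpa [h] using PiLp.norm_apply_le (w t) j
  · simp [h]

theorem comp_grad (w : Tri → E2) (φ : E2 → ℝ) (x : E2) :
    M.comp w 0 x * pd 0 φ x + M.comp w 1 x * pd 1 φ x =
      M.glue (fun t y => fderiv ℝ φ y (w t)) x := by
  rw [comp, comp, step, step, M.glue_mul _ (pd 0 φ), M.glue_mul _ (pd 1 φ), M.glue_add]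
  simp only [fderiv_apply_eq]

theorem integral_comp_sq (w : Tri → E2) :
    ∫ x, (M.comp w 0 x ^ 2 + M.comp w 1 x ^ 2) = M.l2normP0 w ^ 2 := by
  have h : ∀ x, M.comp w 0 x ^ 2 + M.comp w 1 x ^ 2 = M.glue (fun t _ => ‖w t‖ ^ 2) x := by
    intro x
    by_cases hx : ∃ t ∈ M.tris, x ∈ t.inn
    · obtain ⟨t, ht, hm⟩ := hx
      rw [comp, comp, step, step, M.glue_of_mem ht hm, M.glue_of_mem ht hm, M.glue_of_mem ht hm,
        norm_sq_coord]
    · push Not at hx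
      rw [comp, comp, step, step, M.glue_of_forall_notMem hx, M.glue_of_forall_notMem hx,
        M.glue_of_forall_notMem hx]
      simp
  simp_rw [h]
  rw [M.integral_glue fun _ _ => continuous_const, l2normP0_sq]
  refine Finset.sum_congr rfl fun t _ => ?_
  rw [Tri.integral_const_carrier, smul_eq_mul]

theorem sum_mul_integral_fderiv_RT0 {w : Tri → E2} (hw : M.IsRT0const w) (v : Tri → ℝ) {φ : E2 → ℝ}
    (hφ : ContDiff ℝ 1 φ) :
    ∑ t ∈ M.tris, v t * ∫ x in t.carrier, fderiv ℝ φ x (w t) =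
      ∑ σ ∈ M.intEdges, M.flux w σ * savg φ σ.1 σ.2 * (v (M.Kof σ) - v (M.Lof σ)) := by
  rw [M.sum_mul_integral_fderiv w v hφ, Finset.sum_eq_zero (s := M.extEdges) fun σ hσ => by
    rw [hw.2 σ hσ]; ring, add_zero]
  refine Finset.sum_congr rfl fun σ hσ => ?_
  have := hw.1 σ hσ
  rw [inner_sub_left, sub_eq_zero] at this
  rw [this, flux]; ring

theorem integral_comp_grad_eq_zero {w : Tri → E2} (hw : M.IsRT0const w) {φ : E2 → ℝ}
    (hφ : ContDiff ℝ 1 φ) :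
    ∫ x, (M.comp w 0 x * pd 0 φ x + M.comp w 1 x * pd 1 φ x) = 0 := by
  simp_rw [M.comp_grad]
  rw [M.integral_glue fun t _ => (hφ.continuous_fderiv one_ne_zero).clm_apply continuous_const]
  have h := M.sum_mul_integral_fderiv_RT0 hw (fun _ => 1) hφ
  simpa using h

/-- The centered convection form for a scalar transported quantity. -/
def sch (w : Tri → E2) (u v : Tri → ℝ) : ℝ :=
  ∑ σ ∈ M.intEdges, M.flux w σ / 2 * ((u (M.Kof σ) + u (M.Lof σ)) * (v (M.Kof σ) - v (M.Lof σ)))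

theorem sch_eq {w : Tri → E2} (hw : M.IsRT0const w) (u v : Tri → ℝ) {U V : E2 → ℝ}
    (hU : ContDiff ℝ 1 U) (hV : Continuous V) :
    M.sch w u v = (∫ x, (M.comp w 0 x * pd 0 U x + M.comp w 1 x * pd 1 U x) * V x)
      - (∑ t ∈ M.tris, ∫ x in t.carrier, fderiv ℝ U x (w t) * (V x - v t))
      - ∑ σ ∈ M.intEdges, M.flux w σ * ((savg U σ.1 σ.2 - (u (M.Kof σ) + u (M.Lof σ)) / 2) *
          (v (M.Kof σ) - v (M.Lof σ))) := by
  have hd : ∀ t, Continuous fun x => fderiv ℝ U x (w t) := fun t =>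
    (hU.continuous_fderiv one_ne_zero).clm_apply continuous_const
  simp_rw [M.comp_grad, M.glue_mul]
  rw [M.integral_glue (f := fun t y => fderiv ℝ U y (w t) * V y) fun t _ => (hd t).mul hV, ← Finset.sum_sub_distrib]
  have h1 : ∀ t ∈ M.tris, (∫ x in t.carrier, fderiv ℝ U x (w t) * V x) -
      ∫ x in t.carrier, fderiv ℝ U x (w t) * (V x - v t) =
      v t * ∫ x in t.carrier, fderiv ℝ U x (w t) := by
    intro t _
    have i1 : IntegrableOn (fun x => fderiv ℝ U x (w t) * V x) t.carrier :=
      ((hd t).mul hV).continuousOn.integrableOn_compact t.isCompact_carrier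
    have i2 : IntegrableOn (fun x => fderiv ℝ U x (w t) * (V x - v t)) t.carrier :=
      ((hd t).mul (hV.sub continuous_const)).continuousOn.integrableOn_compact t.isCompact_carrier
    rw [← integral_sub i1 i2, ← integral_const_mul]
    congr 1; ext x; ring
  rw [Finset.sum_congr rfl h1, M.sum_mul_integral_fderiv_RT0 hw v hU, ← Finset.sum_sub_distrib, sch]
  exact Finset.sum_congr rfl fun σ _ => by ring

theorem integral_moll_step_sub_sq_le {Creg : ℝ} (hc : 0 < Creg) (hM : M.Regular Creg) {r : ℝ}
    (hr : 0 < r) (hrh : r = Creg ^ 2 * M.meshSize / 12) (u : Tri → ℝ) {t : Tri} (ht : t ∈ M.tris) :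
    ∫ x in t.carrier, (moll (bumpR r hr) (M.step u) x - u t) ^ 2 ≤
      192 / Creg ^ 4 * M.meshSize ^ 2 *
        ∫ x in t.carrier, gsq (moll (bumpR r hr) (M.step u)) x := by
  set b := bumpR r hr with hb
  set U := moll b (M.step u) with hUdef
  have hU : ContDiff ℝ 1 U := moll_contDiff b (M.locallyIntegrable_step u) (n := 1)
  have hh := M.meshSize_pos
  have hbo : b.rOut = r := rfl
  have hsub := M.ball_centroid_subset hc hM ht
  have hB : Metric.closedBall t.centroid r ⊆ t.carrier :=
    (Metric.closedBall_subset_closedBall (by rw [hrh]; nlinarith [mul_pos (pow_pos hc 2) hh])).trans hsub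
  have hUB : ∀ y ∈ Metric.closedBall t.centroid r, U y = u t := fun y hy => by
    refine M.moll_step_eq b u ht (Set.Subset.trans (fun z hz => ?_) hsub)
    rw [hbo] at hz
    have := dist_triangle z y t.centroid
    rw [Metric.mem_closedBall] at hz hy ⊢
    rw [hrh] at hz hy
    linarith
  clear_value U
  have hosc := osc_convex_le t.isCompact_carrier (convex_convexHull ℝ _)
    (fun x hx y hy => M.dist_le_of_mem ht hx hy) hU
  have i1 : IntegrableOn (fun x => (U x - u t) ^ 2) t.carrier :=
    ((hU.continuous.sub continuous_const).pow 2).continuousOn.integrableOn_compact t.isCompact_carrier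
  have i2 : IntegrableOn (fun x => gsq U x) t.carrier :=
    (continuous_gsq hU).continuousOn.integrableOn_compact t.isCompact_carrier
  have hlow : (∫⁻ x in t.carrier, ENNReal.ofReal ((U x - u t) ^ 2)) *
      volume (Metric.closedBall t.centroid r) ≤ osc t.carrier U := by
    rw [osc, ← lintegral_mul_const' _ _ (by rw [volume_closedBall_E2]; finiteness)]
    refine lintegral_mono fun x => ?_
    rw [← setLIntegral_const]
    refine le_trans (le_of_eq ?_) (lintegral_mono_set hB)
    refine setLIntegral_congr_fun Metric.isClosed_closedBall.measurableSet fun y hy => ?_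
    rw [hUB y hy]
  have hv : volume t.carrier = ENNReal.ofReal t.area := by
    rw [Tri.area, ENNReal.ofReal_toReal t.isCompact_carrier.measure_lt_top.ne]
  rw [volume_closedBall_E2, ← ofReal_integral_eq_lintegral_ofReal i1
    (Filter.Eventually.of_forall fun _ => sq_nonneg _)] at hlow
  rw [hv, ← ofReal_integral_eq_lintegral_ofReal i2
    (Filter.Eventually.of_forall fun _ => gsq_nonneg _ _)] at hosc
  have key := hlow.trans hosc
  set A := ∫ x in t.carrier, (U x - u t) ^ 2 with hA
  set G := ∫ x in t.carrier, gsq U x with hG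
  have hA0 : 0 ≤ A := integral_nonneg fun _ => sq_nonneg _
  have hG0 : 0 ≤ G := integral_nonneg fun _ => gsq_nonneg _ _
  have ha0 := t.area_pos.le
  rw [← ENNReal.ofReal_pow hr.le, ← ENNReal.ofReal_mul (by positivity), ← ENNReal.ofReal_mul hA0,
    ← ENNReal.ofReal_mul (by positivity), ← ENNReal.ofReal_mul (by positivity),
    ENNReal.ofReal_le_ofReal_iff (by positivity)] at key
  have hal := M.area_le ht
  have hpi := Real.pi_gt_three
  have e1 : A * (r ^ 2 * 3) ≤ 4 * M.meshSize ^ 2 * M.meshSize ^ 2 * G := by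
    calc A * (r ^ 2 * 3) ≤ A * (r ^ 2 * Real.pi) := by gcongr
      _ ≤ _ := key
      _ ≤ _ := by gcongr
  rw [hrh] at e1
  have e2 : A * (Creg ^ 4 * 3) * M.meshSize ^ 2 ≤ 576 * M.meshSize ^ 2 * G * M.meshSize ^ 2 := by
    nlinarith
  have e3 := le_of_mul_le_mul_right e2 (by positivity)
  rw [show 192 / Creg ^ 4 * M.meshSize ^ 2 * G = (192 * M.meshSize ^ 2 * G) / Creg ^ 4 by ring,
    le_div_iff₀ (by positivity)]
  linarith

end Mesh

theorem abs_mul_le_young {s : ℝ} (hs : 0 < s) (a b : ℝ) : |a * b| ≤ s / 2 * a ^ 2 + s⁻¹ / 2 * b ^ 2 := by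
  have h := sq_nonneg (s * |a| - |b|)
  rw [abs_mul, ← sq_abs a, ← sq_abs b]
  have h2 : s * (|a| * |b|) ≤ s * (s / 2 * |a| ^ 2 + s⁻¹ / 2 * |b| ^ 2) := by
    have : s * (s / 2 * |a| ^ 2 + s⁻¹ / 2 * |b| ^ 2) = s ^ 2 / 2 * |a| ^ 2 + |b| ^ 2 / 2 := by
      field_simp
    rw [this]; nlinarith
  exact le_of_mul_le_mul_left h2 hs

theorem Tri.tavg_sub_sq_le (t : Tri) {U : E2 → ℝ} (hU : Continuous U) (c : ℝ) :
    (t.tavg U - c) ^ 2 ≤ t.area⁻¹ * ∫ x in t.carrier, (U x - c) ^ 2 := by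
  have ha := t.area_pos
  have h := t.norm_integral_sq_le (hU.sub (continuous_const (y := c)))
  have i1 : IntegrableOn U t.carrier := hU.continuousOn.integrableOn_compact t.isCompact_carrier
  have i2 : IntegrableOn (fun _ : E2 => c) t.carrier :=
    continuous_const.continuousOn.integrableOn_compact t.isCompact_carrier
  have e : t.tavg U - c = t.area⁻¹ * ∫ x in t.carrier, (U x - c) := by
    rw [integral_sub i1 i2, Tri.integral_const_carrier, Tri.tavg, smul_eq_mul, smul_eq_mul]
    field_simp
  rw [e, mul_pow, sq t.area⁻¹, mul_assoc]
  refine mul_le_mul_of_nonneg_left ?_ (inv_pos.2 ha).le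
  rw [inv_mul_le_iff₀ ha]
  exact h

namespace Mesh
variable {Ω : Set E2} (M : Mesh Ω)

theorem abs_sum_integral_fderiv_mul_le {Creg : ℝ} (hc : 0 < Creg) (hM : M.Regular Creg)
    (w : Tri → E2) (v : Tri → ℝ) {U V : E2 → ℝ} (hU : ContDiff ℝ 1 U) (hV : Continuous V)
    {s : ℝ} (hs : 0 < s) :
    |∑ t ∈ M.tris, ∫ x in t.carrier, fderiv ℝ U x (w t) * (V x - v t)| ≤
      2 / Creg * M.l2normP0 w * (s * (∑ t ∈ M.tris, ∫ x in t.carrier, gsq U x) +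
        s⁻¹ * ((M.meshSize ^ 2)⁻¹ * ∑ t ∈ M.tris, ∫ x in t.carrier, (V x - v t) ^ 2)) := by
  have hh := M.meshSize_pos
  set h := M.meshSize
  have hl := M.l2normP0_nonneg w
  rw [Finset.mul_sum, Finset.mul_sum, Finset.mul_sum, ← Finset.sum_add_distrib, Finset.mul_sum]
  refine (Finset.abs_sum_le_sum_abs _ _).trans (Finset.sum_le_sum fun t ht => ?_)
  have i1 : IntegrableOn (fun x => s * gsq U x) t.carrier :=
    ((continuous_gsq hU).const_mul s).continuousOn.integrableOn_compact t.isCompact_carrier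
  have i2 : IntegrableOn (fun x => s⁻¹ * ((h ^ 2)⁻¹ * (V x - v t) ^ 2)) t.carrier :=
    ((((hV.sub continuous_const).pow 2).const_mul _).const_mul _).continuousOn.integrableOn_compact
      t.isCompact_carrier
  rw [← integral_const_mul s, ← integral_const_mul (h ^ 2)⁻¹, ← integral_const_mul s⁻¹,
    ← integral_add i1 i2, ← integral_const_mul, ← Real.norm_eq_abs]
  refine norm_integral_le_of_norm_le (Integrable.const_mul (i1.add i2) _)
    (Filter.Eventually.of_forall fun x => ?_)
  have hw := M.meshSize_mul_norm_le hc hM w ht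
  have y := abs_mul_le_young hs ‖fderiv ℝ U x‖ (h⁻¹ * |V x - v t|)
  have g := norm_fderiv_sq_le U x
  calc ‖fderiv ℝ U x (w t) * (V x - v t)‖ ≤ ‖fderiv ℝ U x‖ * ‖w t‖ * |V x - v t| := by
        rw [norm_mul, Real.norm_eq_abs (V x - v t)]
        gcongr
        exact ContinuousLinearMap.le_opNorm _ _
    _ = (h * ‖w t‖) * (‖fderiv ℝ U x‖ * (h⁻¹ * |V x - v t|)) := by field_simp
    _ ≤ (2 / Creg * M.l2normP0 w) * (s * gsq U x + s⁻¹ * ((h ^ 2)⁻¹ * (V x - v t) ^ 2)) := by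
        refine mul_le_mul hw ?_ (by positivity) (by positivity)
        refine (le_abs_self _).trans (y.trans ?_)
        rw [mul_pow, sq_abs, inv_pow]
        have a1 : 0 ≤ s⁻¹ * ((h ^ 2)⁻¹ * (V x - v t) ^ 2) := by positivity
        have a2 : s * ‖fderiv ℝ U x‖ ^ 2 ≤ s * gsq U x := by gcongr
        have a3 : 0 ≤ s * ‖fderiv ℝ U x‖ ^ 2 := by positivity
        nlinarith

theorem sum_savg_sub_sq_le {Creg : ℝ} (hc : 0 < Creg) (hM : M.Regular Creg) (u : Tri → ℝ)
    {U : E2 → ℝ} (hU : ContDiff ℝ 1 U) :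
    ∑ σ ∈ M.intEdges, (savg U σ.1 σ.2 - (u (M.Kof σ) + u (M.Lof σ)) / 2) ^ 2 ≤
      12 / Creg ^ 2 * (∑ t ∈ M.tris, ∫ x in t.carrier, gsq U x) +
      12 / Creg ^ 2 * ((M.meshSize ^ 2)⁻¹ * ∑ t ∈ M.tris, ∫ x in t.carrier, (U x - u t) ^ 2) := by
  have hh := M.meshSize_pos
  have h := M.sum_tris_edges (fun t σ => (savg U σ.1 σ.2 - u t) ^ 2 / 2)
    (fun t _ i => by rw [savg_edge_swap])
  have h1 : ∑ σ ∈ M.intEdges, (savg U σ.1 σ.2 - (u (M.Kof σ) + u (M.Lof σ)) / 2) ^ 2 ≤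
      ∑ t ∈ M.tris, ∑ i, (savg U (t.edge i).1 (t.edge i).2 - u t) ^ 2 / 2 := by
    rw [h]
    refine le_trans (Finset.sum_le_sum fun σ _ => ?_)
      (le_add_of_nonneg_right (Finset.sum_nonneg fun σ _ => by positivity))
    nlinarith [sq_nonneg (u (M.Kof σ) - u (M.Lof σ))]
  refine h1.trans ?_
  rw [Finset.mul_sum, Finset.mul_sum, Finset.mul_sum, ← Finset.sum_add_distrib]
  refine Finset.sum_le_sum fun t ht => ?_
  have ha := M.le_area hc hM ht
  have hinv : t.area⁻¹ ≤ 4 / Creg ^ 2 * (M.meshSize ^ 2)⁻¹ := by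
    rw [inv_le_comm₀ t.area_pos (by positivity)]
    refine le_trans (le_of_eq ?_) ha
    field_simp
  have h2 : ∀ i, (savg U (t.edge i).1 (t.edge i).2 - u t) ^ 2 / 2 ≤
      4 / Creg ^ 2 * (∫ x in t.carrier, gsq U x) +
      4 / Creg ^ 2 * ((M.meshSize ^ 2)⁻¹ * ∫ x in t.carrier, (U x - u t) ^ 2) := by
    intro i
    have e1 := M.eavg_sub_tavg_sq_le hc hM ht hU i
    have e2 := t.tavg_sub_sq_le hU.continuous (u t)
    have e3 : t.area⁻¹ * ∫ x in t.carrier, (U x - u t) ^ 2 ≤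
        4 / Creg ^ 2 * (M.meshSize ^ 2)⁻¹ * ∫ x in t.carrier, (U x - u t) ^ 2 :=
      mul_le_mul_of_nonneg_right hinv (integral_nonneg fun _ => sq_nonneg _)
    change (t.eavg U i - u t) ^ 2 / 2 ≤ _
    nlinarith [sq_nonneg (t.eavg U i - t.tavg U - (t.tavg U - u t))]
  refine (Finset.sum_le_sum fun i _ => h2 i).trans (le_of_eq ?_)
  simp
  ring

theorem sum_sq_jump_le_jsq (v : Tri → ℝ) :
    ∑ σ ∈ M.intEdges, (v (M.Kof σ) - v (M.Lof σ)) ^ 2 ≤ M.jsq v := by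
  rw [jsq, M.sum_edges]
  refine le_trans (le_of_eq ?_) (le_add_of_nonneg_right (Finset.sum_nonneg fun σ _ => sq_nonneg _))
  exact Finset.sum_congr rfl fun σ hσ => by rw [jmp, if_pos hσ]

theorem abs_sum_flux_mul_le {Creg : ℝ} (hc : 0 < Creg) (hM : M.Regular Creg)
    (w : Tri → E2) (a b : E2 × E2 → ℝ) {s : ℝ} (hs : 0 < s) :
    |∑ σ ∈ M.intEdges, M.flux w σ * (a σ * b σ)| ≤ 2 / Creg * M.l2normP0 w *
      (s * (∑ σ ∈ M.intEdges, a σ ^ 2) + s⁻¹ * ∑ σ ∈ M.intEdges, b σ ^ 2) := by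
  have hl := M.l2normP0_nonneg w
  rw [Finset.mul_sum, Finset.mul_sum, ← Finset.sum_add_distrib, Finset.mul_sum]
  refine (Finset.abs_sum_le_sum_abs _ _).trans (Finset.sum_le_sum fun σ hσ => ?_)
  rw [abs_mul]
  refine mul_le_mul (M.abs_flux_le hc hM w (M.int_sub hσ)) ?_ (abs_nonneg _) (by positivity)
  refine (abs_mul_le_young hs _ _).trans ?_
  have a1 : 0 ≤ s * a σ ^ 2 := by positivity
  have a2 : 0 ≤ s⁻¹ * b σ ^ 2 := by positivity
  linarith

theorem abs_integral_comp_grad_le {w : Tri → E2} (hw : M.IsRT0const w) {ρ : ℝ}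
    (hρ : ∀ x ∈ closure Ω, ‖x‖ ≤ ρ) {U V : E2 → ℝ} (hU : ContDiff ℝ (⊤ : ℕ∞) U)
    (hUc : HasCompactSupport U) (hV : ContDiff ℝ (⊤ : ℕ∞) V) (hVc : HasCompactSupport V)
    {s : ℝ} (hs : 0 < s) :
    |∫ x, (M.comp w 0 x * pd 0 U x + M.comp w 1 x * pd 1 U x) * V x| ≤
      3 * M.l2normP0 w * (s * (∫ x, gsq U x) + s⁻¹ * ∫ x, gsq V x) := by
  have h := trilinear_sq_le (M.measurable_comp w) (M.abs_comp_le w) (R := ρ)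
    (fun j x hx => M.glue_eq_zero (fun hm => absurd (hρ x hm) (not_le.2 hx)) _)
    (fun φ hφ => M.integral_comp_grad_eq_zero hw (hφ.of_le (by exact_mod_cast le_top))) hU hUc hV hVc
  rw [M.integral_comp_sq] at h
  have hl := M.l2normP0_nonneg w
  set G := ∫ x, gsq U x
  set H := ∫ x, gsq V x
  have hG : 0 ≤ G := integral_nonneg fun _ => gsq_nonneg _ _
  have hH : 0 ≤ H := integral_nonneg fun _ => gsq_nonneg _ _
  refine abs_le_of_sq_le_sq (h.trans ?_) (by positivity)
  have hp : Real.pi ≤ 4 := Real.pi_le_four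
  have e : 4 * (G * H) ≤ (s * G + s⁻¹ * H) ^ 2 := by
    have : s * s⁻¹ = 1 := mul_inv_cancel₀ hs.ne'
    have e' : (s * G + s⁻¹ * H) ^ 2 - 4 * (s * s⁻¹) * (G * H) = (s * G - s⁻¹ * H) ^ 2 := by ring
    rw [this] at e'
    nlinarith [sq_nonneg (s * G - s⁻¹ * H)]
  calc 8 * Real.pi * (M.l2normP0 w ^ 2 * G * H) ≤ 8 * 4 * (M.l2normP0 w ^ 2 * G * H) := by gcongr
    _ ≤ 9 * M.l2normP0 w ^ 2 * (4 * (G * H)) := by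
        have : 0 ≤ M.l2normP0 w ^ 2 * G * H := by positivity
        linarith
    _ ≤ 9 * M.l2normP0 w ^ 2 * (s * G + s⁻¹ * H) ^ 2 := by gcongr
    _ = _ := by ring

/-- The constant in the bound for the centered convection form. -/
def convConst (Creg : ℝ) : ℝ := 10 ^ 10 / Creg ^ 13

theorem abs_sch_young {Creg : ℝ} (hc : 0 < Creg) (hM : M.Regular Creg) {ρ : ℝ}
    (hρ : ∀ x ∈ closure Ω, ‖x‖ ≤ ρ) {w : Tri → E2} (hw : M.IsRT0const w) (u v : Tri → ℝ)
    {s : ℝ} (hs : 0 < s) :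
    |M.sch w u v| ≤ convConst Creg * M.l2normP0 w * (s * M.jsq u + s⁻¹ * M.jsq v) := by
  have hh := M.meshSize_pos
  have hc1 := M.creg_le_one hM
  set r := Creg ^ 2 * M.meshSize / 12 with hrdef
  have hr : 0 < r := by positivity
  have hrh : r ≤ M.meshSize := by
    have : Creg ^ 2 ≤ 1 := pow_le_one₀ hc.le hc1
    rw [hrdef]; nlinarith
  have hl := M.l2normP0_nonneg w
  have hju := M.jsq_nonneg u
  have hjv := M.jsq_nonneg v
  set b := bumpR r hr with hb
  set U := moll b (M.step u) with hUd
  set V := moll b (M.step v) with hVd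
  have hUs : ContDiff ℝ (⊤ : ℕ∞) U := moll_contDiff b (M.locallyIntegrable_step u)
  have hVs : ContDiff ℝ (⊤ : ℕ∞) V := moll_contDiff b (M.locallyIntegrable_step v)
  have hU1 : ContDiff ℝ 1 U := hUs.of_le (by exact_mod_cast le_top)
  have hV1 : ContDiff ℝ 1 V := hVs.of_le (by exact_mod_cast le_top)
  have hUc : HasCompactSupport U := M.hasCompactSupport_moll_step b hρ u
  have hVc : HasCompactSupport V := M.hasCompactSupport_moll_step b hρ v
  have gU := M.integral_gsq_moll_step_le hc hM hr hrh hρ u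
  have gV := M.integral_gsq_moll_step_le hc hM hr hrh hρ v
  have hconst : 384 * M.meshSize ^ 2 / (Creg ^ 2 * r ^ 2) = 55296 / Creg ^ 6 := by
    rw [hrdef]; field_simp; norm_num
  rw [hconst, ← hb, ← hUd] at gU
  rw [hconst, ← hb, ← hVd] at gV
  have eU : ∑ t ∈ M.tris, ∫ x in t.carrier, (U x - u t) ^ 2 ≤ 192 / Creg ^ 4 * M.meshSize ^ 2 *
      ∑ t ∈ M.tris, ∫ x in t.carrier, gsq U x := by
    rw [Finset.mul_sum]
    exact Finset.sum_le_sum fun t ht => M.integral_moll_step_sub_sq_le hc hM hr rfl u ht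
  have eV : ∑ t ∈ M.tris, ∫ x in t.carrier, (V x - v t) ^ 2 ≤ 192 / Creg ^ 4 * M.meshSize ^ 2 *
      ∑ t ∈ M.tris, ∫ x in t.carrier, gsq V x := by
    rw [Finset.mul_sum]
    exact Finset.sum_le_sum fun t ht => M.integral_moll_step_sub_sq_le hc hM hr rfl v ht
  have sU := M.sum_setIntegral_le (continuous_gsq hU1) (gsq_hasCompactSupport hUc) (gsq_nonneg U)
  have sV := M.sum_setIntegral_le (continuous_gsq hV1) (gsq_hasCompactSupport hVc) (gsq_nonneg V)
  have d0 := M.abs_integral_comp_grad_le hw hρ hUs hUc hVs hVc hs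
  have d1 := M.abs_sum_integral_fderiv_mul_le hc hM w v hU1 hVs.continuous hs
  have d2 := M.abs_sum_flux_mul_le hc hM w
    (fun σ => savg U σ.1 σ.2 - (u (M.Kof σ) + u (M.Lof σ)) / 2)
    (fun σ => v (M.Kof σ) - v (M.Lof σ)) hs
  have d3 := M.sum_savg_sub_sq_le hc hM u hU1
  have d4 := M.sum_sq_jump_le_jsq v
  have heq := M.sch_eq hw u v hU1 hVs.continuous
  clear_value U V
  set GU := ∫ x, gsq U x
  set GV := ∫ x, gsq V x
  set SU := ∑ t ∈ M.tris, ∫ x in t.carrier, gsq U x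
  set SV := ∑ t ∈ M.tris, ∫ x in t.carrier, gsq V x
  set X := ∫ x, (M.comp w 0 x * pd 0 U x + M.comp w 1 x * pd 1 U x) * V x
  set Y := ∑ t ∈ M.tris, ∫ x in t.carrier, fderiv ℝ U x (w t) * (V x - v t)
  set Z := ∑ σ ∈ M.intEdges, M.flux w σ * ((savg U σ.1 σ.2 - (u (M.Kof σ) + u (M.Lof σ)) / 2) *
          (v (M.Kof σ) - v (M.Lof σ)))
  set W := M.l2normP0 w
  set J := M.jsq u
  set L := M.jsq v
  have hC : ∀ (a : ℝ) (n : ℕ), 0 ≤ a → n ≤ 12 → a / Creg ^ n ≤ a / Creg ^ 12 := fun a n ha hn =>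
    div_le_div_of_nonneg_left ha (by positivity) (pow_le_pow_of_le_one hc.le hc1 hn)
  set q := (Creg ^ 12)⁻¹ with hq
  have hq1 : 1 ≤ q := (one_le_inv₀ (by positivity)).2 (pow_le_one₀ hc.le hc1)
  have gU' : GU ≤ 55296 * q * J :=
    gU.trans (mul_le_mul_of_nonneg_right (hC _ 6 (by norm_num) (by norm_num)) hju)
  have gV' : GV ≤ 55296 * q * L :=
    gV.trans (mul_le_mul_of_nonneg_right (hC _ 6 (by norm_num) (by norm_num)) hjv)
  have eU' : (M.meshSize ^ 2)⁻¹ * ∑ t ∈ M.tris, ∫ x in t.carrier, (U x - u t) ^ 2 ≤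
      192 / Creg ^ 4 * (55296 / Creg ^ 6 * J) := by
    rw [inv_mul_le_iff₀ (by positivity)]
    refine eU.trans ?_
    rw [mul_assoc, mul_left_comm]
    gcongr
    exact sU.trans gU
  have eV' : (M.meshSize ^ 2)⁻¹ * ∑ t ∈ M.tris, ∫ x in t.carrier, (V x - v t) ^ 2 ≤
      10616832 * q * L := by
    rw [inv_mul_le_iff₀ (by positivity)]
    refine eV.trans ?_
    calc 192 / Creg ^ 4 * M.meshSize ^ 2 * SV ≤ 192 / Creg ^ 4 * M.meshSize ^ 2 * (55296 / Creg ^ 6 * L) := by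
          gcongr; exact sV.trans gV
      _ = M.meshSize ^ 2 * (10616832 / Creg ^ 10 * L) := by field_simp; ring
      _ ≤ _ := by gcongr; exact hC _ 10 (by norm_num) (by norm_num)
  have d3' : ∑ σ ∈ M.intEdges, (savg U σ.1 σ.2 - (u (M.Kof σ) + u (M.Lof σ)) / 2) ^ 2 ≤
      128065536 * q * J := by
    refine d3.trans ?_
    calc _ ≤ 12 / Creg ^ 2 * (55296 / Creg ^ 6 * J) +
          12 / Creg ^ 2 * (192 / Creg ^ 4 * (55296 / Creg ^ 6 * J)) := by
          gcongr; exact sU.trans gU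
      _ = 663552 / Creg ^ 8 * J + 127401984 / Creg ^ 12 * J := by field_simp; ring
      _ ≤ 663552 / Creg ^ 12 * J + 127401984 / Creg ^ 12 * J := by
          gcongr ?_ * J + _; exact hC _ 8 (by norm_num) (by norm_num)
      _ = _ := by rw [hq]; ring
  have hpc : 1 ≤ Creg⁻¹ := (one_le_inv₀ hc).2 hc1
  have hcc : convConst Creg = 10 ^ 10 * (q * Creg⁻¹) := by
    rw [convConst, hq]; field_simp
  have hsJ : 0 ≤ s * J := by positivity
  have hsL : 0 ≤ s⁻¹ * L := by positivity
  set P := s * J with hP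
  set Q := s⁻¹ * L with hQ
  have x0 : |X| ≤ W * Creg⁻¹ * (165888 * q * (P + Q)) := by
    calc |X| ≤ 3 * W * (s * GU + s⁻¹ * GV) := d0
      _ ≤ 3 * W * (s * (55296 * q * J) + s⁻¹ * (55296 * q * L)) := by gcongr
      _ = W * 1 * (165888 * q * (P + Q)) := by rw [hP, hQ]; ring
      _ ≤ _ := by gcongr
  have x1 : |Y| ≤ W * Creg⁻¹ * (2 * 10616832 * q * (P + Q)) := by
    calc |Y| ≤ 2 / Creg * W * (s * SU + s⁻¹ * _) := d1
      _ ≤ 2 / Creg * W * (s * (10616832 * q * J) + s⁻¹ * (10616832 * q * L)) := by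
          gcongr
          refine (sU.trans gU').trans ?_
          gcongr; norm_num
      _ = _ := by rw [hP, hQ]; ring
  have x2 : |Z| ≤ W * Creg⁻¹ * (2 * 128065536 * q * (P + Q)) := by
    calc |Z| ≤ 2 / Creg * W * (s * _ + s⁻¹ * _) := d2
      _ ≤ 2 / Creg * W * (s * (128065536 * q * J) + s⁻¹ * (128065536 * q * L)) := by
          gcongr
          refine d4.trans ?_
          nlinarith
      _ = _ := by rw [hP, hQ]; ring
  rw [heq, hcc]
  have habs : |X - Y - Z| ≤ |X| + |Y| + |Z| :=
    (abs_sub _ _).trans (add_le_add_left (abs_sub _ _) _)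
  have hnn : 0 ≤ W * Creg⁻¹ * (q * (P + Q)) := by positivity
  linarith

/-- The centered convection form is bounded by the `L²` norm of the transporting field and the
discrete `H¹` norms. -/
theorem abs_ch_le {Creg : ℝ} (hc : 0 < Creg) (hM : M.Regular Creg) {ρ : ℝ}
    (hρ : ∀ x ∈ closure Ω, ‖x‖ ≤ ρ) {w : Tri → E2} (hw : M.IsRT0const w) (v z : Tri → E2) :
    |M.ch w v z| ≤ 2 * (convConst Creg / Creg * M.l2normP0 w) * (M.normh v * M.normh z) := by
  have hcc : 0 ≤ convConst Creg := by unfold convConst; positivity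
  have hl := M.l2normP0_nonneg w
  have hsum : M.ch w v z = M.sch w (fun t => v t 0) (fun t => z t 0) +
      M.sch w (fun t => v t 1) (fun t => z t 1) := by
    rw [ch, sch, sch, ← Finset.sum_add_distrib]
    refine Finset.sum_congr rfl fun σ _ => ?_
    rw [inner_coord]
    simp only [PiLp.add_apply, PiLp.sub_apply]
    ring
  have hj : ∀ y : Tri → E2, M.jsq (fun t => y t 0) + M.jsq (fun t => y t 1) ≤
      1 / Creg * M.normh y ^ 2 := by
    intro y
    have h := M.le_normh_sq hc hM y
    rw [one_div, le_inv_mul_iff₀ hc]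
    refine le_trans (le_of_eq ?_) h
    congr 1
    rw [jsq, jsq, M.sum_edges, M.sum_edges, add_add_add_comm, ← Finset.sum_add_distrib,
      ← Finset.sum_add_distrib]
    congr 1 <;> refine Finset.sum_congr rfl fun σ hσ => ?_
    · rw [jmp, jmp, if_pos hσ, if_pos hσ, norm_sq_coord, PiLp.sub_apply, PiLp.sub_apply]; ring
    · rw [jmp, jmp, if_neg (Finset.disjoint_right.1 M.disj_edges hσ),
        if_neg (Finset.disjoint_right.1 M.disj_edges hσ), norm_sq_coord]; ring
  refine le_two_mul_of_forall_young (by positivity) (M.normh_nonneg v) (M.normh_nonneg z)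
    fun s hs => ?_
  have s0 := M.abs_sch_young hc hM hρ hw (fun t => v t 0) (fun t => z t 0) hs
  have s1 := M.abs_sch_young hc hM hρ hw (fun t => v t 1) (fun t => z t 1) hs
  rw [hsum]
  refine (abs_add_le _ _).trans ((add_le_add s0 s1).trans ?_)
  calc _ = convConst Creg * M.l2normP0 w * (s * (M.jsq (fun t => v t 0) + M.jsq (fun t => v t 1)) +
        s⁻¹ * (M.jsq (fun t => z t 0) + M.jsq (fun t => z t 1))) := by ring
    _ ≤ convConst Creg * M.l2normP0 w * (s * (1 / Creg * M.normh v ^ 2) +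
        s⁻¹ * (1 / Creg * M.normh z ^ 2)) := by
        gcongr
        · exact hj v
        · exact hj z
    _ = _ := by ring

end Mesh

namespace Scheme
variable {Ω : Set E2} {M : Mesh Ω} (S : Scheme M) {Cf C0 C1 : ℝ}

theorem abs_l2P0_gradh_le {Creg ρ : ℝ} (hc : 0 < Creg) (hM : M.Regular Creg) (hρ0 : 0 < ρ)
    (hρ : ∀ x ∈ closure Ω, ‖x‖ ≤ ρ) (hRe : 0 < S.Re) (hC1 : 0 ≤ C1)
    (h0 : M.l2normP0 (S.u 0) + M.l2normP0 (S.u 1) + S.k * M.l2normP0 (gradh (S.p 1)) ≤ C0)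
    (h1 : ∀ n, 1 ≤ n → n ≤ S.N → M.l2normP0 (fun t => S.u n t - S.u (n-1) t) ≤ C1 * S.k)
    (hf : ∀ n ≤ S.N, M.l2normP0 (S.fh n) ≤ Cf) {n : ℕ} (hn : 1 ≤ n) (hn' : n + 1 ≤ S.N)
    (z : Tri → E2) :
    |M.l2P0 (gradh (S.p (n + 1))) z| ≤ ((Cf + 2 * C1) * √(24 * ρ ^ 2 / Creg ^ 3) +
      (S.Re⁻¹ + (2 * (Mesh.convConst Creg / Creg) + 1 / Creg ^ 2) * (3 * (C0 + C1 * S.T))) *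
        M.normh (S.ut (n + 1))) * M.normh z := by
  have hz := M.normh_nonneg z
  have hu := M.normh_nonneg (S.ut (n + 1))
  have hcc : 0 ≤ Mesh.convConst Creg := by unfold Mesh.convConst; positivity
  have hP : M.l2normP0 z ≤ √(24 * ρ ^ 2 / Creg ^ 3) * M.normh z := by
    have hp := M.poincare hc hM hρ0 (fun t ht x hx => hρ x (by
      rw [← M.union_eq]; exact Set.mem_biUnion (x := t) ht hx)) z
    refine le_of_sq_le_sq ?_ (by positivity)
    rw [mul_pow, Real.sq_sqrt (by positivity)]
    exact hp
  have hfn := hf (n + 1) hn'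
  have hdn := S.norm_dt_le h1 hn hn'
  have hwn := S.norm_wex_le hC1 h0 h1 (n := n) (by omega)
  have hw := S.isRT0const_wex (n := n) (by omega)
  have a1 : |M.l2P0 (S.fh (n + 1)) z| ≤ Cf * (√(24 * ρ ^ 2 / Creg ^ 3) * M.normh z) :=
    (M.abs_l2P0_le _ _).trans (mul_le_mul hfn hP (M.l2normP0_nonneg z)
      ((M.l2normP0_nonneg _).trans hfn))
  have a2 : |M.l2P0 (S.dt n) z| ≤ 2 * C1 * (√(24 * ρ ^ 2 / Creg ^ 3) * M.normh z) :=
    (M.abs_l2P0_le _ _).trans (mul_le_mul hdn hP (M.l2normP0_nonneg z) (by positivity))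
  have a3 : |S.Re⁻¹ * M.ah (S.ut (n + 1)) z| ≤ S.Re⁻¹ * (M.normh (S.ut (n + 1)) * M.normh z) := by
    rw [abs_mul, abs_of_pos (inv_pos.2 hRe)]
    exact mul_le_mul_of_nonneg_left (M.abs_ah_le _ _) (inv_pos.2 hRe).le
  have a4 : |M.l2P0 (M.btilde (fun s => AffineMap.const ℝ E2 (S.wex n s)) (S.ut (n + 1))) z| ≤
      (2 * (Mesh.convConst Creg / Creg) + 1 / Creg ^ 2) * (3 * (C0 + C1 * S.T)) *
        (M.normh (S.ut (n + 1)) * M.normh z) := by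
    rw [M.l2P0_btilde hw]
    refine (abs_add_le _ _).trans ((add_le_add (M.abs_ch_le hc hM hρ hw _ _)
      (M.abs_uh_le hc hM _ _ _)).trans ?_)
    calc _ = (2 * (Mesh.convConst Creg / Creg) + 1 / Creg ^ 2) * M.l2normP0 (S.wex n) *
          (M.normh (S.ut (n + 1)) * M.normh z) := by ring
      _ ≤ _ := by gcongr
  rw [S.l2P0_gradh_eq hn hn']
  refine (abs_sub _ _).trans ?_
  refine (add_le_add_left ((abs_sub _ _).trans (add_le_add_left (abs_sub _ _) _)) _).trans ?_
  linarith

end Scheme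

/-- **Stability of the scheme (pressure estimate)**: if the initial values satisfy
`|u⁰_h| + |u¹_h| + k|∇_h p¹_h| ≤ C₀` and the velocity increments satisfy
`|uⁿ_h − uⁿ⁻¹_h| ≤ C₁ k` for all `n ∈ {1,…,N}`, then there is a constant `C > 0`
depending only on `Ω`, `C_reg`, `Re`, `T`, the force bound `Cf`, `C₀` and `C₁`
(but not on `h`, `k` or `N`) such that `k ∑_{n=2}^m |pⁿ_h|² ≤ C` for `m ∈ {2,…,N}`. -/
theorem scheme_pressure_stability
    {Ω : Set E2} (hΩo : IsOpen Ω) (hΩc : IsConnected Ω) (hΩb : Bornology.IsBounded Ω)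
    (Creg Re T Cf C0 C1 : ℝ) (hCreg : 0 < Creg) (hRe : 0 < Re) (hT : 0 < T)
    (hCf : 0 ≤ Cf) (hC0 : 0 ≤ C0) (hC1 : 0 ≤ C1) :
    ∃ C > 0, ∀ M : Mesh Ω, M.Regular Creg → ∀ S : Scheme M, S.Re = Re → S.T = T →
      (∀ n ≤ S.N, M.l2normP0 (S.fh n) ≤ Cf) →
      (M.l2normP0 (S.u 0) + M.l2normP0 (S.u 1)
          + S.k * M.l2normP0 (gradh (S.p 1)) ≤ C0) →
      (∀ n, 1 ≤ n → n ≤ S.N →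
        M.l2normP0 (fun t => S.u n t - S.u (n-1) t) ≤ C1 * S.k) →
      ∀ m, 2 ≤ m → m ≤ S.N →
        S.k * ∑ n ∈ Finset.Icc 2 m, (M.l2normP1 (S.p n)) ^ 2 ≤ C := by
  by_cases hne : Nonempty (Mesh Ω)
  swap
  · exact ⟨1, one_pos, fun M => (hne ⟨M⟩).elim⟩
  obtain ⟨M₀⟩ := hne
  obtain ⟨C, hC, hinf⟩ := Mesh.infsup hΩo hΩc hΩb hCreg M₀
  obtain ⟨ρ, hρ0, hρ'⟩ := hΩb.closure.exists_pos_norm_le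
  have hρ : ∀ x ∈ closure Ω, ‖x‖ ≤ ρ := hρ'
  have hcc : 0 ≤ Mesh.convConst Creg := by unfold Mesh.convConst; positivity
  set A := (Cf + 2 * C1) * √(24 * ρ ^ 2 / Creg ^ 3) with hA
  set B := Re⁻¹ + (2 * (Mesh.convConst Creg / Creg) + 1 / Creg ^ 2) * (3 * (C0 + C1 * T)) with hB
  set E := C0 ^ 2 / 3 + T * ((Cf + 2 * C1) * (C0 + C1 * T) + T / 3 * (Cf + 2 * C1) ^ 2) with hE
  have hA0 : 0 ≤ A := by positivity
  have hB0 : 0 ≤ B := by positivity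
  have hE0 : 0 ≤ E := by positivity
  refine ⟨C * (2 * A ^ 2 * T + 2 * B ^ 2 * (Re * E)) + 1, by positivity, ?_⟩
  rintro M hM S rfl rfl hf h0 h1 m hm hmN
  have hk := S.k_pos
  have hp : ∀ n ∈ Finset.Icc 2 m, M.l2normP1 (S.p n) ^ 2 ≤
      C * (2 * A ^ 2) + C * (2 * B ^ 2) * M.normh (S.ut n) ^ 2 := by
    intro n hn
    rw [Finset.mem_Icc] at hn
    obtain ⟨l, rfl⟩ : ∃ l, n = l + 1 := ⟨n - 1, by omega⟩
    have hu := M.normh_nonneg (S.ut (l + 1))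
    have hpl := S.hp (l + 1) (by omega) (by omega)
    have h := hinf M hM _ hpl.1 hpl.2 (A + B * M.normh (S.ut (l + 1))) (by positivity)
      (S.abs_l2P0_gradh_le hCreg hM hρ0 hρ hRe hC1 h0 h1 hf (by omega) (by omega))
    refine h.trans ?_
    have : (A + B * M.normh (S.ut (l + 1))) ^ 2 ≤
        2 * A ^ 2 + 2 * B ^ 2 * M.normh (S.ut (l + 1)) ^ 2 := by
      nlinarith [sq_nonneg (A - B * M.normh (S.ut (l + 1)))]
    calc _ ≤ C * (2 * A ^ 2 + 2 * B ^ 2 * M.normh (S.ut (l + 1)) ^ 2) := by gcongr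
      _ = _ := by ring
  have hen := S.energy hC1 h0 h1 hf (m := m) (by omega) hmN
  rw [inv_mul_le_iff₀ hRe] at hen
  have hcard : S.k * ((Finset.Icc 2 m).card : ℝ) ≤ S.T := by
    rw [← S.k_mul_N]
    refine mul_le_mul_of_nonneg_left ?_ hk.le
    rw [Nat.card_Icc]
    exact_mod_cast (by omega : m + 1 - 2 ≤ S.N)
  calc S.k * ∑ n ∈ Finset.Icc 2 m, (M.l2normP1 (S.p n)) ^ 2
      ≤ S.k * ∑ n ∈ Finset.Icc 2 m, (C * (2 * A ^ 2) + C * (2 * B ^ 2) * M.normh (S.ut n) ^ 2) := by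
        gcongr with n hn; exact hp n hn
    _ = C * (2 * A ^ 2) * (S.k * ((Finset.Icc 2 m).card : ℝ)) +
        C * (2 * B ^ 2) * (S.k * ∑ n ∈ Finset.Icc 2 m, M.normh (S.ut n) ^ 2) := by
        rw [Finset.sum_add_distrib, Finset.sum_const, nsmul_eq_mul, ← Finset.mul_sum]; ring
    _ ≤ C * (2 * A ^ 2) * S.T + C * (2 * B ^ 2) * (S.Re * E) := by gcongr
    _ ≤ _ := by linarith

end
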